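/- Let X ⊆ P^r_K be a non-degenerate variety of degree 4 and codimension 2 which is not a cone and which is not a generic projection of the Veronese surface F ⊆ P^5_K. Then either (a) X is a complete intersection cut out by two quadrics, or (b) dim X ≤ 4 and the Betti diagram of I_X has exactly the entries β_{1,1} = 1, β_{1,2} = 3, β_{2,2} = 4, β_{3,2} = 1, with all other entries β_{i,j} (i ≥ 1) equal to zero. -/

import Mathlib

noncomputable section

open MvPolynomial

/-- The polynomial ring `S = K[x_0, …, x_r]`, the homogeneous coordinate ring of `ℙ^r_K`. -/
abbrev PS (K : Type) [Field K] (r : ℕ) : Type := MvPolynomial (Fin (r + 1)) K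

namespace AMD

variable (K : Type) [Field K] (r : ℕ)

/-- `I` is a homogeneous ideal of `S = K[x_0, …, x_r]`. -/
def IsHomIdeal (I : Ideal (PS K r)) : Prop :=
  ∀ p ∈ I, ∀ n : ℕ, homogeneousComponent n p ∈ I

/-- `X = V_+(I)` is non-degenerate: `I` contains no nonzero linear form. -/
def Nondeg (I : Ideal (PS K r)) : Prop :=
  ∀ p ∈ I, p.IsHomogeneous 1 → p = 0

/-- The irrelevant maximal ideal of the homogeneous coordinate ring `A_X = S/I`. -/
def maxIdl (I : Ideal (PS K r)) : Ideal (PS K r ⧸ I) :=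
  (Ideal.span (Set.range (X : Fin (r + 1) → PS K r))).map (Ideal.Quotient.mk I)

/-- `dim X = d`, i.e. the Krull dimension of `A_X = S/I` equals `d + 1`. -/
def DimEq (I : Ideal (PS K r)) (d : ℕ) : Prop :=
  ringKrullDim (PS K r ⧸ I) = (((d : ℕ∞) + 1 : ℕ∞) : WithBot ℕ∞)

/-- The degree-`n` homogeneous component of `A_X = S/I`, as a `K`-subspace. -/
def quotComponent (I : Ideal (PS K r)) (n : ℕ) : Submodule K (PS K r ⧸ I) :=
  (homogeneousSubmodule (Fin (r + 1)) K n).map (Ideal.Quotient.mkₐ K I).toLinearMap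

/-- The Hilbert series of the graded algebra `A_X = S/I`. -/
def hilbSeries (I : Ideal (PS K r)) : PowerSeries ℤ :=
  PowerSeries.mk fun n => (Module.finrank K (quotComponent K r I n) : ℤ)

/-- `deg X = e`, where `d = dim X`:  the numerator polynomial of the Hilbert series of
`A_X` with respect to the denominator `(1 - λ)^(d+1)` takes the value `e` at `λ = 1`. -/
def DegreeEq (I : Ideal (PS K r)) (d e : ℕ) : Prop :=
  ∃ h : Polynomial ℤ,
    hilbSeries K r I * (1 - PowerSeries.X) ^ (d + 1) = PowerSeries.mk (fun n => h.coeff n) ∧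
    h.eval 1 = (e : ℤ)

/-- A graded automorphism of `S`, i.e. a linear change of coordinates of `ℙ^r_K`. -/
def IsGrAut (φ : PS K r ≃ₐ[K] PS K r) : Prop :=
  ∀ i, (φ (X i)).IsHomogeneous 1

/-- `X = V_+(I) ⊆ ℙ^r_K` is a cone (over a variety lying in some hyperplane): after a
linear change of coordinates, `I` is generated by polynomials not involving the last
variable. -/
def IsConeIdeal (I : Ideal (PS K r)) : Prop :=
  ∃ φ : PS K r ≃ₐ[K] PS K r, IsGrAut K r φ ∧
    ∃ J : Ideal (MvPolynomial (Fin r) K),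
      Ideal.map φ I = Ideal.map (rename (Fin.castSucc : Fin r → Fin (r + 1))) J

/-- A (weakly) regular sequence on the ring `A`. -/
def IsRegSeq {A : Type} [CommRing A] (rs : List A) : Prop :=
  ∀ (i : Fin rs.length) (y : A),
    rs.get i * y ∈ Ideal.span {x | x ∈ rs.take i.1} → y ∈ Ideal.span {x | x ∈ rs.take i.1}

/-- `depth A_X = t`: the maximal length of a regular sequence on `A_X = S/I` consisting
of elements of the irrelevant maximal ideal is `t`. -/
def DepthEq (I : Ideal (PS K r)) (t : ℕ) : Prop :=
  (∃ rs : List (PS K r ⧸ I), rs.length = t ∧ (∀ x ∈ rs, x ∈ maxIdl K r I) ∧ IsRegSeq rs) ∧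
  ∀ rs : List (PS K r ⧸ I), (∀ x ∈ rs, x ∈ maxIdl K r I) → IsRegSeq rs → rs.length ≤ t

/-- `X` is arithmetically Cohen-Macaulay: `depth A_X = dim A_X`. -/
def IsACM (I : Ideal (PS K r)) : Prop :=
  ∃ t : ℕ, ringKrullDim (PS K r ⧸ I) = ((t : ℕ∞) : WithBot ℕ∞) ∧ DepthEq K r I t

/-- The socle `{y | m·y = 0}` of `B`, as a `K`-subspace of `B`. -/
def socle (B : Type) [CommRing B] [Algebra K B] (m : Ideal B) : Submodule K B where
  carrier := {y | ∀ z ∈ m, z * y = 0}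
  add_mem' := by
    intro a b ha hb z hz
    rw [mul_add, ha z hz, hb z hz, add_zero]
  zero_mem' := by
    intro z hz
    rw [mul_zero]
  smul_mem' := by
    intro c y hy z hz
    rw [mul_smul_comm, hy z hz, smul_zero]

/-- `X` is arithmetically Gorenstein: `A_X = S/I` is Cohen-Macaulay and its Artinian
reduction by a maximal regular sequence has a one-dimensional socle. -/
def IsArithGorenstein (I : Ideal (PS K r)) : Prop :=
  ∃ (t : ℕ) (rs : List (PS K r ⧸ I)),
    ringKrullDim (PS K r ⧸ I) = ((t : ℕ∞) : WithBot ℕ∞) ∧ rs.length = t ∧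
    (∀ x ∈ rs, x ∈ maxIdl K r I) ∧ IsRegSeq rs ∧
    Module.finrank K
      (socle K ((PS K r ⧸ I) ⧸ Ideal.span {x | x ∈ rs})
        (Ideal.map (Ideal.Quotient.mk (Ideal.span {x | x ∈ rs})) (maxIdl K r I))) = 1

/-- The graded free `S`-module with `β j` generators in "row `j`" for each `j : ℕ`. -/
abbrev FreeGr (β : ℕ → ℕ) : Type := ((j : ℕ) × Fin (β j)) →₀ PS K r

/-- `φ` is a minimal graded homomorphism of graded free modules, where the generator
`(j, t)` of the source has degree `m₁ + j` and the generator `(j', t')` of the target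
has degree `m₂ + j'`: every matrix entry of `φ` is either zero or homogeneous of the
appropriate positive degree. -/
def IsMinGrMap (b₁ b₂ : ℕ → ℕ) (m₁ m₂ : ℕ)
    (φ : FreeGr K r b₁ →ₗ[PS K r] FreeGr K r b₂) : Prop :=
  ∀ (j : ℕ) (t : Fin (b₁ j)) (j' : ℕ) (t' : Fin (b₂ j')),
    (φ (Finsupp.single ⟨j, t⟩ 1)) ⟨j', t'⟩ = 0 ∨
      ∃ dd : ℕ, 1 ≤ dd ∧ dd + (m₂ + j') = m₁ + j ∧
        ((φ (Finsupp.single ⟨j, t⟩ 1)) ⟨j', t'⟩).IsHomogeneous dd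

/-- `b` is the Betti diagram of the ideal `I ⊆ S`, i.e.
`b i j = dim_K Tor_i^S(K, S/I)_{i+j}` for all `i ≥ 1`.  This is expressed by the
existence of a minimal graded free resolution `⋯ → F₂ → F₁ → S → S/I → 0` of `S/I`
in which, for `i ≥ 1`, the free module `F_i` has exactly `b i j` generators of degree
`i + j`. -/
def HasBettiDiagram (I : Ideal (PS K r)) (b : ℕ → ℕ → ℕ) : Prop :=
  ∃ (φ : (i : ℕ) → (FreeGr K r (b (i + 2)) →ₗ[PS K r] FreeGr K r (b (i + 1))))
    (ε : FreeGr K r (b 1) →ₗ[PS K r] PS K r),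
    (∀ (j : ℕ) (t : Fin (b 1 j)), (ε (Finsupp.single ⟨j, t⟩ 1)).IsHomogeneous (1 + j)) ∧
    (∀ i, IsMinGrMap K r (b (i + 2)) (b (i + 1)) (i + 2) (i + 1) (φ i)) ∧
    LinearMap.range ε = I ∧
    LinearMap.ker ε = LinearMap.range (φ 0) ∧
    ∀ i, LinearMap.ker (φ i) = LinearMap.range (φ (i + 1))

/-- The Pfaffian of a (skew-symmetric) `4 × 4` matrix. -/
def pfaff4 {R : Type} [CommRing R] (N : Matrix (Fin 4) (Fin 4) R) : R :=
  N 0 1 * N 2 3 - N 0 2 * N 1 3 + N 0 3 * N 1 2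

/-- The five submaximal (`4 × 4`) Pfaffians of a skew-symmetric `5 × 5` matrix. -/
def subPfaffian {R : Type} [CommRing R] (M : Matrix (Fin 5) (Fin 5) R) (i : Fin 5) : R :=
  pfaff4 (M.submatrix i.succAbove i.succAbove)

/-- `X = V_+(I)` is the Pfaffian variety defined by the five `4 × 4` Pfaffians of a
skew-symmetric `5 × 5` matrix of linear forms. -/
def IsPfaffianVariety (I : Ideal (PS K r)) : Prop :=
  ∃ M : Matrix (Fin 5) (Fin 5) (PS K r),
    M.transpose = -M ∧ (∀ i j, (M i j).IsHomogeneous 1) ∧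
    I = Ideal.span (Set.range (subPfaffian M))

/-- The vanishing ideal of the coordinate point `(0 : ⋯ : 0 : 1) ∈ ℙ^{r+1}_K`. -/
def pointIdl : Ideal (PS K (r + 1)) :=
  Ideal.span ((X : Fin (r + 2) → PS K (r + 1)) '' {i : Fin (r + 2) | i ≠ Fin.last (r + 1)})

/-- `X = V_+(I) ⊆ ℙ^r_K` is the image of `Z = V_+(J) ⊆ ℙ^{r+1}_K` under the projection
from a point `P ∈ ℙ^{r+1}_K ∖ Z`: after a linear change of coordinates moving `P` to
`(0 : ⋯ : 0 : 1)`, the ideal `I` is the contraction of `J` to `K[x_0, …, x_r]`. -/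
def IsProjectionOf (I : Ideal (PS K r)) (J : Ideal (PS K (r + 1))) : Prop :=
  ∃ ψ : PS K (r + 1) ≃ₐ[K] PS K (r + 1), IsGrAut K (r + 1) ψ ∧
    ¬ Ideal.map ψ J ≤ pointIdl K r ∧
    I = Ideal.comap (rename (Fin.castSucc : Fin (r + 1) → Fin (r + 2))) (Ideal.map ψ J)

/-- The ideal of the Veronese surface `F ⊆ ℙ^5_K`, generated by the `2 × 2` minors of
the generic symmetric `3 × 3` matrix with rows `(x₀,x₁,x₂), (x₁,x₃,x₄), (x₂,x₄,x₅)`. -/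
def veroneseIdeal : Ideal (PS K 5) :=
  Ideal.span {X 0 * X 3 - X 1 * X 1, X 0 * X 4 - X 1 * X 2, X 1 * X 4 - X 2 * X 3,
    X 0 * X 5 - X 2 * X 2, X 1 * X 5 - X 2 * X 4, X 3 * X 5 - X 4 * X 4}

/-- The determinant of the generic symmetric `3 × 3` matrix defining the Veronese
surface; it cuts out the secant variety of `F ⊆ ℙ^5_K`. -/
def veroneseDet : PS K 5 :=
  X 0 * X 3 * X 5 - X 0 * X 4 * X 4 - X 1 * X 1 * X 5 + 2 * (X 1 * X 2 * X 4) -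
    X 2 * X 2 * X 3

/-- `X = V_+(I) ⊆ ℙ^4_K` is a generic projection of the Veronese surface `F ⊆ ℙ^5_K`,
i.e. the projection of `F` from a point `P ∈ ℙ^5_K ∖ F` at which the generic symmetric
`3 × 3` matrix `M` has rank `3` (equivalently, `P` does not lie on the secant variety
`{det M = 0}` of `F`). -/
def IsGenProjVeronese4 (I : Ideal (PS K 4)) : Prop :=
  ∃ ψ : PS K 5 ≃ₐ[K] PS K 5, IsGrAut K 5 ψ ∧
    ¬ Ideal.map ψ (Ideal.span {veroneseDet K}) ≤ pointIdl K 4 ∧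
    I = Ideal.comap (rename (Fin.castSucc : Fin 5 → Fin 6)) (Ideal.map ψ (veroneseIdeal K))

/-- `X = V_+(I) ⊆ ℙ^r_K` is a generic projection of the Veronese surface (which forces
`r = 4`). -/
def IsGenProjVeronese (I : Ideal (PS K r)) : Prop :=
  ∃ h : r + 1 = 5, IsGenProjVeronese4 K (Ideal.map (rename (Fin.cast h)) I)

/-- `X = V_+(I) ⊆ ℙ^r_K` is a generic projection of (a cone over) the Veronese surface
`F ⊆ ℙ^5_K`:  `X` is the projection of a cone `Z ⊆ ℙ^{r+1}_K` over `F` from a point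
not lying on the (cone over the) secant variety of `F`. -/
def IsGenProjVeroneseCone (I : Ideal (PS K r)) : Prop :=
  ∃ (h : 6 ≤ r + 2) (ψ : PS K (r + 1) ≃ₐ[K] PS K (r + 1)), IsGrAut K (r + 1) ψ ∧
    ¬ Ideal.map ψ (Ideal.map (rename (Fin.castLE h))
        (Ideal.span {veroneseDet K})) ≤ pointIdl K r ∧
    I = Ideal.comap (rename (Fin.castSucc : Fin (r + 1) → Fin (r + 2)))
      (Ideal.map ψ (Ideal.map (rename (Fin.castLE h)) (veroneseIdeal K)))

/-- The ideal of the rational normal scroll `S(a_1, …, a_k)`, generated by the `2 × 2`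
minors of the standard `2 × (Σ a_i)` matrix of indeterminates. -/
def scrollIdeal (k : ℕ) (a : Fin k → ℕ) :
    Ideal (MvPolynomial ((i : Fin k) × Fin (a i + 1)) K) :=
  Ideal.span {p | ∃ (i : Fin k) (j : Fin (a i)) (i' : Fin k) (j' : Fin (a i')),
    p = X ⟨i, j.castSucc⟩ * X ⟨i', j'.succ⟩ - X ⟨i, j.succ⟩ * X ⟨i', j'.castSucc⟩}

/-- The affine cone in `K^{r+2}` of the projective scheme `V_+(J) ⊆ ℙ^{r+1}_K`. -/
def zeroSet (J : Ideal (PS K (r + 1))) : Set (Fin (r + 2) → K) :=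
  {v | ∀ f ∈ J, MvPolynomial.eval v f = 0}

/-- Restriction of polynomials to the plane spanned by the vectors `p` and `q`
(i.e. to the line through the corresponding projective points). -/
def lineRestrict (p q : Fin (r + 2) → K) : PS K (r + 1) →ₐ[K] MvPolynomial (Fin 2) K :=
  aeval fun i => MvPolynomial.C (p i) * X 0 + MvPolynomial.C (q i) * X 1

/-- The line through the (independent) points `p`, `q` is a secant line of
`Z = V_+(J)`: the scheme `Z ∩ L ⊆ L ≅ ℙ^1` has length at least `2`, i.e. the
restriction of `J` to the line is contained in a principal ideal generated by a
form of degree `≥ 2` (or is zero, in which case `L ⊆ Z`). -/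
def IsSecantLine (J : Ideal (PS K (r + 1))) (p q : Fin (r + 2) → K) : Prop :=
  ∃ h : MvPolynomial (Fin 2) K,
    (∀ f ∈ J, lineRestrict K r p q f ∈ Ideal.span {h}) ∧
    (h = 0 ∨ ∃ dd : ℕ, 2 ≤ dd ∧ h.IsHomogeneous dd)

/-- The (affine cone over the) secant cone `Sec_P(Z)` of `Z = V_+(J)` with respect to
the point `P = [p]`: the union of `{P}` and of all secant lines of `Z` through `P`. -/
def secantCone (J : Ideal (PS K (r + 1))) (p : Fin (r + 2) → K) : Set (Fin (r + 2) → K) :=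
  {v | ∃ a : K, v = a • p} ∪
    {v | ∃ q : Fin (r + 2) → K, LinearIndependent K ![p, q] ∧ IsSecantLine K r J p q ∧
      ∃ a b : K, v = a • p + b • q}

/-- The (homogeneous) vanishing ideal of a subset of the affine cone `K^{r+2}`. -/
def vanishingIdl (T : Set (Fin (r + 2) → K)) : Ideal (PS K (r + 1)) where
  carrier := {f | ∀ v ∈ T, MvPolynomial.eval v f = 0}
  add_mem' := by
    intro a b ha hb v hv
    rw [map_add, ha v hv, hb v hv, add_zero]
  zero_mem' := by
    intro v hv
    rw [map_zero]
  smul_mem' := by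
    intro c f hf v hv
    rw [smul_eq_mul, map_mul, hf v hv, mul_zero]

/-- `X = V_+(I) ⊆ ℙ^r_K` is the image of `Z = V_+(J) ⊆ ℙ^{r+1}_K` under the linear
projection `π : ℙ^{r+1}_K ∖ {P} → ℙ^r_K` from the point `P = [p]`:  `I` is the
contraction of `J` along the substitution homomorphism induced by a surjective linear
map `K^{r+2} → K^{r+1}` with kernel `K·p`. -/
def IsProjectionFromPoint (I : Ideal (PS K r)) (J : Ideal (PS K (r + 1)))
    (p : Fin (r + 2) → K) : Prop :=
  ∃ π : (Fin (r + 2) → K) →ₗ[K] (Fin (r + 1) → K),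
    Function.Surjective π ∧ LinearMap.ker π = Submodule.span K {p} ∧
    I = Ideal.comap
      (aeval (fun j : Fin (r + 1) =>
        ∑ i : Fin (r + 2), MvPolynomial.C (π (Pi.single i 1) j) * X i) :
          PS K r →ₐ[K] PS K (r + 1)) J

end AMD

end

noncomputable section
namespace AMDP
set_option linter.unusedSectionVars false
set_option linter.unusedSimpArgs false
set_option linter.unusedVariables false
notation "MP" K:max n:max => MvPolynomial (Fin n) K
notation "kF" K:max t:max => IntermediateField.adjoin K (Set.range t)
open MvPolynomial renaming aeval → maeval, aeval_def → maeval_def, homogeneousComponent → mcomp, sum_homogeneousComponent → msum_comp, homogeneousComponent_isHomogeneous → mcomp_hom, X → mX, isHomogeneous_zero → misHomogeneous_zero, algHom_ext → malgHom_ext, isHomogeneous_X → misHomogeneous_X, aeval_X → maeval_X, constantCoeff → mconstantCoeff, coeff → mcoeff, isHomogeneous_C → misHomogeneous_C, aeval_C → maeval_C, eval → meval, monomial → mmonomial, induction_on → minduction_on, pderiv → mpderiv, totalDegree → mtotalDegree, rename → mrename, aeval_rename → maeval_rename, homogeneousSubmodule → mhomogeneousSubmodule, smul_eq_C_mul → 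msmul_eq_C_mul

section
open Polynomial IntermediateField.algebraAdjoinAdjoin
theorem minpoly_coeff_mem {F E : Type} [Field F] [Field E] [Algebra F E] (S : Set E)
    [IsIntegrallyClosed (Algebra.adjoin F S)] {w : E}
    (hw : IsIntegral (Algebra.adjoin F S) w) (j : ℕ) :
    (((minpoly (IntermediateField.adjoin F S) w).coeff j : IntermediateField.adjoin F S) : E)
      ∈ Algebra.adjoin F S := by
  rw [minpoly.isIntegrallyClosed_eq_field_fractions' (R := Algebra.adjoin F S)
    (IntermediateField.adjoin F S) hw, Polynomial.coeff_map]
  exact ((minpoly (Algebra.adjoin F S) w).coeff j).2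

end

section
open Polynomial IntermediateField.algebraAdjoinAdjoin
theorem minpoly_coeff_mem' {F E : Type} [Field F] [Field E] [Algebra F E] (S : Set E)
    [IsIntegrallyClosed (Algebra.adjoin F S)] (k : IntermediateField F E)
    (hk : k = IntermediateField.adjoin F S) {w : E}
    (hw : IsIntegral (Algebra.adjoin F S) w) (j : ℕ) :
    (((minpoly k w).coeff j : k) : E) ∈ Algebra.adjoin F S := by
  subst hk
  exact minpoly_coeff_mem S hw j

theorem intClosed_of_transcendental {L E : Type} [Field L] [Field E] [Algebra L E] {u : E}
    (hu : Transcendental L u) : IsIntegrallyClosed (Algebra.adjoin L {u}) := by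
  have hinj : Function.Injective (aeval u : L[X] →ₐ[L] E) := by
    rwa [transcendental_iff_injective] at hu
  have e : L[X] ≃ₐ[L] Algebra.adjoin L {u} :=
    (AlgEquiv.ofInjective _ hinj).trans
      (Subalgebra.equivOfEq _ _ (Algebra.adjoin_singleton_eq_range_aeval L u).symm)
  exact IsIntegrallyClosed.of_equiv e.toRingEquiv

theorem inv_transcendental {L E : Type} [Field L] [Field E] [Algebra L E] {u : E}
    (hu : Transcendental L u) : Transcendental L u⁻¹ := by
  intro h
  apply hu
  simpa using h.inv

theorem adjoin_inv_eq {L E : Type} [Field L] [Field E] [Algebra L E] (u : E) :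
    IntermediateField.adjoin L {u} = IntermediateField.adjoin L {u⁻¹} := by
  apply le_antisymm
  · rw [IntermediateField.adjoin_le_iff]
    rintro x rfl
    have := (IntermediateField.adjoin L {x⁻¹}).inv_mem
      (IntermediateField.mem_adjoin_simple_self L x⁻¹)
    simpa using this
  · rw [IntermediateField.adjoin_le_iff]
    rintro x rfl
    exact (IntermediateField.adjoin L {u}).inv_mem (IntermediateField.mem_adjoin_simple_self L u)

variable {L E : Type} [Field L] [Field E] [Algebra L E]

theorem reflect_aeval (τ : E) (hτ : τ ≠ 0) (N : ℕ) (P : L[X]) (hP : P.natDegree ≤ N) :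
    aeval τ⁻¹ (P.reflect N) = aeval τ P * τ⁻¹ ^ N := by
  rw [aeval_def, aeval_def]
  letI : Invertible τ := invertibleOfNonzero hτ
  have h := eval₂_reflect_mul_pow (algebraMap L E) τ N P hP
  rw [invOf_eq_inv] at h
  rw [← h, mul_assoc, ← mul_pow, mul_inv_cancel₀ hτ, one_pow, mul_one]

theorem poly_inter {τ : E} (hτ : Transcendental L τ) (P Q : L[X])
    (h : aeval τ P = aeval τ⁻¹ Q) : P.natDegree = 0 := by
  have h0 : τ ≠ 0 := by
    rintro rfl
    exact hτ isAlgebraic_zero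
  have hinj : Function.Injective (aeval τ : L[X] →ₐ[L] E) := by
    rwa [transcendental_iff_injective] at hτ
  have h1 := reflect_aeval (L := L) τ⁻¹ (inv_ne_zero h0) Q.natDegree Q le_rfl
  rw [inv_inv, ← h] at h1
  have h2 : Q.reflect Q.natDegree = P * X ^ Q.natDegree := by
    apply hinj
    rw [h1]
    simp
  by_cases hP : P = 0
  · simp [hP]
  have h3 : (P * X ^ Q.natDegree).natDegree ≤ Q.natDegree := by
    rw [← h2]
    exact (natDegree_reflect_le).trans (by simp)
  rw [natDegree_mul_X_pow _ hP] at h3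
  omega

/-- sections of degree `n` -/
def Bn (L : Type) {E : Type} [Field L] [Field E] [Algebra L E] (τ : E) (n : ℕ) : Submodule L E where
  carrier := {w | IsIntegral (Algebra.adjoin L {τ}) w ∧
    IsIntegral (Algebra.adjoin L {τ⁻¹}) (w * τ⁻¹ ^ n)}
  add_mem' := by
    rintro a b ⟨h1, h2⟩ ⟨h3, h4⟩
    exact ⟨h1.add h3, by rw [add_mul]; exact h2.add h4⟩
  zero_mem' := ⟨isIntegral_zero, by rw [zero_mul]; exact isIntegral_zero⟩
  smul_mem' := by
    rintro c a ⟨h1, h2⟩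
    exact ⟨h1.smul c, by rw [smul_mul_assoc]; exact h2.smul c⟩

theorem mem_Bn {τ : E} {n : ℕ} {w : E} : w ∈ Bn L τ n ↔ IsIntegral (Algebra.adjoin L {τ}) w ∧
    IsIntegral (Algebra.adjoin L {τ⁻¹}) (w * τ⁻¹ ^ n) := Iff.rfl

theorem Bn_mul {τ : E} {n m : ℕ} {w v : E} (hw : w ∈ Bn L τ n) (hv : v ∈ Bn L τ m) :
    w * v ∈ Bn L τ (n + m) := by
  refine ⟨hw.1.mul hv.1, ?_⟩
  have := hw.2.mul hv.2
  rwa [mul_mul_mul_comm, ← pow_add] at this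

theorem isInt_adjoin {u v : E} (h : v ∈ Algebra.adjoin L {u}) :
    IsIntegral (Algebra.adjoin L {u}) v := isIntegral_algebraMap (x := (⟨v, h⟩ : Algebra.adjoin L {u}))

theorem aeval_mem_adj (u : E) (P : L[X]) : aeval u P ∈ Algebra.adjoin L {u} :=
  aeval_mem_adjoin_singleton L u

theorem aeval_mem_Bn {τ : E} (hτ : τ ≠ 0) {n : ℕ} (P : L[X]) (hP : P.natDegree ≤ n) :
    aeval τ P ∈ Bn L τ n := by
  refine ⟨isInt_adjoin (aeval_mem_adj τ P), ?_⟩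
  rw [← reflect_aeval τ hτ n P hP]
  exact isInt_adjoin (aeval_mem_adj _ _)

theorem Bn_zero {τ : E} (hτ : Transcendental L τ)
    (hcl : ∀ w : E, IsAlgebraic L w → ∃ l : L, algebraMap L E l = w)
    {w : E} (hw : w ∈ Bn L τ 0) : ∃ l : L, algebraMap L E l = w := by
  apply hcl
  have := intClosed_of_transcendental hτ
  have := intClosed_of_transcendental (inv_transcendental hτ)
  set k := IntermediateField.adjoin L {τ} with hk
  obtain ⟨h1, h2⟩ := hw
  rw [pow_zero, mul_one] at h2
  have hc : ∀ j, ∃ l : L, algebraMap L k l = (minpoly k w).coeff j := by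
    intro j
    have m1 := minpoly_coeff_mem' {τ} k hk h1 j
    have m2 := minpoly_coeff_mem' {τ⁻¹} k (hk.trans (adjoin_inv_eq τ)) h2 j
    rw [Algebra.adjoin_singleton_eq_range_aeval] at m1 m2
    obtain ⟨P, hP⟩ := m1
    obtain ⟨Q, hQ⟩ := m2
    have hP0 := poly_inter hτ P Q (hP.trans hQ.symm)
    rw [natDegree_eq_zero] at hP0
    obtain ⟨l, hl⟩ := hP0
    refine ⟨l, ?_⟩
    apply Subtype.ext
    rw [← hP, ← hl]
    simp
  have hitg : IsIntegral k w := h1.tower_top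
  choose l hl using hc
  have hlift : minpoly k w ∈ Polynomial.lifts (algebraMap L k) := by
    rw [Polynomial.lifts_iff_coeff_lifts]
    exact fun j => ⟨l j, hl j⟩
  obtain ⟨q, hq⟩ := hlift
  simp only [coe_mapRingHom] at hq
  refine ⟨q, ?_, ?_⟩
  · rintro rfl
    rw [Polynomial.map_zero] at hq
    exact minpoly.ne_zero hitg hq.symm
  · have := minpoly.aeval k w
    rw [← hq, aeval_map_algebraMap] at this
    exact this

theorem Bn_dep {τ : E} (hτ0 : τ ≠ 0)
    (n ρ : ℕ) (V : Submodule (IntermediateField.adjoin L {τ}) E)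
    [FiniteDimensional (IntermediateField.adjoin L {τ}) V]
    (hV : Module.finrank (IntermediateField.adjoin L {τ}) V ≤ ρ) {ι : Type} [Fintype ι]
    (hι : ρ < Fintype.card ι) (e : ι → E) (he : ∀ i, e i ∈ Bn L τ (n + 1)) (heV : ∀ i, e i ∈ V) :
    ∃ a : ι → L, a ≠ 0 ∧ ∑ i, a i • e i ∈ Bn L τ n := by
  classical
  have hdep : ¬ LinearIndependent (IntermediateField.adjoin L {τ}) (fun i => (⟨e i, heV i⟩ : V)) := by
    intro h
    have := h.fintype_card_le_finrank
    omega
  rw [Fintype.not_linearIndependent_iff] at hdep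
  obtain ⟨g, hg0, i0, hi0⟩ := hdep
  obtain ⟨b, hb⟩ := IsLocalization.exist_integer_multiples_of_finset
    (nonZeroDivisors (Algebra.adjoin L {τ})) (Finset.univ.image g)
  have hP : ∀ i, ∃ P : L[X], aeval τ P = ((b : Algebra.adjoin L {τ}) : E) * (g i : E) := by
    intro i
    obtain ⟨c, hc⟩ := hb (g i) (by simp)
    obtain ⟨P, hP⟩ := (Algebra.adjoin_singleton_eq_range_aeval L τ).le c.2
    refine ⟨P, ?_⟩
    have := congrArg (fun z : IntermediateField.adjoin L {τ} => (z : E)) hc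
    simp only [Algebra.smul_def] at this
    exact hP.trans this
  choose P hP using hP
  have hb0 : ((b : Algebra.adjoin L {τ}) : E) ≠ 0 := by
    have := nonZeroDivisors.ne_zero b.2
    intro h
    exact this (Subtype.ext h)
  have hsum : ∑ i, aeval τ (P i) * e i = 0 := by
    have := congrArg (fun z : V => (z : E)) hg0
    simp only [Submodule.coe_sum, Submodule.coe_smul, Submodule.coe_zero] at this
    calc ∑ i, aeval τ (P i) * e i = ((b : Algebra.adjoin L {τ}) : E) * ∑ i, g i • e i := by
          rw [Finset.mul_sum]
          refine Finset.sum_congr rfl fun i _ => ?_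
          rw [hP, mul_assoc]
          rfl
      _ = 0 := by rw [this, mul_zero]
  have hPi0 : P i0 ≠ 0 := by
    intro h
    have h2 := hP i0
    rw [h, map_zero] at h2
    rcases mul_eq_zero.mp h2.symm with h3 | h3
    · exact hb0 h3
    · exact hi0 (Subtype.ext h3)
  set N := Finset.univ.sup (fun i => (P i).natDegree) with hN
  have hle : ∀ i, (P i).natDegree ≤ N := fun i =>
    Finset.le_sup (f := fun i => (P i).natDegree) (Finset.mem_univ i)
  refine ⟨fun i => (P i).coeff N, ?_, ?_⟩
  · obtain ⟨i1, -, hi1⟩ := Finset.exists_mem_eq_sup Finset.univ ⟨i0, Finset.mem_univ _⟩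
      (fun i => (P i).natDegree)
    by_cases h : P i1 = 0
    · intro hz
      have hN0 : N = 0 := by rw [hN, hi1, h]; simp
      have h3 := hle i0
      rw [hN0] at h3
      have h4 := congrFun hz i0
      simp only [hN0, Pi.zero_apply] at h4
      have h5 := eq_C_of_natDegree_le_zero h3
      rw [h4] at h5
      exact hPi0 (by simpa using h5)
    · intro hz
      have h4 := congrFun hz i1
      simp only [Pi.zero_apply] at h4
      rw [hN, hi1] at h4
      exact h (by simpa using h4)
  · refine ⟨IsIntegral.sum _ fun i _ => ((he i).1).smul _, ?_⟩
    have key : ∀ i, aeval τ (P i) * τ⁻¹ ^ N =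
        algebraMap L E ((P i).coeff N) + aeval τ⁻¹ ((P i).reflect N).divX * τ⁻¹ := by
      intro i
      rw [← reflect_aeval τ hτ0 N (P i) (hle i)]
      conv_lhs => rw [← divX_mul_X_add ((P i).reflect N)]
      simp only [map_add, map_mul, aeval_X, aeval_C, coeff_reflect]
      rw [add_comm]
      simp
    have h1 : (∑ i, (P i).coeff N • e i) * τ⁻¹ ^ n =
        - ∑ i, aeval τ⁻¹ ((P i).reflect N).divX * (e i * τ⁻¹ ^ (n + 1)) := by
      have h2 : ∑ i, (aeval τ (P i) * τ⁻¹ ^ N) * e i = 0 := by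
        rw [← mul_zero (τ⁻¹ ^ N), ← hsum, Finset.mul_sum]
        refine Finset.sum_congr rfl fun i _ => by ring
      have h3 : ∑ i, (P i).coeff N • e i =
          - ∑ i, aeval τ⁻¹ ((P i).reflect N).divX * τ⁻¹ * e i := by
        rw [eq_neg_iff_add_eq_zero, ← Finset.sum_add_distrib, ← h2]
        refine Finset.sum_congr rfl fun i _ => ?_
        rw [key, Algebra.smul_def]
        ring
      rw [h3, neg_mul, Finset.sum_mul]
      congr 1
      refine Finset.sum_congr rfl fun i _ => by ring
    rw [h1]
    refine (IsIntegral.sum _ fun i _ => ?_).neg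
    exact (isInt_adjoin (aeval_mem_adj _ _)).mul (he i).2

end

section
open Polynomial IntermediateField IntermediateField.algebraAdjoinAdjoin
variable {L E : Type} [Field L] [Field E] [Algebra L E]

theorem BV_rank {τ : E} (hτ : Transcendental L τ)
    (hcl : ∀ w : E, IsAlgebraic L w → ∃ l : L, algebraMap L E l = w)
    (ρ : ℕ) (V : Submodule L⟮τ⟯ E) [FiniteDimensional L⟮τ⟯ V]
    (hV : Module.finrank L⟮τ⟯ V ≤ ρ) (n : ℕ) :
    Module.rank L (Bn L τ n ⊓ V.restrictScalars L : Submodule L E) ≤ ((ρ * n + 1 : ℕ) : Cardinal) := by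
  have h0 : τ ≠ 0 := by
    rintro rfl
    exact hτ isAlgebraic_zero
  induction n with
  | zero =>
    have : (Bn L τ 0 ⊓ V.restrictScalars L : Submodule L E) ≤ Submodule.span L {1} := by
      rintro w ⟨hw, -⟩
      obtain ⟨l, rfl⟩ := Bn_zero hτ hcl hw
      rw [Submodule.mem_span_singleton]
      exact ⟨l, by rw [Algebra.smul_def, mul_one]⟩
    refine (Submodule.rank_mono this).trans ?_
    refine (rank_span_le _).trans ?_
    simp
  | succ n ih =>
    let f : (Bn L τ (n+1) ⊓ V.restrictScalars L : Submodule L E) →ₗ[L] (E ⧸ Bn L τ n) :=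
      (Bn L τ n).mkQ.comp (Submodule.subtype _)
    rw [← LinearMap.rank_range_add_rank_ker f]
    have h1 : Module.rank L (LinearMap.ker f) ≤ ((ρ * n + 1 : ℕ) : Cardinal) := by
      refine le_trans ?_ ih
      let g : LinearMap.ker f →ₗ[L] (Bn L τ n ⊓ V.restrictScalars L : Submodule L E) :=
        LinearMap.codRestrict _ ((Submodule.subtype _).comp (Submodule.subtype _)) (by
          rintro ⟨⟨w, hw⟩, hw2⟩
          refine ⟨?_, hw.2⟩
          have : (Bn L τ n).mkQ w = 0 := hw2
          simpa using this)
      apply LinearMap.rank_le_of_injective g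
      intro a b hab
      have := congrArg (fun z : (Bn L τ n ⊓ V.restrictScalars L : Submodule L E) => (z : E)) hab
      exact Subtype.ext (Subtype.ext this)
    have h2 : Module.rank L (LinearMap.range f) ≤ (ρ : Cardinal) := by
      apply rank_le
      intro s hs
      by_contra hlt
      push Not at hlt
      have hpre : ∀ i : s, ∃ w : (Bn L τ (n+1) ⊓ V.restrictScalars L : Submodule L E),
          f w = (i : LinearMap.range f) := fun i => i.1.2
      choose w hw using hpre
      obtain ⟨a, ha0, ha⟩ := Bn_dep h0 n ρ V hV (ι := s) (by simpa using hlt) (fun i => (w i : E))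
        (fun i => (w i).2.1) (fun i => (w i).2.2)
      rw [Fintype.linearIndependent_iff] at hs
      apply ha0
      funext i
      apply hs a
      apply Subtype.ext
      rw [Submodule.coe_sum]
      simp only [Submodule.coe_smul, ← hw, Submodule.coe_zero]
      rw [← Submodule.Quotient.mk_eq_zero] at ha
      rw [← ha, ← Submodule.mkQ_apply, map_sum]
      rfl
    calc _ ≤ (ρ : Cardinal) + ((ρ * n + 1 : ℕ) : Cardinal) := add_le_add h2 h1
      _ = _ := by push_cast; ring

theorem BV_fin {τ : E} (hτ : Transcendental L τ)
    (hcl : ∀ w : E, IsAlgebraic L w → ∃ l : L, algebraMap L E l = w)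
    (ρ : ℕ) (V : Submodule L⟮τ⟯ E) [FiniteDimensional L⟮τ⟯ V]
    (hV : Module.finrank L⟮τ⟯ V ≤ ρ) (n : ℕ) :
    FiniteDimensional L (Bn L τ n ⊓ V.restrictScalars L : Submodule L E) ∧
    Module.finrank L (Bn L τ n ⊓ V.restrictScalars L : Submodule L E) ≤ ρ * n + 1 := by
  have h := BV_rank hτ hcl ρ V hV n
  constructor
  · rw [FiniteDimensional, ← Module.rank_lt_aleph0_iff]
    exact h.trans_lt Cardinal.natCast_lt_aleph0
  · exact Module.finrank_le_of_rank_le h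

/-- the data of a curve over `L` -/
structure Curve (L : Type) {E : Type} [Field L] [Field E] [Algebra L E] (τ x y : E) : Prop where
  tr : Transcendental L τ
  cl : ∀ w : E, IsAlgebraic L w → ∃ l : L, algebraMap L E l = w
  hx : x ∈ Bn L τ 1
  hy : y ∈ Bn L τ 1
  indep : LinearIndependent L⟮τ⟯ (![1, x, y] : Fin 3 → E)

theorem Curve.ne {τ x y : E} (h : Curve L τ x y) : τ ≠ 0 := by
  rintro rfl
  exact h.tr isAlgebraic_zero

/-- the three-dimensional space -/
def Vsp (L : Type) {E : Type} [Field L] [Field E] [Algebra L E] (τ x y : E) :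
    Submodule L⟮τ⟯ E := Submodule.span L⟮τ⟯ (Set.range ![1, x, y])

theorem mem_Vsp {τ x y w : E} : w ∈ Vsp L τ x y ↔
    ∃ f : Fin 3 → L⟮τ⟯, w = f 0 + f 1 * x + f 2 * y := by
  rw [Vsp, Submodule.mem_span_range_iff_exists_fun]
  simp only [Fin.sum_univ_three]
  constructor
  · rintro ⟨c, hc⟩
    refine ⟨c, ?_⟩
    rw [← hc]
    simp [Algebra.smul_def]
  · rintro ⟨c, hc⟩
    refine ⟨c, ?_⟩
    rw [hc]
    simp [Algebra.smul_def]

instance {τ x y : E} : FiniteDimensional L⟮τ⟯ (Vsp L τ x y) :=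
  FiniteDimensional.span_of_finite _ (Set.finite_range _)

theorem Curve.indep' {τ x y : E} (h : Curve L τ x y) (f : Fin 3 → L⟮τ⟯)
    (hf : (f 0 : E) + f 1 * x + f 2 * y = 0) : f = 0 := by
  have := h.indep
  rw [Fintype.linearIndependent_iff] at this
  funext i
  apply this f
  simp only [Fin.sum_univ_three]
  simpa [Algebra.smul_def] using hf

theorem aeval_inj {τ : E} (hτ : Transcendental L τ) :
    Function.Injective (aeval τ : L[X] →ₐ[L] E) := by
  rwa [transcendental_iff_injective] at hτ

theorem mem_adj (τ : E) (P : L[X]) : aeval τ P ∈ L⟮τ⟯ :=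
  algebra_adjoin_le_adjoin L {τ} (aeval_mem_adj τ P)

/-- polynomials mapping to sections in `V` -/
def Curve.polyMap {τ x y : E} (h : Curve L τ x y) (n : ℕ) :
    (degreeLT L (n+1) × degreeLT L n × degreeLT L n) →ₗ[L]
      (Bn L τ n ⊓ (Vsp L τ x y).restrictScalars L : Submodule L E) :=
  LinearMap.codRestrict _
    { toFun := fun P => aeval τ (P.1 : L[X]) + aeval τ (P.2.1 : L[X]) * x
        + aeval τ (P.2.2 : L[X]) * y
      map_add' := by intro P Q; simp; ring
      map_smul' := by intro c P; simp [Algebra.smul_def]; ring } (by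
    rintro ⟨⟨P, hP⟩, ⟨Q, hQ⟩, ⟨R, hR⟩⟩
    rw [mem_degreeLT] at hP hQ hR
    have aux : ∀ Q : L[X], Q.degree < n → ∀ z ∈ Bn L τ 1, aeval τ Q * z ∈ Bn L τ n := by
      intro Q hQ z hz
      by_cases hQ0 : Q = 0
      · simp [hQ0]
      rw [← natDegree_lt_iff_degree_lt hQ0] at hQ
      have := Bn_mul (aeval_mem_Bn (n := n - 1) h.ne Q (by omega)) hz
      rwa [Nat.sub_add_cancel (by omega)] at this
    refine ⟨add_mem (add_mem (aeval_mem_Bn h.ne P ?_) (aux Q hQ x h.hx)) (aux R hR y h.hy), ?_⟩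
    · exact natDegree_le_of_degree_le (by simpa [Order.lt_succ_iff] using Order.le_of_lt_succ hP)
    · rw [SetLike.mem_coe, Submodule.restrictScalars_mem, mem_Vsp]
      exact ⟨![⟨_, mem_adj τ P⟩, ⟨_, mem_adj τ Q⟩, ⟨_, mem_adj τ R⟩], by simp⟩)

theorem Curve.polyMap_inj {τ x y : E} (h : Curve L τ x y) (n : ℕ) :
    Function.Injective (h.polyMap n) := by
  rw [← LinearMap.ker_eq_bot, LinearMap.ker_eq_bot']
  rintro ⟨⟨P, hP⟩, ⟨Q, hQ⟩, ⟨R, hR⟩⟩ h0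
  have h1 := congrArg (fun z : (Bn L τ n ⊓ (Vsp L τ x y).restrictScalars L : Submodule L E) =>
      (z : E)) h0
  have h1' : aeval τ P + aeval τ Q * x + aeval τ R * y = 0 := h1
  have h2 := h.indep' ![⟨_, mem_adj τ P⟩, ⟨_, mem_adj τ Q⟩, ⟨_, mem_adj τ R⟩] (by
    simpa using h1')
  have e0 := congrArg (fun z : L⟮τ⟯ => (z : E)) (congrFun h2 0)
  have e1 := congrArg (fun z : L⟮τ⟯ => (z : E)) (congrFun h2 1)
  have e2 := congrArg (fun z : L⟮τ⟯ => (z : E)) (congrFun h2 2)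
  simp at e0 e1 e2
  have := aeval_inj h.tr
  rw [injective_iff_map_eq_zero] at this
  have a0 := this P e0
  have a1 := this Q e1
  have a2 := this R e2
  subst a0 a1 a2
  rfl

theorem finrank_degreeLT (n : ℕ) : Module.finrank L (degreeLT L n) = n := by
  rw [(degreeLTEquiv L n).finrank_eq]; simp

instance (n : ℕ) : FiniteDimensional L (degreeLT L n) :=
  Module.Finite.equiv (degreeLTEquiv L n).symm

theorem Curve.V_le {τ x y : E} : Module.finrank L⟮τ⟯ (Vsp L τ x y) ≤ 3 := by
  have := finrank_range_le_card (R := L⟮τ⟯) (![1, x, y] : Fin 3 → E)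
  rw [Fintype.card_fin] at this
  exact this

theorem Curve.polyMap_bij {τ x y : E} (h : Curve L τ x y) (n : ℕ) :
    Function.Bijective (h.polyMap n) := by
  refine ⟨h.polyMap_inj n, ?_⟩
  obtain ⟨hf, hle⟩ := BV_fin h.tr h.cl 3 _ (Curve.V_le (L := L) (τ := τ) (x := x) (y := y)) n
  have h1 := LinearMap.finrank_range_of_inj (h.polyMap_inj n)
  rw [← LinearMap.range_eq_top]
  apply Submodule.eq_top_of_finrank_eq
  apply le_antisymm (Submodule.finrank_le _)
  rw [h1, Module.finrank_prod, Module.finrank_prod, finrank_degreeLT, finrank_degreeLT]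
  omega

theorem Curve.V_finrank {τ x y : E} (h : Curve L τ x y) (n : ℕ) :
    Module.finrank L (Bn L τ n ⊓ (Vsp L τ x y).restrictScalars L : Submodule L E) = 3 * n + 1 := by
  rw [← (LinearEquiv.ofBijective _ (h.polyMap_bij n)).finrank_eq, Module.finrank_prod,
    Module.finrank_prod, finrank_degreeLT, finrank_degreeLT]
  omega

theorem Curve.C1 {τ x y : E} (h : Curve L τ x y) (n : ℕ) (f : Fin 3 → L⟮τ⟯)
    (hf : (f 0 : E) + f 1 * x + f 2 * y ∈ Bn L τ n) :
    ∃ P0 P1 P2 : L[X], P0.degree < (n + 1 : ℕ) ∧ P1.degree < n ∧ P2.degree < n ∧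
      aeval τ P0 = (f 0 : E) ∧ aeval τ P1 = (f 1 : E) ∧ aeval τ P2 = (f 2 : E) := by
  obtain ⟨⟨⟨P, hP⟩, ⟨Q, hQ⟩, ⟨R, hR⟩⟩, he⟩ := (h.polyMap_bij n).2
    ⟨_, hf, by rw [SetLike.mem_coe, Submodule.restrictScalars_mem, mem_Vsp]; exact ⟨f, rfl⟩⟩
  have h1 := congrArg (fun z : (Bn L τ n ⊓ (Vsp L τ x y).restrictScalars L : Submodule L E) =>
      (z : E)) he
  have h1' : aeval τ P + aeval τ Q * x + aeval τ R * y = (f 0 : E) + f 1 * x + f 2 * y := h1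
  have h2 := h.indep' (![⟨_, mem_adj τ P⟩, ⟨_, mem_adj τ Q⟩, ⟨_, mem_adj τ R⟩] - f) (by
    simp
    linear_combination h1')
  rw [mem_degreeLT] at hP hQ hR
  refine ⟨P, Q, R, hP, hQ, hR, ?_⟩
  rw [sub_eq_zero] at h2
  refine ⟨?_, ?_, ?_⟩ <;> rw [← h2] <;> simp

end

section
open Polynomial IntermediateField IntermediateField.algebraAdjoinAdjoin
variable {L E : Type} [Field L] [Field E] [Algebra L E]

/-- `χ` as an `L`-linear map into `E` -/
def chiE {τ : E} (χ : E →ₗ[L⟮τ⟯] L⟮τ⟯) : E →ₗ[L] E :=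
  (L⟮τ⟯.val.toLinearMap).comp (χ.restrictScalars L)

theorem chiE_apply {τ : E} (χ : E →ₗ[L⟮τ⟯] L⟮τ⟯) (w : E) : chiE χ w = (χ w : E) := rfl

theorem chi_poly {τ : E} (χ : E →ₗ[L⟮τ⟯] L⟮τ⟯) (P : L[X]) (w : E) :
    (χ (aeval τ P * w) : E) = aeval τ P * (χ w : E) := by
  have : aeval τ P * w = (⟨_, mem_adj τ P⟩ : L⟮τ⟯) • w := rfl
  rw [this, map_smul]
  rfl

theorem Curve.image_fin {τ x y : E} (h : Curve L τ x y) (h4 : Module.finrank L⟮τ⟯ E = 4)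
    (χ : E →ₗ[L⟮τ⟯] L⟮τ⟯) (hχ : ∀ w ∈ Vsp L τ x y, χ w = 0) (n : ℕ) :
    FiniteDimensional L ((Bn L τ n).map (chiE χ)) ∧
    Module.finrank L ((Bn L τ n).map (chiE χ)) ≤ n := by
  have : FiniteDimensional L⟮τ⟯ E := Module.finite_of_finrank_pos (by omega)
  have htop : Module.finrank L⟮τ⟯ (⊤ : Submodule L⟮τ⟯ E) ≤ 4 := by
    rw [finrank_top, h4]
  obtain ⟨hf, hle⟩ := BV_fin h.tr h.cl 4 _ htop n
  have he : (Bn L τ n ⊓ (⊤ : Submodule L⟮τ⟯ E).restrictScalars L : Submodule L E) = Bn L τ n := by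
    simp
  rw [he] at hf hle
  refine ⟨inferInstance, ?_⟩
  have h1 := LinearMap.finrank_range_add_finrank_ker ((chiE χ).domRestrict (Bn L τ n))
  rw [LinearMap.range_domRestrict] at h1
  let g : (Bn L τ n ⊓ (Vsp L τ x y).restrictScalars L : Submodule L E) →ₗ[L]
      LinearMap.ker ((chiE χ).domRestrict (Bn L τ n)) :=
    LinearMap.codRestrict _ (Submodule.inclusion inf_le_left) (by
      rintro ⟨w, hw1, hw2⟩
      rw [LinearMap.mem_ker]
      change ((χ w : L⟮τ⟯) : E) = 0
      rw [hχ w hw2]; rfl)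
  have h2 : Module.finrank L (Bn L τ n ⊓ (Vsp L τ x y).restrictScalars L : Submodule L E) ≤
      Module.finrank L (LinearMap.ker ((chiE χ).domRestrict (Bn L τ n))) := by
    apply LinearMap.finrank_le_finrank_of_injective (f := g)
    intro a b hab
    have := congrArg (fun z : LinearMap.ker ((chiE χ).domRestrict (Bn L τ n)) => ((z : Bn L τ n) : E)) hab
    exact Subtype.ext this
  rw [h.V_finrank] at h2
  omega

theorem solve_poly (c u : Fin 3 → L[X]) (hu : ∑ i, u i * c i = 1) (i0 : Fin 3)
    (hpos : 1 ≤ (c i0).natDegree)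
    (hmax : ∀ i, (c i).natDegree ≤ (c i0).natDegree) (N : ℕ) (hN : (c i0).natDegree ≤ N)
    (f : L[X]) (hf : f.natDegree ≤ N + (c i0).natDegree) :
    ∃ s : Fin 3 → L[X], (∀ i, (s i).natDegree ≤ N) ∧ ∑ i, s i * c i = f := by
  have hc0 : c i0 ≠ 0 := by
    intro h0
    rw [h0] at hpos
    simp at hpos
  let r : Fin 3 → L[X] := fun i => (f * u i) % c i0
  let q : Fin 3 → L[X] := fun i => (f * u i) / c i0
  have hr : ∀ i, (r i).natDegree ≤ N := by
    intro i
    have : (r i).natDegree < (c i0).natDegree := natDegree_mod_lt _ (by omega)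
    omega
  have hqr : ∀ i, f * u i = c i0 * q i + r i := fun i => (EuclideanDomain.div_add_mod _ _).symm
  have hsum : f = ∑ i, (c i0 * q i + r i) * c i := by
    calc f = f * ∑ i, u i * c i := by rw [hu, mul_one]
      _ = ∑ i, (f * u i) * c i := by rw [Finset.mul_sum]; simp only [mul_assoc]
      _ = _ := by simp only [hqr]
  let Q : L[X] := ∑ i, q i * c i
  have hsum' : f = c i0 * Q + ∑ i, r i * c i := by
    rw [hsum, Finset.mul_sum, ← Finset.sum_add_distrib]
    exact Finset.sum_congr rfl fun i _ => by ring
  have hd : (c i0 * Q).natDegree ≤ N + (c i0).natDegree := by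
    have : c i0 * Q = f - ∑ i, r i * c i := by
      rw [eq_sub_iff_add_eq]; exact hsum'.symm
    rw [this]
    refine (natDegree_sub_le _ _).trans (max_le hf ?_)
    refine natDegree_sum_le_of_forall_le _ _ fun i _ => ?_
    exact natDegree_mul_le.trans (add_le_add (hr i) (hmax i))
  have hQ : Q.natDegree ≤ N := by
    by_cases h0 : Q = 0
    · simp [h0]
    rw [natDegree_mul hc0 h0] at hd
    omega
  refine ⟨fun i => r i + if i = i0 then Q else 0, ?_, ?_⟩
  · intro i
    refine (natDegree_add_le _ _).trans (max_le (hr i) ?_)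
    split_ifs <;> simp [hQ]
  · simp only [add_mul, Finset.sum_add_distrib, ite_mul, zero_mul, Finset.sum_ite_eq',
      Finset.mem_univ, if_true]
    rw [hsum']; ring

theorem Curve.image_ge {τ x y : E} (h : Curve L τ x y)
    (χ : E →ₗ[L⟮τ⟯] L⟮τ⟯) (c u : Fin 3 → L[X])
    (hc0 : (χ (x * x) : E) = aeval τ (c 0)) (hc1 : (χ (x * y) : E) = aeval τ (c 1))
    (hc2 : (χ (y * y) : E) = aeval τ (c 2))
    (hu : ∑ i, u i * c i = 1) (i0 : Fin 3) (hpos : 1 ≤ (c i0).natDegree)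
    (hmax : ∀ i, (c i).natDegree ≤ (c i0).natDegree) (N : ℕ) (hN : (c i0).natDegree ≤ N) :
    (degreeLT L (N + (c i0).natDegree + 1)).map (aeval τ : L[X] →ₐ[L] E).toLinearMap ≤
      (Bn L τ (N+2)).map (chiE χ) := by
  rintro _ ⟨f, hf, rfl⟩
  have hf' : f.natDegree ≤ N + (c i0).natDegree := by
    rw [SetLike.mem_coe, mem_degreeLT] at hf
    by_cases h0 : f = 0
    · simp [h0]
    · rw [← natDegree_lt_iff_degree_lt h0] at hf
      omega
  obtain ⟨s, hs, hsf⟩ := solve_poly c u hu i0 hpos hmax N hN f hf'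
  rw [Fin.sum_univ_three] at hsf
  refine ⟨aeval τ (s 0) * (x * x) + aeval τ (s 1) * (x * y) + aeval τ (s 2) * (y * y), ?_, ?_⟩
  · exact add_mem (add_mem (Bn_mul (aeval_mem_Bn h.ne _ (hs 0)) (Bn_mul h.hx h.hx))
      (Bn_mul (aeval_mem_Bn h.ne _ (hs 1)) (Bn_mul h.hx h.hy)))
      (Bn_mul (aeval_mem_Bn h.ne _ (hs 2)) (Bn_mul h.hy h.hy))
  · rw [map_add, map_add, chiE_apply, chiE_apply, chiE_apply, chi_poly, chi_poly, chi_poly,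
      hc0, hc1, hc2, AlgHom.toLinearMap_apply, ← hsf]
    simp

theorem finrank_degreeLT_map {τ : E} (hτ : Transcendental L τ) (n : ℕ) :
    Module.finrank L ((degreeLT L n).map (aeval τ : L[X] →ₐ[L] E).toLinearMap) = n := by
  have := (Submodule.equivMapOfInjective (aeval τ : L[X] →ₐ[L] E).toLinearMap (aeval_inj hτ)
    (degreeLT L n)).finrank_eq
  rw [← this, finrank_degreeLT]

theorem Curve.C2 {τ x y : E} (h : Curve L τ x y) (h4 : Module.finrank L⟮τ⟯ E = 4)
    (χ : E →ₗ[L⟮τ⟯] L⟮τ⟯) (hχ : ∀ w ∈ Vsp L τ x y, χ w = 0) (c u : Fin 3 → L[X])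
    (hc0 : (χ (x * x) : E) = aeval τ (c 0)) (hc1 : (χ (x * y) : E) = aeval τ (c 1))
    (hc2 : (χ (y * y) : E) = aeval τ (c 2)) (hu : ∑ i, u i * c i = 1) :
    (∀ i, (c i).natDegree ≤ 1) ∧ ((∃ i, (c i).natDegree = 1) →
      ∀ n, ∀ w ∈ Bn L τ n, ∃ P : L[X], P.degree < n ∧ aeval τ P = (χ w : E)) := by
  obtain ⟨i0, -, hmax⟩ := Finset.exists_max_image Finset.univ (fun i => (c i).natDegree)
    ⟨0, Finset.mem_univ _⟩
  replace hmax := fun i => hmax i (Finset.mem_univ i)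
  have key : 1 ≤ (c i0).natDegree → (c i0).natDegree = 1 ∧ ∀ n, 3 ≤ n →
      (degreeLT L n).map (aeval τ : L[X] →ₐ[L] E).toLinearMap = (Bn L τ n).map (chiE χ) := by
    intro hpos
    have hle : (c i0).natDegree ≤ 1 := by
      have h1 := h.image_ge χ c u hc0 hc1 hc2 hu i0 hpos hmax (c i0).natDegree le_rfl
      obtain ⟨hfd, h2⟩ := h.image_fin h4 χ hχ ((c i0).natDegree + 2)
      have h3 := Submodule.finrank_mono h1
      rw [finrank_degreeLT_map h.tr] at h3
      omega
    have h1 : (c i0).natDegree = 1 := le_antisymm hle hpos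
    refine ⟨h1, fun n hn => ?_⟩
    obtain ⟨N, rfl⟩ : ∃ N, n = N + 2 := ⟨n - 2, by omega⟩
    have h3 := h.image_ge χ c u hc0 hc1 hc2 hu i0 hpos hmax N (by omega)
    rw [h1] at h3
    obtain ⟨hfd, h2⟩ := h.image_fin h4 χ hχ (N + 2)
    apply Submodule.eq_of_le_of_finrank_le h3
    rw [finrank_degreeLT_map h.tr]
    exact h2
  constructor
  · intro i
    have := hmax i
    by_contra hi
    have h2 := (key (by omega)).1
    omega
  · rintro ⟨i, hi⟩ n w hw
    have := hmax i
    obtain ⟨-, h2⟩ := key (by omega)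
    have hw3 : aeval τ (X ^ 3 : L[X]) * w ∈ Bn L τ (3 + n) :=
      Bn_mul (aeval_mem_Bn h.ne _ (by simp)) hw
    have hw4 : aeval τ (1 : L[X]) * w ∈ Bn L τ (3 + n) :=
      Bn_mul (aeval_mem_Bn h.ne _ (by simp)) hw
    have e3 : chiE χ (aeval τ (X ^ 3 : L[X]) * w) ∈ (Bn L τ (3+n)).map (chiE χ) := ⟨_, hw3, rfl⟩
    have e4 : chiE χ (aeval τ (1 : L[X]) * w) ∈ (Bn L τ (3+n)).map (chiE χ) := ⟨_, hw4, rfl⟩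
    rw [← h2 _ (by omega)] at e3 e4
    obtain ⟨P, hP, hP'⟩ := e3
    obtain ⟨Q, hQ, hQ'⟩ := e4
    rw [chiE_apply, chi_poly, AlgHom.toLinearMap_apply] at hP' hQ'
    rw [map_one, one_mul] at hQ'
    refine ⟨Q, ?_, hQ'⟩
    rw [← hQ', ← map_mul] at hP'
    have := aeval_inj h.tr hP'
    rw [SetLike.mem_coe, mem_degreeLT] at hP
    rw [this, mul_comm] at hP
    by_cases hQ0 : Q = 0
    · rw [hQ0, degree_zero]
      exact WithBot.bot_lt_coe _
    rw [← natDegree_lt_iff_degree_lt (mul_ne_zero hQ0 (pow_ne_zero _ X_ne_zero)),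
      natDegree_mul_X_pow _ hQ0] at hP
    rw [← natDegree_lt_iff_degree_lt hQ0]
    omega

end

section
open Polynomial IntermediateField
section gen
variable {K S σ : Type} [Field K] [CommRing S] [Algebra K S]

/-- substitution `X i ↦ a i * Z` -/
def hz (a : σ → S) : MvPolynomial σ K →ₐ[K] S[X] :=
  maeval fun i => C (a i) * X

theorem hz_hom (a : σ → S) {F : MvPolynomial σ K} {n : ℕ} (hF : F.IsHomogeneous n) :
    hz a F = C (maeval a F) * X ^ n := by
  rw [hz]
  rw [maeval_def, MvPolynomial.eval₂_eq, maeval_def,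
    MvPolynomial.eval₂_eq, map_sum, Finset.sum_mul]
  refine Finset.sum_congr rfl fun u hu => ?_
  have h1 : u.degree = n := by
    have := hF (MvPolynomial.mem_support_iff.mp hu)
    rw [Finsupp.degree_eq_weight_one]; exact this
  simp only [mul_pow, Finset.prod_mul_distrib, Finset.prod_pow_eq_pow_sum, map_mul, map_prod,
    map_pow]
  rw [← h1, Finsupp.degree_apply, mul_assoc]
  rfl

theorem hz_coeff (a : σ → S) (F : MvPolynomial σ K) (j : ℕ) :
    (hz a F).coeff j = maeval a (mcomp j F) := by
  conv_lhs => rw [← msum_comp F]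
  rw [map_sum, Polynomial.finsetSum_coeff]
  have : ∀ i, (hz a (mcomp i F)).coeff j =
      if j = i then maeval a (mcomp i F) else 0 := by
    intro i
    rw [hz_hom a (mcomp_hom i F), coeff_C_mul_X_pow]
  simp only [this]
  rw [Finset.sum_ite_eq]
  split_ifs with h
  · rfl
  · rw [Finset.mem_range, not_lt] at h
    rw [MvPolynomial.homogeneousComponent_eq_zero _ _ (by omega), map_zero]

theorem hz_natDegree_le (a : σ → S) (F : MvPolynomial σ K) :
    (hz a F).natDegree ≤ F.totalDegree := by
  rw [natDegree_le_iff_coeff_eq_zero]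
  intro N hN
  rw [hz_coeff, MvPolynomial.homogeneousComponent_eq_zero _ _ hN, map_zero]

/-- factors of nonzero homogeneous polynomials are homogeneous -/
theorem homog_of_mul {f g : MvPolynomial σ K} {n : ℕ} (h : (f * g).IsHomogeneous n)
    (h0 : f * g ≠ 0) : ∃ k, f.IsHomogeneous k := by
  have hf : f ≠ 0 := left_ne_zero_of_mul h0
  have hg : g ≠ 0 := right_ne_zero_of_mul h0
  let φ : MvPolynomial σ K →ₐ[K] (MvPolynomial σ K)[X] := hz mX
  have hco : ∀ F j, (φ F).coeff j = mcomp j F := by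
    intro F j
    have := hz_coeff (K := K) (S := MvPolynomial σ K) mX F j
    rwa [MvPolynomial.aeval_X_left_apply] at this
  have hinj : ∀ F, F ≠ 0 → φ F ≠ 0 := by
    intro F hF h1
    apply hF
    rw [← msum_comp F]
    apply Finset.sum_eq_zero
    intro i _
    rw [← hco, h1, coeff_zero]
  have hfg : φ f * φ g = C (f * g) * X ^ n := by
    rw [← map_mul]
    have := hz_hom (K := K) (S := MvPolynomial σ K) mX h
    rwa [MvPolynomial.aeval_X_left_apply] at this
  have d1 := natDegree_mul (hinj f hf) (hinj g hg)
  have d2 := natTrailingDegree_mul (hinj f hf) (hinj g hg)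
  rw [hfg, C_mul_X_pow_eq_monomial, natDegree_monomial_eq _ h0] at d1
  rw [hfg, C_mul_X_pow_eq_monomial, natTrailingDegree_monomial h0] at d2
  have d3 := natTrailingDegree_le_natDegree (φ f)
  have d4 := natTrailingDegree_le_natDegree (φ g)
  refine ⟨(φ f).natDegree, ?_⟩
  have hgoal : (∑ i ∈ Finset.range (f.totalDegree + 1),
      mcomp i f).IsHomogeneous (φ f).natDegree := ?_
  · rwa [msum_comp f] at hgoal
  apply MvPolynomial.IsHomogeneous.sum
  intro i _
  by_cases hi : i = (φ f).natDegree
  · rw [hi]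
    exact mcomp_hom _ _
  · have : mcomp i f = 0 := by
      rw [← hco]
      rcases lt_or_gt_of_ne hi with h1 | h1
      · exact coeff_eq_zero_of_lt_natTrailingDegree (by omega)
      · exact coeff_eq_zero_of_natDegree_lt h1
    rw [this]
    exact misHomogeneous_zero _ _ _

end gen

variable {K E : Type} [Field K] [Field E] [Algebra K E] {m : ℕ}

/-- slopes -/
def lam (s : Fin (m+1) → E) (i : Fin (m+1)) : E := s i / s 0

/-- the field generated by the slopes -/
def Lf (K : Type) {E : Type} [Field K] [Field E] [Algebra K E] {m : ℕ} (s : Fin (m+1) → E) :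
    IntermediateField K E :=
  IntermediateField.adjoin K (Set.range (lam s))

/-- slopes as elements of `Lf` -/
def lamL (K : Type) {E : Type} [Field K] [Field E] [Algebra K E] {m : ℕ} (s : Fin (m+1) → E)
    (i : Fin (m+1)) : Lf K s :=
  ⟨lam s i, IntermediateField.subset_adjoin _ _ ⟨i, rfl⟩⟩

/-- pass to the curve -/
def toCurve (s : Fin (m+1) → E) : MP K (m+1) →ₐ[K] (Lf K s)[X] :=
  hz (lamL K s)

theorem aeval_toCurve {s : Fin (m+1) → E} (h0 : s 0 ≠ 0) (F : MP K (m+1)) :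
    aeval (s 0) (toCurve s F) = maeval s F := by
  have : ((aeval (s 0) : (Lf K s)[X] →ₐ[Lf K s] E).restrictScalars K).comp (toCurve s) =
      (maeval s : MP K (m+1) →ₐ[K] E) := by
    apply malgHom_ext
    intro i
    simp [toCurve, hz]
    change lam s i * s 0 = s i
    rw [lam, div_mul_cancel₀ _ h0]
  exact DFunLike.congr_fun this F

theorem lamL_zero {s : Fin (m+1) → E} (h0 : s 0 ≠ 0) : lamL K s 0 = 1 := by
  apply Subtype.ext
  exact div_self h0

theorem homogenize {S : Type} [CommRing S] [Algebra K S] {a : Fin (m+1) → S} (ha : a 0 = 1)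
    (A : MP K (m+1)) (n : ℕ) (hn : A.totalDegree ≤ n) :
    ∃ A' : MP K (m+1), A'.IsHomogeneous n ∧
      maeval a A' = maeval a A := by
  refine ⟨∑ j ∈ Finset.range (A.totalDegree + 1),
    mcomp j A * mX 0 ^ (n - j), ?_, ?_⟩
  · apply MvPolynomial.IsHomogeneous.sum
    intro j hj
    rw [Finset.mem_range] at hj
    have h1 := (mcomp_hom j A).mul
      ((misHomogeneous_X K (0 : Fin (m+1))).pow (n-j))
    rwa [one_mul, Nat.add_sub_of_le (by omega)] at h1
  · rw [map_sum]
    simp only [map_mul, map_pow, maeval_X, ha, one_pow, mul_one]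
    rw [← map_sum, msum_comp]

section ai
variable {s : Fin (m+1) → E}

theorem s_ne (hs : AlgebraicIndependent K s) (i : Fin (m+1)) : s i ≠ 0 := hs.ne_zero i

theorem toCurve_inj (hs : AlgebraicIndependent K s) : Function.Injective (toCurve (K := K) s) := by
  intro F G h
  apply hs
  rw [← aeval_toCurve (K := K) (s_ne hs 0), ← aeval_toCurve (K := K) (s_ne hs 0), h]

theorem lift_L (hs : AlgebraicIndependent K s) (l : Lf K s) : ∃ (n : ℕ) (A B : MP K (m+1)), A.IsHomogeneous n ∧
    B.IsHomogeneous n ∧ B ≠ 0 ∧ maeval (lamL K s) A =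
      maeval (lamL K s) B * l := by
  obtain ⟨l, hl⟩ := l
  obtain ⟨P, Q, hPQ⟩ := (IntermediateField.mem_adjoin_range_iff _ _ _).mp hl
  have hc : ∀ P : MP K (m+1), ((maeval (lamL K s) P : Lf K s) : E) = maeval (lam s) P := by
    intro P
    have := MvPolynomial.comp_aeval_apply (lamL K s) ((Lf K s).val) P
    exact this
  by_cases hQ : maeval (lam s) Q = 0
  · refine ⟨0, 0, 1, misHomogeneous_zero _ _ _, MvPolynomial.isHomogeneous_one _ _,
      one_ne_zero, ?_⟩
    rw [hQ, div_zero] at hPQ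
    subst hPQ
    have : (⟨0, hl⟩ : Lf K s) = 0 := rfl
    rw [this]; simp
  · obtain ⟨A, hA, hA'⟩ := homogenize (lamL_zero (K := K) (s_ne hs 0)) P
      (max P.totalDegree Q.totalDegree) (le_max_left _ _)
    obtain ⟨B, hB, hB'⟩ := homogenize (lamL_zero (K := K) (s_ne hs 0)) Q
      (max P.totalDegree Q.totalDegree) (le_max_right _ _)
    refine ⟨_, A, B, hA, hB, ?_, ?_⟩
    · rintro rfl
      apply hQ
      rw [← hc, ← hB', map_zero]; rfl
    · rw [hA', hB']
      apply Subtype.ext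
      change ((maeval (lamL K s) P : Lf K s) : E) =
        ((maeval (lamL K s) Q : Lf K s) : E) * l
      rw [hc, hc, hPQ, mul_div_cancel₀ _ hQ]

theorem lift_poly (hs : AlgebraicIndependent K s) (P : (Lf K s)[X]) : ∃ (n : ℕ) (B F : MP K (m+1)),
    B.IsHomogeneous n ∧ B ≠ 0 ∧ toCurve s F = toCurve s B * P := by
  induction P using Polynomial.induction_on' with
  | add P Q hP hQ =>
    obtain ⟨n, B, F, h1, h2, h3⟩ := hP
    obtain ⟨n', B', F', h1', h2', h3'⟩ := hQ
    refine ⟨_, B * B', F * B' + F' * B, h1.mul h1', mul_ne_zero h2 h2', ?_⟩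
    rw [map_add, map_mul, map_mul, map_mul, h3, h3']
    ring
  | monomial j l =>
    obtain ⟨n, A, B, hA, hB, hB0, hAB⟩ := lift_L hs l
    refine ⟨n, B, A * mX 0 ^ j, hB, hB0, ?_⟩
    rw [map_mul, toCurve, hz_hom _ hA, hz_hom _ hB, hAB, ← C_mul_X_pow_eq_monomial]
    have : hz (lamL K s) (mX 0 ^ j : MP K (m+1)) = X ^ j := by
      rw [map_pow, hz, maeval_X, lamL_zero (s_ne hs 0)]
      simp
    rw [this, map_mul]
    ring

theorem tau_tr (hs : AlgebraicIndependent K s) : Transcendental (Lf K s) (s 0) := by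
  rw [transcendental_iff]
  intro P hP
  obtain ⟨n, B, F, h1, h2, h3⟩ := lift_poly hs P
  have h4 := congrArg (aeval (s 0)) h3
  rw [map_mul, hP, mul_zero, aeval_toCurve (s_ne hs 0)] at h4
  have hF : F = 0 := hs (by rw [h4, map_zero])
  rw [hF, map_zero] at h3
  rcases mul_eq_zero.mp h3.symm with h | h
  · exact absurd (toCurve_inj hs (by rw [h, map_zero])) h2
  · exact h

/-- descent -/
theorem descent (N D : MP K (m+1)) (hD : mconstantCoeff D ≠ 0)
    (P : (Lf K s)[X]) (h : toCurve s D * P = toCurve s N) :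
    ∃ F : MP K (m+1), toCurve s F = P ∧ F.totalDegree ≤ P.natDegree := by
  have key : ∀ j, ∃ G : MP K (m+1), G.IsHomogeneous j ∧
      maeval (lamL K s) G = P.coeff j := by
    intro j
    induction j using Nat.strong_induction_on with
    | _ j ih =>
    choose! G hG hG' using ih
    have h1 := congrArg (fun Q => Q.coeff j) h
    simp only [coeff_mul, toCurve, hz_coeff] at h1
    rw [Finset.Nat.sum_antidiagonal_eq_sum_range_succ_mk, Finset.sum_range_succ'] at h1
    simp only [MvPolynomial.homogeneousComponent_zero, Nat.sub_zero] at h1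
    set d0 := mcoeff 0 D with hd0
    have hd0' : d0 ≠ 0 := hD
    refine ⟨MvPolynomial.C d0⁻¹ * (mcomp j N -
      ∑ k ∈ Finset.range j, mcomp (k+1) D * G (j - (k+1))), ?_, ?_⟩
    · have : j = 0 + j := by omega
      rw [this]
      apply (misHomogeneous_C _ _).mul
      rw [← this]
      apply (mcomp_hom _ _).sub
      apply MvPolynomial.IsHomogeneous.sum
      intro k hk
      rw [Finset.mem_range] at hk
      have := (mcomp_hom (k+1) D).mul
        (hG (j - (k+1)) (by omega))
      rwa [Nat.add_sub_of_le (by omega)] at this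
    · rw [map_mul, map_sub, map_sum, ← h1]
      have : ∀ k ∈ Finset.range j, maeval (lamL K s)
          (mcomp (k+1) D * G (j - (k+1))) =
          maeval (lamL K s) (mcomp (k+1) D) *
            P.coeff (j - (k+1)) := by
        intro k hk
        rw [Finset.mem_range] at hk
        rw [map_mul, hG' _ (by omega)]
      rw [Finset.sum_congr rfl this, add_sub_cancel_left, ← mul_assoc, ← map_mul, ← map_mul,
        inv_mul_cancel₀ hd0']
      simp
  choose G hG hG' using key
  refine ⟨∑ j ∈ Finset.range (P.natDegree + 1), G j, ?_, ?_⟩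
  · rw [map_sum]
    conv_rhs => rw [P.as_sum_range_C_mul_X_pow]
    refine Finset.sum_congr rfl fun j _ => ?_
    rw [toCurve, hz_hom _ (hG j), hG']
  · refine (MvPolynomial.totalDegree_finsetSum _ _).trans ?_
    apply Finset.sup_le
    intro j hj
    rw [Finset.mem_range] at hj
    exact (hG j).totalDegree_le.trans (by omega)

theorem toCurve_natDegree (hs : AlgebraicIndependent K s) (F : MP K (m+1)) :
    (toCurve s F).natDegree = F.totalDegree := by
  apply le_antisymm (hz_natDegree_le _ _)
  by_cases h0 : F = 0
  · simp [h0]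
  apply le_natDegree_of_ne_zero
  intro h1
  replace h1 : (hz (lamL K s) F).coeff F.totalDegree = 0 := h1
  rw [hz_coeff] at h1
  have hh := mcomp_hom F.totalDegree F
  have h2 := hz_hom (lamL K s) hh
  rw [h1, map_zero, zero_mul] at h2
  have h3 : mcomp F.totalDegree F = 0 :=
    toCurve_inj hs (by rw [map_zero]; exact h2)
  obtain ⟨u, hu, hu'⟩ := Finset.exists_mem_eq_sup F.support
    (MvPolynomial.support_nonempty.mpr h0) (fun s => s.sum fun _ e => e)
  replace hu' : F.totalDegree = Finsupp.degree u := hu'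
  have := congrArg (mcoeff u) h3
  rw [MvPolynomial.coeff_homogeneousComponent, if_pos hu'.symm] at this
  exact (MvPolynomial.mem_support_iff.mp hu) (by simpa using this)

end ai

end

section
open Polynomial IntermediateField IntermediateField.algebraAdjoinAdjoin
variable {K E : Type} [Field K] [Field E] [Algebra K E] {m : ℕ}

theorem homog_of_factors {σ : Type} (F : MvPolynomial σ K) :
    (∀ f, Irreducible f → f ∣ F → ∃ k, f.IsHomogeneous k) → ∃ k, F.IsHomogeneous k := by
  induction F using UniqueFactorizationMonoid.induction_on_prime with
  | h₁ => exact fun _ => ⟨0, misHomogeneous_zero _ _ _⟩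
  | h₂ u hu =>
    intro _
    rw [MvPolynomial.isUnit_iff_eq_C_of_isReduced] at hu
    obtain ⟨r, -, rfl⟩ := hu
    exact ⟨0, misHomogeneous_C _ _⟩
  | h₃ a p ha hp ih =>
    intro h
    obtain ⟨k, hk⟩ := ih fun f hf hfa => h f hf (hfa.mul_left p)
    obtain ⟨l, hl⟩ := h p hp.irreducible (dvd_mul_right _ _)
    exact ⟨_, hl.mul hk⟩

theorem coprime_curve {s : Fin (m+1) → E} (hs : AlgebraicIndependent K s)
    (c : Fin 3 → MP K (m+1))
    (hcop : ∀ f, (∀ i, f ∣ c i) → IsUnit f)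
    (hj : ∃ j, mconstantCoeff (c j) ≠ 0) :
    ∃ u : Fin 3 → (Lf K s)[X], ∑ i, u i * toCurve s (c i) = 1 := by
  by_contra hcon
  have hne : Ideal.span (Set.range fun i => toCurve s (c i)) ≠ ⊤ := by
    intro htop
    rw [Ideal.eq_top_iff_one, Ideal.mem_span_range_iff_exists_fun] at htop
    exact hcon htop
  obtain ⟨M, hM, hle⟩ := Ideal.exists_le_maximal _ hne
  obtain ⟨π, hπ⟩ := (IsPrincipalIdealRing.principal M).principal
  have hMπ : M = Ideal.span {π} := hπ
  have hdiv : ∀ i, π ∣ toCurve s (c i) := by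
    intro i
    rw [← Ideal.mem_span_singleton, ← hMπ]
    exact hle (Ideal.subset_span ⟨i, rfl⟩)
  obtain ⟨j, hj⟩ := hj
  have hcj : (toCurve s (c j)).coeff 0 ≠ 0 := by
    rw [toCurve, hz_coeff, MvPolynomial.homogeneousComponent_zero]
    simp only [MvPolynomial.algHom_C]
    intro h
    exact hj ((map_eq_zero _).mp h)
  have hπ0 : π ≠ 0 := by
    rintro rfl
    have := zero_dvd_iff.mp (hdiv j)
    rw [this] at hcj
    simp at hcj
  have hprime : Prime π := by
    rw [← Ideal.span_singleton_prime hπ0, ← hMπ]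
    exact hM.isPrime
  obtain ⟨n, B, F, hB, hB0, hF⟩ := lift_poly hs π
  have hF0 : F ≠ 0 := by
    rintro rfl
    rw [map_zero] at hF
    rcases mul_eq_zero.mp hF.symm with h | h
    · exact hB0 (toCurve_inj hs (by rw [h, map_zero]))
    · exact hπ0 h
  have hFnh : ¬ ∃ k, F.IsHomogeneous k := by
    rintro ⟨k, hk⟩
    have h1 : π ∣ toCurve s F := by rw [hF]; exact dvd_mul_left _ _
    rw [toCurve, hz_hom _ hk] at h1
    have h2 : toCurve s F ≠ 0 := fun h => hF0 (toCurve_inj hs (by rw [h, map_zero]))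
    rw [toCurve, hz_hom _ hk] at h2
    have h3 : maeval (lamL K s) F ≠ 0 := by
      intro h; rw [h, map_zero, zero_mul] at h2; exact h2 rfl
    rcases hprime.dvd_or_dvd h1 with h | h
    · exact hprime.not_isUnit (isUnit_of_dvd_unit h (Polynomial.isUnit_C.mpr (isUnit_iff_ne_zero.mpr h3)))
    · have h4 := hprime.dvd_of_dvd_pow h
      have h5 : X ∣ π := (hprime.irreducible.associated_of_dvd irreducible_X h4).symm.dvd
      have h6 := h5.trans (hdiv j)
      rw [X_dvd_iff] at h6
      exact hcj h6
  have hex : ∃ f, Irreducible f ∧ f ∣ F ∧ ¬ ∃ k, f.IsHomogeneous k := by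
    by_contra hno
    push Not at hno
    exact hFnh (homog_of_factors F fun f h1 h2 => by
      by_contra h3
      obtain ⟨k, hk⟩ := hno f h1 h2
      exact h3 ⟨k, hk⟩)
  obtain ⟨f, hfi, hfF, hfn⟩ := hex
  have hnd : ∀ {n : ℕ} {B : MP K (m+1)}, B.IsHomogeneous n → B ≠ 0 → ¬ f ∣ B := by
    rintro n B hB hB0 ⟨g, rfl⟩
    exact hfn (homog_of_mul hB hB0)
  refine hfi.not_isUnit (hcop f fun i => ?_)
  obtain ⟨q, hq⟩ := hdiv i
  obtain ⟨n', B', G, hB', hB0', hG⟩ := lift_poly hs q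
  have heq : c i * B * B' = F * G := by
    apply toCurve_inj hs
    rw [map_mul, map_mul, map_mul, hF, hG, hq]
    ring
  have hfd : f ∣ c i * B * B' := by rw [heq]; exact hfF.mul_right G
  have hfp := hfi.prime
  rcases hfp.dvd_or_dvd hfd with h | h
  · rcases hfp.dvd_or_dvd h with h | h
    · exact h
    · exact absurd h (hnd hB hB0)
  · exact absurd h (hnd hB' hB0')

theorem aeval_surj_adj {L E : Type} [Field L] [Field E] [Algebra L E] (τ θ z : E)
    (hz : z ∈ Algebra.adjoin (Algebra.adjoin L {τ}) {θ}) :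
    ∃ G : L[X][X], eval₂ (aeval τ : L[X] →ₐ[L] E).toRingHom θ G = z := by
  induction hz using Algebra.adjoin_induction with
  | mem x hx =>
    rw [Set.mem_singleton_iff] at hx
    exact ⟨X, by rw [eval₂_X, hx]⟩
  | algebraMap r =>
    obtain ⟨r, hr⟩ := r
    rw [Algebra.adjoin_singleton_eq_range_aeval] at hr
    obtain ⟨P, rfl⟩ := hr
    exact ⟨C P, by rw [eval₂_C]; rfl⟩
  | add x y _ _ hx hy =>
    obtain ⟨G, rfl⟩ := hx
    obtain ⟨H, rfl⟩ := hy
    exact ⟨G + H, eval₂_add _ _⟩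
  | mul x y _ _ hx hy =>
    obtain ⟨G, rfl⟩ := hx
    obtain ⟨H, rfl⟩ := hy
    exact ⟨G * H, eval₂_mul _ _⟩

/-- `F'(θ) z ∈ L[τ][θ]` -/
theorem deriv_mul_mem {L E : Type} [Field L] [Field E] [Algebra L E] {τ θ : E}
    (hτ : Transcendental L τ) [FiniteDimensional L⟮τ⟯ E] [Algebra.IsSeparable L⟮τ⟯ E]
    (hgen : L⟮τ⟯⟮θ⟯ = ⊤) (hθ : IsIntegral (Algebra.adjoin L {τ}) θ) (z : E)
    (hzi : IsIntegral (Algebra.adjoin L {τ}) z) :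
    aeval θ (derivative (minpoly L⟮τ⟯ θ)) * z ∈ Algebra.adjoin (Algebra.adjoin L {τ}) {θ} := by
  have := intClosed_of_transcendental hτ
  have hx : Algebra.adjoin L⟮τ⟯ {θ} = ⊤ := by
    rw [← IntermediateField.adjoin_simple_toSubalgebra_of_isAlgebraic
      (Algebra.IsAlgebraic.isAlgebraic θ), hgen]
    rfl
  have h1 := traceForm_dualSubmodule_adjoin (Algebra.adjoin L {τ}) L⟮τ⟯ hx hθ
  have h2 : z ∈ (Algebra.traceForm L⟮τ⟯ E).dualSubmodule
      (Subalgebra.toSubmodule (Algebra.adjoin (Algebra.adjoin L {τ}) {θ})) := by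
    rw [LinearMap.BilinForm.mem_dualSubmodule]
    intro y hy
    have hyi : IsIntegral (Algebra.adjoin L {τ}) y := by
      have : Algebra.adjoin (Algebra.adjoin L {τ}) {θ} ≤
          integralClosure (Algebra.adjoin L {τ}) E := by
        apply Algebra.adjoin_le
        rw [Set.singleton_subset_iff]
        exact hθ
      exact this hy
    rw [Algebra.traceForm_apply]
    have h3 : IsIntegral (Algebra.adjoin L {τ}) (Algebra.trace L⟮τ⟯ E (z * y)) :=
      Algebra.isIntegral_trace (hzi.mul hyi)
    obtain ⟨a, ha⟩ := IsIntegrallyClosed.isIntegral_iff.mp h3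
    rw [Submodule.mem_one]
    exact ⟨a, ha⟩
  rw [h1] at h2
  obtain ⟨y, hy, hyz⟩ := h2
  have hne : aeval θ (derivative (minpoly L⟮τ⟯ θ)) ≠ 0 :=
    (Algebra.IsSeparable.isSeparable L⟮τ⟯ θ).aeval_derivative_ne_zero (minpoly.aeval _ _)
  rw [← hyz]
  change _ * ((aeval θ (derivative (minpoly L⟮τ⟯ θ)))⁻¹ * y) ∈ _
  rw [mul_inv_cancel_left₀ hne]
  exact hy

end

section
open Polynomial IntermediateField IntermediateField.algebraAdjoinAdjoin
variable {L E : Type} [Field L] [Field E] [Algebra L E]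

theorem minpoly_eq_map {τ θ : E} [FiniteDimensional L⟮τ⟯ E]
    (hgen : L⟮τ⟯⟮θ⟯ = ⊤) (F : L[X][X]) (hF : F.Monic)
    (hroot : eval₂ (aeval τ : L[X] →ₐ[L] E).toRingHom θ F = 0)
    (hdeg : F.natDegree = Module.finrank L⟮τ⟯ E) :
    minpoly L⟮τ⟯ θ = F.map (aeval (AdjoinSimple.gen L τ) : L[X] →ₐ[L] L⟮τ⟯).toRingHom := by
  have hcomp : (algebraMap L⟮τ⟯ E).comp (aeval (AdjoinSimple.gen L τ) : L[X] →ₐ[L] L⟮τ⟯).toRingHom =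
      (aeval τ : L[X] →ₐ[L] E).toRingHom := by
    ext
    · simp
    · simp
  refine (minpoly.unique' (A := L⟮τ⟯) θ (hF.map _) ?_ ?_).symm
  · rw [aeval_def, eval₂_map, hcomp, hroot]
  · intro q hq
    by_cases hq0 : q = 0
    · exact Or.inl hq0
    right
    intro hroot2
    have h1 := minpoly.degree_le_of_ne_zero L⟮τ⟯ θ hq0 hroot2
    have h2 : (minpoly L⟮τ⟯ θ).natDegree = F.natDegree := by
      rw [hdeg, ← IntermediateField.adjoin.finrank (Algebra.IsIntegral.isIntegral θ), hgen]
      exact finrank_top'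
    have h3 := natDegree_le_natDegree h1
    have h4 : (F.map (aeval (AdjoinSimple.gen L τ) : L[X] →ₐ[L] L⟮τ⟯).toRingHom).natDegree =
      F.natDegree := hF.natDegree_map _
    have h5 := natDegree_lt_natDegree hq0 hq
    omega

theorem van_transfer {τ θ : E} (hτ : Transcendental L τ) [FiniteDimensional L⟮τ⟯ E]
    (hgen : L⟮τ⟯⟮θ⟯ = ⊤) (F : L[X][X]) (hF : F.Monic)
    (hroot : eval₂ (aeval τ : L[X] →ₐ[L] E).toRingHom θ F = 0)
    (hdeg : F.natDegree = Module.finrank L⟮τ⟯ E) (θ0 : L)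
    (h0 : eval₂ (evalRingHom 0) θ0 F = 0) (G : L[X][X])
    (hG : eval₂ (aeval τ : L[X] →ₐ[L] E).toRingHom θ G = 0) :
    eval₂ (evalRingHom 0) θ0 G = 0 := by
  have hcomp : (algebraMap L⟮τ⟯ E).comp (aeval (AdjoinSimple.gen L τ) : L[X] →ₐ[L] L⟮τ⟯).toRingHom =
      (aeval τ : L[X] →ₐ[L] E).toRingHom := by
    ext
    · simp
    · simp
  have hinj : Function.Injective (aeval (AdjoinSimple.gen L τ) : L[X] →ₐ[L] L⟮τ⟯).toRingHom := by
    intro P Q hPQ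
    apply aeval_inj hτ
    change (aeval τ : L[X] →ₐ[L] E).toRingHom P = (aeval τ : L[X] →ₐ[L] E).toRingHom Q
    rw [← hcomp, RingHom.comp_apply, RingHom.comp_apply, hPQ]
  have hmp := minpoly_eq_map hgen F hF hroot hdeg
  have hd : F ∣ G := by
    rw [← modByMonic_eq_zero_iff_dvd hF, ← Polynomial.map_eq_zero_iff hinj, map_modByMonic _ hF,
      ← hmp, modByMonic_eq_zero_iff_dvd (minpoly.monic (Algebra.IsIntegral.isIntegral θ))]
    apply minpoly.dvd
    rw [aeval_def, eval₂_map, hcomp, hG]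
  obtain ⟨Q, rfl⟩ := hd
  rw [eval₂_mul, h0, zero_mul]

theorem L_closed {τ θ : E} (hτ : Transcendental L τ) [FiniteDimensional L⟮τ⟯ E]
    [Algebra.IsSeparable L⟮τ⟯ E]
    (hgen : L⟮τ⟯⟮θ⟯ = ⊤) (F : L[X][X]) (hF : F.Monic)
    (hroot : eval₂ (aeval τ : L[X] →ₐ[L] E).toRingHom θ F = 0)
    (hdeg : F.natDegree = Module.finrank L⟮τ⟯ E) (θ0 : L)
    (h0 : eval₂ (evalRingHom 0) θ0 F = 0)
    (h1 : eval₂ (evalRingHom 0) θ0 (derivative F) ≠ 0) (w : E) (hw : IsAlgebraic L w) :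
    ∃ l : L, algebraMap L E l = w := by
  have hθ : IsIntegral (Algebra.adjoin L {τ}) θ := by
    let j : L[X] →+* Algebra.adjoin L {τ} :=
      ((aeval τ : L[X] →ₐ[L] E).codRestrict (Algebra.adjoin L {τ}) (aeval_mem_adj τ)).toRingHom
    refine ⟨F.map j, hF.map _, ?_⟩
    rw [eval₂_map]
    exact hroot
  have hmp := minpoly_eq_map hgen F hF hroot hdeg
  have hcomp : (algebraMap L⟮τ⟯ E).comp (aeval (AdjoinSimple.gen L τ) : L[X] →ₐ[L] L⟮τ⟯).toRingHom =
      (aeval τ : L[X] →ₐ[L] E).toRingHom := by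
    ext
    · simp
    · simp
  have hH : aeval θ (derivative (minpoly L⟮τ⟯ θ)) =
      eval₂ (aeval τ : L[X] →ₐ[L] E).toRingHom θ (derivative F) := by
    rw [hmp, derivative_map, aeval_def, eval₂_map, hcomp]
  have hwi : IsIntegral (Algebra.adjoin L {τ}) w := hw.isIntegral.tower_top
  obtain ⟨G, hG⟩ := aeval_surj_adj τ θ _ (deriv_mul_mem hτ hgen hθ w hwi)
  rw [hH] at hG
  set H := derivative F with hHdef
  set ev : L[X][X] →+* E := eval₂RingHom (aeval τ : L[X] →ₐ[L] E).toRingHom θ with hev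
  set ev0 : L[X][X] →+* L := eval₂RingHom (evalRingHom 0) θ0 with hev0
  let M := minpoly L w
  have hM : Irreducible M := minpoly.irreducible hw.isIntegral
  let N := M.natDegree
  let Q : L[X][X] := ∑ i ∈ Finset.range (N + 1), C (C (M.coeff i)) * G ^ i * H ^ (N - i)
  have hevC : ∀ a : L, ev (C (C a)) = algebraMap L E a := by
    intro a
    simp [hev]
  have hev0C : ∀ a : L, ev0 (C (C a)) = a := by
    intro a
    simp [hev0]
  have hGev : ev G = ev H * w := hG
  have hQ : ev Q = 0 := by
    have h2 : ev Q = ev H ^ N * aeval w M := by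
      rw [aeval_eq_sum_range, Finset.mul_sum, map_sum]
      refine Finset.sum_congr rfl fun i hi => ?_
      rw [Finset.mem_range] at hi
      have h5 : N = (N - i) + i := by omega
      rw [map_mul, map_mul, map_pow, map_pow, hevC, hGev, Algebra.smul_def, mul_pow]
      conv_rhs => rw [h5, pow_add]
      ring
    rw [h2, minpoly.aeval, mul_zero]
  have hQ0 : ev0 Q = 0 := van_transfer hτ hgen F hF hroot hdeg θ0 h0 Q hQ
  have hH0 : ev0 H ≠ 0 := h1
  have hr : aeval (ev0 G / ev0 H) M = 0 := by
    have h2 : ev0 Q = ev0 H ^ N * aeval (ev0 G / ev0 H) M := by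
      rw [aeval_eq_sum_range, Finset.mul_sum, map_sum]
      refine Finset.sum_congr rfl fun i hi => ?_
      rw [Finset.mem_range] at hi
      have h5 : N = (N - i) + i := by omega
      rw [map_mul, map_mul, map_pow, map_pow, hev0C, smul_eq_mul, div_pow]
      conv_rhs => rw [h5, pow_add]
      field_simp
    rw [hQ0] at h2
    exact (mul_eq_zero.mp h2.symm).resolve_left (pow_ne_zero _ hH0)
  have hdeg1 : M.degree = 1 := by
    apply degree_eq_one_of_irreducible_of_root hM (x := ev0 G / ev0 H)
    rw [IsRoot, ← coe_aeval_eq_eval]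
    exact hr
  exact minpoly.mem_range_of_degree_eq_one L w hdeg1

end

section
open Polynomial IntermediateField IntermediateField.algebraAdjoinAdjoin
variable {K E : Type} [Field K] [Field E] [Algebra K E]

theorem exists_F {ι : Type} {t : ι → E} (ht : AlgebraicIndependent K t)
    [FiniteDimensional (kF K t) E]
    [Algebra.IsSeparable (kF K t) E] :
    ∃ (θ : E) (F : (MvPolynomial ι K)[X]), F.Monic ∧
      F.natDegree = Module.finrank (kF K t) E ∧
      eval₂ (maeval t : MvPolynomial ι K →ₐ[K] E).toRingHom θ F = 0 ∧
      (kF K t)⟮θ⟯ = ⊤ ∧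
      ∃ D : MvPolynomial ι K, D ≠ 0 ∧ ∃ P Q, P * F + Q * derivative F = C D := by
  have hcl : IsIntegrallyClosed (Algebra.adjoin K (Set.range t)) :=
    IsIntegrallyClosed.of_equiv ht.aevalEquiv.toRingEquiv
  obtain ⟨θ1, hθ1⟩ := Field.exists_primitive_element (kF K t) E
  have halg : IsAlgebraic (Algebra.adjoin K (Set.range t)) θ1 := by
    rw [IsFractionRing.isAlgebraic_iff (Algebra.adjoin K (Set.range t)) (kF K t) E]
    exact Algebra.IsAlgebraic.isAlgebraic θ1
  obtain ⟨y, hy0, hyi⟩ := halg.exists_integral_multiple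
  set θ := y • θ1 with hθdef
  have hgen : (kF K t)⟮θ⟯ = ⊤ := by
    rw [eq_top_iff, ← hθ1, adjoin_simple_le_iff]
    let yk : kF K t := algebraMap (Algebra.adjoin K (Set.range t)) _ y
    have hyk : yk ≠ 0 := by
      intro h
      exact hy0 ((FaithfulSMul.algebraMap_eq_zero_iff _ _).mp h)
    have h1 : θ1 = yk⁻¹ • θ := by
      rw [hθdef]
      have : y • θ1 = yk • θ1 := rfl
      rw [this, smul_smul, inv_mul_cancel₀ hyk, one_smul]
    rw [h1]
    exact (IntermediateField.toSubalgebra _).smul_mem (mem_adjoin_simple_self _ θ) _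
  have hmp := minpoly.isIntegrallyClosed_eq_field_fractions' (R := Algebra.adjoin K (Set.range t))
    (kF K t) hyi
  set F0 := minpoly (Algebra.adjoin K (Set.range t)) θ with hF0
  let e : Algebra.adjoin K (Set.range t) →+* MvPolynomial ι K := ht.aevalEquiv.symm.toRingEquiv.toRingHom
  have hF0m : F0.Monic := minpoly.monic hyi
  have hcomp : (maeval t : MvPolynomial ι K →ₐ[K] E).toRingHom.comp e =
      algebraMap (Algebra.adjoin K (Set.range t)) E := by
    ext a
    have := ht.algebraMap_aevalEquiv (e a)
    rw [RingHom.comp_apply]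
    refine this.symm.trans ?_
    congr 1
    exact ht.aevalEquiv.apply_symm_apply a
  have hsep : (minpoly (kF K t) θ).Separable :=
    Algebra.IsSeparable.isSeparable _ θ
  obtain ⟨P, Q, hPQ⟩ := hsep
  obtain ⟨b, hb, hP⟩ := IsLocalization.integerNormalization_spec
    (nonZeroDivisors (Algebra.adjoin K (Set.range t))) P
  obtain ⟨c, hc, hQ⟩ := IsLocalization.integerNormalization_spec
    (nonZeroDivisors (Algebra.adjoin K (Set.range t))) Q
  set P0 := IsLocalization.integerNormalization
    (nonZeroDivisors (Algebra.adjoin K (Set.range t))) P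
  set Q0 := IsLocalization.integerNormalization
    (nonZeroDivisors (Algebra.adjoin K (Set.range t))) Q
  have hrel : (C c * P0) * F0 + (C b * Q0) * derivative F0 = C (b * c) := by
    apply Polynomial.map_injective (algebraMap (Algebra.adjoin K (Set.range t)) (kF K t))
      (FaithfulSMul.algebraMap_injective _ _)
    rw [Polynomial.map_add, Polynomial.map_mul, Polynomial.map_mul, Polynomial.map_mul,
      Polynomial.map_mul, hP, hQ, map_C, map_C, map_C, ← derivative_map, ← hmp]
    rw [map_mul, map_mul, ← mul_one (C _ * C _), ← hPQ]
    rw [← algebraMap_smul (kF K t) b P,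
      ← algebraMap_smul (kF K t) c Q, smul_eq_C_mul, smul_eq_C_mul]
    ring
  refine ⟨θ, F0.map e, hF0m.map e, ?_, ?_, hgen, e (b * c), ?_, (C c * P0).map e,
    (C b * Q0).map e, ?_⟩
  · rw [hF0m.natDegree_map, ← hF0m.natDegree_map (algebraMap _ (kF K t)), ← hmp,
      ← IntermediateField.adjoin.finrank (Algebra.IsIntegral.isIntegral θ), hgen]
    exact finrank_top'
  · rw [eval₂_map, hcomp]
    exact minpoly.aeval _ θ
  · intro h
    have h1 : b * c = 0 := ht.aevalEquiv.symm.injective (h.trans (map_zero _).symm)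
    exact (nonZeroDivisors.ne_zero (mul_mem hb hc)) h1
  · rw [derivative_map, ← Polynomial.map_mul, ← Polynomial.map_mul, ← Polynomial.map_add, hrel,
      map_C]

/-- translation -/
def shift {ι : Type} (p : ι → K) : MvPolynomial ι K →ₐ[K] MvPolynomial ι K :=
  maeval fun i => mX i + MvPolynomial.C (p i)

theorem shift_shift {ι : Type} (p : ι → K) (F : MvPolynomial ι K) :
    shift (-p) (shift p F) = F := by
  have : (shift (-p)).comp (shift p) = AlgHom.id K (MvPolynomial ι K) := by
    apply malgHom_ext
    intro i
    simp [shift]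
  exact DFunLike.congr_fun this F

theorem aeval_shift {ι : Type} (t : ι → E) (p : ι → K) (F : MvPolynomial ι K) :
    maeval (fun i => t i - algebraMap K E (p i)) (shift p F) = maeval t F := by
  have : (maeval (fun i => t i - algebraMap K E (p i))).comp (shift p) =
      (maeval t : MvPolynomial ι K →ₐ[K] E) := by
    apply malgHom_ext
    intro i
    simp [shift, maeval_C]
  exact DFunLike.congr_fun this F

theorem constCoeff_shift {ι : Type} (p : ι → K) (F : MvPolynomial ι K) :
    mconstantCoeff (shift p F) = meval p F := by
  have : (mconstantCoeff).comp (shift p).toRingHom = meval p := by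
    apply MvPolynomial.ringHom_ext
    · intro r; simp [shift]
    · intro i; simp [shift]
  exact RingHom.congr_fun this F

theorem totalDegree_shift_le {ι : Type} (p : ι → K) (F : MvPolynomial ι K) :
    (shift p F).totalDegree ≤ F.totalDegree := by
  rw [shift, maeval_def, MvPolynomial.eval₂_eq]
  refine (MvPolynomial.totalDegree_finsetSum _ _).trans (Finset.sup_le fun u hu => ?_)
  refine (MvPolynomial.totalDegree_mul _ _).trans ?_
  rw [MvPolynomial.algebraMap_eq, MvPolynomial.totalDegree_C, zero_add]
  refine (MvPolynomial.totalDegree_finsetProd _ _).trans ?_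
  refine le_trans ?_ (MvPolynomial.le_totalDegree hu)
  refine Finset.sum_le_sum fun i _ => ?_
  refine (MvPolynomial.totalDegree_pow _ _).trans ?_
  have : (mX i + MvPolynomial.C (p i) : MvPolynomial ι K).totalDegree ≤ 1 := by
    refine (MvPolynomial.totalDegree_add _ _).trans ?_
    simp
  calc _ ≤ u i * 1 := Nat.mul_le_mul_left _ this
    _ = u i := mul_one _

theorem totalDegree_shift {ι : Type} (p : ι → K) (F : MvPolynomial ι K) :
    (shift p F).totalDegree = F.totalDegree := by
  apply le_antisymm (totalDegree_shift_le p F)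
  conv_lhs => rw [← shift_shift p F]
  exact totalDegree_shift_le _ _

/-- translated coordinates -/
def tsub {ι : Type} (t : ι → E) (p : ι → K) : ι → E := fun i => t i - algebraMap K E (p i)

theorem tsub_ai {ι : Type} {t : ι → E} (ht : AlgebraicIndependent K t) (p : ι → K) :
    AlgebraicIndependent K (tsub t p) := by
  rw [algebraicIndependent_iff]
  intro F hF
  have h1 : F = shift p (shift (-p) F) := by
    have := shift_shift (-p) F
    rw [neg_neg] at this
    exact this.symm
  rw [h1] at hF
  have h2 := aeval_shift t p (shift (-p) F)
  have h3 : maeval t (shift (-p) F) = 0 := by rw [← h2]; exact hF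
  rw [algebraicIndependent_iff] at ht
  rw [h1, ht _ h3, map_zero]

end

section
open Polynomial IntermediateField IntermediateField.algebraAdjoinAdjoin
variable {K E : Type} [Field K] [Field E] [Algebra K E] {m : ℕ}

theorem k0_mem {t : Fin (m+1) → E} (p : Fin (m+1) → K) (h0 : tsub t p 0 ≠ 0) (z : E) :
    z ∈ kF K t ↔ z ∈ (Lf K (tsub t p))⟮tsub t p 0⟯ := by
  set s := tsub t p with hs
  have hst : ∀ i, s i = t i - algebraMap K E (p i) := fun i => rfl
  constructor
  · intro hz
    have : kF K t ≤ restrictScalars K ((Lf K s)⟮s 0⟯) := by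
      rw [adjoin_le_iff]
      rintro _ ⟨i, rfl⟩
      change t i ∈ (Lf K s)⟮s 0⟯
      have h1 : t i = algebraMap (Lf K s) E (lamL K s i) * s 0 +
          algebraMap (Lf K s) E (algebraMap K (Lf K s) (p i)) := by
        have : algebraMap (Lf K s) E (lamL K s i) = s i / s 0 := rfl
        rw [this, div_mul_cancel₀ _ h0, hst]
        rw [← IsScalarTower.algebraMap_apply]; ring
      rw [h1]
      exact add_mem (mul_mem (IntermediateField.algebraMap_mem _ _) (mem_adjoin_simple_self _ _)) (IntermediateField.algebraMap_mem _ _)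
    exact this hz
  · intro hz
    have h1 : ∀ i, s i ∈ kF K t := fun i => by
      rw [hst]
      exact sub_mem (subset_adjoin _ _ ⟨i, rfl⟩) (IntermediateField.algebraMap_mem _ _)
    have hL : Lf K s ≤ kF K t := by
      rw [Lf, adjoin_le_iff]
      rintro _ ⟨i, rfl⟩
      exact div_mem (h1 i) (h1 0)
    have : (Lf K s)⟮s 0⟯ ≤ extendScalars hL := by
      rw [adjoin_simple_le_iff]
      exact h1 0
    exact this hz

/-- the identification of the two descriptions of the base field -/
def k0Equiv (t : Fin (m+1) → E) (p : Fin (m+1) → K) (h0 : tsub t p 0 ≠ 0) :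
    kF K t ≃+* (Lf K (tsub t p))⟮tsub t p 0⟯ where
  toFun z := ⟨z.1, (k0_mem p h0 z.1).mp z.2⟩
  invFun z := ⟨z.1, (k0_mem p h0 z.1).mpr z.2⟩
  left_inv _ := rfl
  right_inv _ := rfl
  map_mul' _ _ := rfl
  map_add' _ _ := rfl

theorem k0_finrank (t : Fin (m+1) → E) (p : Fin (m+1) → K) (h0 : tsub t p 0 ≠ 0) :
    Module.finrank (kF K t) E =
      Module.finrank (Lf K (tsub t p))⟮tsub t p 0⟯ E :=
  Algebra.finrank_eq_of_equiv_equiv (k0Equiv t p h0) (RingEquiv.refl E) rfl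

theorem k0_sep (t : Fin (m+1) → E) (p : Fin (m+1) → K) (h0 : tsub t p 0 ≠ 0)
    [Algebra.IsSeparable (kF K t) E] :
    Algebra.IsSeparable (Lf K (tsub t p))⟮tsub t p 0⟯ E :=
  Algebra.IsSeparable.of_equiv_equiv (k0Equiv t p h0) (RingEquiv.refl E) rfl

theorem k0_fd (t : Fin (m+1) → E) (p : Fin (m+1) → K) (h0 : tsub t p 0 ≠ 0)
    [FiniteDimensional (kF K t) E] :
    FiniteDimensional (Lf K (tsub t p))⟮tsub t p 0⟯ E := by
  apply Module.finite_of_finrank_pos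
  rw [← k0_finrank t p h0]
  exact Module.finrank_pos

theorem k0_gen (t : Fin (m+1) → E) (p : Fin (m+1) → K) (h0 : tsub t p 0 ≠ 0) {θ : E}
    (h : (kF K t)⟮θ⟯ = ⊤) : (Lf K (tsub t p))⟮tsub t p 0⟯⟮θ⟯ = ⊤ := by
  rw [eq_top_iff]
  intro z _
  have hz : z ∈ (kF K t)⟮θ⟯ := by rw [h]; trivial
  let T : IntermediateField (kF K t) E :=
    { ((Lf K (tsub t p))⟮tsub t p 0⟯⟮θ⟯).toSubfield with
      algebraMap_mem' := fun a => IntermediateField.algebraMap_mem ((Lf K (tsub t p))⟮tsub t p 0⟯⟮θ⟯) (k0Equiv t p h0 a) }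
  have : (kF K t)⟮θ⟯ ≤ T := by
    rw [adjoin_simple_le_iff]
    exact mem_adjoin_simple_self _ θ
  exact this hz

/-- good points exist -/
theorem good_point [Infinite K] {ι : Type} {D : MvPolynomial ι K} (hD : D ≠ 0) :
    ∃ p, meval p D ≠ 0 := by
  by_contra! h
  exact hD (MvPolynomial.funext fun p => by rw [h, map_zero])

theorem L_closed_good [IsAlgClosed K] {t : Fin (m+1) → E} (ht : AlgebraicIndependent K t)
    [FiniteDimensional (kF K t) E]
    [Algebra.IsSeparable (kF K t) E] :
    ∃ D : MP K (m+1), D ≠ 0 ∧ ∀ p, meval p D ≠ 0 →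
      ∀ w : E, IsAlgebraic (Lf K (tsub t p)) w → ∃ l, algebraMap (Lf K (tsub t p)) E l = w := by
  obtain ⟨θ, F, hF, hdeg, hroot, hgen, D, hD, P, Q, hPQ⟩ := exists_F ht
  refine ⟨D, hD, fun p hp w hw => ?_⟩
  have hs := tsub_ai ht p
  set s := tsub t p with hsdef
  have h0 : s 0 ≠ 0 := s_ne hs 0
  have := k0_sep t p h0
  have := k0_fd t p h0
  have hdegp : (F.map (meval p)).degree ≠ 0 := by
    rw [hF.degree_map]
    rw [degree_eq_natDegree hF.ne_zero, hdeg]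
    have : 0 < Module.finrank (kF K t) E := Module.finrank_pos
    exact_mod_cast this.ne'
  obtain ⟨θ0, hθ0⟩ := IsAlgClosed.exists_root _ hdegp
  have hθ0' : eval₂ (meval p) θ0 F = 0 := by
    rw [← eval_map]; exact hθ0
  let ψ : MP K (m+1) →+* (Lf K s)[X] := (toCurve s).toRingHom.comp (shift p).toRingHom
  have hev : (evalRingHom (0 : Lf K s)).comp ψ = (algebraMap K (Lf K s)).comp (meval p) := by
    apply MvPolynomial.ringHom_ext
    · intro x
      simp [ψ, shift]
    · intro i
      simp [ψ, shift, toCurve, hz]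
  have hψ : ((aeval (s 0) : (Lf K s)[X] →ₐ[Lf K s] E).toRingHom).comp ψ =
      (maeval t : MP K (m+1) →ₐ[K] E).toRingHom := by
    apply RingHom.ext
    intro G
    have := aeval_toCurve (K := K) h0 (shift p G)
    have h2 := aeval_shift t p G
    exact this.trans h2
  refine L_closed (tau_tr hs) (k0_gen t p h0 hgen) (F.map ψ) (hF.map ψ) ?_ ?_ (algebraMap K _ θ0)
    ?_ ?_ w hw
  · rw [eval₂_map, hψ, hroot]
  · rw [hF.natDegree_map, hdeg, k0_finrank t p h0]
  · rw [eval₂_map, hev, ← hom_eval₂, hθ0', map_zero]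
  · rw [derivative_map, eval₂_map, hev, ← hom_eval₂]
    rw [_root_.map_ne_zero]
    intro h
    have h1 := congrArg (eval₂ (meval p) θ0) hPQ
    rw [eval₂_add, eval₂_mul, eval₂_mul, h, hθ0', eval₂_C] at h1
    apply hp
    rw [← h1]; ring

/-- sections of degree `n` (integral over the Rees algebra) -/
def nInt (K : Type) {E : Type} [Field K] [Field E] [Algebra K E] {ι : Type} (t : ι → E) (n : ℕ)
    (w : E) : Prop :=
  IsIntegral (Algebra.adjoin K (insert X (Set.range fun i => C (t i) * X)) : Subalgebra K E[X])
    (C w * X ^ n)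

theorem nInt_mem {t : Fin (m+1) → E} {p : Fin (m+1) → K} (h0 : tsub t p 0 ≠ 0)
    {n : ℕ} {w : E} (h : nInt K t n w) : w ∈ Bn (Lf K (tsub t p)) (tsub t p 0) n := by
  set s := tsub t p with hs
  have hst : ∀ i, t i = s i + algebraMap K E (p i) := fun i => by simp [hs, tsub]
  set R := (Algebra.adjoin K (insert X (Set.range fun i => C (t i) * X)) : Subalgebra K E[X]) with hR
  have key : ∀ (z : E) (T : Subalgebra (Lf K s) E), (z ∈ T) → (∀ i, t i * z ∈ T) →
      IsIntegral T (w * z ^ n) := by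
    intro z T hz htz
    have hmem : ∀ x ∈ R, eval z x ∈ T := by
      intro x hx
      induction hx using Algebra.adjoin_induction with
      | mem x hx =>
        rcases hx with rfl | ⟨i, rfl⟩
        · simpa using hz
        · simpa using htz i
      | algebraMap r =>
        have : eval z (algebraMap K E[X] r) = algebraMap (Lf K s) E (algebraMap K (Lf K s) r) := by
          rw [← IsScalarTower.algebraMap_apply, Polynomial.algebraMap_apply, eval_C]
        rw [this]
        exact T.algebraMap_mem _
      | add x y _ _ hx hy => rw [eval_add]; exact add_mem hx hy
      | mul x y _ _ hx hy => rw [eval_mul]; exact mul_mem hx hy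
    let f : R →+* T :=
      { toFun := fun x => ⟨eval z x.1, hmem x.1 x.2⟩
        map_one' := by ext; simp
        map_zero' := by ext; simp
        map_add' := by intro a b; ext; simp
        map_mul' := by intro a b; ext; simp }
    have h2 := IsIntegral.map_of_comp_eq f (evalRingHom z) (by ext x; rfl) h
    simpa using h2
  rw [mem_Bn]
  constructor
  · have := key 1 (Algebra.adjoin (Lf K s) {s 0}) (one_mem _) ?_
    · simpa using this
    · intro i
      rw [mul_one, hst]
      have h1 : s i = algebraMap (Lf K s) E (lamL K s i) * s 0 := by
        have : algebraMap (Lf K s) E (lamL K s i) = s i / s 0 := rfl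
        rw [this, div_mul_cancel₀ _ h0]
      rw [h1, IsScalarTower.algebraMap_apply K (Lf K s) E]
      exact add_mem (mul_mem (Subalgebra.algebraMap_mem _ _) (Algebra.subset_adjoin rfl))
        (Subalgebra.algebraMap_mem _ _)
  · refine key (s 0)⁻¹ (Algebra.adjoin (Lf K s) {(s 0)⁻¹}) (Algebra.subset_adjoin rfl) ?_
    intro i
    rw [hst, add_mul]
    have h1 : s i * (s 0)⁻¹ = algebraMap (Lf K s) E (lamL K s i) :=
      (div_eq_mul_inv _ _).symm
    rw [h1, IsScalarTower.algebraMap_apply K (Lf K s) E]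
    exact add_mem (Subalgebra.algebraMap_mem _ _) (mul_mem (Subalgebra.algebraMap_mem _ _) (Algebra.subset_adjoin rfl))

end

section
open Polynomial IntermediateField IntermediateField.algebraAdjoinAdjoin
theorem BV_dep {L E : Type} [Field L] [Field E] [Algebra L E] {τ : E} (hτ : Transcendental L τ)
    (hcl : ∀ w : E, IsAlgebraic L w → ∃ l : L, algebraMap L E l = w)
    (ρ : ℕ) (V : Submodule L⟮τ⟯ E) [FiniteDimensional L⟮τ⟯ V]
    (hV : Module.finrank L⟮τ⟯ V ≤ ρ) (n N : ℕ) (hN : ρ * n + 1 < N) (v : Fin N → E)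
    (hv : ∀ i, v i ∈ Bn L τ n) (hvV : ∀ i, v i ∈ V) :
    ∃ a : Fin N → L, (∑ i, a i • v i = 0) ∧ ∃ i, a i ≠ 0 := by
  obtain ⟨h1, h2⟩ := BV_fin hτ hcl ρ V hV n
  let v' : Fin N → (Bn L τ n ⊓ V.restrictScalars L : Submodule L E) := fun i => ⟨v i, hv i, hvV i⟩
  have h3 : ¬ LinearIndependent L v' := by
    intro h
    have := h.fintype_card_le_finrank
    rw [Fintype.card_fin] at this
    omega
  rw [Fintype.not_linearIndependent_iff] at h3
  obtain ⟨g, hg, hi⟩ := h3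
  refine ⟨g, ?_, hi⟩
  have := congrArg (Submodule.subtype _) hg
  simpa [v'] using this

variable {K E : Type} [Field K] [Field E] [Algebra K E] {m : ℕ}

theorem nInt_add {ι : Type} {t : ι → E} {n : ℕ} {v w : E} (hv : nInt K t n v) (hw : nInt K t n w) :
    nInt K t n (v + w) := by
  unfold nInt at *
  rw [C_add, add_mul]
  exact hv.add hw

theorem nInt_mul {ι : Type} {t : ι → E} {n k : ℕ} {v w : E} (hv : nInt K t n v) (hw : nInt K t k w) :
    nInt K t (n + k) (v * w) := by
  unfold nInt at *
  have : C (v * w) * X ^ (n + k) = (C v * X ^ n) * (C w * X ^ k) := by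
    rw [C_mul, pow_add]; ring
  rw [this]
  exact hv.mul hw

theorem nInt_const {ι : Type} {t : ι → E} (a : K) : nInt K t 0 (algebraMap K E a) := by
  unfold nInt
  rw [pow_zero, mul_one]
  exact isIntegral_algebraMap (x := algebraMap K (Algebra.adjoin K _ : Subalgebra K E[X]) a)

theorem nInt_one {ι : Type} {t : ι → E} (n : ℕ) : nInt K t n 1 := by
  unfold nInt
  rw [C_1, one_mul]
  exact isIntegral_algebraMap (x := (⟨X ^ n, pow_mem (Algebra.subset_adjoin (Set.mem_insert _ _)) n⟩ :
    Algebra.adjoin K (insert X (Set.range fun i => C (t i) * X))))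

theorem nInt_t {ι : Type} {t : ι → E} (i : ι) : nInt K t 1 (t i) := by
  unfold nInt
  rw [pow_one]
  exact isIntegral_algebraMap (x := (⟨C (t i) * X, Algebra.subset_adjoin (Set.mem_insert_of_mem _ ⟨i, rfl⟩)⟩ :
    Algebra.adjoin K (insert X (Set.range fun i => C (t i) * X))))

theorem nInt_smul {ι : Type} {t : ι → E} {n : ℕ} {v : E} (a : K) (hv : nInt K t n v) :
    nInt K t n (algebraMap K E a * v) := by
  have := nInt_mul (nInt_const a) hv
  rwa [zero_add] at this

theorem aeval_mem_k0 {ι : Type} (t : ι → E) (F : MvPolynomial ι K) :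
    maeval t F ∈ kF K t := by
  have h1 : maeval t F ∈ Algebra.adjoin K (Set.range t) := by
    rw [Algebra.adjoin_range_eq_range_aeval]; exact ⟨F, rfl⟩
  exact (algebra_adjoin_le_adjoin K (Set.range t)) h1

theorem k0_frac {ι : Type} {t : ι → E} {w : E} (hw : w ∈ kF K t) :
    ∃ N D : MvPolynomial ι K, maeval t D ≠ 0 ∧
      maeval t D * w = maeval t N := by
  obtain ⟨P, Q, hPQ⟩ := (IntermediateField.mem_adjoin_range_iff _ _ _).mp hw
  by_cases hQ : maeval t Q = 0
  · refine ⟨0, 1, ?_, ?_⟩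
    · rw [map_one]; exact one_ne_zero
    · rw [hPQ, hQ]; simp
  · refine ⟨P, Q, hQ, ?_⟩
    rw [hPQ]; field_simp

theorem lin_L {L E : Type} [Field L] [Field E] [Algebra L E] {τ : E} (hτ : Transcendental L τ)
    {a b : L} (h : algebraMap L E a + algebraMap L E b * τ = 0) : a = 0 ∧ b = 0 := by
  rw [transcendental_iff] at hτ
  have h1 : C a + C b * X = (0 : L[X]) := hτ _ (by simpa using h)
  have h2 := congrArg (fun P => coeff P 0) h1
  have h3 := congrArg (fun P => coeff P 1) h1
  simp at h2 h3
  exact ⟨h2, h3⟩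

/-- the data at a good point: descent to polynomials -/
theorem descend {t : Fin (m+1) → E} (ht : AlgebraicIndependent K t) {p : Fin (m+1) → K}
    {N D : MP K (m+1)} (hD : meval p D ≠ 0) {P : (Lf K (tsub t p))[X]}
    (h : maeval t D * aeval (tsub t p 0) P = maeval t N) :
    ∃ F : MP K (m+1), F.totalDegree ≤ P.natDegree ∧
      maeval t F = aeval (tsub t p 0) P := by
  have hs := tsub_ai ht p
  have h0 := s_ne hs 0
  have h1 : toCurve (tsub t p) (shift p D) * P = toCurve (tsub t p) (shift p N) := by
    apply aeval_inj (tau_tr hs)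
    rw [map_mul, aeval_toCurve h0, aeval_toCurve h0]
    have := aeval_shift t p
    erw [this, this]
    exact h
  obtain ⟨F, hF1, hF2⟩ := descent _ _ (by rw [constCoeff_shift]; exact hD) P h1
  refine ⟨shift (-p) F, ?_, ?_⟩
  · rwa [totalDegree_shift]
  · rw [← hF1, aeval_toCurve h0]
    have := aeval_shift t p (shift (-p) F)
    rw [← this]
    have h2 := shift_shift (-p) F
    rw [neg_neg] at h2
    rw [h2]; rfl

theorem I1 [IsAlgClosed K] {t : Fin (m+1) → E} (ht : AlgebraicIndependent K t)
    [FiniteDimensional (kF K t) E]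
    [Algebra.IsSeparable (kF K t) E] {w : E} (hw : nInt K t 1 w)
    (hk : w ∈ kF K t) :
    ∃ F : MP K (m+1), F.totalDegree ≤ 1 ∧ maeval t F = w := by
  obtain ⟨D0, hD0, hcl⟩ := L_closed_good ht
  obtain ⟨N, D, hD, hND⟩ := k0_frac hk
  have hD' : D ≠ 0 := by rintro rfl; simp at hD
  have : Infinite K := IsAlgClosed.instInfinite
  obtain ⟨p, hp⟩ := good_point (mul_ne_zero hD0 hD')
  rw [map_mul] at hp
  have hs := tsub_ai ht p
  have h0 := s_ne hs 0
  have hcl' := hcl p (left_ne_zero_of_mul hp)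
  have htr := tau_tr hs
  have hw' := nInt_mem h0 hw
  set L := Lf K (tsub t p)
  set τ := tsub t p 0
  let V : Submodule L⟮τ⟯ E := Submodule.span L⟮τ⟯ {1}
  have hV : ∀ z ∈ L⟮τ⟯, z ∈ V := fun z hz => by
    rw [Submodule.mem_span_singleton]
    exact ⟨⟨z, hz⟩, by rw [Algebra.smul_def, mul_one]; rfl⟩
  have h1 : Module.finrank L⟮τ⟯ V ≤ 1 := by
    refine (finrank_span_le_card ({1} : Set E)).trans ?_
    simp
  obtain ⟨a, ha, i, hi⟩ := BV_dep htr hcl' 1 V h1 1 3 (by norm_num) ![1, τ, w] (by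
    intro i
    fin_cases i
    · have := aeval_mem_Bn (L := L) h0 (n := 1) 1 (by simp)
      simpa using this
    · have := aeval_mem_Bn (L := L) h0 (n := 1) X (by simp)
      simpa using this
    · exact hw') (by
    intro i
    fin_cases i
    · exact hV _ (one_mem _)
    · exact hV _ (mem_adjoin_simple_self _ _)
    · exact hV _ ((k0_mem p h0 w).mp hk))
  rw [Fin.sum_univ_three] at ha
  change a 0 • (1:E) + a 1 • τ + a 2 • w = 0 at ha
  simp only [Algebra.smul_def, mul_one] at ha
  have ha2 : a 2 ≠ 0 := by
    intro h2
    rw [h2, map_zero, zero_mul, add_zero] at ha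
    obtain ⟨q0, q1⟩ := lin_L htr ha
    fin_cases i
    · exact hi q0
    · exact hi q1
    · exact hi h2
  have hw2 : w = aeval τ (C (- a 0 / a 2) + C (- a 1 / a 2) * X) := by
    have : algebraMap L E (a 2) ≠ 0 := by rwa [_root_.map_ne_zero]
    simp only [map_add, map_mul, aeval_C, aeval_X, map_div₀, map_neg]
    field_simp
    linear_combination ha
  obtain ⟨F, hF1, hF2⟩ := descend ht (right_ne_zero_of_mul hp) (N := N) (P := C (- a 0 / a 2) + C (- a 1 / a 2) * X) (by
    rw [← hw2]; exact hND)
  refine ⟨F, hF1.trans ?_, by rw [hF2, ← hw2]⟩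
  compute_degree

/-- generic independence -/
theorem G1 [IsAlgClosed K] {t : Fin (m+1) → E} (ht : AlgebraicIndependent K t)
    [FiniteDimensional (kF K t) E]
    [Algebra.IsSeparable (kF K t) E] {x y : E}
    (hx : nInt K t 1 x) (hy : nInt K t 1 y)
    (hli : ∀ (F : MP K (m+1)) (a b : K), F.totalDegree ≤ 1 →
      maeval t F + algebraMap K E a * x + algebraMap K E b * y = 0 → a = 0 ∧ b = 0)
    (f : Fin 3 → MP K (m+1))
    (hf : maeval t (f 0) + maeval t (f 1) * x
      + maeval t (f 2) * y = 0) : f = 0 := by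
  have hxk : x ∉ kF K t := by
    intro h
    obtain ⟨F, hF1, hF2⟩ := I1 ht hx h
    have := hli F (-1) 0 hF1 (by rw [hF2]; simp)
    simpa using this.1
  have hne : ∀ F : MP K (m+1), F ≠ 0 → maeval t F ≠ 0 := by
    intro F hF h
    exact hF (ht (by rw [h, map_zero]))
  have hz : ∀ F : MP K (m+1), maeval t F = 0 → F = 0 := by
    intro F h
    exact ht (by rw [h, map_zero])
  have hmem := aeval_mem_k0 (K := K) t
  have hxlin : ∀ a ∈ kF K t, ∀ b ∈ kF K t, a + b * x = 0 → b = 0 := by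
    intro a ha b hb hab
    by_contra hb0
    apply hxk
    have : x = - a / b := by field_simp; linear_combination hab
    rw [this]
    exact div_mem (neg_mem ha) hb
  by_cases h2 : f 2 = 0
  · have h1 : f 1 = 0 := by
      apply hz
      refine hxlin _ (hmem (f 0)) _ (hmem (f 1)) ?_
      rw [h2] at hf; simpa using hf
    have h3 : f 0 = 0 := by
      apply hz
      rw [h1, h2] at hf; simpa using hf
    ext1 i
    fin_cases i
    · exact h3
    · exact h1
    · exact h2
  exfalso
  obtain ⟨D0, hD0, hcl⟩ := L_closed_good ht
  have : Infinite K := IsAlgClosed.instInfinite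
  obtain ⟨p, hp⟩ := good_point (mul_ne_zero hD0 h2)
  rw [map_mul] at hp
  have hs := tsub_ai ht p
  have h0 := s_ne hs 0
  have hcl' := hcl p (left_ne_zero_of_mul hp)
  have htr := tau_tr hs
  have hx' := nInt_mem h0 hx
  have hy' := nInt_mem h0 hy
  have hkm := k0_mem (t := t) p h0
  have hdesc := fun N P => descend ht (right_ne_zero_of_mul hp) (N := N) (P := P)
  set L := Lf K (tsub t p)
  set τ := tsub t p 0
  let V : Submodule L⟮τ⟯ E := Submodule.span L⟮τ⟯ {1, x}
  have hV : ∀ z ∈ L⟮τ⟯, ∀ z' ∈ L⟮τ⟯, z + z' * x ∈ V := fun z hz z' hz' => by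
    rw [Submodule.mem_span_pair]
    exact ⟨⟨z, hz⟩, ⟨z', hz'⟩, by rw [Algebra.smul_def, mul_one, Algebra.smul_def]; rfl⟩
  have hVfd : FiniteDimensional L⟮τ⟯ V :=
    FiniteDimensional.span_of_finite _ (Set.toFinite _)
  have h1 : Module.finrank L⟮τ⟯ V ≤ 2 := by
    classical
    have := finrank_span_finset_le_card (R := L⟮τ⟯) ({1, x} : Finset E)
    rw [Finset.coe_pair] at this
    exact this.trans Finset.card_le_two
  have hf2 := hne _ h2
  obtain ⟨a, ha, i, hi⟩ := BV_dep htr hcl' 2 V h1 1 4 (by norm_num) ![1, τ, x, y] (by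
    intro i
    fin_cases i
    · have := aeval_mem_Bn (L := L) h0 (n := 1) 1 (by simp)
      simpa using this
    · have := aeval_mem_Bn (L := L) h0 (n := 1) X (by simp)
      simpa using this
    · exact hx'
    · exact hy') (by
    intro i
    fin_cases i
    · simpa using hV 1 (one_mem _) 0 (zero_mem _)
    · simpa using hV τ (mem_adjoin_simple_self _ _) 0 (zero_mem _)
    · simpa using hV 0 (zero_mem _) 1 (one_mem _)
    · have : y = (- maeval t (f 0) / maeval t (f 2)) +
          (- maeval t (f 1) / maeval t (f 2)) * x := by
        field_simp; linear_combination hf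
      change y ∈ V
      rw [this]
      exact hV _ ((hkm _).mp (div_mem (neg_mem (hmem _)) (hmem _)))
        _ ((hkm _).mp (div_mem (neg_mem (hmem _)) (hmem _))))
  rw [Fin.sum_univ_four] at ha
  change a 0 • (1:E) + a 1 • τ + a 2 • x + a 3 • y = 0 at ha
  simp only [Algebra.smul_def, mul_one] at ha
  have hLm : ∀ l : L, algebraMap L E l ∈ kF K t := fun l =>
    (hkm _).mpr (IntermediateField.algebraMap_mem _ _)
  have hτm : τ ∈ kF K t := (hkm _).mpr (mem_adjoin_simple_self _ _)
  have ha3 : a 3 ≠ 0 := by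
    intro h3
    rw [h3, map_zero, zero_mul, add_zero] at ha
    have q2 := hxlin _ (add_mem (hLm _) (mul_mem (hLm _) hτm)) _ (hLm _) ha
    rw [q2, zero_mul, add_zero] at ha
    rw [map_eq_zero] at q2
    obtain ⟨q0, q1⟩ := lin_L htr ha
    fin_cases i
    · exact hi q0
    · exact hi q1
    · exact hi q2
    · exact hi h3
  have ha3' : algebraMap L E (a 3) ≠ 0 := by rwa [_root_.map_ne_zero]
  have hrel := hxlin (algebraMap L E (a 3) * maeval t (f 0) -
      maeval t (f 2) * (algebraMap L E (a 0) + algebraMap L E (a 1) * τ))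
    (sub_mem (mul_mem (hLm _) (hmem _)) (mul_mem (hmem _) (add_mem (hLm _) (mul_mem (hLm _) hτm))))
    (algebraMap L E (a 3) * maeval t (f 1) - maeval t (f 2) * algebraMap L E (a 2))
    (sub_mem (mul_mem (hLm _) (hmem _)) (mul_mem (hmem _) (hLm _)))
    (by linear_combination algebraMap L E (a 3) * hf - maeval t (f 2) * ha)
  obtain ⟨F, hF1, hF2⟩ := hdesc (f 1) (C (a 2 / a 3)) (by
    rw [aeval_C, map_div₀]; field_simp; linear_combination -hrel)
  rw [natDegree_C, Nat.le_zero] at hF1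
  rw [MvPolynomial.totalDegree_eq_zero_iff_eq_C] at hF1
  set κ := mcoeff 0 F
  rw [hF1, maeval_C, aeval_C, map_div₀] at hF2
  have hf1 : maeval t (f 1) = algebraMap K E κ * maeval t (f 2) := by
    rw [hF2]; field_simp; linear_combination hrel
  obtain ⟨G, hG1, hG2⟩ := I1 ht (nInt_add hy (nInt_smul κ hx)) (by
    have : y + algebraMap K E κ * x = - maeval t (f 0) / maeval t (f 2) := by
      rw [eq_div_iff hf2]; rw [hf1] at hf; linear_combination hf
    rw [this]
    exact div_mem (neg_mem (hmem _)) (hmem _))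
  have := hli G (-κ) (-1) hG1 (by rw [hG2]; simp)
  simpa using this.2

end

section
open Polynomial IntermediateField IntermediateField.algebraAdjoinAdjoin
variable {K E : Type} [Field K] [Field E] [Algebra K E] {m : ℕ}

/-- the geometric situation -/
structure Setup (K : Type) {E : Type} [Field K] [Field E] [Algebra K E] {m : ℕ}
    (t : Fin (m+1) → E) (x y : E) : Prop where
  ai : AlgebraicIndependent K t
  fd : FiniteDimensional (kF K t) E
  sep : Algebra.IsSeparable (kF K t) E
  hx : nInt K t 1 x
  hy : nInt K t 1 y
  hli : ∀ (F : MP K (m+1)) (a b : K), F.totalDegree ≤ 1 →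
      maeval t F + algebraMap K E a * x + algebraMap K E b * y = 0 → a = 0 ∧ b = 0
  four : Module.finrank (kF K t) E = 4

theorem aeval_ne {t : Fin (m+1) → E} (ht : AlgebraicIndependent K t)
    {F : MP K (m+1)} (hF : F ≠ 0) : maeval t F ≠ 0 := by
  intro h
  exact hF (ht (by rw [h, map_zero]))

theorem ne_of_aeval {t : Fin (m+1) → E}
    {F : MP K (m+1)} (hF : maeval t F ≠ 0) : F ≠ 0 := by
  rintro rfl
  simp at hF

namespace Setup
variable {t : Fin (m+1) → E} {x y : E}

theorem indep [IsAlgClosed K] (h : Setup K t x y) (f : Fin 3 → MP K (m+1))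
    (hf : maeval t (f 0) + maeval t (f 1) * x
      + maeval t (f 2) * y = 0) : f = 0 := by
  have := h.fd
  have := h.sep
  exact G1 h.ai h.hx h.hy h.hli f hf

theorem indepk [IsAlgClosed K] (h : Setup K t x y) {a b c : E} (ha : a ∈ kF K t)
    (hb : b ∈ kF K t) (hc : c ∈ kF K t)
    (hf : a + b * x + c * y = 0) : a = 0 ∧ b = 0 ∧ c = 0 := by
  obtain ⟨N0, D0, hD0, h0⟩ := k0_frac ha
  obtain ⟨N1, D1, hD1, h1⟩ := k0_frac hb
  obtain ⟨N2, D2, hD2, h2⟩ := k0_frac hc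
  have key := h.indep ![N0 * D1 * D2, N1 * D0 * D2, N2 * D0 * D1] (by
    simp only [Matrix.cons_val_zero, Matrix.cons_val_one, Matrix.cons_val, map_mul, ← h0, ← h1, ← h2]
    linear_combination maeval t D0 * maeval t D1 * maeval t D2 * hf)
  have k0 : N0 * D1 * D2 = 0 := congrFun key 0
  have k1 : N1 * D0 * D2 = 0 := congrFun key 1
  have k2 : N2 * D0 * D1 = 0 := congrFun key 2
  have e0 := ne_of_aeval hD0
  have e1 := ne_of_aeval hD1
  have e2 := ne_of_aeval hD2
  have n0 : N0 = 0 := by simpa [e1, e2] using k0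
  have n1 : N1 = 0 := by simpa [e0, e2] using k1
  have n2 : N2 = 0 := by simpa [e0, e1] using k2
  subst n0 n1 n2
  simp only [map_zero, mul_eq_zero, hD0, hD1, hD2, false_or] at h0 h1 h2
  exact ⟨h0, h1, h2⟩

theorem curve [IsAlgClosed K] (h : Setup K t x y) : ∃ D : MP K (m+1), D ≠ 0 ∧
    ∀ p, meval p D ≠ 0 → Curve (Lf K (tsub t p)) (tsub t p 0) x y := by
  have := h.fd
  have := h.sep
  obtain ⟨D, hD, hcl⟩ := L_closed_good h.ai
  refine ⟨D, hD, fun p hp => ?_⟩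
  have hs := tsub_ai h.ai p
  have h0 := s_ne hs 0
  refine ⟨tau_tr hs, hcl p hp, nInt_mem h0 h.hx, nInt_mem h0 h.hy, ?_⟩
  rw [Fintype.linearIndependent_iff]
  intro g hg
  rw [Fin.sum_univ_three] at hg
  have hk : ∀ i, (g i : E) ∈ kF K t := fun i => (k0_mem p h0 _).mpr (g i).2
  have key := h.indepk (hk 0) (hk 1) (hk 2) (by
    change g 0 • (1:E) + g 1 • x + g 2 • y = 0 at hg
    simp only [Algebra.smul_def, mul_one] at hg
    exact hg)
  intro i
  apply Subtype.ext
  fin_cases i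
  · exact key.1
  · exact key.2.1
  · exact key.2.2

theorem G2 [IsAlgClosed K] (h : Setup K t x y) {n : ℕ} {w : E} (hw : nInt K t n w)
    {D : MP K (m+1)} (hD : D ≠ 0) (f : Fin 3 → MP K (m+1))
    (hf : maeval t D * w = maeval t (f 0) + maeval t (f 1) * x
      + maeval t (f 2) * y) :
    ∃ F0 F1 F2 : MP K (m+1), F0.totalDegree ≤ n ∧
      (n = 0 → F1 = 0) ∧ F1.totalDegree ≤ n - 1 ∧ (n = 0 → F2 = 0) ∧ F2.totalDegree ≤ n - 1 ∧
      w = maeval t F0 + maeval t F1 * x + maeval t F2 * y := by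
  obtain ⟨D0, hD0, hcur⟩ := h.curve
  have : Infinite K := IsAlgClosed.instInfinite
  obtain ⟨p, hp⟩ := good_point (mul_ne_zero hD0 hD)
  rw [map_mul] at hp
  have hs := tsub_ai h.ai p
  have h0 := s_ne hs 0
  have hc := hcur p (left_ne_zero_of_mul hp)
  have hDt := aeval_ne h.ai hD
  let g : Fin 3 → (Lf K (tsub t p))⟮tsub t p 0⟯ := fun i =>
    ⟨maeval t (f i) / maeval t D,
      (k0_mem p h0 _).mp (div_mem (aeval_mem_k0 _ _) (aeval_mem_k0 _ _))⟩
  have hg : ∀ i, (g i : E) = maeval t (f i) / maeval t D := fun i => rfl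
  have hwg : (g 0 : E) + g 1 * x + g 2 * y = w := by
    rw [hg, hg, hg]; field_simp; linear_combination -hf
  obtain ⟨P0, P1, P2, d0, d1, d2, e0, e1, e2⟩ := hc.C1 n g (by rw [hwg]; exact nInt_mem h0 hw)
  obtain ⟨F0, a0, b0⟩ := descend h.ai (right_ne_zero_of_mul hp) (N := f 0) (P := P0) (by
    rw [e0, hg]; field_simp)
  obtain ⟨F1, a1, b1⟩ := descend h.ai (right_ne_zero_of_mul hp) (N := f 1) (P := P1) (by
    rw [e1, hg]; field_simp)
  obtain ⟨F2, a2, b2⟩ := descend h.ai (right_ne_zero_of_mul hp) (N := f 2) (P := P2) (by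
    rw [e2, hg]; field_simp)
  have hz : ∀ (P : (Lf K (tsub t p))[X]) (F : MP K (m+1)), P.degree < n →
      F.totalDegree ≤ P.natDegree → maeval t F = aeval (tsub t p 0) P →
      (n = 0 → F = 0) ∧ F.totalDegree ≤ n - 1 := by
    intro P F hP hF hFP
    constructor
    · rintro rfl
      have : P = 0 := by
        rw [← Polynomial.degree_eq_bot]
        simpa using hP
      rw [this, map_zero] at hFP
      exact h.ai (by rw [hFP, map_zero])
    · by_cases hP0 : P = 0
      · rw [hP0, natDegree_zero] at hF; omega
      · have := (natDegree_lt_iff_degree_lt hP0).mpr hP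
        omega
  refine ⟨F0, F1, F2, ?_, (hz P1 F1 d1 a1 b1).1, (hz P1 F1 d1 a1 b1).2, (hz P2 F2 d2 a2 b2).1,
    (hz P2 F2 d2 a2 b2).2, ?_⟩
  · by_cases hP0 : P0 = 0
    · rw [hP0, natDegree_zero] at a0; omega
    · have := (natDegree_lt_iff_degree_lt hP0).mpr d0
      omega
  · rw [b0, b1, b2, e0, e1, e2, hwg]

/-- the span of `1,x,y` over the base field -/
def V (_ : Setup K t x y) : Submodule (kF K t) E :=
  Submodule.span _ (Set.range ![1, x, y])

theorem mem_V (h : Setup K t x y) (w : E) : w ∈ h.V ↔ ∃ f : Fin 3 → kF K t,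
    w = f 0 + f 1 * x + f 2 * y := by
  rw [V, Submodule.mem_span_range_iff_exists_fun]
  simp only [Fin.sum_univ_three]
  constructor
  · rintro ⟨c, hc⟩
    refine ⟨c, ?_⟩
    rw [← hc]
    simp [Algebra.smul_def]
  · rintro ⟨c, hc⟩
    refine ⟨c, ?_⟩
    rw [hc]
    simp [Algebra.smul_def]

theorem V_rank [IsAlgClosed K] (h : Setup K t x y) :
    Module.finrank (kF K t) h.V = 3 := by
  have : LinearIndependent (kF K t) (![1, x, y] : Fin 3 → E) := by
    rw [Fintype.linearIndependent_iff]
    intro g hg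
    rw [Fin.sum_univ_three] at hg
    have key := h.indepk (g 0).2 (g 1).2 (g 2).2 (by
      change g 0 • (1:E) + g 1 • x + g 2 • y = 0 at hg
      simp only [Algebra.smul_def, mul_one] at hg
      exact hg)
    intro i
    apply Subtype.ext
    fin_cases i
    · exact key.1
    · exact key.2.1
    · exact key.2.2
  exact (finrank_span_eq_card this).trans (by simp)

theorem chi_exists [IsAlgClosed K] (h : Setup K t x y) :
    ∃ χ : E →ₗ[kF K t] kF K t, LinearMap.ker χ = h.V := by
  have := h.fd
  have hlt : h.V < ⊤ := by
    rw [lt_top_iff_ne_top]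
    intro hV
    have h1 := h.V_rank
    rw [hV, finrank_top, h.four] at h1
    norm_num at h1
  obtain ⟨χ, hχ0, hχ⟩ := Submodule.exists_le_ker_of_lt_top _ hlt
  refine ⟨χ, (Submodule.eq_of_le_of_finrank_le hχ ?_).symm⟩
  rw [h.V_rank]
  have h2 := LinearMap.finrank_range_add_finrank_ker χ
  rw [h.four] at h2
  have h3 : 0 < Module.finrank (kF K t) (LinearMap.range χ) := by
    rw [Module.finrank_pos_iff, Submodule.nontrivial_iff_ne_bot]
    intro h4
    exact hχ0 (LinearMap.range_eq_bot.mp h4)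
  omega

theorem not_closed [IsAlgClosed K] (h : Setup K t x y) (h1 : x * x ∈ h.V) (h2 : x * y ∈ h.V)
    (h3 : y * y ∈ h.V) : False := by
  have := h.fd
  have hx : x ∈ h.V := Submodule.subset_span ⟨1, rfl⟩
  have hy : y ∈ h.V := Submodule.subset_span ⟨2, rfl⟩
  have ho : (1:E) ∈ h.V := Submodule.subset_span ⟨0, rfl⟩
  let A : Subalgebra (kF K t) E := h.V.toSubalgebra ho (by
    intro a b ha hb
    rw [h.mem_V] at ha hb
    obtain ⟨f, rfl⟩ := ha
    obtain ⟨g, rfl⟩ := hb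
    have e : ((f 0 : E) + f 1 * x + f 2 * y) * (g 0 + g 1 * x + g 2 * y) =
      (f 0 * g 0) • (1:E) + (f 0 * g 1 + f 1 * g 0) • x + (f 0 * g 2 + f 2 * g 0) • y +
       (f 1 * g 1) • (x * x) + (f 1 * g 2 + f 2 * g 1) • (x * y) + (f 2 * g 2) • (y * y) := by
      simp only [Algebra.smul_def, map_add, map_mul, IntermediateField.algebraMap_apply]
      ring
    rw [e]
    have sm := fun a {z} (hz : z ∈ h.V) => h.V.smul_mem a hz
    exact add_mem (add_mem (add_mem (add_mem (add_mem (sm _ ho) (sm _ hx)) (sm _ hy)) (sm _ h1)) (sm _ h2)) (sm _ h3))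
  have hA : Module.finrank (kF K t) A = 3 := h.V_rank
  let F := A.toIntermediateField' ((Subalgebra.isField_of_algebraic A))
  have hF : Module.finrank (kF K t) F = 3 := hA
  have h4 := Module.finrank_mul_finrank (kF K t) F E
  rw [hF, h.four] at h4
  omega

end Setup

end

section
open Polynomial IntermediateField IntermediateField.algebraAdjoinAdjoin
variable {K E : Type} [Field K] [Field E] [Algebra K E] {m : ℕ}

theorem extract_cop {R : Type} [CommRing R] [IsDomain R] [UniqueFactorizationMonoid R]
    (c : Fin 3 → R) (hc : ∃ i, c i ≠ 0) : ∃ (g : R) (c' : Fin 3 → R), g ≠ 0 ∧ (∀ i, c i = g * c' i) ∧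
      ∀ f, (∀ i, f ∣ c' i) → IsUnit f := by
  classical
  let := UniqueFactorizationMonoid.strongNormalizationMonoid (α := R)
  let := UniqueFactorizationMonoid.toNormalizedGCDMonoid R
  obtain ⟨c', h1, h2⟩ := Finset.extract_gcd c (Finset.univ_nonempty (α := Fin 3))
  refine ⟨_, c', ?_, fun i => h1 i (Finset.mem_univ i), ?_⟩
  · intro h0
    obtain ⟨i, hi⟩ := hc
    apply hi
    rw [h1 i (Finset.mem_univ i), h0, zero_mul]
  · intro f hf
    apply isUnit_of_dvd_one
    rw [← h2]
    exact Finset.dvd_gcd fun i _ => hf i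

namespace Setup
variable {t : Fin (m+1) → E} {x y : E}

/-- the quadratic monomials -/
def qm (x y : E) : Fin 3 → E := ![x * x, x * y, y * y]

theorem chi_norm [IsAlgClosed K] (h : Setup K t x y) :
    ∃ (χ : E →ₗ[kF K t] kF K t)
      (c : Fin 3 → MP K (m+1)), LinearMap.ker χ = h.V ∧
      (∀ i, (χ (qm x y i) : E) = maeval t (c i)) ∧
      ∀ f, (∀ i, f ∣ c i) → IsUnit f := by
  obtain ⟨χ, hχ⟩ := h.chi_exists
  have hfr := fun i => k0_frac (χ (qm x y i)).2
  choose N D hD hND using hfr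
  let c0 : Fin 3 → MP K (m+1) := ![N 0 * D 1 * D 2, N 1 * D 0 * D 2, N 2 * D 0 * D 1]
  have hDD : maeval t (D 0 * D 1 * D 2) ≠ 0 := by
    rw [map_mul, map_mul]
    exact mul_ne_zero (mul_ne_zero (hD 0) (hD 1)) (hD 2)
  have hc0 : ∀ i, maeval t (c0 i) = maeval t (D 0 * D 1 * D 2) * χ (qm x y i) := by
    intro i
    fin_cases i
    · simp only [c0, Fin.mk_zero, Matrix.cons_val_zero, map_mul, ← hND]; ring
    · change maeval t (N 1 * D 0 * D 2) = maeval t (D 0 * D 1 * D 2) * χ (qm x y 1)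
      simp only [map_mul, ← hND]; ring
    · change maeval t (N 2 * D 0 * D 1) = maeval t (D 0 * D 1 * D 2) * χ (qm x y 2)
      simp only [map_mul, ← hND]; ring
  have hne : ∃ i, c0 i ≠ 0 := by
    by_contra! hall
    have hz : ∀ i, qm x y i ∈ h.V := by
      intro i
      rw [← hχ, LinearMap.mem_ker]
      have := hc0 i
      rw [hall i, map_zero] at this
      exact Subtype.ext ((mul_eq_zero.mp this.symm).resolve_left hDD)
    exact h.not_closed (hz 0) (hz 1) (hz 2)
  obtain ⟨g, c, hg0, hgc, hcop⟩ := extract_cop c0 hne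
  have hgt := aeval_ne h.ai hg0
  let a : kF K t := ⟨maeval t (D 0 * D 1 * D 2) / maeval t g,
    div_mem (aeval_mem_k0 _ _) (aeval_mem_k0 _ _)⟩
  have ha : (a : E) = maeval t (D 0 * D 1 * D 2) / maeval t g := rfl
  have ha0 : a ≠ 0 := by
    intro h0
    have : (a : E) = 0 := by rw [h0]; rfl
    rw [ha] at this
    exact div_ne_zero hDD hgt this
  refine ⟨a • χ, c, ?_, ?_, hcop⟩
  · rw [LinearMap.ker_smul _ _ ha0, hχ]
  · intro i
    have h1 : ((a • χ) (qm x y i) : E) = a * (χ (qm x y i) : E) := rfl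
    have h2 := hc0 i
    rw [hgc i, map_mul] at h2
    rw [h1, ha, div_mul_eq_mul_div, ← h2]
    field_simp

theorem chi_p1 (t : Fin (m+1) → E) (p : Fin (m+1) → K) (h0 : tsub t p 0 ≠ 0)
    (χ : E →ₗ[kF K t] kF K t) : ∀ w, (χ w : E) ∈ (Lf K (tsub t p))⟮tsub t p 0⟯ := fun w => (k0_mem p h0 _).mp (χ w).2
theorem chi_p2 (t : Fin (m+1) → E)
    (χ : E →ₗ[kF K t] kF K t) (a : E) (ha : a ∈ kF K t) (b : E) : (χ (a * b) : E) = a * (χ b : E) := by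
    have h1 : a * b = (⟨a, ha⟩ : kF K t) • b := by
      rw [Algebra.smul_def]
      rfl
    rw [h1, χ.map_smul, smul_eq_mul]
    rfl
theorem chi_p3 (t : Fin (m+1) → E)
    (χ : E →ₗ[kF K t] kF K t) : ∀ a b, (χ (a + b) : E) = (χ a : E) + (χ b : E) := by
    intro a b
    rw [χ.map_add]; rfl
theorem chi_p4 (L : IntermediateField K E) (M : IntermediateField L E) (f : E → E) (hf : ∀ w, f w ∈ M)
   (h1 : ∀ a b, f (a + b) = f a + f b) (h2 : ∀ a ∈ M, ∀ b, f (a * b) = a * f b) :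
   ∃ χ : E →ₗ[M] M, ∀ w, Subtype.val (χ w) = f w := by
  let g : E → M := fun w => ⟨f w, hf w⟩
  refine ⟨{ toFun := g, map_add' := fun a b => Subtype.ext (h1 a b), map_smul' := fun a b => Subtype.ext (h2 a.1 a.2 b) }, fun w => rfl⟩
theorem chiT_ex (t : Fin (m+1) → E) (p : Fin (m+1) → K) (h0 : tsub t p 0 ≠ 0)
    (χ : E →ₗ[kF K t] kF K t) :
    ∃ χ' : E →ₗ[(Lf K (tsub t p))⟮tsub t p 0⟯] (Lf K (tsub t p))⟮tsub t p 0⟯,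
    ∀ w, Subtype.val (χ' w)  = Subtype.val (χ w)  := by
  refine chi_p4 _ _ (fun w => (χ w : E)) (chi_p1 t p h0 χ) (chi_p3 t χ) fun a ha b => chi_p2 t χ a ((k0_mem p h0 _).mpr ha) b

theorem coprime_curve' {p : Fin (m+1) → K} (hs : AlgebraicIndependent K (tsub t p))
    (c : Fin 3 → MP K (m+1))
    (hcop : ∀ f, (∀ i, f ∣ c i) → IsUnit f) {j : Fin 3} (hj : meval p (c j) ≠ 0) :
    ∃ u : Fin 3 → (Lf K (tsub t p))[X], ∑ i, u i * toCurve (tsub t p) (shift p (c i)) = 1 := by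
  apply coprime_curve hs (fun i => shift p (c i))
  · intro f hf
    have h1 : IsUnit (shift (-p) f) := by
      apply hcop
      intro i
      have := map_dvd (shift (-p)) (hf i)
      rwa [shift_shift] at this
    have h2 := h1.map (shift p)
    have := shift_shift (-p) f
    rw [neg_neg] at this
    rwa [this] at h2
  · exact ⟨j, by rw [constCoeff_shift]; exact hj⟩

theorem G3 [IsAlgClosed K] (h : Setup K t x y) :
    ∃ (χ : E →ₗ[kF K t] kF K t)
      (c : Fin 3 → MP K (m+1)), LinearMap.ker χ = h.V ∧
      (∀ i, (χ (qm x y i) : E) = maeval t (c i)) ∧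
      (∀ f, (∀ i, f ∣ c i) → IsUnit f) ∧ (∀ i, (c i).totalDegree ≤ 1) ∧
      ((∃ i, (c i).totalDegree = 1) → ∀ n w, nInt K t n w →
        ∃ F : MP K (m+1), (n = 0 → F = 0) ∧ F.totalDegree ≤ n - 1 ∧
          (χ w : E) = maeval t F) := by
  obtain ⟨χ, c, hker, hc, hcop⟩ := h.chi_norm
  have : Infinite K := IsAlgClosed.instInfinite
  obtain ⟨D0, hD0, hcur⟩ := h.curve
  have hj : ∃ j, c j ≠ 0 := by
    by_contra! hall
    have := hcop 0 (fun i => by rw [hall i])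
    exact not_isUnit_zero this
  obtain ⟨j, hj⟩ := hj
  have main : ∀ p, meval p D0 ≠ 0 → meval p (c j) ≠ 0 →
      (∀ i, (c i).totalDegree ≤ 1) ∧ ((∃ i, (c i).totalDegree = 1) → ∀ n w, nInt K t n w →
        ∃ P : (Lf K (tsub t p))[X], P.degree < n ∧ aeval (tsub t p 0) P = (χ w : E)) := by
    intro p hp1 hp2
    have hs := tsub_ai h.ai p
    have h0 := s_ne hs 0
    have hC := hcur p hp1
    obtain ⟨u, hu⟩ := coprime_curve' hs c hcop hp2
    obtain ⟨χ', hχ'⟩ := chiT_ex t p h0 χ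
    have hce : ∀ i, (χ' (qm x y i) : E) =
        aeval (tsub t p 0) (toCurve (tsub t p) (shift p (c i))) := by
      intro i
      rw [aeval_toCurve h0]
      have := aeval_shift t p (c i)
      erw [this]
      rw [hχ']
      exact hc i
    have hdeg : ∀ i, (toCurve (tsub t p) (shift p (c i))).natDegree = (c i).totalDegree := by
      intro i
      rw [toCurve_natDegree hs, totalDegree_shift]
    have key := hC.C2 (by rw [← k0_finrank t p h0, h.four]) χ' (by
      intro w hw
      rw [mem_Vsp] at hw
      obtain ⟨f, rfl⟩ := hw
      apply Subtype.ext
      have hm : (f 0 : E) + f 1 * x + f 2 * y ∈ h.V := by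
        rw [h.mem_V]
        exact ⟨fun i => ⟨(f i : E), (k0_mem p h0 _).mpr (f i).2⟩, rfl⟩
      rw [← hker, LinearMap.mem_ker] at hm
      rw [hχ', hm]
      rfl) (fun i => toCurve (tsub t p) (shift p (c i))) u
      (hce 0) (hce 1) (hce 2) hu
    constructor
    · intro i
      rw [← hdeg]; exact key.1 i
    · rintro ⟨i, hi⟩ n w hw
      obtain ⟨P, hP1, hP2⟩ := key.2 ⟨i, by rw [hdeg, hi]⟩ n w (nInt_mem h0 hw)
      exact ⟨P, hP1, hP2.trans (hχ' w)⟩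
  refine ⟨χ, c, hker, hc, hcop, ?_, ?_⟩
  · obtain ⟨p, hp⟩ := good_point (mul_ne_zero hD0 hj)
    rw [map_mul] at hp
    exact (main p (left_ne_zero_of_mul hp) (right_ne_zero_of_mul hp)).1
  · intro hi n w hw
    obtain ⟨N, D, hD, hND⟩ := k0_frac (χ w).2
    obtain ⟨p, hp⟩ := good_point (mul_ne_zero (mul_ne_zero hD0 hj) (ne_of_aeval hD))
    rw [map_mul, map_mul] at hp
    have hp1 := left_ne_zero_of_mul hp
    obtain ⟨P, hP1, hP2⟩ := (main p (left_ne_zero_of_mul hp1) (right_ne_zero_of_mul hp1)).2 hi n w hw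
    obtain ⟨F, a, b⟩ := descend h.ai (right_ne_zero_of_mul hp) (N := N) (P := P) (by
      rw [hP2]; exact hND)
    refine ⟨F, ?_, ?_, ?_⟩
    · rintro rfl
      have : P = 0 := by
        rw [← Polynomial.degree_eq_bot]
        simpa using hP1
      rw [this, map_zero] at b
      exact h.ai (by rw [b, map_zero])
    · by_cases hP0 : P = 0
      · rw [hP0, natDegree_zero] at a; omega
      · have := (natDegree_lt_iff_degree_lt hP0).mpr hP1
        omega
    · rw [b, hP2]

end Setup

end

section
open Polynomial
/-- leading-coefficient bookkeeping -/
theorem lead_prod {R ι : Type} [CommRing R] (s : Finset ι) (f : ι → R[X]) (n : ι → ℕ) (c : ι → R)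
    (h : ∀ i ∈ s, (f i).natDegree ≤ n i ∧ (f i).coeff (n i) = c i) :
    (∏ i ∈ s, f i).natDegree ≤ ∑ i ∈ s, n i ∧ (∏ i ∈ s, f i).coeff (∑ i ∈ s, n i) = ∏ i ∈ s, c i := by
  classical
  induction s using Finset.induction_on with
  | empty => simp
  | insert a s ha ih =>
    have h1 := h a (Finset.mem_insert_self _ _)
    have h2 := ih (fun i hi => h i (Finset.mem_insert_of_mem hi))
    rw [Finset.prod_insert ha, Finset.sum_insert ha, Finset.prod_insert ha]
    refine ⟨natDegree_mul_le.trans (add_le_add h1.1 h2.1), ?_⟩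
    rw [coeff_mul_add_eq_of_natDegree_le h1.1 h2.1, h1.2, h2.2]

theorem lead_aeval {K R : Type} {N : ℕ} [Field K] [CommRing R] [Algebra K R] (b : Fin N → R) (a : Fin N → K)
    (F : MP K N) (n : ℕ) (hF : F.IsHomogeneous n) :
    (maeval (fun i => C (b i) + C (algebraMap K R (a i)) * X) F : R[X]).natDegree ≤ n ∧
    (maeval (fun i => C (b i) + C (algebraMap K R (a i)) * X) F : R[X]).coeff n
      = algebraMap K R (meval a F) := by
  have key : ∀ s ∈ F.support, (maeval (fun i => C (b i) + C (algebraMap K R (a i)) * X) (mmonomial s (F.coeff s)) : R[X]).natDegree ≤ n ∧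
    (maeval (fun i => C (b i) + C (algebraMap K R (a i)) * X) (mmonomial s (F.coeff s)) : R[X]).coeff n
      = algebraMap K R (meval a (mmonomial s (F.coeff s))) := by
    intro s hs
    have hd : s.degree = n := by
      have := hF (MvPolynomial.mem_support_iff.mp hs)
      rw [Finsupp.degree_eq_weight_one]; exact this
    have hsum : ∑ i, s i = n := by rw [← hd, Finsupp.degree_eq_sum]
    have := lead_prod Finset.univ (fun i => (C (b i) + C (algebraMap K R (a i)) * X)^(s i)) (fun i => s i)
      (fun i => (algebraMap K R (a i))^(s i)) (by
        intro i _
        have h1 : (C (b i) + C (algebraMap K R (a i)) * X).natDegree ≤ 1 := by compute_degree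
        have h3 : ((C (b i) + C (algebraMap K R (a i)) * X)).coeff 1 = algebraMap K R (a i) := by
          simp [coeff_C]
        have h2 := coeff_pow_of_natDegree_le (m := s i) h1
        constructor
        · exact (natDegree_pow_le_of_le (s i) h1).trans (by simp)
        · rw [mul_one] at h2; rw [h2, h3])
    rw [hsum] at this
    rw [MvPolynomial.aeval_monomial, MvPolynomial.eval_monomial]
    have hp : (s.prod fun i k => (C (b i) + C (algebraMap K R (a i)) * X)^k) = ∏ i, (C (b i) + C (algebraMap K R (a i)) * X)^(s i) := by
      rw [Finsupp.prod_fintype]; intro i; simp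
    have hp2 : (s.prod fun i k => (a i)^k) = ∏ i, (a i)^(s i) := by
      rw [Finsupp.prod_fintype]; intro i; simp
    rw [hp, hp2, Polynomial.algebraMap_apply]
    refine ⟨(natDegree_C_mul_le _ _).trans this.1, ?_⟩
    rw [coeff_C_mul, this.2]; simp
  conv_lhs => rw [F.as_sum]
  constructor
  · rw [map_sum]
    exact natDegree_sum_le_of_forall_le _ _ (fun s hs => (key s hs).1)
  · conv_lhs => rw [F.as_sum]
    conv_rhs => rw [F.as_sum]
    rw [map_sum, finsetSum_coeff, map_sum, map_sum]
    exact Finset.sum_congr rfl (fun s hs => (key s hs).2)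

/-- integral dependence from a relation with nonvanishing top form in direction `a` -/
theorem integral_of_rel {K R B : Type} {N : ℕ} [Field K] [CommRing R] [CommRing B] [Algebra K R] [Algebra K B]
    [Algebra R B] [IsScalarTower K R B] [Nontrivial B] (F : MP K N) (b : Fin N → B) (x0 w : B) (a : Fin N → K)
    (n : ℕ)
    (hb : ∀ i, IsIntegral R (b i)) (hx0 : IsIntegral R x0)
    (htop : meval a (mcomp n F) ≠ 0)
    (hrel : ∑ k ∈ Finset.range (n+1), x0^(n-k) *
      maeval (fun i => b i + algebraMap K B (a i) * w) (mcomp k F) = 0) :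
    IsIntegral R w := by
  let IC := integralClosure R B
  let b' : Fin N → IC := fun i => ⟨b i, hb i⟩
  let x0' : IC := ⟨x0, hx0⟩
  let Q : IC[X] := ∑ k ∈ Finset.range (n+1), C (x0'^(n-k)) *
      maeval (fun i => C (b' i) + C (algebraMap K IC (a i)) * X) (mcomp k F)
  have hk := fun k => lead_aeval b' a _ k (mcomp_hom k F)
  have hdeg : Q.natDegree ≤ n := by
    refine natDegree_sum_le_of_forall_le _ _ (fun k hk' => ?_)
    refine (natDegree_C_mul_le _ _).trans ((hk k).1.trans ?_)
    have := Finset.mem_range.mp hk'; omega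
  have hlead : Q.coeff n = algebraMap K IC (meval a (mcomp n F)) := by
    rw [finsetSum_coeff, Finset.sum_range_succ, Finset.sum_eq_zero]
    · rw [coeff_C_mul, (hk n).2]; simp
    · intro k hk'
      rw [coeff_C_mul, coeff_eq_zero_of_natDegree_lt, mul_zero]
      exact lt_of_le_of_lt (hk k).1 (Finset.mem_range.mp hk')
  have hev : aeval w Q = 0 := by
    rw [← hrel, map_sum]
    refine Finset.sum_congr rfl (fun k _ => ?_)
    rw [map_mul, aeval_C, map_pow]
    congr 1
    generalize (mcomp k F) = G
    induction G using minduction_on with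
    | C c =>
      rw [maeval_C, maeval_C, Polynomial.algebraMap_apply, aeval_C]; rfl
    | add p q hp hq => rw [map_add, map_add, hp, hq, map_add]
    | mul_X p i hp =>
      rw [map_mul, map_mul, hp, map_mul, maeval_X, maeval_X]
      simp only [map_add, map_mul, aeval_C, aeval_X]; rfl
  set c := meval a (mcomp n F) with hc
  have hitg : IsIntegral IC w := by
    refine ⟨C (algebraMap K IC c⁻¹) * Q, ?_, ?_⟩
    · refine monic_of_natDegree_le_of_coeff_eq_one n ((natDegree_C_mul_le _ _).trans hdeg) ?_
      rw [coeff_C_mul, hlead, ← map_mul, inv_mul_cancel₀ htop, map_one]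
    · rw [← aeval_def, map_mul, hev, mul_zero]
  exact isIntegral_trans (R := R) (A := IC) w hitg

theorem deriv_aeval {K R : Type} {N : ℕ} [Field K] [CommRing R] [Algebra K R] (b : Fin N → R) (a : Fin N → K)
    (F : MP K N) :
    derivative (maeval (fun i => C (b i) + C (algebraMap K R (a i)) * X) F : R[X])
      = ∑ i, C (algebraMap K R (a i)) * maeval (fun i => C (b i) + C (algebraMap K R (a i)) * X) (mpderiv i F) := by
  induction F using minduction_on with
  | C c =>
    simp [Polynomial.algebraMap_apply]
  | add p q hp hq => simp only [map_add, hp, hq, mul_add, Finset.sum_add_distrib]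
  | mul_X p j hp =>
    have h1 : ∀ i, mpderiv i (p * mX j) = p * (if i = j then 1 else 0) +
        mX j * mpderiv i p := by
      intro i
      rw [Derivation.leibniz, MvPolynomial.pderiv_X, smul_eq_mul, smul_eq_mul]
      congr 2
      by_cases h : i = j
      · subst h; simp
      · simp [h]
    rw [map_mul, derivative_mul, hp, maeval_X]
    have h2 : derivative (C (b j) + C (algebraMap K R (a j)) * X) = C (algebraMap K R (a j)) := by simp
    rw [h2]
    have h3 : ∀ i, C (algebraMap K R (a i)) * maeval (fun i => C (b i) + C (algebraMap K R (a i)) * X) (mpderiv i (p * mX j))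
      = (if i = j then maeval (fun i => C (b i) + C (algebraMap K R (a i)) * X) p * C (algebraMap K R (a i)) else 0) + C (algebraMap K R (a i)) * maeval (fun i => C (b i) + C (algebraMap K R (a i)) * X) (mpderiv i p) * (C (b j) + C (algebraMap K R (a j)) * X) := by
      intro i
      rw [h1, map_add, map_mul, map_mul, maeval_X]
      split_ifs
      · rw [map_one]; ring
      · rw [map_zero]; ring
    rw [Finset.sum_congr rfl (fun i _ => h3 i), Finset.sum_add_distrib, ← Finset.sum_mul, Finset.sum_ite_eq' Finset.univ j, if_pos (Finset.mem_univ _), add_comm]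

theorem sep_of_deriv {F E : Type} [Field F] [Field E] [Algebra F E] (P : F[X]) (w : E)
    (h0 : aeval w P = 0) (h1 : aeval w (derivative P) ≠ 0) : IsSeparable F w := by
  obtain ⟨Q, hQ⟩ := minpoly.dvd F w h0
  have hP : P ≠ 0 := by rintro rfl; simp at h1
  have hitg : IsIntegral F w := (isAlgebraic_iff_isIntegral.mp ⟨P, hP, h0⟩)
  unfold IsSeparable
  rw [separable_iff_derivative_ne_zero (minpoly.irreducible hitg)]
  intro hd
  apply h1
  rw [hQ, derivative_mul, hd, map_add, map_mul, map_mul, minpoly.aeval]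
  simp

end

section
open Polynomial IntermediateField
variable {K E : Type} [Field K] [Field E] [Algebra K E]

theorem totalDegree_pderiv_lt {N : ℕ} (F : MP K N) (e : Fin N)
    (h : mpderiv e F ≠ 0) : (mpderiv e F).totalDegree < F.totalDegree := by
  have hs : ∀ s ∈ (mpderiv e F).support, (s.sum fun _ k => k) < F.totalDegree := by
    intro s hs
    rw [MvPolynomial.mem_support_iff, MvPolynomial.coeff_pderiv] at hs
    have h1 : s + Finsupp.single e 1 ∈ F.support := by
      rw [MvPolynomial.mem_support_iff]
      intro h0
      rw [h0, zero_mul] at hs; exact hs rfl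
    have := MvPolynomial.le_totalDegree h1
    rw [Finsupp.sum_add_index' (by simp) (by simp), Finsupp.sum_single_index rfl] at this
    omega
  obtain ⟨s, hs'⟩ := MvPolynomial.support_nonempty.mpr h
  rw [mtotalDegree, Finset.sup_lt_iff]
  · exact hs
  · exact lt_of_le_of_lt (Nat.zero_le _) (hs s hs')

theorem rel_exists [PerfectField K] {N : ℕ} (u : Fin N → E) (hu : ¬ AlgebraicIndependent K u) :
    ∃ F : MP K N, F ≠ 0 ∧ maeval u F = 0 ∧
      ∃ e, maeval u (mpderiv e F) ≠ 0 := by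
  set S := {F : MP K N | F ≠ 0 ∧ F.aeval u = 0}
  obtain ⟨F, ⟨hF₀, hFa⟩, hFmin⟩ :
      ∃ F ∈ S, ∀ G : MP K N, G ≠ 0 → G.aeval u = 0 → F.totalDegree ≤ G.totalDegree := by
    suffices S.Nonempty from
      ⟨Function.argminOn mtotalDegree S this, Function.argminOn_mem ..,
        fun _ h₁ h₂ ↦ Function.argminOn_le mtotalDegree S ⟨h₁, h₂⟩⟩
    simpa [S, algebraicIndependent_iff, and_comm, Set.Nonempty] using hu
  refine ⟨F, hF₀, hFa, ?_⟩
  suffices ∃ e, mpderiv e F ≠ 0 by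
    obtain ⟨e, he⟩ := this
    refine ⟨e, fun h => ?_⟩
    exact absurd (hFmin _ he h) (not_le.mpr (totalDegree_pderiv_lt F e he))
  have key : ∃ e, ∃ σ ∈ F.support, ((σ e : ℕ) : K) ≠ 0 := by
    obtain _ | ⟨p, hp, hpk⟩ := CharP.exists' K
    · have hne : F.totalDegree ≠ 0 := by
        intro h0
        rw [MvPolynomial.totalDegree_eq_zero_iff_eq_C.mp h0, maeval_C] at hFa
        apply hF₀
        rw [MvPolynomial.totalDegree_eq_zero_iff_eq_C.mp h0]
        rw [map_eq_zero] at hFa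
        rw [hFa, map_zero]
      by_contra hcon
      push Not at hcon
      apply hne
      rw [← Nat.le_zero]
      refine Finset.sup_le (fun s hs => ?_)
      have : s = 0 := Finsupp.ext (fun e => by
        have := hcon e s hs
        simpa using this)
      simp [this]
    · have : ExpChar K p := .prime hp.out
      have : CharP E p := .of_ringHom_of_ne_zero (algebraMap K E) p hp.out.ne_zero
      have H : ∀ s : Finset E, LinearIndepOn K _root_.id (s : Set E) → LinearIndepOn K (· ^ p) (s : Set E) := by
        intro s hs
        have : ExpChar E p := .prime hp.out
        apply hs.map_of_injective_injective (frobeniusEquiv K p).symm (frobenius E p).toAddMonoidHom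
        · simp
        · simp
        · intro r m
          change (_ • m) ^ p = r • (m ^ p)
          rw [Algebra.smul_def, Algebra.smul_def, mul_pow, ← map_pow]
          congr 2
          exact frobenius_apply_frobeniusEquiv_symm K p r
      obtain ⟨i, σ, hσ, hi⟩ := MvPolynomial.exists_mem_support_not_dvd_of_forall_totalDegree_le p hp.out H hFmin hF₀ hFa
      exact ⟨i, σ, hσ, by rwa [Ne, CharP.cast_eq_zero_iff K p]⟩
  obtain ⟨e, σ, hσ, hne⟩ := key
  refine ⟨e, fun h => ?_⟩
  have hσe : σ e ≠ 0 := by intro h; rw [h] at hne; simp at hne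
  have hle : Finsupp.single e 1 ≤ σ := by
    rw [Finsupp.single_le_iff]; omega
  have := congrArg (mcoeff (σ - Finsupp.single e 1)) h
  rw [MvPolynomial.coeff_pderiv, MvPolynomial.coeff_zero, tsub_add_cancel_of_le hle] at this
  have h3 : ((σ - Finsupp.single e 1 : Fin N →₀ ℕ) e : ℕ) + 1 = σ e := by
    simp; omega
  have h4 : (((σ - Finsupp.single e 1 : Fin N →₀ ℕ) e : ℕ) : K) + 1 = (σ e : K) := by rw [← h3]; push_cast; rfl
  rw [h4] at this
  rcases mul_eq_zero.mp this with h5 | h5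
  · exact MvPolynomial.mem_support_iff.mp hσ h5
  · exact hne h5

/-- a nonzero polynomial over `E` does not vanish at some `K`-point -/
theorem K_point [Infinite K] {N : ℕ} (P : MvPolynomial (Fin N) E) (hP : P ≠ 0) :
    ∃ a : Fin N → K, meval (fun i => algebraMap K E (a i)) P ≠ 0 := by
  by_contra hcon
  push Not at hcon
  apply hP
  refine MvPolynomial.funext_set (fun _ => Set.range (algebraMap K E)) (fun _ => ?_) (fun x hx => ?_)
  · exact Set.infinite_range_of_injective (algebraMap K E).injective
  · rw [map_zero]
    choose a ha using fun i => hx i (Set.mem_univ i)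
    rw [← hcon a]
    congr 1
    congr 1
    funext i; exact (ha i).symm

theorem F3_step [IsAlgClosed K] {N : ℕ} (u : Fin (N+1) → E) (hu : ¬ AlgebraicIndependent K u) :
    ∃ (F : MP K (N+1)) (a : Fin (N+1) → K) (e : Fin (N+1)), a e ≠ 0 ∧ maeval u F = 0 ∧
      meval a (mcomp F.totalDegree F) ≠ 0 ∧
      ∑ i, algebraMap K E (a i) * maeval u (mpderiv i F) ≠ 0 := by
  obtain ⟨F, hF0, hFu, e, he⟩ := rel_exists u hu
  have : Infinite K := IsAlgClosed.instInfinite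
  have hinj := MvPolynomial.map_injective (σ := Fin (N+1)) (algebraMap K E) (algebraMap K E).injective
  have h1 : mcomp F.totalDegree F ≠ 0 := by
    obtain ⟨s, hs, hs'⟩ : ∃ s ∈ F.support, (s.sum fun _ k => k) = F.totalDegree := by
      obtain ⟨s, hs, h⟩ := Finset.exists_mem_eq_sup F.support (MvPolynomial.support_nonempty.mpr hF0) (fun s => s.sum fun _ k => k)
      exact ⟨s, hs, h.symm⟩
    intro h
    have := congrArg (mcoeff s) h
    rw [MvPolynomial.coeff_homogeneousComponent, if_pos, MvPolynomial.coeff_zero] at this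
    · exact MvPolynomial.mem_support_iff.mp hs this
    · rw [← hs']; rfl
  have h2 : (∑ i, MvPolynomial.C (maeval u (mpderiv i F)) * mX i : MvPolynomial (Fin (N+1)) E) ≠ 0 := by
    intro h
    apply he
    have hg : ∀ c : Fin (N+1) → E, ∑ i, MvPolynomial.C (c i) * mX i = 0 → c e = 0 := by
      intro c h
      have := congrArg (meval (Pi.single e (1:E))) h
      simpa [Pi.single_apply] using this
    exact hg _ h
  obtain ⟨a, ha⟩ := K_point (K := K) (MvPolynomial.map (algebraMap K E) (mcomp F.totalDegree F) * (∑ i, MvPolynomial.C (maeval u (mpderiv i F)) * mX i : MvPolynomial (Fin (N+1)) E) * mX e)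
    (mul_ne_zero (mul_ne_zero (fun h => h1 (hinj (by rw [h, map_zero]))) h2) (MvPolynomial.X_ne_zero e))
  rw [map_mul, map_mul] at ha
  have ha1 := left_ne_zero_of_mul (left_ne_zero_of_mul ha)
  have ha2 := right_ne_zero_of_mul (left_ne_zero_of_mul ha)
  have ha3 := right_ne_zero_of_mul ha
  refine ⟨F, a, e, ?_, hFu, ?_, ?_⟩
  · intro h; apply ha3; simp [h]
  · intro h; apply ha1
    rw [MvPolynomial.eval_map]
    have := MvPolynomial.eval₂_comp_left (algebraMap K E) (RingHom.id K) a (mcomp F.totalDegree F)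
    rw [MvPolynomial.eval₂_id, h, map_zero] at this
    exact this.symm
  · intro h; apply ha2
    rw [map_sum, ← h]
    refine Finset.sum_congr rfl (fun i _ => ?_)
    rw [map_mul, MvPolynomial.eval_C, MvPolynomial.eval_X, mul_comm]

theorem aeval_line {N : ℕ} {F : Type} [Field F] [Algebra F E] [Algebra K F] [IsScalarTower K F E] (b : Fin N → F) (a : Fin N → K) (w : E)
    (G : MP K N) :
    aeval w (maeval (fun i => C (b i) + C (algebraMap K F (a i)) * X) G : F[X]) =
      maeval (fun i => algebraMap F E (b i) + algebraMap K E (a i) * w) G := by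
  induction G using minduction_on with
  | C c =>
    rw [maeval_C, maeval_C, Polynomial.algebraMap_apply, aeval_C]; exact (IsScalarTower.algebraMap_apply K F E c).symm
  | add p q hp hq => rw [map_add, map_add, hp, hq, map_add]
  | mul_X p i hp =>
    rw [map_mul, map_mul, hp, map_mul, maeval_X, maeval_X]
    simp only [map_add, map_mul, aeval_C, aeval_X]
    rw [← IsScalarTower.algebraMap_apply]

theorem F3 [IsAlgClosed K] : ∀ (N : ℕ) (u : Fin N → E), ∃ (δ : ℕ) (t : Fin δ → E),
    (∀ i, t i ∈ Submodule.span K (Set.range u)) ∧ AlgebraicIndependent K t ∧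
    (∀ j, IsSeparable (kF K t) (u j)) ∧ ∀ j, nInt K t 1 (u j) := by
  intro N
  induction N with
  | zero =>
    intro u
    refine ⟨0, u, fun i => i.elim0, ?_, fun j => j.elim0, fun j => j.elim0⟩
    exact algebraicIndependent_empty_type_iff.mpr (algebraMap K E).injective
  | succ N ih =>
    intro u
    by_cases hu : AlgebraicIndependent K u
    · refine ⟨_, u, fun i => Submodule.subset_span ⟨i, rfl⟩, hu, fun j => ?_, fun j => nInt_t j⟩
      exact isSeparable_algebraMap (F := kF K u) ⟨_, subset_adjoin _ _ ⟨j, rfl⟩⟩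
    obtain ⟨F, a, e, hae, hFu, htop, hder⟩ := F3_step u hu
    have hae' : algebraMap K E (a e) ≠ 0 := by rwa [Ne, map_eq_zero]
    obtain ⟨w, hw⟩ : ∃ w : E, w = algebraMap K E (a e)⁻¹ * u e := ⟨_, rfl⟩
    set b : Fin (N+1) → E := fun i => u i - algebraMap K E (a i) * w with hb
    have hbe : b e = 0 := by
      rw [hb, hw]; simp only [map_inv₀]; field_simp; ring
    obtain ⟨δ, t, ht1, ht2, ht3, ht4⟩ := ih (fun i => b (e.succAbove i))
    have hub : (fun i => b i + algebraMap K E (a i) * w) = u := by funext i; rw [hb]; ring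
    have hbsep : ∀ i, IsSeparable (kF K t) (b i) := by
      intro i
      rcases Fin.eq_self_or_eq_succAbove e i with rfl | ⟨j, rfl⟩
      · rw [hbe]; simpa using isSeparable_algebraMap (F := kF K t) (K := E) 0
      · exact ht3 j
    have hbint : ∀ i, nInt K t 1 (b i) := by
      intro i
      rcases Fin.eq_self_or_eq_succAbove e i with rfl | ⟨j, rfl⟩
      · rw [hbe]; unfold nInt; rw [map_zero, zero_mul]; exact isIntegral_zero
      · exact ht4 j
    have hwsep : IsSeparable (kF K t) w := by
      let Cl := separableClosure (kF K t) E
      let b' : Fin (N+1) → Cl := fun i => ⟨b i, hbsep i⟩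
      haveI : IsScalarTower K Cl E := IsScalarTower.of_algebraMap_eq (fun _ => rfl)
      have h0 : IsSeparable Cl w := by
        refine sep_of_deriv (maeval (fun i => C (b' i) + C (algebraMap K Cl (a i)) * X) F) w ?_ ?_
        · rw [aeval_line b' a w F]
          change maeval (fun i => b i + algebraMap K E (a i) * w) F = 0
          rw [hub, hFu]
        · rw [deriv_aeval, map_sum]
          intro h
          apply hder
          rw [← h]
          refine Finset.sum_congr rfl (fun i _ => ?_)
          rw [map_mul, aeval_line b' a w, aeval_C]
          change _ = _ * maeval (fun i => b i + algebraMap K E (a i) * w) _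
          rw [hub, ← IsScalarTower.algebraMap_apply]
      exact IsSeparable.of_algebra_isSeparable_of_isSeparable (kF K t) h0
    have hwint : nInt K t 1 w := by
      unfold nInt
      refine integral_of_rel F (fun i => C (b i) * X^1) X _ a F.totalDegree (fun i => hbint i) ?_ htop ?_
      · have := nInt_one (K := K) (t := t) 1
        unfold nInt at this
        simpa using this
      · have h1 : ∀ k, maeval (fun i => C (b i) * X^1 + algebraMap K E[X] (a i) * (C w * X^1)) (mcomp k F)
           = C (maeval u (mcomp k F)) * X^k := by
          intro k
          rw [← hz_hom u (mcomp_hom k F)]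
          unfold hz
          congr 1
          congr 1
          funext i
          rw [← hub, Polynomial.algebraMap_apply, C_add, C_mul]; ring
        rw [Finset.sum_congr rfl (fun k hk => by rw [h1 k])]
        have h2 : ∀ k ∈ Finset.range (F.totalDegree+1), X^(F.totalDegree-k) * (C (maeval u (mcomp k F)) * X^k) = C (maeval u (mcomp k F)) * (X:E[X])^F.totalDegree := by
          intro k hk
          have : F.totalDegree = (F.totalDegree - k) + k := by have := Finset.mem_range.mp hk; omega
          conv_rhs => rw [this, pow_add]
          ring
        rw [Finset.sum_congr rfl h2, ← Finset.sum_mul, ← map_sum, ← map_sum, msum_comp, hFu, map_zero, zero_mul]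
    refine ⟨δ, t, ?_, ht2, ?_, ?_⟩
    · intro i
      refine (Submodule.span_le.mpr ?_) (ht1 i)
      rintro _ ⟨j, rfl⟩
      have hue := Submodule.subset_span (R := K) (Set.mem_range_self (f := u) e)
      refine sub_mem (Submodule.subset_span ⟨_, rfl⟩) ?_
      rw [hw, ← Algebra.smul_def, ← Algebra.smul_def]
      exact Submodule.smul_mem _ _ (Submodule.smul_mem _ _ hue)
    · intro j
      rw [← hub]
      refine Field.isSeparable_add (hbsep j) (Field.isSeparable_mul ?_ hwsep)
      rw [IsScalarTower.algebraMap_apply K (kF K t) E]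
      exact isSeparable_algebraMap _
    · intro j
      rw [← hub]
      exact nInt_add (hbint j) (nInt_smul _ hwint)

end

section
open Filter Topology
theorem lim_choose (a k : ℕ) : Tendsto (fun n : ℕ => (((n + a).choose k : ℕ) : ℝ) / (n:ℝ)^k) atTop (𝓝 (1 / (k.factorial : ℝ))) := by
  have h1 := (isEquivalent_choose k)
  have h2 : Tendsto (fun n : ℕ => ((n.choose k : ℕ) : ℝ) / ((n:ℝ)^k / k.factorial)) atTop (𝓝 1) := by
    refine (Asymptotics.isEquivalent_iff_tendsto_one ?_).mp h1
    filter_upwards [eventually_gt_atTop 0] with n hn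
    have : (n:ℝ) ≠ 0 := by positivity
    positivity
  have h3 := h2.comp (tendsto_add_atTop_nat a)
  have h4 : Tendsto (fun n : ℕ => (((n + a : ℕ) : ℝ) / n)^k) atTop (𝓝 1) := by
    have : Tendsto (fun n : ℕ => ((n + a : ℕ) : ℝ) / n) atTop (𝓝 1) := by
      have h5 : Tendsto (fun n : ℕ => 1 + (a:ℝ) / n) atTop (𝓝 (1 + 0)) :=
        tendsto_const_nhds.add (tendsto_const_div_atTop_nhds_zero_nat _)
      rw [add_zero] at h5
      refine h5.congr' ?_
      filter_upwards [eventually_gt_atTop 0] with n hn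
      have : (n:ℝ) ≠ 0 := by positivity
      push_cast; field_simp
    simpa using this.pow k
  have h5 := (h3.mul h4).mul_const (1 / (k.factorial : ℝ))
  rw [one_mul, one_mul] at h5
  refine h5.congr' ?_
  filter_upwards [eventually_gt_atTop 0] with n hn
  have h6 : (n:ℝ) ≠ 0 := by positivity
  have h7 : ((n+a : ℕ):ℝ) ≠ 0 := by positivity
  simp only [Function.comp]
  rw [div_pow]
  field_simp

theorem lim_choose0 (a k e : ℕ) (he : k < e) : Tendsto (fun n : ℕ => (((n + a).choose k : ℕ) : ℝ) / (n:ℝ)^e) atTop (𝓝 0) := by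
  have h1 := lim_choose a k
  have h2 : Tendsto (fun n : ℕ => (1:ℝ) / (n:ℝ)^(e-k)) atTop (𝓝 0) := by
    have := tendsto_one_div_atTop_nhds_zero_nat (𝕜 := ℝ)
    have := this.pow (e-k)
    rw [zero_pow (by omega)] at this
    simpa using this
  have h3 := h1.mul h2
  rw [mul_zero] at h3
  refine h3.congr (fun n => ?_)
  rw [div_mul_div_comm, mul_one, ← pow_add]
  congr 2; omega

theorem hilb_formula (H : ℕ → ℕ) (h : Polynomial ℤ) (d : ℕ)
    (hH : PowerSeries.mk (fun n => (H n : ℤ)) * (1 - PowerSeries.X)^(d+1) = PowerSeries.mk (fun n => h.coeff n))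
    (n : ℕ) : (H (n + h.natDegree) : ℤ) = ∑ i ∈ Finset.range (h.natDegree + 1), h.coeff i * ((n + (h.natDegree - i + d)).choose d : ℤ) := by
  have h1 : PowerSeries.mk (fun n => (H n : ℤ)) = PowerSeries.mk (fun n => h.coeff n) * (PowerSeries.invOneSubPow ℤ (d+1)).val := by
    rw [← hH, mul_assoc, ← PowerSeries.invOneSubPow_inv_eq_one_sub_pow]
    have : (PowerSeries.invOneSubPow ℤ (d+1)).inv * (PowerSeries.invOneSubPow ℤ (d+1)).val = 1 := (PowerSeries.invOneSubPow ℤ (d+1)).inv_val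
    rw [this, mul_one]
  have h2 := congrArg (PowerSeries.coeff (n + h.natDegree)) h1
  rw [PowerSeries.coeff_mk, PowerSeries.coeff_mul, PowerSeries.invOneSubPow_val_succ_eq_mk_add_choose] at h2
  rw [h2, Finset.Nat.sum_antidiagonal_eq_sum_range_succ_mk]
  symm
  refine Finset.sum_subset_zero_on_sdiff ?_ ?_ ?_
  · intro i; simp only [Finset.mem_range]; omega
  · intro i hi
    simp only [Finset.mem_sdiff, Finset.mem_range] at hi
    simp only [PowerSeries.coeff_mk]
    rw [Polynomial.coeff_eq_zero_of_natDegree_lt (by omega), zero_mul]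
  · intro i hi
    simp only [PowerSeries.coeff_mk]
    have := Finset.mem_range.mp hi
    congr 3
    omega

theorem growth (H : ℕ → ℕ) (h : Polynomial ℤ) (d : ℕ)
    (hH : PowerSeries.mk (fun n => (H n : ℤ)) * (1 - PowerSeries.X)^(d+1) = PowerSeries.mk (fun n => h.coeff n))
    (h1 : h.eval 1 = 4) (ρ δ m c : ℕ) (hρ : 0 < ρ)
    (lower : ∀ n, ρ * (n + δ).choose δ ≤ H (n + m)) (upper : ∀ n, H n ≤ ρ * (n + c + δ).choose δ) :
    δ = d ∧ ρ = 4 := by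
  set D := h.natDegree
  have hf := hilb_formula H h d hH
  -- limit of H(n + D + m)/n^e
  have hlim : ∀ e l, (∀ a, Tendsto (fun n : ℕ => (((n + a).choose d : ℕ) : ℝ) / (n:ℝ)^e) atTop (𝓝 l)) →
      Tendsto (fun n : ℕ => (H (n + m + D) : ℝ) / (n:ℝ)^e) atTop (𝓝 (4 * l)) := by
    intro e l hl
    have e1 : ∀ n : ℕ, (H (n + m + D) : ℝ) / (n:ℝ)^e = ∑ i ∈ Finset.range (D + 1), (h.coeff i : ℝ) * ((((n + (m + (D - i + d))).choose d : ℕ) : ℝ) / (n:ℝ)^e) := by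
      intro n
      have := hf (n + m)
      have h3 : (H (n + m + D) : ℝ) = ∑ i ∈ Finset.range (D + 1), (h.coeff i : ℝ) * (((n + m + (D - i + d)).choose d : ℕ) : ℝ) := by
        exact_mod_cast this
      rw [h3, Finset.sum_div]
      refine Finset.sum_congr rfl (fun i _ => ?_)
      rw [mul_div_assoc, ← add_assoc n m]
    simp_rw [e1]
    have e2 : (4:ℝ) * l = ∑ i ∈ Finset.range (D + 1), (h.coeff i : ℝ) * l := by
      rw [← Finset.sum_mul]
      congr 1
      rw [Polynomial.eval_eq_sum_range] at h1
      simp only [one_pow, mul_one] at h1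
      exact_mod_cast h1.symm
    rw [e2]
    exact tendsto_finsetSum _ (fun i _ => (hl _).const_mul _)
  have lo : ∀ n : ℕ, (ρ:ℝ) * (((n + (D + δ)).choose δ : ℕ):ℝ) ≤ H (n + m + D) := by
    intro n
    have := lower (n + D)
    rw [show n + D + δ = n + (D + δ) by ring, show n + D + m = n + m + D by ring] at this
    exact_mod_cast this
  have up : ∀ n : ℕ, (H (n + m + D) : ℝ) ≤ (ρ:ℝ) * (((n + (m + D + c + δ)).choose δ : ℕ):ℝ) := by
    intro n
    have := upper (n + m + D)
    rw [show n + m + D + c + δ = n + (m + D + c + δ) by ring] at this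
    exact_mod_cast this
  have lo' : ∀ e (n : ℕ), (ρ:ℝ) * ((((n + (D + δ)).choose δ : ℕ):ℝ) / (n:ℝ)^e) ≤ H (n + m + D) / (n:ℝ)^e := by
    intro e n
    rw [← mul_div_assoc]
    exact div_le_div_of_nonneg_right (lo n) (by positivity)
  have up' : ∀ e (n : ℕ), (H (n + m + D) : ℝ) / (n:ℝ)^e ≤ (ρ:ℝ) * ((((n + (m + D + c + δ)).choose δ : ℕ):ℝ) / (n:ℝ)^e) := by
    intro e n
    rw [← mul_div_assoc]
    exact div_le_div_of_nonneg_right (up n) (by positivity)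
  have hρ' : (0:ℝ) < ρ := by exact_mod_cast hρ
  have hδd : δ = d := by
    rcases lt_trichotomy δ d with hlt | heq | hgt
    · exfalso
      have a1 := hlim d _ (fun a => lim_choose a d)
      have a2 := (lim_choose0 (m + D + c + δ) δ d hlt).const_mul (ρ:ℝ)
      have := le_of_tendsto_of_tendsto' a1 a2 (up' d)
      rw [mul_zero] at this
      have h5 : (0:ℝ) < 4 * (1 / (d.factorial:ℝ)) := by positivity
      linarith
    · exact heq
    · exfalso
      have a1 := hlim δ 0 (fun a => lim_choose0 a d δ hgt)
      have a2 := (lim_choose (D + δ) δ).const_mul (ρ:ℝ)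
      have := le_of_tendsto_of_tendsto' a2 a1 (lo' δ)
      rw [mul_zero] at this
      have h5 : (0:ℝ) < ρ * (1 / (δ.factorial:ℝ)) := by positivity
      linarith
  refine ⟨hδd, ?_⟩
  subst hδd
  have a1 := hlim δ _ (fun a => lim_choose a δ)
  have b1 := le_of_tendsto_of_tendsto' a1 ((lim_choose (m + D + c + δ) δ).const_mul (ρ:ℝ)) (up' δ)
  have b2 := le_of_tendsto_of_tendsto' ((lim_choose (D + δ) δ).const_mul (ρ:ℝ)) a1 (lo' δ)
  have h5 : (0:ℝ) < (1 / (δ.factorial:ℝ)) := by positivity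
  have h6 := le_of_mul_le_mul_right b1 h5
  have h7 := le_of_mul_le_mul_right b2 h5
  have : (ρ:ℝ) = 4 := le_antisymm h7 h6
  exact_mod_cast this

end

section
open MvPolynomial
variable {K E : Type} [Field K] [Field E] [Algebra K E]

theorem finrank_hom (δ n : ℕ) : Module.finrank K (homogeneousSubmodule (Fin (δ+1)) K n) = (n + δ).choose δ := by
  rw [homogeneousSubmodule_eq_finsupp_supported]
  have b := basisRestrictSupport (σ := Fin (δ+1)) K {d : Fin (δ+1) →₀ ℕ | d.degree = n}
  have h1 := Module.finrank_eq_nat_card_basis b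
  refine h1.trans ?_
  have h2 : {d : Fin (δ+1) →₀ ℕ | d.degree = n} = ((Finset.univ : Finset (Fin (δ+1))).finsuppAntidiag n : Set _) := by
    ext d
    simp only [Set.mem_ofPred_eq, Finset.mem_coe, Finset.mem_finsuppAntidiag, Finset.subset_univ, and_true]
    rw [Finsupp.degree_eq_sum]
  rw [h2, Nat.card_coe_set_eq, Set.ncard_coe_finset, Finset.card_finsuppAntidiag_nat_eq_choose]
  simp only [Finset.card_univ, Fintype.card_fin]
  rw [show δ + 1 + n - 1 = n + δ by omega]
  rw [← Nat.choose_symm (by omega : n ≤ n + δ)]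
  congr 1
  omega

instance fd_hom (N n : ℕ) : Module.Finite K (homogeneousSubmodule (Fin N) K n) :=
  Module.Finite.iff_fg.mpr (homogeneousSubmodule_fg (Fin N) K n)

/-- dehomogenisation is injective on forms -/
theorem hom_inj {δ n : ℕ} {t : Fin δ → E} (ht : AlgebraicIndependent K t) {F : MP K (δ+1)}
    (hF : F.IsHomogeneous n) (h : aeval (Fin.cons 1 t : Fin (δ+1) → E) F = 0) : F = 0 := by
  have h1 : aeval (Fin.cons 1 t : Fin (δ+1) → E) F = aeval t (aeval (Fin.cons 1 X : Fin (δ+1) → MP K δ) F) := by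
    rw [← AlgHom.comp_apply, comp_aeval]
    congr 2
    funext i
    refine Fin.cases ?_ (fun i => ?_) i <;> simp
  rw [h1] at h
  have h2 : aeval (Fin.cons 1 X : Fin (δ+1) → MP K δ) F = 0 := ht (by rw [h, map_zero])
  have h3 : ∀ (s : Fin (δ+1) →₀ ℕ) (c : K), aeval (Fin.cons 1 X : Fin (δ+1) → MP K δ) (monomial s c) = monomial s.tail c := by
    intro s c
    rw [aeval_monomial, monomial_eq, Finsupp.prod_fintype _ _ (by simp), Finsupp.prod_fintype _ _ (by simp), Fin.prod_univ_succ]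
    simp [Finsupp.tail_apply]
  ext s
  rw [coeff_zero]
  by_contra hs
  have hsd : s.degree = n := by
    have := hF hs
    rw [Finsupp.degree_eq_weight_one]; exact this
  have h4 := congrArg (coeff s.tail) h2
  rw [F.as_sum, map_sum, coeff_sum, coeff_zero] at h4
  rw [Finset.sum_eq_single s] at h4
  · rw [h3, coeff_monomial, if_pos rfl] at h4
    exact hs h4
  · intro s' hs' hne
    rw [h3, coeff_monomial, if_neg]
    intro heq
    apply hne
    have hsd' : s'.degree = n := by
      have := hF (mem_support_iff.mp hs')
      rw [Finsupp.degree_eq_weight_one]; exact this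
    rw [Finsupp.degree_eq_sum, Fin.sum_univ_succ] at hsd hsd'
    have htl : ∀ i : Fin δ, s' i.succ = s i.succ := fun i => by
      have := DFunLike.congr_fun heq i
      simpa [Finsupp.tail_apply] using this
    rw [Finset.sum_congr rfl (fun i _ => htl i)] at hsd'
    ext i
    refine Fin.cases ?_ htl i
    omega
  · intro hs'
    rw [notMem_support_iff.mp hs']
    simp

/-- the space of values of forms of degree `n` -/
def Wn (K : Type) {E : Type} [Field K] [Field E] [Algebra K E] {N : ℕ} (v : Fin N → E) (n : ℕ) : Submodule K E :=
  (homogeneousSubmodule (Fin N) K n).map (aeval v).toLinearMap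

theorem mem_Wn {N : ℕ} {v : Fin N → E} {n : ℕ} {w : E} : w ∈ Wn K v n ↔ ∃ F : MP K N, F.IsHomogeneous n ∧ aeval v F = w := by
  unfold Wn
  rw [Submodule.mem_map]
  rfl

instance fd_Wn {N : ℕ} (v : Fin N → E) (n : ℕ) : Module.Finite K (Wn K v n) := by
  unfold Wn; infer_instance

theorem Wn_mul {N : ℕ} {v : Fin N → E} {n k : ℕ} {a b : E} (ha : a ∈ Wn K v n) (hb : b ∈ Wn K v k) : a * b ∈ Wn K v (n + k) := by
  rw [mem_Wn] at *
  obtain ⟨F, hF, rfl⟩ := ha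
  obtain ⟨G, hG, rfl⟩ := hb
  exact ⟨F * G, hF.mul hG, by rw [map_mul]⟩

theorem Wn_gen {N : ℕ} {v : Fin N → E} (i : Fin N) : v i ∈ Wn K v 1 := mem_Wn.mpr ⟨X i, isHomogeneous_X _ _, by simp⟩

theorem Wn_one {N : ℕ} {v : Fin (N+1) → E} (hv : v 0 = 1) (n : ℕ) : 1 ∈ Wn K v n :=
  mem_Wn.mpr ⟨X 0 ^ n, isHomogeneous_X_pow _ _, by simp [hv]⟩

theorem Wn_mono {N : ℕ} {v : Fin (N+1) → E} (hv : v 0 = 1) {n k : ℕ} (h : n ≤ k) {a : E} (ha : a ∈ Wn K v n) : a ∈ Wn K v k := by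
  have := Wn_mul ha (Wn_one hv (k - n))
  rwa [mul_one, Nat.add_sub_cancel' h] at this

theorem Wn_le {N N' : ℕ} {v : Fin N → E} {u : Fin N' → E} (h : ∀ i, u i ∈ Wn K v 1) {n : ℕ} {a : E} (ha : a ∈ Wn K u n) : a ∈ Wn K v n := by
  rw [mem_Wn] at ha
  obtain ⟨F, hF, rfl⟩ := ha
  choose L hL using fun i => mem_Wn.mp (h i)
  refine mem_Wn.mpr ⟨aeval L F, ?_, ?_⟩
  · have := hF.aeval L (fun i => (hL i).1)
    rwa [one_mul] at this
  · rw [← AlgHom.comp_apply, comp_aeval]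
    congr 2
    funext i; exact (hL i).2

theorem Wn_all {N : ℕ} {v : Fin (N+1) → E} (hv : v 0 = 1) (F : MP K (N+1)) : aeval v F ∈ Wn K v F.totalDegree := by
  obtain ⟨A, hA, hA'⟩ := homogenize hv F _ le_rfl
  exact mem_Wn.mpr ⟨A, hA, hA'⟩

theorem finrank_Pn {δ : ℕ} {t : Fin δ → E} (ht : AlgebraicIndependent K t) (n : ℕ) :
    Module.finrank K (Wn K (Fin.cons 1 t : Fin (δ+1) → E) n) = (n + δ).choose δ := by
  rw [← finrank_hom (K := K)]
  unfold Wn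
  have := LinearEquiv.ofInjective ((aeval (Fin.cons 1 t : Fin (δ+1) → E)).toLinearMap.domRestrict (homogeneousSubmodule (Fin (δ+1)) K n)) (by
    rw [← LinearMap.ker_eq_bot, LinearMap.ker_eq_bot']
    intro F hF
    exact Subtype.ext (hom_inj ht F.2 hF))
  rw [LinearMap.range_domRestrict] at this
  exact this.finrank_eq.symm

end

section
open Polynomial IntermediateField IntermediateField.algebraAdjoinAdjoin
variable {K E : Type} [Field K] [Field E] [Algebra K E]

theorem P_sub_k0 {δ : ℕ} {t : Fin δ → E} {n : ℕ} {w : E} (hw : w ∈ Wn K (Fin.cons 1 t : Fin (δ+1) → E) n) :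
    w ∈ kF K t := by
  obtain ⟨F, -, rfl⟩ := mem_Wn.mp hw
  clear hw
  induction F using minduction_on with
  | C c => rw [maeval_C]; exact IntermediateField.algebraMap_mem _ _
  | add p q hp hq => rw [map_add]; exact add_mem hp hq
  | mul_X p i hp =>
    rw [map_mul, maeval_X]
    refine mul_mem hp ?_
    refine Fin.cases ?_ (fun j => ?_) i
    · simp only [Fin.cons_zero]; exact one_mem _
    · simp only [Fin.cons_succ]; exact subset_adjoin _ _ ⟨j, rfl⟩

theorem span_W {N δ : ℕ} {v : Fin (N+1) → E} (hv : v 0 = 1) (hgen : kF K v = ⊤)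
    {t : Fin δ → E} [FiniteDimensional (kF K t) E] :
    ⊤ ≤ Submodule.span (kF K t) {w : E | ∃ n, w ∈ Wn K v n} := by
  set k0 := kF K t
  have h1 : adjoin k0 (Set.range v) = ⊤ := by
    rw [eq_top_iff]
    intro z _
    have hz : z ∈ kF K v := by rw [hgen]; trivial
    have : kF K v ≤ restrictScalars K (adjoin k0 (Set.range v)) := by
      rw [adjoin_le_iff]
      exact subset_adjoin _ _
    exact this hz
  have h2 : Algebra.adjoin k0 (Set.range v) = ⊤ := by
    rw [← adjoin_toSubalgebra_of_isAlgebraic (fun x _ => Algebra.IsAlgebraic.isAlgebraic x), h1]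
    rfl
  have h3 := Algebra.adjoin_eq_span k0 (Set.range v)
  rw [h2, Algebra.top_toSubmodule] at h3
  rw [h3]
  refine Submodule.span_mono ?_
  intro w hw
  refine Submonoid.closure_induction (motive := fun w _ => ∃ n, w ∈ Wn K v n) ?_ ?_ ?_ hw
  · rintro _ ⟨i, rfl⟩; exact ⟨1, Wn_gen i⟩
  · exact ⟨0, Wn_one hv 0⟩
  · rintro a b _ _ ⟨n, hn⟩ ⟨k, hk⟩; exact ⟨n + k, Wn_mul hn hk⟩

/-- `K`-linear combination map -/
def combMap {ρ : ℕ} (b : Fin ρ → E) (P : Submodule K E) : (Fin ρ → P) →ₗ[K] E where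
  toFun f := ∑ i, (f i : E) * b i
  map_add' f g := by simp [add_mul, Finset.sum_add_distrib]
  map_smul' c f := by simp [Finset.smul_sum]

theorem lower_bound {N δ : ℕ} {v : Fin (N+1) → E} (hv : v 0 = 1) (hgen : kF K v = ⊤)
    {t : Fin δ → E} (ht : AlgebraicIndependent K t) (htv : ∀ i, t i ∈ Wn K v 1) [FiniteDimensional (kF K t) E] :
    ∃ m, ∀ n, Module.finrank (kF K t) E * (n + δ).choose δ ≤ Module.finrank K (Wn K v (n + m)) := by
  set k0 := kF K t with hk0
  set ρ := Module.finrank k0 E with hρ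
  let b0 := Module.Basis.ofSpan (span_W (t := t) hv hgen)
  have hfin := Module.Finite.finite_basis b0
  have := Fintype.ofFinite ((linearIndepOn_empty k0 id).extend (Set.empty_subset {w : E | ∃ n, w ∈ Wn K v n}))
  let e := Fintype.equivFinOfCardEq (Module.finrank_eq_card_basis b0).symm
  let b := b0.reindex e
  have hb : ∀ i, ∃ n, b i ∈ Wn K v n := by
    intro i
    have : b0 (e.symm i) ∈ {w : E | ∃ n, w ∈ Wn K v n} := Module.Basis.ofSpan_subset _ ⟨_, rfl⟩
    simpa [b] using this
  choose mi hmi using hb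
  refine ⟨Finset.univ.sup mi, fun n => ?_⟩
  have hbm : ∀ i, b i ∈ Wn K v (Finset.univ.sup mi) := fun i => Wn_mono hv (Finset.le_sup (Finset.mem_univ i)) (hmi i)
  set P := Wn K (Fin.cons 1 t : Fin (δ+1) → E) n with hP
  have hPv : ∀ w ∈ P, w ∈ Wn K v n := fun w hw => Wn_le (fun i => by
    refine Fin.cases ?_ (fun j => ?_) i
    · simpa using Wn_one hv 1
    · simpa using htv j) hw
  have hrange : ∀ f, combMap (fun i => b i) P f ∈ Wn K v (n + Finset.univ.sup mi) := by
    intro f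
    change ∑ i, (f i : E) * b i ∈ _
    exact Submodule.sum_mem _ (fun i _ => Wn_mul (hPv _ (f i).2) (hbm i))
  have hinj : Function.Injective ((combMap (fun i => b i) P).codRestrict _ hrange) := by
    rw [← LinearMap.ker_eq_bot, LinearMap.ker_eq_bot']
    intro f hf
    have hf' : ∑ i, (f i : E) * b i = 0 := congrArg Subtype.val hf
    have := Fintype.linearIndependent_iff.mp b.linearIndependent (fun i => (⟨f i, P_sub_k0 (f i).2⟩ : k0)) hf'
    funext i
    have h2 : (f i : E) = 0 := congrArg (Subtype.val : k0 → E) (this i)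
    exact Subtype.ext h2
  have := LinearMap.finrank_le_finrank_of_injective hinj
  rw [Module.finrank_pi_fintype, hP, Finset.sum_const, finrank_Pn ht] at this
  simpa using this

theorem rees_coeff {δ : ℕ} {t : Fin δ → E} {f : E[X]}
    (hf : f ∈ (Algebra.adjoin K (insert X (Set.range fun i => C (t i) * X)) : Subalgebra K E[X])) :
    ∀ n, f.coeff n ∈ Wn K (Fin.cons 1 t : Fin (δ+1) → E) n := by
  induction hf using Algebra.adjoin_induction with
  | mem x hx =>
    have key : ∀ a, a ∈ Wn K (Fin.cons 1 t : Fin (δ+1) → E) 1 → ∀ n, (C a * X).coeff n ∈ Wn K (Fin.cons 1 t : Fin (δ+1) → E) n := by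
      intro a ha n
      rw [coeff_C_mul, coeff_X]
      split_ifs with h
      · rw [mul_one, ← h]; exact ha
      · rw [mul_zero]; exact zero_mem _
    rcases hx with rfl | ⟨i, rfl⟩
    · have := key 1 (Wn_one (by simp) 1)
      simpa using this
    · refine key _ ?_
      have := Wn_gen (K := K) (v := (Fin.cons 1 t : Fin (δ+1) → E)) i.succ
      simpa using this
  | algebraMap c =>
    intro n
    rw [Polynomial.algebraMap_apply, coeff_C]
    split_ifs with h
    · rw [Algebra.algebraMap_eq_smul_one]; exact Submodule.smul_mem _ _ (Wn_one (by simp) n)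
    · exact zero_mem _
  | add x y _ _ hx hy => intro n; rw [coeff_add]; exact add_mem (hx n) (hy n)
  | mul x y _ _ hx hy =>
    intro n
    rw [coeff_mul]
    refine Submodule.sum_mem _ (fun p hp => ?_)
    rw [← Finset.HasAntidiagonal.mem_antidiagonal.mp hp]
    exact Wn_mul (hx _) (hy _)

theorem upper_bound {N δ : ℕ} {v : Fin (N+1) → E}
    {t : Fin δ → E} (ht : AlgebraicIndependent K t) (hitg : ∀ i, nInt K t 1 (v i)) [FiniteDimensional (kF K t) E] :
    ∃ c, ∀ n, Module.finrank K (Wn K v n) ≤ Module.finrank (kF K t) E * (n + c + δ).choose δ := by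
  classical
  set k0 := kF K t with hk0
  set ρ := Module.finrank k0 E with hρ
  set R := (Algebra.adjoin K (insert X (Set.range fun i => C (t i) * X)) : Subalgebra K E[X]) with hR
  let b := Module.finBasis k0 E
  obtain ⟨G, hG⟩ := _root_.fg_adjoin_of_finite (R := R) (s := Set.range fun i => C (v i) * X) (Set.finite_range _) (by
    rintro _ ⟨i, rfl⟩
    have := hitg i
    unfold nInt at this
    rwa [pow_one] at this)
  -- the finite set of coefficients
  let ι := (g : G) × Fin (g.1.natDegree + 1) × Fin ρ
  let cf : ι → k0 := fun z => b.repr (z.1.1.coeff z.2.1) z.2.2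
  obtain ⟨D, hD⟩ := IsLocalization.exist_integer_multiples_of_finite (R := Algebra.adjoin K (Set.range t)) (nonZeroDivisors (Algebra.adjoin K (Set.range t))) (S := k0) cf
  choose A hA using hD
  have hAP : ∀ z, ∃ n, (A z : E) ∈ Wn K (Fin.cons 1 t : Fin (δ+1) → E) n := by
    intro z
    have h1 := (A z).2
    have h2 : Algebra.adjoin K (Set.range t) = (maeval t).range := Algebra.adjoin_range_eq_range_aeval ..
    obtain ⟨F, hF⟩ : ∃ F, maeval t F = (A z : E) := (SetLike.ext_iff.mp h2 _).mp h1
    have : (A z : E) = maeval (Fin.cons 1 t : Fin (δ+1) → E) (mrename Fin.succ F) := by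
      rw [maeval_rename, ← hF]
      rfl
    rw [this]
    exact ⟨_, Wn_all (by simp) _⟩
  choose mi hmi using hAP
  set c := Finset.univ.sup mi with hc
  have hAc : ∀ z, (A z : E) ∈ Wn K (Fin.cons 1 t : Fin (δ+1) → E) c := fun z => Wn_mono (by simp) (Finset.le_sup (Finset.mem_univ z)) (hmi z)
  have hD0 : ((D : Algebra.adjoin K (Set.range t)) : E) ≠ 0 := by
    intro h
    exact nonZeroDivisors.ne_zero D.2 (Subtype.ext h)
  have hAE : ∀ z, (A z : E) = (D.1 : E) * (cf z : E) := by
    intro z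
    have := congrArg Subtype.val (hA z)
    rw [Algebra.smul_def] at this
    exact this
  refine ⟨c, fun n => ?_⟩
  set P := Wn K (Fin.cons 1 t : Fin (δ+1) → E) (n + c) with hP
  -- multiples lie in the range
  have hDg : ∀ g ∈ G, ∀ j, ∀ a ∈ Wn K (Fin.cons 1 t : Fin (δ+1) → E) n, (D.1 : E) * (a * g.coeff j) ∈ LinearMap.range (combMap (fun i => b i) P) := by
    intro g hg j a ha
    by_cases hj : j < g.natDegree + 1
    · let z : Fin ρ → ι := fun i => ⟨⟨g, hg⟩, ⟨j, hj⟩, i⟩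
      have h1 := b.sum_repr (g.coeff j)
      refine ⟨fun i => ⟨a * A (z i), Wn_mul ha (hAc _)⟩, ?_⟩
      conv_rhs => rw [← h1]
      rw [Finset.mul_sum, Finset.mul_sum]
      change ∑ i, (a * A (z i)) * b i = _
      refine Finset.sum_congr rfl (fun i _ => ?_)
      rw [hAE, Algebra.smul_def]
      change a * (D.1 * ((b.repr (g.coeff j) i : k0) : E)) * b i = D.1 * (a * (((b.repr (g.coeff j) i : k0) : E) * b i))
      ring
    · rw [coeff_eq_zero_of_natDegree_lt (by omega), mul_zero, mul_zero]
      exact zero_mem _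
  have hW : ∀ w ∈ Wn K v n, (D.1 : E) * w ∈ LinearMap.range (combMap (fun i => b i) P) := by
    intro w hw
    obtain ⟨F, hF, rfl⟩ := mem_Wn.mp hw
    have h1 : hz v F ∈ Algebra.adjoin R (Set.range fun i => C (v i) * X) := by
      unfold hz
      have : ∀ F : MP K (N+1), maeval (fun i => C (v i) * X) F ∈ Algebra.adjoin R (Set.range fun i => C (v i) * X) := by
        intro F
        induction F using minduction_on with
        | C c =>
          rw [maeval_C, IsScalarTower.algebraMap_apply K R E[X]]
          exact Subalgebra.algebraMap_mem _ _
        | add p q hp hq => rw [map_add]; exact add_mem hp hq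
        | mul_X p i hp => rw [map_mul, maeval_X]; exact mul_mem hp (Algebra.subset_adjoin ⟨i, rfl⟩)
      exact this F
    rw [hz_hom v hF] at h1
    have h2 : C (maeval v F) * X^n ∈ Submodule.span R (G : Set E[X]) := by rw [hG]; exact h1
    obtain ⟨f, -, hf⟩ := Submodule.mem_span_finset.mp h2
    have h3 : maeval v F = ∑ g ∈ G, ((f g : E[X]) * g).coeff n := by
      have := congrArg (fun p => coeff p n) hf
      simp only [finsetSum_coeff, coeff_C_mul, coeff_X_pow, if_true, mul_one] at this
      rw [← this]
      rfl
    rw [h3, Finset.mul_sum]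
    refine Submodule.sum_mem _ (fun g hg => ?_)
    rw [coeff_mul, Finset.mul_sum]
    refine Submodule.sum_mem _ (fun p hp => ?_)
    refine hDg g hg p.2 _ (Wn_mono (by simp) ?_ (rees_coeff (f g).2 p.1))
    have := Finset.HasAntidiagonal.mem_antidiagonal.mp hp
    omega
  have hinj : Function.Injective (((LinearMap.mulLeft K (D.1 : E)).domRestrict (Wn K v n)).codRestrict (LinearMap.range (combMap (fun i => b i) P)) (fun w => hW w w.2)) := by
    intro w w' h
    have h' : (D.1 : E) * w = (D.1 : E) * w' := congrArg Subtype.val h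
    exact Subtype.ext (mul_left_cancel₀ hD0 h')
  refine (LinearMap.finrank_le_finrank_of_injective hinj).trans ?_
  refine (LinearMap.finrank_range_le _).trans ?_
  rw [Module.finrank_pi_fintype, hP, Finset.sum_const, finrank_Pn ht]
  simp [hρ]

end

section
open Polynomial IntermediateField
variable {K : Type} [Field K]

theorem hz_eq_zero {E : Type} [Field E] [Algebra K E] {σ : Type} (a : σ → E) (F : MvPolynomial σ K) :
    hz a F = 0 ↔ ∀ n, maeval a (mcomp n F) = 0 := by
  rw [Polynomial.ext_iff]
  simp only [hz_coeff, coeff_zero]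

theorem E_lemma {r : ℕ} (I : Ideal (PS K r)) (hprime : I.IsPrime)
    (hhom : AMD.IsHomIdeal K r I) (hnd : AMD.Nondeg K r I) :
    ∃ (E : Type) (_ : Field E) (_ : Algebra K E) (v : Fin (r+1) → E), v 0 = 1 ∧
      (∀ F, F ∈ I ↔ hz v F = 0) ∧ kF K v = ⊤ := by
  let Fr := FractionRing (PS K r ⧸ I)
  let ξ : Fin (r+1) → Fr := fun i => algebraMap (PS K r ⧸ I) Fr (Ideal.Quotient.mk I (mX i))
  have hξ : ∀ F : PS K r, maeval ξ F = algebraMap (PS K r ⧸ I) Fr (Ideal.Quotient.mk I F) := by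
    intro F
    have : maeval ξ = ((IsScalarTower.toAlgHom K (PS K r ⧸ I) Fr).comp (Ideal.Quotient.mkₐ K I)) := by
      apply malgHom_ext
      intro i
      rw [maeval_X]; rfl
    rw [this]; rfl
  have hξI : ∀ F : PS K r, maeval ξ F = 0 ↔ F ∈ I := by
    intro F
    rw [hξ, FaithfulSMul.algebraMap_eq_zero_iff, Ideal.Quotient.eq_zero_iff_mem]
  have h0 : ξ 0 ≠ 0 := by
    intro h
    have h1 := (hξI (mX 0)).mp (by rw [maeval_X]; exact h)
    exact MvPolynomial.X_ne_zero _ (hnd _ h1 (misHomogeneous_X _ _))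
  let v' : Fin (r+1) → Fr := fun i => ξ i * (ξ 0)⁻¹
  have hv' : ∀ n (F : PS K r), F.IsHomogeneous n → maeval v' F = maeval ξ F * ((ξ 0)⁻¹)^n := by
    intro n F hF
    have h1 := congrArg (Polynomial.aeval ((ξ 0)⁻¹)) (hz_hom ξ hF)
    simp only [map_mul, Polynomial.aeval_C, map_pow, Polynomial.aeval_X, Algebra.algebraMap_self, RingHom.id_apply] at h1
    rw [← h1]
    unfold hz
    have h2 : ((Polynomial.aeval ((ξ 0)⁻¹) : Fr[X] →ₐ[Fr] Fr).restrictScalars K).comp (maeval (fun i => C (ξ i) * X)) = maeval v' := by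
      apply malgHom_ext
      intro i
      simp [v']
    rw [← h2]; rfl
  let E := adjoin K (Set.range v')
  let v : Fin (r+1) → E := fun i => ⟨v' i, subset_adjoin _ _ ⟨i, rfl⟩⟩
  have hval : ∀ F : PS K r, ((maeval v F : E) : Fr) = maeval v' F := by
    intro F
    have : (E.val).comp (maeval v) = maeval v' := by
      apply malgHom_ext
      intro i
      simp [v]
    rw [← this]; rfl
  refine ⟨E, inferInstance, inferInstance, v, ?_, ?_, ?_⟩
  · apply Subtype.ext
    change ξ 0 * (ξ 0)⁻¹ = 1
    exact mul_inv_cancel₀ h0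
  · intro F
    have hc : ∀ n, maeval v (mcomp n F) = 0 ↔ mcomp n F ∈ I := by
      intro n
      rw [← hξI]
      have h1 := hval (mcomp n F)
      rw [hv' n _ (mcomp_hom n F)] at h1
      constructor
      · intro h
        rw [h] at h1
        rcases mul_eq_zero.mp h1.symm with h | h
        · exact h
        · exact absurd h (pow_ne_zero _ (inv_ne_zero h0))
      · intro h
        rw [h, zero_mul] at h1
        exact Subtype.ext h1
    rw [hz_eq_zero]
    simp only [hc]
    constructor
    · intro h n; exact hhom F h n
    · intro h
      rw [← msum_comp F]
      exact Ideal.sum_mem _ (fun n _ => h n)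
  · apply IntermediateField.map_injective E.val
    rw [adjoin_map, ← Set.range_comp]
    have : (E.val ∘ v) = v' := rfl
    change adjoin K (Set.range (E.val ∘ v)) = _
    rw [this]
    ext z
    simp only [IntermediateField.mem_map, IntermediateField.mem_top, true_and]
    constructor
    · intro h; exact ⟨⟨z, h⟩, rfl⟩
    · rintro ⟨w, rfl⟩; exact w.2

end

section
open Polynomial IntermediateField
variable {K : Type} [Field K]

/-- linear forms -/
theorem lin_aeval {σ : Type} {S : Type} [CommRing S] [Algebra K S] (L : σ → S) {F : MvPolynomial σ K}
    (hF : F.IsHomogeneous 1) : maeval L F ∈ Submodule.span K (Set.range L) := by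
  have h1 : F ∈ mhomogeneousSubmodule σ K 1 := hF
  rw [MvPolynomial.homogeneousSubmodule_one_eq_span_X] at h1
  have h2 := Submodule.mem_map_of_mem (f := (maeval L : MvPolynomial σ K →ₐ[K] S).toLinearMap) h1
  rw [Submodule.map_span, ← Set.range_comp] at h2
  have h3 : (⇑(maeval L : MvPolynomial σ K →ₐ[K] S).toLinearMap ∘ mX) = L := by
    funext i; simp
  rw [h3] at h2
  exact h2

theorem exists_not_span {V : Type} [AddCommGroup V] [Module K V] [FiniteDimensional K V] {n : ℕ} (u : Fin n → V)
    (h : n < Module.finrank K V) : ∃ x, x ∉ Submodule.span K (Set.range u) := by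
  by_contra hc
  push Not at hc
  have h1 : Submodule.span K (Set.range u) = ⊤ := eq_top_iff.mpr (fun x _ => hc x)
  have h2 := finrank_range_le_card (R := K) u
  unfold Set.finrank at h2
  rw [h1, finrank_top, Fintype.card_fin] at h2
  omega

theorem fin_sep {E : Type} [Field E] [Algebra K E] {k0 : IntermediateField K E} {N : ℕ} {v : Fin N → E}
    (hgen : kF K v = ⊤) (hs : ∀ j, IsSeparable k0 (v j)) :
    FiniteDimensional k0 E ∧ Algebra.IsSeparable k0 E := by
  have h1 : adjoin k0 (Set.range v) = ⊤ := by
    rw [eq_top_iff]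
    intro z _
    have hz : z ∈ kF K v := by rw [hgen]; trivial
    have : kF K v ≤ restrictScalars K (adjoin k0 (Set.range v)) := by
      rw [adjoin_le_iff]
      exact subset_adjoin _ _
    exact this hz
  have h2 : FiniteDimensional k0 (adjoin k0 (Set.range v)) := finiteDimensional_adjoin (by
    rintro _ ⟨j, rfl⟩; exact (hs j).isIntegral)
  have h3 : Algebra.IsSeparable k0 (adjoin k0 (Set.range v)) := (isSeparable_adjoin_iff_isSeparable k0 E).mpr (by
    rintro _ ⟨j, rfl⟩; exact hs j)
  rw [h1] at h2 h3
  exact ⟨LinearEquiv.finiteDimensional (topEquiv (F := k0) (E := E)).toLinearEquiv, AlgEquiv.Algebra.isSeparable (topEquiv (F := k0) (E := E))⟩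

theorem one_of_zero [IsAlgClosed K] {E : Type} [Field E] [Algebra K E] (t : Fin 0 → E)
    [FiniteDimensional (kF K t) E] : Module.finrank (kF K t) E = 1 := by
  have h1 : Algebra.IsAlgebraic K (kF K t) := isAlgebraic_adjoin (by rintro _ ⟨i, _⟩; exact i.elim0)
  have h2 : Algebra.IsAlgebraic K E := Algebra.IsAlgebraic.trans K (kF K t) E
  have h3 := IsAlgClosed.algebraMap_bijective_of_isIntegral (k := K) (K := E)
  rw [IntermediateField.finrank_eq_one_iff_eq_top, eq_top_iff]
  intro z _
  obtain ⟨a, rfl⟩ := h3.2 z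
  exact IntermediateField.algebraMap_mem _ _

theorem quot_W {r : ℕ} {I : Ideal (PS K r)} {E : Type} [Field E] [Algebra K E] {v : Fin (r+1) → E}
    (hI : ∀ F, F ∈ I ↔ hz v F = 0) (n : ℕ) : Module.finrank K (AMD.quotComponent K r I n) = Module.finrank K (Wn K v n) := by
  unfold AMD.quotComponent Wn
  have key : ∀ F : PS K r, F.IsHomogeneous n → (F ∈ I ↔ maeval v F = 0) := by
    intro F hF
    rw [hI, hz_hom v hF, mul_eq_zero, Polynomial.C_eq_zero, or_iff_left (pow_ne_zero _ Polynomial.X_ne_zero)]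
  rw [← LinearMap.range_domRestrict, ← LinearMap.range_domRestrict]
  have h3 : LinearMap.ker ((Ideal.Quotient.mkₐ K I).toLinearMap.domRestrict (mhomogeneousSubmodule (Fin (r+1)) K n))
     = LinearMap.ker ((maeval v : PS K r →ₐ[K] E).toLinearMap.domRestrict (mhomogeneousSubmodule (Fin (r+1)) K n)) := by
    ext F
    rw [LinearMap.mem_ker, LinearMap.mem_ker]
    have := key F.1 F.2
    rw [← Ideal.Quotient.eq_zero_iff_mem] at this
    exact this
  rw [← (LinearMap.quotKerEquivRange _).finrank_eq, ← (LinearMap.quotKerEquivRange _).finrank_eq]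
  exact (Submodule.quotEquivOfEq _ _ h3).finrank_eq

theorem setup_exists [IsAlgClosed K] {r : ℕ} (I : Ideal (PS K r)) (hprime : I.IsPrime)
    (hhom : AMD.IsHomIdeal K r I) (hnd : AMD.Nondeg K r I) (d : ℕ) (hd : d + 2 = r) (hdeg : AMD.DegreeEq K r I d 4) :
    ∃ (E : Type) (_ : Field E) (_ : Algebra K E) (v : Fin (r+1) → E) (m : ℕ) (t : Fin (m+1) → E)
      (L : Fin (m+2) → PS K r) (X Y : PS K r), d = m + 1 ∧ (∀ F, F ∈ I ↔ hz v F = 0) ∧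
      Setup K t (maeval v X) (maeval v Y) ∧ (∀ i, (L i).IsHomogeneous 1) ∧
      X.IsHomogeneous 1 ∧ Y.IsHomogeneous 1 ∧ (∀ i, maeval v (L i) = (Fin.cons 1 t : Fin (m+2) → E) i) ∧
      LinearIndependent K (Fin.cons X (Fin.cons Y L) : Fin (m+2+1+1) → PS K r) := by
  obtain ⟨E, _, _, v, hv, hI, hgen⟩ := E_lemma I hprime hhom hnd
  obtain ⟨δ, t, hts, hai, hsep, hitg⟩ := F3 (K := K) (r+1) v
  obtain ⟨hfd, hse⟩ := fin_sep hgen hsep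
  have htv : ∀ i, t i ∈ Wn K v 1 := by
    intro i
    refine (Submodule.span_le.mpr ?_) (hts i)
    rintro _ ⟨j, rfl⟩
    exact Wn_gen j
  obtain ⟨m, hlow⟩ := lower_bound hv hgen hai htv
  obtain ⟨c, hup⟩ := upper_bound hai hitg
  obtain ⟨h, hh, h1⟩ := hdeg
  unfold AMD.hilbSeries at hh
  simp only [quot_W hI] at hh
  obtain ⟨rfl, h4⟩ := growth _ h d hh h1 _ δ m c Module.finrank_pos hlow hup
  obtain _ | m := δ
  · rw [one_of_zero] at h4; omega
  have hW : ∀ i, ∃ F : PS K r, F.IsHomogeneous 1 ∧ maeval v F = (Fin.cons 1 t : Fin (m+2) → E) i := by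
    intro i
    refine mem_Wn.mp ?_
    refine Fin.cases ?_ (fun j => ?_) i
    · exact Wn_one hv 1
    · exact htv j
  choose L hL hLv using hW
  have hker : ∀ F : PS K r, F.IsHomogeneous 1 → maeval v F = 0 → F = 0 := by
    intro F hF h0
    refine hnd F ((hI F).mpr ?_) hF
    rw [hz_hom v hF, h0, C_0, zero_mul]
  have hLI : LinearIndependent K L := by
    rw [Fintype.linearIndependent_iff]
    intro g hg i
    have h5 : (∑ i, MvPolynomial.C (g i) * mX i : MP K (m+2)) = 0 := by
      refine hom_inj hai (n := 1) ?_ ?_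
      · refine MvPolynomial.IsHomogeneous.sum _ _ _ (fun i _ => ?_)
        have := (misHomogeneous_C (Fin (m+2)) (g i)).mul (misHomogeneous_X K i)
        rwa [zero_add] at this
      · have := congrArg (maeval v) hg
        rw [map_zero, map_sum] at this
        rw [← this, map_sum]
        refine Finset.sum_congr rfl (fun i _ => ?_)
        rw [map_mul, maeval_C, maeval_X, map_smul, hLv, Algebra.smul_def]
    have h6 := congrArg (mcoeff (Finsupp.single i 1)) h5
    rw [MvPolynomial.coeff_sum] at h6
    simpa [MvPolynomial.coeff_C_mul, MvPolynomial.coeff_X, Finsupp.single_left_inj] using h6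
  have hfr : Module.finrank K (mhomogeneousSubmodule (Fin (r+1)) K 1) = r + 1 := by
    rw [finrank_hom, Nat.choose_symm_of_eq_add (Nat.add_comm 1 r), Nat.choose_one_right, Nat.add_comm]
  have := fd_hom (K := K) r 1
  have ext1 : ∀ n (u : Fin n → PS K r), (∀ i, (u i).IsHomogeneous 1) → n < r + 1 →
      ∃ X : PS K r, X.IsHomogeneous 1 ∧ X ∉ Submodule.span K (Set.range u) := by
    intro n u hu hn
    obtain ⟨X, hX⟩ := exists_not_span (K := K) (fun i => (⟨u i, hu i⟩ : mhomogeneousSubmodule (Fin (r+1)) K 1)) (by omega)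
    refine ⟨X.1, X.2, fun hX' => hX ?_⟩
    have h7 : Submodule.map (Submodule.subtype _) (Submodule.span K (Set.range (fun i => (⟨u i, hu i⟩ : mhomogeneousSubmodule (Fin (r+1)) K 1)))) = Submodule.span K (Set.range u) := by
      rw [Submodule.map_span, ← Set.range_comp]; rfl
    rw [← h7] at hX'
    obtain ⟨X', hX1, hX2⟩ := hX'
    rwa [← Subtype.ext hX2]
  obtain ⟨Y, hY, hYs⟩ := ext1 _ L hL (by omega)
  have hLI2 : LinearIndependent K (Fin.cons Y L : Fin (m+2+1) → PS K r) := linearIndependent_finCons.mpr ⟨hLI, hYs⟩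
  obtain ⟨X, hX, hXs⟩ := ext1 _ (Fin.cons Y L : Fin (m+2+1) → PS K r) (fun i => by
    refine Fin.cases ?_ (fun j => ?_) i
    · exact hY
    · exact hL j) (by omega)
  have hLI3 : LinearIndependent K (Fin.cons X (Fin.cons Y L) : Fin (m+2+1+1) → PS K r) := linearIndependent_finCons.mpr ⟨hLI2, hXs⟩
  have hnI : ∀ F : PS K r, F.IsHomogeneous 1 → nInt K t 1 (maeval v F) := by
    intro F hF
    refine Submodule.span_induction (p := fun w _ => nInt K t 1 w) ?_ ?_ ?_ ?_ (lin_aeval v hF)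
    · rintro _ ⟨i, rfl⟩; exact hitg i
    · unfold nInt; rw [C_0, zero_mul]; exact isIntegral_zero
    · intro a b _ _ ha hb; exact nInt_add ha hb
    · intro a b _ hb; rw [Algebra.smul_def]; exact nInt_smul a hb
  refine ⟨E, _, _, v, m, t, L, X, Y, rfl, hI, ⟨hai, hfd, hse, hnI X hX, hnI Y hY, ?_, h4⟩, hL, hX, hY, hLv, hLI3⟩
  intro F a b hF h0
  obtain ⟨F', hF', hFF⟩ := homogenize (a := (Fin.cons 1 t : Fin (m+2) → E)) rfl (mrename Fin.succ F) 1 ((MvPolynomial.totalDegree_rename_le _ _).trans hF)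
  have h8 : maeval v (maeval L F') = maeval t F := by
    rw [← AlgHom.comp_apply, MvPolynomial.comp_aeval]
    have : (fun i => maeval v (L i)) = (Fin.cons 1 t : Fin (m+2) → E) := funext hLv
    rw [this, hFF, maeval_rename]
    rfl
  have h9 : maeval L F' + MvPolynomial.C a * X + MvPolynomial.C b * Y = 0 := by
    refine hker _ ?_ ?_
    · refine MvPolynomial.IsHomogeneous.add (MvPolynomial.IsHomogeneous.add ?_ ?_) ?_
      · simpa using hF'.aeval L hL
      · simpa using (misHomogeneous_C (Fin (r+1)) a).mul hX
      · simpa using (misHomogeneous_C (Fin (r+1)) b).mul hY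
    · rw [← h0, map_add, map_add, h8, map_mul, map_mul, maeval_C, maeval_C]
  have hs := lin_aeval L hF'
  have hsub : Submodule.span K (Set.range L) ≤ Submodule.span K (Set.range (Fin.cons Y L : Fin (m+2+1) → PS K r)) :=
    Submodule.span_mono (by rintro _ ⟨i, rfl⟩; exact ⟨i.succ, rfl⟩)
  have hYin : Y ∈ Submodule.span K (Set.range (Fin.cons Y L : Fin (m+2+1) → PS K r)) := Submodule.subset_span ⟨0, rfl⟩
  have ha : a = 0 := by
    by_contra ha
    apply hXs
    have : X = a⁻¹ • (-(maeval L F') - b • Y) := by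
      rw [eq_inv_smul_iff₀ ha, msmul_eq_C_mul, msmul_eq_C_mul]
      linear_combination h9
    rw [this]
    exact Submodule.smul_mem _ _ (Submodule.sub_mem _ (Submodule.neg_mem _ (hsub hs)) (Submodule.smul_mem _ _ hYin))
  refine ⟨ha, ?_⟩
  by_contra hb
  apply hYs
  have : Y = b⁻¹ • (-(maeval L F')) := by
    rw [eq_inv_smul_iff₀ hb, msmul_eq_C_mul]
    rw [ha, MvPolynomial.C_0, zero_mul] at h9
    linear_combination h9
  rw [this]
  exact Submodule.smul_mem _ _ (Submodule.neg_mem _ hs)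

end

section
open Polynomial IntermediateField
section abstract
variable {K B : Type} [Field K] [CommRing B] [Algebra K B] {n : ℕ}

/-- elements of the module spanned by `1, x, y` -/
def InV (j : MP K n →ₐ[K] B) (x y a : B) : Prop :=
  ∃ f0 f1 f2, a = j f0 + j f1 * x + j f2 * y

/-- graded version, degree `k+1` -/
def InVn (j : MP K n →ₐ[K] B) (x y : B) (k : ℕ) (a : B) : Prop :=
  ∃ f0 f1 f2, f0.IsHomogeneous (k+1) ∧ f1.IsHomogeneous k ∧ f2.IsHomogeneous k ∧ a = j f0 + j f1 * x + j f2 * y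

theorem InVn.inV {j : MP K n →ₐ[K] B} {x y a : B} {k : ℕ} (h : InVn j x y k a) : InV j x y a := by
  obtain ⟨f0, f1, f2, -, -, -, h⟩ := h
  exact ⟨f0, f1, f2, h⟩

/-- graded data -/
structure Gr (j : MP K n →ₐ[K] B) (x y : B) (G : ℕ → Submodule K B) : Prop where
  indep : ∀ f0 f1 f2, j f0 + j f1 * x + j f2 * y = 0 → f0 = 0 ∧ f1 = 0 ∧ f2 = 0
  hj : ∀ k f, f.IsHomogeneous k → j f ∈ G k
  hx : x ∈ G 1
  hy : y ∈ G 1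
  mul : ∀ k l a b, a ∈ G k → b ∈ G l → a * b ∈ G (k + l)
  sat : ∀ k a f, a ∈ G (k+1) → f ≠ 0 → InV j x y (j f * a) → InVn j x y k a
  nc : ¬ (InV j x y (x * x) ∧ InV j x y (x * y) ∧ InV j x y (y * y))

/-- the relation `χ a = F` -/
def Chi (j : MP K n →ₐ[K] B) (x y : B) (c0 c1 c2 : MP K n) (a : B)
    (F : MP K n) : Prop :=
  InV j x y (j c0 * a - j F * (x * x)) ∧ InV j x y (j c1 * a - j F * (x * y)) ∧
    InV j x y (j c2 * a - j F * (y * y))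

/-- graded data in the non-normal case -/
structure Gr1 (j : MP K n →ₐ[K] B) (x y : B) (G : ℕ → Submodule K B)
    (c0 c1 c2 : MP K n) : Prop extends Gr j x y G where
  h0 : c0.IsHomogeneous 1
  h1 : c1.IsHomogeneous 1
  h2 : c2.IsHomogeneous 1
  chi0 : Chi j x y c0 c1 c2 (x * x) c0
  chi1 : Chi j x y c0 c1 c2 (x * y) c1
  chi2 : Chi j x y c0 c1 c2 (y * y) c2
  ex : ∀ k a, a ∈ G (k+1) → ∃ F : MP K n, F.IsHomogeneous k ∧ Chi j x y c0 c1 c2 a F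
  line : ¬ ∃ (l : MP K n) (a0 a1 a2 : K), l.IsHomogeneous 1 ∧ c0 = MvPolynomial.C a0 * l ∧
    c1 = MvPolynomial.C a1 * l ∧ c2 = MvPolynomial.C a2 * l

end abstract

variable {K E : Type} [Field K] [Field E] [Algebra K E] {m : ℕ} {t : Fin (m+1) → E} {x y : E}

/-- dehomogenization -/
theorem deh (t : Fin m → E) (F : MP K (m+1)) :
    maeval (Fin.cons 1 t : Fin (m+1) → E) F = maeval t
      (maeval (Fin.cons 1 mX : Fin (m+1) → MP K m) F) := by
  rw [← AlgHom.comp_apply, MvPolynomial.comp_aeval]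
  congr 2
  funext i
  refine Fin.cases ?_ (fun j => ?_) i
  · simp
  · simp

theorem rehom (t : Fin m → E) (F : MP K m) (k : ℕ) (hF : F.totalDegree ≤ k) :
    ∃ F' : MP K (m+1), F'.IsHomogeneous k ∧
      maeval (Fin.cons 1 t : Fin (m+1) → E) F' = maeval t F ∧
      maeval (Fin.cons 1 mX : Fin (m+1) → MP K m) F' = F := by
  obtain ⟨F', h1, h2⟩ := homogenize (a := (Fin.cons 1 mX : Fin (m+1) → MP K m)) rfl
    (mrename Fin.succ F) k ((MvPolynomial.totalDegree_rename_le _ _).trans hF)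
  have h3 : maeval (Fin.cons 1 mX : Fin (m+1) → MP K m) F' = F := by
    rw [h2, maeval_rename]
    have : ((Fin.cons 1 mX : Fin (m+1) → MP K m) ∘ Fin.succ) = mX := rfl
    rw [this, MvPolynomial.aeval_X_left]; rfl
  exact ⟨F', h1, by rw [deh, h3], h3⟩

theorem inV_of [IsAlgClosed K] (h : Setup K t x y) {k : ℕ} {w : E} (hw : w ∈ h.V) (hn : nInt K t (k+1) w) :
    InVn (hz (K := K) (Fin.cons 1 t : Fin (m+2) → E)) (C x * X) (C y * X) k (C w * X^(k+1)) := by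
  obtain ⟨f, hf⟩ := (h.mem_V w).mp hw
  obtain ⟨N0, D0, hD0, h0⟩ := k0_frac (f 0).2
  obtain ⟨N1, D1, hD1, h1⟩ := k0_frac (f 1).2
  obtain ⟨N2, D2, hD2, h2⟩ := k0_frac (f 2).2
  obtain ⟨F0, F1, F2, d0, -, d1, -, d2, hF⟩ := h.G2 hn (D := D0 * D1 * D2)
    (mul_ne_zero (mul_ne_zero (ne_of_aeval hD0) (ne_of_aeval hD1)) (ne_of_aeval hD2))
    ![N0 * D1 * D2, N1 * D0 * D2, N2 * D0 * D1] (by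
    simp only [Matrix.cons_val_zero, Matrix.cons_val_one, Matrix.cons_val, map_mul, ← h0, ← h1, ← h2]
    rw [hf]
    ring)
  obtain ⟨G0, e0, g0, -⟩ := rehom t F0 _ d0
  obtain ⟨G1, e1, g1, -⟩ := rehom t F1 _ d1
  obtain ⟨G2, e2, g2, -⟩ := rehom t F2 _ d2
  refine ⟨G0, G1, G2, e0, e1, e2, ?_⟩
  rw [hz_hom _ e0, hz_hom _ e1, hz_hom _ e2, g0, g1, g2, hF]
  simp only [C_add, C_mul, Nat.add_sub_cancel]
  ring

/-- graded pieces -/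
def Gn (K : Type) {E : Type} [Field K] [Field E] [Algebra K E] {m : ℕ} (t : Fin m → E) (k : ℕ) : Submodule K E[X] where
  carrier := {a | ∃ w, nInt K t k w ∧ a = C w * X^k}
  add_mem' := by
    rintro _ _ ⟨v, hv, rfl⟩ ⟨w, hw, rfl⟩
    exact ⟨v + w, nInt_add hv hw, by rw [C_add, add_mul]⟩
  zero_mem' := ⟨0, by unfold nInt; rw [C_0, zero_mul]; exact isIntegral_zero, by simp⟩
  smul_mem' := by
    rintro c _ ⟨v, hv, rfl⟩
    refine ⟨algebraMap K E c * v, nInt_smul c hv, ?_⟩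
    rw [Algebra.smul_def, C_mul, mul_assoc]; rfl

theorem nInt_hom (t : Fin m → E) {k : ℕ} {F : MP K (m+1)} (hF : F.IsHomogeneous k) :
    nInt K t k (maeval (Fin.cons 1 t : Fin (m+1) → E) F) := by
  have h1 : ∀ w ∈ Wn K (Fin.cons 1 t : Fin (m+1) → E) k, nInt K t k w := by
    intro w hw
    unfold nInt
    obtain ⟨F, hF, rfl⟩ := mem_Wn.mp hw
    rw [← hz_hom _ hF]
    clear hw hF
    unfold hz
    induction F using minduction_on with
    | C c => rw [maeval_C]; exact isIntegral_algebraMap (x := algebraMap K (Algebra.adjoin K _ : Subalgebra K E[X]) c)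
    | add p q hp hq => rw [map_add]; exact hp.add hq
    | mul_X p i hp =>
      rw [map_mul, maeval_X]
      refine hp.mul ?_
      have h2 : ∀ i, nInt K t 1 ((Fin.cons 1 t : Fin (m+1) → E) i) := by
        intro i
        refine Fin.cases ?_ (fun j => ?_) i
        · exact nInt_one 1
        · exact nInt_t j
      have := h2 i
      unfold nInt at this
      rwa [pow_one] at this
  exact h1 _ (mem_Wn.mpr ⟨F, hF, rfl⟩)

theorem one_V (h : Setup K t x y) : (1:E) ∈ h.V := Submodule.subset_span ⟨0, rfl⟩
theorem x_V (h : Setup K t x y) : x ∈ h.V := Submodule.subset_span ⟨1, rfl⟩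
theorem y_V (h : Setup K t x y) : y ∈ h.V := Submodule.subset_span ⟨2, rfl⟩

theorem k0_mul_V (h : Setup K t x y) {a w : E} (ha : a ∈ kF K t) (hw : w ∈ h.V) : a * w ∈ h.V :=
  h.V.smul_mem ⟨a, ha⟩ hw

theorem tau_k0 (t : Fin m → E) (F : MP K (m+1)) :
    maeval (Fin.cons 1 t : Fin (m+1) → E) F ∈ kF K t := by
  rw [deh]; exact aeval_mem_k0 _ _

theorem coeff_V (h : Setup K t x y) {a : E[X]}
    (ha : InV (hz (K := K) (Fin.cons 1 t : Fin (m+2) → E)) (C x * X) (C y * X) a) (k : ℕ) : a.coeff k ∈ h.V := by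
  obtain ⟨f0, f1, f2, rfl⟩ := ha
  have h0 : ∀ f : MP K (m+2), ∀ k, (hz (Fin.cons 1 t : Fin (m+2) → E) f).coeff k ∈ kF K t := by
    intro f k; rw [hz_coeff]; exact tau_k0 _ _
  rw [coeff_add, coeff_add, ← mul_assoc, ← mul_assoc]
  have h1 : ∀ (f : MP K (m+2)) (z : E), z ∈ h.V → (hz (Fin.cons 1 t : Fin (m+2) → E) f * C z * X).coeff k ∈ h.V := by
    intro f z hz'
    obtain _ | k := k
    · rw [coeff_mul_X_zero]; exact zero_mem _
    · rw [coeff_mul_X, coeff_mul_C]; exact k0_mul_V h (h0 _ _) hz'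
  refine add_mem (add_mem ?_ (h1 _ _ (x_V h))) (h1 _ _ (y_V h))
  have := k0_mul_V h (h0 f0 k) (one_V h)
  rwa [mul_one] at this

theorem gr_of_setup [IsAlgClosed K] (h : Setup K t x y) :
    Gr (hz (K := K) (Fin.cons 1 t : Fin (m+2) → E)) (C x * X) (C y * X) (Gn K t) where
  indep f0 f1 f2 hf := by
    have hc := fun k => congrArg (fun p => coeff p k) hf
    simp only [coeff_add, ← mul_assoc, coeff_zero] at hc
    have key : ∀ k, mcomp (k+1) f0 = 0 ∧ mcomp k f1 = 0 ∧
        mcomp k f2 = 0 := by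
      intro k
      have h1 := hc (k+1)
      rw [coeff_mul_X, coeff_mul_X, coeff_mul_C, coeff_mul_C, hz_coeff, hz_coeff, hz_coeff] at h1
      have h2 := h.indepk (tau_k0 _ _) (tau_k0 _ _) (tau_k0 _ _) h1
      exact ⟨hom_inj h.ai (mcomp_hom _ _) h2.1,
        hom_inj h.ai (mcomp_hom _ _) h2.2.1,
        hom_inj h.ai (mcomp_hom _ _) h2.2.2⟩
    have key0 : mcomp 0 f0 = 0 := by
      have h1 := hc 0
      rw [coeff_mul_X_zero, coeff_mul_X_zero, hz_coeff, add_zero, add_zero] at h1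
      exact hom_inj h.ai (mcomp_hom _ _) h1
    refine ⟨?_, ?_, ?_⟩
    · rw [← msum_comp f0]
      refine Finset.sum_eq_zero (fun k _ => ?_)
      obtain _ | k := k
      · exact key0
      · exact (key k).1
    · rw [← msum_comp f1]
      exact Finset.sum_eq_zero (fun k _ => (key k).2.1)
    · rw [← msum_comp f2]
      exact Finset.sum_eq_zero (fun k _ => (key k).2.2)
  hj k f hf := ⟨_, nInt_hom t hf, hz_hom _ hf⟩
  hx := ⟨x, h.hx, by rw [pow_one]⟩
  hy := ⟨y, h.hy, by rw [pow_one]⟩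
  mul := by
    rintro k l _ _ ⟨v, hv, rfl⟩ ⟨w, hw, rfl⟩
    exact ⟨v * w, nInt_mul hv hw, by rw [C_mul, pow_add]; ring⟩
  sat := by
    rintro k _ f ⟨w, hw, rfl⟩ hf hV
    obtain ⟨s, hs⟩ : ∃ s, mcomp s f ≠ 0 := by
      by_contra hc
      push Not at hc
      apply hf
      rw [← msum_comp f]
      exact Finset.sum_eq_zero (fun k _ => hc k)
    have h1 := coeff_V h hV (s + (k+1))
    rw [← mul_assoc, coeff_mul_X_pow, coeff_mul_C, hz_coeff] at h1
    refine inV_of h ?_ hw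
    have h2 : maeval (Fin.cons 1 t : Fin (m+2) → E) (mcomp s f) ≠ 0 := fun h0 =>
      hs (hom_inj h.ai (mcomp_hom _ _) h0)
    have h3 := k0_mul_V h (inv_mem (tau_k0 t (mcomp s f))) h1
    rwa [← mul_assoc, inv_mul_cancel₀ h2, one_mul] at h3
  nc := by
    rintro ⟨h1, h2, h3⟩
    have e : ∀ a b : E, ((C a * X) * (C b * X) : E[X]).coeff 2 = a * b := by
      intro a b
      have : ((C a * X) * (C b * X) : E[X]) = C (a * b) * X^2 := by rw [C_mul]; ring
      rw [this, coeff_C_mul, coeff_X_pow]; simp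
    have k1 := coeff_V h h1 2
    have k2 := coeff_V h h2 2
    have k3 := coeff_V h h3 2
    rw [e] at k1 k2 k3
    exact h.not_closed k1 k2 k3

end

section
open Polynomial IntermediateField
variable {K E : Type} [Field K] [Field E] [Algebra K E] {m : ℕ} {t : Fin (m+1) → E} {x y : E}

theorem nInt_sub {k : ℕ} {v w : E} (hv : nInt K t k v) (hw : nInt K t k w) : nInt K t k (v - w) := by
  have := nInt_add hv (nInt_smul (-1) hw)
  rwa [map_neg, map_one, neg_one_mul, ← sub_eq_add_neg] at this

theorem dich [IsAlgClosed K] (h : Setup K t x y) :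
    (∃ a0 a1 a2 : K, ¬ (a0 = 0 ∧ a1 = 0 ∧ a2 = 0) ∧
      InVn (hz (K := K) (Fin.cons 1 t : Fin (m+2) → E)) (C x * X) (C y * X) 1 (a0 • (C x * X * (C y * X)) - a1 • (C x * X * (C x * X))) ∧
      InVn (hz (K := K) (Fin.cons 1 t : Fin (m+2) → E)) (C x * X) (C y * X) 1 (a0 • (C y * X * (C y * X)) - a2 • (C x * X * (C x * X))) ∧
      InVn (hz (K := K) (Fin.cons 1 t : Fin (m+2) → E)) (C x * X) (C y * X) 1 (a1 • (C y * X * (C y * X)) - a2 • (C x * X * (C y * X)))) ∨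
    ∃ c0 c1 c2, Gr1 (hz (K := K) (Fin.cons 1 t : Fin (m+2) → E)) (C x * X) (C y * X) (Gn K t) c0 c1 c2 := by
  obtain ⟨χ, c, hker, hc, hcop, hdeg, hF⟩ := h.G3
  have hc0 : (χ (x * x) : E) = maeval t (c 0) := hc 0
  have hc1 : (χ (x * y) : E) = maeval t (c 1) := hc 1
  have hc2 : (χ (y * y) : E) = maeval t (c 2) := hc 2
  have hlin : ∀ a w : E, a ∈ kF K t → (χ (a * w) : E) = a * χ w := by
    intro a w ha
    have := χ.map_smul ⟨a, ha⟩ w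
    exact congrArg Subtype.val this
  have hxx := nInt_mul h.hx h.hx
  have hxy := nInt_mul h.hx h.hy
  have hyy := nInt_mul h.hy h.hy
  have hV : ∀ w, (χ w : E) = 0 → w ∈ h.V := by
    intro w hw
    rw [← hker]
    exact Subtype.ext hw
  have hsub : ∀ a b : E, (χ (a - b) : E) = χ a - χ b := by
    intro a b; rw [map_sub]; rfl
  by_cases h1 : ∃ i, (c i).totalDegree = 1
  · right
    have hF := hF h1
    obtain ⟨C0, e0, g0, k0⟩ := rehom t (c 0) 1 (hdeg 0)
    obtain ⟨C1, e1, g1, k1⟩ := rehom t (c 1) 1 (hdeg 1)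
    obtain ⟨C2, e2, g2, k2⟩ := rehom t (c 2) 1 (hdeg 2)
    have key : ∀ (k : ℕ) (w z : E) (P F : MP K (m+2)), nInt K t (k+1) w → nInt K t 2 z → P.IsHomogeneous 1 → F.IsHomogeneous k →
        (χ z : E) = maeval (Fin.cons 1 t : Fin (m+2) → E) P → (χ w : E) = maeval (Fin.cons 1 t : Fin (m+2) → E) F →
        InV (hz (K := K) (Fin.cons 1 t : Fin (m+2) → E)) (C x * X) (C y * X) (hz (Fin.cons 1 t : Fin (m+2) → E) P * (C w * X^(k+1)) - hz (Fin.cons 1 t : Fin (m+2) → E) F * (C z * X^2)) := by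
      intro k w z P F hw hz' hP hF' hχz hχw
      have : hz (Fin.cons 1 t : Fin (m+2) → E) P * (C w * X^(k+1)) - hz (Fin.cons 1 t : Fin (m+2) → E) F * (C z * X^2)
          = C (maeval (Fin.cons 1 t : Fin (m+2) → E) P * w - maeval (Fin.cons 1 t : Fin (m+2) → E) F * z) * X^(k+1+1) := by
        rw [hz_hom _ hP, hz_hom _ hF', C_sub, C_mul, C_mul]; ring
      rw [this]
      refine (inV_of h (hV _ ?_) ?_).inV
      · rw [hsub, hlin _ _ (tau_k0 _ _), hlin _ _ (tau_k0 _ _), hχz, hχw]; ring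
      · refine nInt_sub ?_ ?_
        · have := nInt_mul (nInt_hom t hP) hw
          rwa [add_comm 1 (k+1)] at this
        · have h3 := nInt_mul (nInt_hom t hF') hz'
          exact h3
    have chi : ∀ (k : ℕ) (w : E) (F : MP K (m+2)), nInt K t (k+1) w → F.IsHomogeneous k →
        (χ w : E) = maeval (Fin.cons 1 t : Fin (m+2) → E) F →
        Chi (hz (K := K) (Fin.cons 1 t : Fin (m+2) → E)) (C x * X) (C y * X) C0 C1 C2 (C w * X^(k+1)) F := by
      intro k w F hw hF' hχ
      have m0 : (C x * X * (C x * X) : E[X]) = C (x * x) * X^2 := by rw [C_mul]; ring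
      have m1 : (C x * X * (C y * X) : E[X]) = C (x * y) * X^2 := by rw [C_mul]; ring
      have m2 : (C y * X * (C y * X) : E[X]) = C (y * y) * X^2 := by rw [C_mul]; ring
      unfold Chi
      rw [m0, m1, m2]
      exact ⟨key k w _ _ F hw hxx e0 hF' (by rw [hc0, g0]) hχ, key k w _ _ F hw hxy e1 hF' (by rw [hc1, g1]) hχ,
        key k w _ _ F hw hyy e2 hF' (by rw [hc2, g2]) hχ⟩
    refine ⟨C0, C1, C2, ⟨gr_of_setup h, e0, e1, e2, ?_, ?_, ?_, ?_, ?_⟩⟩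
    · have : (C x * X * (C x * X) : E[X]) = C (x * x) * X^(1+1) := by rw [C_mul]; ring
      rw [this]; exact chi 1 _ _ hxx e0 (by rw [hc0, g0])
    · have : (C x * X * (C y * X) : E[X]) = C (x * y) * X^(1+1) := by rw [C_mul]; ring
      rw [this]; exact chi 1 _ _ hxy e1 (by rw [hc1, g1])
    · have : (C y * X * (C y * X) : E[X]) = C (y * y) * X^(1+1) := by rw [C_mul]; ring
      rw [this]; exact chi 1 _ _ hyy e2 (by rw [hc2, g2])
    · rintro k _ ⟨w, hw, rfl⟩
      obtain ⟨F, -, hFd, hFw⟩ := hF _ _ hw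
      obtain ⟨F', f1, f2, -⟩ := rehom t F k (by simpa using hFd)
      exact ⟨F', f1, chi k w F' hw f1 (by rw [hFw, f2])⟩
    · rintro ⟨l, a0, a1, a2, -, r0, r1, r2⟩
      set l' := maeval (Fin.cons 1 mX : Fin (m+2) → MP K (m+1)) l with hl'
      have d0 : c 0 = MvPolynomial.C a0 * l' := by
        rw [← k0, r0, map_mul, maeval_C]; rfl
      have d1 : c 1 = MvPolynomial.C a1 * l' := by
        rw [← k1, r1, map_mul, maeval_C]; rfl
      have d2 : c 2 = MvPolynomial.C a2 * l' := by
        rw [← k2, r2, map_mul, maeval_C]; rfl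
      have hd : ∀ i, ∃ a, c i = MvPolynomial.C a * l' := by
        intro i
        fin_cases i
        · exact ⟨a0, d0⟩
        · exact ⟨a1, d1⟩
        · exact ⟨a2, d2⟩
      have hu := hcop l' (fun i => by obtain ⟨a, ha⟩ := hd i; exact ⟨_, by rw [ha]; ring⟩)
      obtain ⟨u, -, hu'⟩ := MvPolynomial.isUnit_iff_eq_C_of_isReduced.mp hu
      obtain ⟨i, hi⟩ := h1
      obtain ⟨a, ha⟩ := hd i
      rw [ha, hu', ← MvPolynomial.C_mul, MvPolynomial.totalDegree_C] at hi
      exact zero_ne_one hi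
  · left
    have h0 : ∀ i, ∃ a, c i = MvPolynomial.C a := by
      intro i
      have : (c i).totalDegree = 0 := by
        have := hdeg i
        have h2 : ¬ (c i).totalDegree = 1 := fun h2 => h1 ⟨i, h2⟩
        omega
      exact ⟨_, MvPolynomial.totalDegree_eq_zero_iff_eq_C.mp this⟩
    choose a ha using h0
    have ev : ∀ i, maeval t (c i) = algebraMap K E (a i) := fun i => by rw [ha, maeval_C]
    rw [ev] at hc0 hc1 hc2
    have key : ∀ (p q : K) (z w : E), nInt K t 2 z → nInt K t 2 w → (χ z : E) = algebraMap K E p → (χ w : E) = algebraMap K E q →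
        InVn (hz (K := K) (Fin.cons 1 t : Fin (m+2) → E)) (C x * X) (C y * X) 1 (p • (C w * X^2) - q • (C z * X^2)) := by
      intro p q z w hz' hw hχz hχw
      have : p • (C w * X^2) - q • (C z * X^2) = C (algebraMap K E p * w - algebraMap K E q * z) * X^(1+1) := by
        rw [C_sub, C_mul, C_mul, Algebra.smul_def, Algebra.smul_def, Polynomial.algebraMap_apply, Polynomial.algebraMap_apply]; ring
      rw [this]
      refine inV_of h (hV _ ?_) ?_
      · rw [hsub, hlin _ _ (IntermediateField.algebraMap_mem _ _), hlin _ _ (IntermediateField.algebraMap_mem _ _), hχz, hχw]; ring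
      · exact nInt_sub (nInt_smul _ hw) (nInt_smul _ hz')
    have m0 : (C x * X * (C x * X) : E[X]) = C (x * x) * X^2 := by rw [C_mul]; ring
    have m1 : (C x * X * (C y * X) : E[X]) = C (x * y) * X^2 := by rw [C_mul]; ring
    have m2 : (C y * X * (C y * X) : E[X]) = C (y * y) * X^2 := by rw [C_mul]; ring
    refine ⟨a 0, a 1, a 2, ?_, ?_, ?_, ?_⟩
    · rintro ⟨z0, z1, z2⟩
      have : IsUnit (0 : MP K (m+1)) := hcop 0 (by
        intro i
        rw [ha]
        fin_cases i
        · simp [z0]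
        · simp [z1]
        · simp [z2])
      exact not_isUnit_zero this
    · rw [m0, m1]; exact key _ _ _ _ hxx hxy hc0 hc1
    · rw [m0, m2]; exact key _ _ _ _ hxx hyy hc0 hc2
    · rw [m1, m2]; exact key _ _ _ _ hxy hyy hc1 hc2

end

section
open MvPolynomial
section
variable {K : Type} [Field K] {N : ℕ}

theorem finrank_lin (N : ℕ) : Module.finrank K (homogeneousSubmodule (Fin N) K 1) = N := by
  rcases N with _ | N
  · rw [homogeneousSubmodule_one_eq_span_X]
    have : Set.range (X : Fin 0 → MP K 0) = ∅ := Set.range_eq_empty _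
    rw [this, Submodule.span_empty, finrank_bot]
  · rw [finrank_hom]; simp [add_comm]

theorem X_li : LinearIndependent K (X : Fin N → MP K N) := by
  have := AlgebraicIndependent.linearIndependent (R := K) (x := (X : Fin N → MP K N)) (MvPolynomial.algebraicIndependent_X _ _)
  exact this

theorem fd_lin (N : ℕ) : FiniteDimensional K (homogeneousSubmodule (Fin N) K 1) := by
  rw [homogeneousSubmodule_one_eq_span_X]
  exact FiniteDimensional.span_of_finite _ (Set.finite_range _)

theorem lin_mem_span {l : Fin N → MP K N} (h1 : ∀ i, (l i).IsHomogeneous 1) (hl : LinearIndependent K l)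
    {F : MP K N} (hF : F.IsHomogeneous 1) : F ∈ Submodule.span K (Set.range l) := by
  have := fd_lin (K := K) N
  let l' : Fin N → homogeneousSubmodule (Fin N) K 1 := fun i => ⟨l i, h1 i⟩
  have hl' : LinearIndependent K l' := LinearIndependent.of_comp (homogeneousSubmodule (Fin N) K 1).subtype hl
  have h2 := hl'.span_eq_top_of_card_eq_finrank' (by simp [finrank_lin])
  have h3 : (⟨F, hF⟩ : homogeneousSubmodule (Fin N) K 1) ∈ Submodule.span K (Set.range l') := by rw [h2]; trivial
  have h4 := Submodule.mem_map_of_mem (f := (homogeneousSubmodule (Fin N) K 1).subtype) h3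
  rw [Submodule.map_span, ← Set.range_comp] at h4
  exact h4

theorem right_inv {l : Fin N → MP K N} (h1 : ∀ i, (l i).IsHomogeneous 1) (hl : LinearIndependent K l) :
    ∃ m : Fin N → MP K N, (∀ i, (m i).IsHomogeneous 1) ∧ LinearIndependent K m ∧ (∀ i, aeval l (m i) = X i) := by
  have : ∀ i, ∃ m : MP K N, m.IsHomogeneous 1 ∧ aeval l m = X i := by
    intro i
    obtain ⟨c, hc⟩ := (Submodule.mem_span_range_iff_exists_fun K).mp (lin_mem_span h1 hl (isHomogeneous_X K i))
    refine ⟨∑ j, c j • X j, ?_, ?_⟩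
    · exact IsHomogeneous.sum _ _ _ (fun j _ => by
        rw [smul_eq_C_mul]; exact (isHomogeneous_X K j).C_mul _)
    · rw [map_sum, ← hc]
      exact Finset.sum_congr rfl (fun j _ => by rw [map_smul, aeval_X])
  choose m hm1 hm2 using this
  refine ⟨m, hm1, ?_, hm2⟩
  refine LinearIndependent.of_comp (aeval l : MP K N →ₐ[K] MP K N).toLinearMap ?_
  have : (⇑(aeval l : MP K N →ₐ[K] MP K N).toLinearMap ∘ m) = X := funext hm2
  rw [this]; exact X_li

theorem lin_equiv {l : Fin N → MP K N} (h1 : ∀ i, (l i).IsHomogeneous 1) (hl : LinearIndependent K l) :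
    ∃ e : MP K N ≃ₐ[K] MP K N, (∀ i, e (X i) = l i) ∧ (∀ i, (e.symm (X i)).IsHomogeneous 1) := by
  obtain ⟨m, hm1, hm2, hm3⟩ := right_inv h1 hl
  obtain ⟨p, hp1, hp2, hp3⟩ := right_inv hm1 hm2
  have a1 : (aeval l).comp (aeval m) = AlgHom.id K (MP K N) := by
    apply algHom_ext; intro i; simpa using hm3 i
  have a2 : (aeval m).comp (aeval p) = AlgHom.id K (MP K N) := by
    apply algHom_ext; intro i; simpa using hp3 i
  have a3 : (aeval l : MP K N →ₐ[K] MP K N) = aeval p := by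
    have : ((aeval l).comp (aeval m)).comp (aeval p) = (aeval p : MP K N →ₐ[K] MP K N) := by rw [a1, AlgHom.id_comp]
    rw [← this, AlgHom.comp_assoc, a2, AlgHom.comp_id]
  refine ⟨AlgEquiv.ofAlgHom (aeval l) (aeval m) a1 (by rw [a3, a2]), fun i => by simp, fun i => ?_⟩
  simpa using hm1 i

theorem lin_extend {k : ℕ} (hk : k ≤ N) {l : Fin k → MP K N} (h1 : ∀ i, (l i).IsHomogeneous 1) (hl : LinearIndependent K l) :
    ∃ l' : Fin N → MP K N, (∀ i, (l' i).IsHomogeneous 1) ∧ LinearIndependent K l' ∧ ∀ i, l' (Fin.castLE hk i) = l i := by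
  induction h : N - k generalizing k with
  | zero =>
    obtain rfl : k = N := by omega
    exact ⟨l, h1, hl, fun i => rfl⟩
  | succ n ih =>
    have := fd_lin (K := K) N
    have hk' : k < N := by omega
    obtain ⟨x, hx⟩ := exists_not_span (K := K) (fun i => (⟨l i, h1 i⟩ : homogeneousSubmodule (Fin N) K 1)) (by rw [finrank_lin]; exact hk')
    have hli : LinearIndependent K (Fin.snoc l x.1 : Fin (k+1) → MP K N) := by
      rw [linearIndependent_finSnoc]
      refine ⟨hl, fun h => hx ?_⟩
      have h2 : x.1 ∈ (Submodule.span K (Set.range (fun i => (⟨l i, h1 i⟩ : homogeneousSubmodule (Fin N) K 1)))).map (homogeneousSubmodule (Fin N) K 1).subtype := by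
        rw [Submodule.map_span, ← Set.range_comp]; exact h
      obtain ⟨y, hy, hy'⟩ := h2
      obtain rfl : y = x := Subtype.ext hy'
      exact hy
    obtain ⟨l', a, b, c⟩ := ih (k := k+1) hk' (l := Fin.snoc l x.1) (by
      intro i
      refine Fin.lastCases ?_ (fun j => ?_) i
      · rw [Fin.snoc_last]; exact x.2
      · rw [Fin.snoc_castSucc]; exact h1 j) hli (by omega)
    refine ⟨l', a, b, fun i => ?_⟩
    have := c i.castSucc
    rw [Fin.snoc_castSucc] at this
    exact this

theorem lin_card {k : ℕ} {l : Fin k → MP K N} (h1 : ∀ i, (l i).IsHomogeneous 1) (hl : LinearIndependent K l) : k ≤ N := by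
  have := fd_lin (K := K) N
  let l' : Fin k → homogeneousSubmodule (Fin N) K 1 := fun i => ⟨l i, h1 i⟩
  have hl' : LinearIndependent K l' := LinearIndependent.of_comp (homogeneousSubmodule (Fin N) K 1).subtype hl
  have := hl'.fintype_card_le_finrank
  simpa [finrank_lin] using this

theorem lin_equiv' {k : ℕ} {l : Fin k → MP K N} (h1 : ∀ i, (l i).IsHomogeneous 1) (hl : LinearIndependent K l) :
    ∃ (e : MP K N ≃ₐ[K] MP K N) (s : Fin k → Fin N), Function.Injective s ∧ ∀ i, e (X (s i)) = l i := by
  obtain ⟨l', a, b, c⟩ := lin_extend (lin_card h1 hl) h1 hl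
  obtain ⟨e, he, -⟩ := lin_equiv a b
  exact ⟨e, Fin.castLE (lin_card h1 hl), Fin.castLE_injective _, fun i => by rw [he, c]⟩

/-- set the `i`-th variable to zero -/
def za (i : Fin N) : MP K N →ₐ[K] MP K N := aeval (fun j => if j = i then 0 else X j)

theorem za_dvd (i : Fin N) (F : MP K N) : X i ∣ F - za i F := by
  induction F using MvPolynomial.induction_on with
  | C a => simp [za]
  | add p q hp hq => rw [map_add]; convert dvd_add hp hq using 1; ring
  | mul_X p j hp =>
    rw [map_mul]
    by_cases h : j = i
    · subst h
      have : za j (X j) = (0 : MP K N) := by simp [za]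
      rw [this]; simp
    · have : za i (X j) = (X j : MP K N) := by simp [za, h]
      rw [this, ← sub_mul]; exact Dvd.dvd.mul_right hp _

theorem za_iff (i : Fin N) (F : MP K N) : X i ∣ F ↔ za i F = 0 := by
  constructor
  · rintro ⟨G, rfl⟩; simp [za]
  · intro h; have := za_dvd i F; rwa [h, sub_zero] at this

theorem lin_prime {a : MP K N} (ha : a.IsHomogeneous 1) (h : a ≠ 0) : Prime a := by
  obtain ⟨e, s, hs, he⟩ := lin_equiv' (l := fun _ : Fin 1 => a) (fun _ => ha) (LinearIndependent.of_subsingleton 0 h)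
  have := X_prime (R := K) (i := s 0)
  have h2 := (MulEquiv.prime_iff (e : MP K N ≃* MP K N) (p := X (s 0))).mpr this
  have h3 := he 0
  change Prime (e (X (s 0))) at h2
  rwa [h3] at h2

theorem X_ndvd {i k : Fin N} (h : i ≠ k) : ¬ (X i : MP K N) ∣ X k := by
  rw [X_dvd_X]; exact h

theorem lin_dvd2 {a b F : MP K N} (ha : a.IsHomogeneous 1) (hb : b.IsHomogeneous 1)
    (h : LinearIndependent K ![a, b]) (hd : a ∣ b * F) : a ∣ F := by
  obtain ⟨e, s, hs, he⟩ := lin_equiv' (l := ![a, b]) (by simp [Fin.forall_fin_two, ha, hb]) h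
  have e0 : e (X (s 0)) = a := he 0
  have e1 : e (X (s 1)) = b := he 1
  obtain ⟨F, rfl⟩ := e.surjective F
  rw [← e0, ← e1, ← map_mul, map_dvd_iff] at hd
  rw [← e0, map_dvd_iff]
  exact (X_prime.dvd_or_dvd hd).resolve_left (X_ndvd (hs.ne (by decide)))

theorem lin_dvd3 {a b c F G : MP K N} (ha : a.IsHomogeneous 1) (hb : b.IsHomogeneous 1) (hc : c.IsHomogeneous 1)
    (h : LinearIndependent K ![a, b, c]) (hd : a ∣ b * F - c * G) : ∃ u, a ∣ F - c * u ∧ a ∣ G - b * u := by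
  obtain ⟨e, s, hs, he⟩ := lin_equiv' (l := ![a, b, c]) (by simp [Fin.forall_fin_succ, ha, hb, hc]) h
  have e0 : e (X (s 0)) = a := he 0
  have e1 : e (X (s 1)) = b := he 1
  have e2 : e (X (s 2)) = c := he 2
  obtain ⟨F, rfl⟩ := e.surjective F
  obtain ⟨G, rfl⟩ := e.surjective G
  rw [← e0, ← e1, ← e2, ← map_mul, ← map_mul, ← map_sub, map_dvd_iff, za_iff, map_sub, map_mul, map_mul] at hd
  have z1 : za (s 0) (X (s 1)) = (X (s 1) : MP K N) := by simp [za, hs.ne_iff]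
  have z2 : za (s 0) (X (s 2)) = (X (s 2) : MP K N) := by simp [za, hs.ne_iff]
  rw [z1, z2] at hd
  obtain ⟨u, hu⟩ : (X (s 2) : MP K N) ∣ za (s 0) F :=
    (X_prime.dvd_or_dvd (⟨_, sub_eq_zero.mp hd⟩ : X (s 2) ∣ X (s 1) * za (s 0) F)).resolve_left (X_ndvd (hs.ne (by decide)))
  have hG : za (s 0) G = X (s 1) * u := by
    have h2 : (X (s 2) : MP K N) ≠ 0 := X_ne_zero _
    apply mul_left_cancel₀ h2
    rw [hu] at hd
    linear_combination -hd
  refine ⟨e u, ?_, ?_⟩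
  · rw [← e0, ← e2, ← map_mul, ← map_sub, map_dvd_iff, ← hu]; exact za_dvd _ _
  · rw [← e0, ← e1, ← map_mul, ← map_sub, map_dvd_iff, ← hG]; exact za_dvd _ _

theorem lin_sq {a b F G : MP K N} (ha : a.IsHomogeneous 1) (hb : b.IsHomogeneous 1)
    (h : LinearIndependent K ![a, b]) (hd : a ∣ F * F - b * G) : ∃ u, a ∣ F - b * u := by
  obtain ⟨e, s, hs, he⟩ := lin_equiv' (l := ![a, b]) (by simp [Fin.forall_fin_two, ha, hb]) h
  have e0 : e (X (s 0)) = a := he 0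
  have e1 : e (X (s 1)) = b := he 1
  obtain ⟨F, rfl⟩ := e.surjective F
  obtain ⟨G, rfl⟩ := e.surjective G
  rw [← e0, ← e1, ← map_mul, ← map_mul, ← map_sub, map_dvd_iff, za_iff, map_sub, map_mul, map_mul] at hd
  have z1 : za (s 0) (X (s 1)) = (X (s 1) : MP K N) := by simp [za, hs.ne_iff]
  rw [z1] at hd
  obtain ⟨u, hu⟩ : (X (s 1) : MP K N) ∣ za (s 0) F := by
    have : (X (s 1) : MP K N) ∣ za (s 0) F * za (s 0) F := ⟨_, sub_eq_zero.mp hd⟩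
    rcases X_prime.dvd_or_dvd this with h | h <;> exact h
  exact ⟨e u, by rw [← e0, ← e1, ← map_mul, ← map_sub, map_dvd_iff, ← hu]; exact za_dvd _ _⟩

theorem hc_mul {i : ℕ} {a : MP K N} (ha : a.IsHomogeneous i) (k : ℕ) (u : MP K N) :
    homogeneousComponent (i + k) (a * u) = a * homogeneousComponent k u := by
  conv_lhs => rw [← sum_homogeneousComponent u, Finset.mul_sum, map_sum]
  have : ∀ j, homogeneousComponent (i + k) (a * homogeneousComponent j u) = if j = k then a * homogeneousComponent j u else 0 := by
    intro j
    rw [homogeneousComponent_of_mem ((ha.mul (homogeneousComponent_isHomogeneous j u)))]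
    simp [eq_comm]
  simp_rw [this]
  rw [Finset.sum_ite_eq']
  split_ifs with h
  · rfl
  · rw [homogeneousComponent_eq_zero _ _ (by simpa using h), mul_zero]

theorem hom_comp {k : ℕ} {F : MP K N} (h : F.IsHomogeneous k) : homogeneousComponent k F = F := by
  rw [homogeneousComponent_of_mem h, if_pos rfl]

theorem hom_zero {F : MP K N} (h : F.IsHomogeneous 0) : ∃ c, F = C c :=
  ⟨_, totalDegree_eq_zero_iff_eq_C.mp ((totalDegree_zero_iff_isHomogeneous _).mpr h)⟩

/-- a homogeneous combination can be made homogeneous -/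
theorem hom_two {k : ℕ} {a b F u : MP K N} (ha : a.IsHomogeneous 1) (hb : b.IsHomogeneous 1)
    (hF : F.IsHomogeneous (1 + k)) (h : a ∣ F - b * u) : ∃ v w, v.IsHomogeneous k ∧ w.IsHomogeneous k ∧ F = a * v + b * w := by
  obtain ⟨v, hv⟩ := h
  refine ⟨homogeneousComponent k v, homogeneousComponent k u, homogeneousComponent_isHomogeneous _ _, homogeneousComponent_isHomogeneous _ _, ?_⟩
  rw [← hc_mul ha, ← hc_mul hb, ← map_add, ← hv, sub_add_cancel, hom_comp hF]

theorem hom_dvd {k : ℕ} {a F : MP K N} (ha : a.IsHomogeneous 1)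
    (hF : F.IsHomogeneous (1 + k)) (h : a ∣ F) : ∃ v, v.IsHomogeneous k ∧ F = a * v := by
  obtain ⟨v, hv⟩ := h
  refine ⟨homogeneousComponent k v, homogeneousComponent_isHomogeneous _ _, ?_⟩
  rw [← hc_mul ha, ← hv, hom_comp hF]

end

section
variable {K B : Type} [Field K] [CommRing B] [Algebra K B] {n : ℕ} {j : MP K n →ₐ[K] B} {x y x' y' : B}
  {G : ℕ → Submodule K B} {c0 c1 c2 : MP K n}

theorem InV.add {a b : B} (ha : InV j x y a) (hb : InV j x y b) : InV j x y (a + b) := by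
  obtain ⟨f0, f1, f2, rfl⟩ := ha
  obtain ⟨g0, g1, g2, rfl⟩ := hb
  exact ⟨f0 + g0, f1 + g1, f2 + g2, by simp only [map_add]; ring⟩

theorem InV.mul {a : B} (ha : InV j x y a) (f : MP K n) : InV j x y (j f * a) := by
  obtain ⟨f0, f1, f2, rfl⟩ := ha
  exact ⟨f * f0, f * f1, f * f2, by simp only [map_mul]; ring⟩

theorem InV.of_eq {a b : B} (ha : InV j x y a) (h : b = a) : InV j x y b := h ▸ ha

theorem InV.sub {a b : B} (ha : InV j x y a) (hb : InV j x y b) : InV j x y (a - b) := by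
  refine (ha.add (hb.mul (-1))).of_eq ?_
  simp only [map_neg, map_one]; ring

theorem inV_j (f : MP K n) : InV j x y (j f) := ⟨f, 0, 0, by simp⟩
theorem inV_x : InV j x y x := ⟨0, 1, 0, by simp⟩
theorem inV_y : InV j x y y := ⟨0, 0, 1, by simp⟩

/-- admissible linear change of the two generators -/
def Lin (j : MP K n →ₐ[K] B) (x y x' y' : B) (α β γ δ : K) (l l' : MP K n) : Prop :=
  l.IsHomogeneous 1 ∧ l'.IsHomogeneous 1 ∧ α * δ - β * γ ≠ 0 ∧
    x' = j (C α) * x + j (C β) * y + j l ∧ y' = j (C γ) * x + j (C δ) * y + j l'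

theorem InV.lin {α β γ δ : K} {l l' : MP K n} (h : Lin j x y x' y' α β γ δ l l') {a : B} (ha : InV j x' y' a) : InV j x y a := by
  obtain ⟨-, -, -, rfl, rfl⟩ := h
  obtain ⟨f0, f1, f2, rfl⟩ := ha
  exact ⟨f0 + f1 * l + f2 * l', f1 * C α + f2 * C γ, f1 * C β + f2 * C δ, by simp only [map_add, map_mul]; ring⟩

theorem InVn.lin {α β γ δ : K} {l l' : MP K n} (h : Lin j x y x' y' α β γ δ l l') {k : ℕ} {a : B} (ha : InVn j x' y' k a) : InVn j x y k a := by
  obtain ⟨hl, hl', -, rfl, rfl⟩ := h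
  obtain ⟨f0, f1, f2, h0, h1, h2, rfl⟩ := ha
  exact ⟨f0 + f1 * l + f2 * l', f1 * C α + f2 * C γ, f1 * C β + f2 * C δ, (h0.add (h1.mul hl)).add (h2.mul hl'),
    (h1.mul (isHomogeneous_C _ α)).add (h2.mul (isHomogeneous_C _ γ)), (h1.mul (isHomogeneous_C _ β)).add (h2.mul (isHomogeneous_C _ δ)), by simp only [map_add, map_mul]; ring⟩

theorem Lin.symm {α β γ δ : K} {l l' : MP K n} (h : Lin j x y x' y' α β γ δ l l') :
    Lin j x' y' x y (δ / (α * δ - β * γ)) (-β / (α * δ - β * γ)) (-γ / (α * δ - β * γ)) (α / (α * δ - β * γ))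
      (- (C (δ / (α * δ - β * γ)) * l + C (-β / (α * δ - β * γ)) * l')) (- (C (-γ / (α * δ - β * γ)) * l + C (α / (α * δ - β * γ)) * l')) := by
  obtain ⟨hl, hl', hD, rfl, rfl⟩ := h
  have h1 : (δ / (α * δ - β * γ)) * α + (-β / (α * δ - β * γ)) * γ = 1 := by
    rw [div_mul_eq_mul_div, div_mul_eq_mul_div, ← add_div, div_eq_one_iff_eq hD]; ring
  have h2 : (δ / (α * δ - β * γ)) * β + (-β / (α * δ - β * γ)) * δ = 0 := by field_simp; ring
  have h3 : (-γ / (α * δ - β * γ)) * α + (α / (α * δ - β * γ)) * γ = 0 := by field_simp; ring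
  have h4 : (-γ / (α * δ - β * γ)) * β + (α / (α * δ - β * γ)) * δ = 1 := by
    rw [div_mul_eq_mul_div, div_mul_eq_mul_div, ← add_div, div_eq_one_iff_eq hD]; ring
  have k1 := congrArg (fun c => j (C c)) h1
  have k2 := congrArg (fun c => j (C c)) h2
  have k3 := congrArg (fun c => j (C c)) h3
  have k4 := congrArg (fun c => j (C c)) h4
  simp only [map_add, map_mul, map_one, map_zero] at k1 k2 k3 k4
  refine ⟨((hl.C_mul _).add (hl'.C_mul _)).neg, ((hl.C_mul _).add (hl'.C_mul _)).neg, ?_, ?_, ?_⟩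
  · have : δ / (α * δ - β * γ) * (α / (α * δ - β * γ)) - -β / (α * δ - β * γ) * (-γ / (α * δ - β * γ)) = 1 / (α * δ - β * γ) := by
      field_simp
    rw [this]; exact one_div_ne_zero hD
  · simp only [map_add, map_mul, map_neg]
    linear_combination -x * k1 - y * k2
  · simp only [map_add, map_mul, map_neg]
    linear_combination -x * k3 - y * k4

theorem Lin.inV {α β γ δ : K} {l l' : MP K n} (h : Lin j x y x' y' α β γ δ l l') {a : B} : InV j x' y' a ↔ InV j x y a :=
  ⟨fun ha => ha.lin h, fun ha => ha.lin h.symm⟩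

theorem Gr.change {α β γ δ : K} {l l' : MP K n} (hG : Gr j x y G) (h : Lin j x y x' y' α β γ δ l l') : Gr j x' y' G where
  indep f0 f1 f2 he := by
    obtain ⟨-, -, hD, rfl, rfl⟩ := h
    obtain ⟨e0, e1, e2⟩ := hG.indep (f0 + f1 * l + f2 * l') (f1 * C α + f2 * C γ) (f1 * C β + f2 * C δ) (by
      rw [← he]; simp only [map_add, map_mul]; ring)
    have hD' : (C (α * δ - β * γ) : MP K n) ≠ 0 := C_ne_zero.mpr hD
    have g1 : f1 = 0 := by
      apply (mul_eq_zero.mp (_ : C (α * δ - β * γ) * f1 = 0)).resolve_left hD'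
      simp only [map_sub, map_mul]
      linear_combination (C δ) * e1 - C γ * e2
    have g2 : f2 = 0 := by
      apply (mul_eq_zero.mp (_ : C (α * δ - β * γ) * f2 = 0)).resolve_left hD'
      simp only [map_sub, map_mul]
      linear_combination (C α) * e2 - C β * e1
    subst g1; subst g2
    simpa using e0
  hj := hG.hj
  hx := by
    obtain ⟨hl, hl', hD, rfl, rfl⟩ := h
    refine add_mem (add_mem ?_ ?_) (hG.hj _ _ hl)
    · simpa using hG.mul 0 1 _ _ (hG.hj 0 _ (isHomogeneous_C _ α)) hG.hx
    · simpa using hG.mul 0 1 _ _ (hG.hj 0 _ (isHomogeneous_C _ β)) hG.hy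
  hy := by
    obtain ⟨hl, hl', hD, rfl, rfl⟩ := h
    refine add_mem (add_mem ?_ ?_) (hG.hj _ _ hl')
    · simpa using hG.mul 0 1 _ _ (hG.hj 0 _ (isHomogeneous_C _ γ)) hG.hx
    · simpa using hG.mul 0 1 _ _ (hG.hj 0 _ (isHomogeneous_C _ δ)) hG.hy
  mul := hG.mul
  sat k a f ha hf hv := (hG.sat k a f ha hf (h.inV.mp hv)).lin h.symm
  nc := by
    rintro ⟨h1, h2, h3⟩
    rw [h.inV] at h1 h2 h3
    have key : ∀ a b c d : K, ∀ m m' : MP K n, ∀ u v, u = j (C a) * x' + j (C b) * y' + j m → v = j (C c) * x' + j (C d) * y' + j m' → InV j x y (u * v) := by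
      rintro a b c d m m' u v rfl rfl
      have hx : InV j x y x' := h.inV.mp inV_x
      have hy : InV j x y y' := h.inV.mp inV_y
      refine (((h1.mul (C a * C c)).add (h2.mul (C a * C d + C b * C c))).add ((h3.mul (C b * C d)).add
        (((hx.mul (C a * m' + C c * m)).add (hy.mul (C b * m' + C d * m))).add (inV_j (m * m'))))).of_eq ?_
      simp only [map_add, map_mul]; ring
    obtain ⟨-, -, -, hx, hy⟩ := h.symm
    exact hG.nc ⟨key _ _ _ _ _ _ _ _ hx hx, key _ _ _ _ _ _ _ _ hx hy, key _ _ _ _ _ _ _ _ hy hy⟩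

theorem Chi.add {a b : B} {F F' : MP K n} (ha : Chi j x y c0 c1 c2 a F) (hb : Chi j x y c0 c1 c2 b F') :
    Chi j x y c0 c1 c2 (a + b) (F + F') := by
  obtain ⟨h0, h1, h2⟩ := ha
  obtain ⟨g0, g1, g2⟩ := hb
  refine ⟨(h0.add g0).of_eq ?_, (h1.add g1).of_eq ?_, (h2.add g2).of_eq ?_⟩ <;> · rw [map_add]; ring

theorem Chi.mul {a : B} {F : MP K n} (ha : Chi j x y c0 c1 c2 a F) (f : MP K n) :
    Chi j x y c0 c1 c2 (j f * a) (f * F) := by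
  obtain ⟨h0, h1, h2⟩ := ha
  refine ⟨(h0.mul f).of_eq ?_, (h1.mul f).of_eq ?_, (h2.mul f).of_eq ?_⟩ <;> · rw [map_mul]; ring

theorem InV.chi {a : B} (ha : InV j x y a) : Chi j x y c0 c1 c2 a 0 := by
  refine ⟨(ha.mul c0).of_eq ?_, (ha.mul c1).of_eq ?_, (ha.mul c2).of_eq ?_⟩ <;> simp

theorem Chi.of_eq {a b : B} {F F' : MP K n} (ha : Chi j x y c0 c1 c2 a F) (h : b = a) (h' : F' = F) : Chi j x y c0 c1 c2 b F' := by
  subst h; subst h'; exact ha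

/-- transformation of `Chi` -/
theorem Chi.lin {α β γ δ : K} {l l' : MP K n} (h : Lin j x y x' y' α β γ δ l l') {a : B} {F : MP K n}
    (ha : Chi j x y c0 c1 c2 a F) : Chi j x' y' (C α * C α * c0 + 2 * (C α * C β) * c1 + C β * C β * c2)
      (C α * C γ * c0 + (C α * C δ + C β * C γ) * c1 + C β * C δ * c2) (C γ * C γ * c0 + 2 * (C γ * C δ) * c1 + C δ * C δ * c2) a F := by
  obtain ⟨h0, h1, h2⟩ := ha
  have key : ∀ a' b c d : K, ∀ m m' : MP K n, ∀ u v, u = j (C a') * x + j (C b) * y + j m → v = j (C c) * x + j (C d) * y + j m' →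
      InV j x y (j (C a' * C c * c0 + (C a' * C d + C b * C c) * c1 + C b * C d * c2) * a - j F * (u * v)) := by
    rintro a' b c d m m' u v rfl rfl
    refine (((h0.mul (C a' * C c)).add (h1.mul (C a' * C d + C b * C c))).add ((h2.mul (C b * C d)).add
      (((inV_x.mul (- F * (C a' * m' + C c * m))).add (inV_y.mul (- F * (C b * m' + C d * m)))).add (inV_j (- F * (m * m')))))).of_eq ?_
    simp only [map_add, map_mul, map_neg]; ring
  obtain ⟨-, -, -, hx, hy⟩ := id h
  unfold Chi
  rw [h.inV, h.inV, h.inV]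
  refine ⟨(key _ _ _ _ _ _ _ _ hx hx).of_eq ?_, key _ _ _ _ _ _ _ _ hx hy, (key _ _ _ _ _ _ _ _ hy hy).of_eq ?_⟩ <;>
  · simp only [map_add, map_mul, map_ofNat]; ring

theorem Gr1.change {α β γ δ : K} {l l' : MP K n} (hG : Gr1 j x y G c0 c1 c2) (h : Lin j x y x' y' α β γ δ l l') :
    Gr1 j x' y' G (C α * C α * c0 + 2 * (C α * C β) * c1 + C β * C β * c2)
      (C α * C γ * c0 + (C α * C δ + C β * C γ) * c1 + C β * C δ * c2) (C γ * C γ * c0 + 2 * (C γ * C δ) * c1 + C δ * C δ * c2) := by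
  have key : ∀ a' b c d : K, ∀ m m' : MP K n, ∀ u v, u = j (C a') * x + j (C b) * y + j m → v = j (C c) * x + j (C d) * y + j m' →
      Chi j x y c0 c1 c2 (u * v) (C a' * C c * c0 + (C a' * C d + C b * C c) * c1 + C b * C d * c2) := by
    rintro a' b c d m m' u v rfl rfl
    refine (((hG.chi0.mul (C a' * C c)).add (hG.chi1.mul (C a' * C d + C b * C c))).add ((hG.chi2.mul (C b * C d)).add
      (((inV_x.mul ((C a' * m' + C c * m))).add (inV_y.mul ((C b * m' + C d * m)))).add (inV_j ((m * m')))).chi)).of_eq ?_ ?_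
    · simp only [map_add, map_mul]; ring
    · ring
  have hh : ∀ a b c : MP K n, a.IsHomogeneous 0 → b.IsHomogeneous 0 → c.IsHomogeneous 0 → (a * c0 + b * c1 + c * c2).IsHomogeneous 1 := by
    intro a b c ha hb hc
    have h1 := ha.mul hG.h0
    have h2 := hb.mul hG.h1
    have h3 := hc.mul hG.h2
    rw [zero_add] at h1 h2 h3
    exact (h1.add h2).add h3
  have hC : ∀ a b : K, (C a * C b : MP K n).IsHomogeneous 0 := by
    intro a b; rw [← map_mul]; exact isHomogeneous_C _ _
  have hC2 : ∀ a b : K, (2 * (C a * C b) : MP K n).IsHomogeneous 0 := by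
    intro a b; rw [two_mul]; exact (hC a b).add (hC a b)
  obtain ⟨-, -, hD, hx, hy⟩ := id h
  exact {
    hG.toGr.change h with
    h0 := hh _ _ _ (hC _ _) (hC2 _ _) (hC _ _)
    h1 := hh _ _ _ (hC _ _) ((hC _ _).add (hC _ _)) (hC _ _)
    h2 := hh _ _ _ (hC _ _) (hC2 _ _) (hC _ _)
    chi0 := ((key _ _ _ _ _ _ _ _ hx hx).of_eq rfl (by ring)).lin h
    chi1 := (key _ _ _ _ _ _ _ _ hx hy).lin h
    chi2 := ((key _ _ _ _ _ _ _ _ hy hy).of_eq rfl (by ring)).lin h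
    ex := fun k a ha => by
      obtain ⟨F, hF, hc⟩ := hG.ex k a ha
      exact ⟨F, hF, hc.lin h⟩
    line := by
      rintro ⟨L, a0, a1, a2, hL, e0, e1, e2⟩
      apply hG.line
      set D := α * δ - β * γ with hDd
      have hCD : (C D : MP K n) ≠ 0 := C_ne_zero.mpr hD
      have hDe : (C D : MP K n) = C α * C δ - C β * C γ := by rw [hDd]; simp
      have hi : (C (D * D)⁻¹ : MP K n) * (C D * C D) = 1 := by
        rw [← map_mul, ← map_mul, inv_mul_cancel₀ (mul_ne_zero hD hD), map_one]
      refine ⟨L, (D * D)⁻¹ * (δ * δ * a0 - 2 * (β * δ) * a1 + β * β * a2), (D * D)⁻¹ * (-(γ * δ * a0) + (α * δ + β * γ) * a1 - α * β * a2),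
        (D * D)⁻¹ * (γ * γ * a0 - 2 * (α * γ) * a1 + α * α * a2), hL, ?_, ?_, ?_⟩
      · apply mul_left_cancel₀ hCD
        apply mul_left_cancel₀ hCD
        simp only [map_add, map_mul, map_sub, map_ofNat]
        have : C D * (C D * c0) = (C δ * C δ * C a0 - 2 * (C β * C δ) * C a1 + C β * C β * C a2) * L := by
          rw [hDe]
          linear_combination C δ * C δ * e0 - 2 * C β * C δ * e1 + C β * C β * e2
        rw [this]
        linear_combination -(C δ * C δ * C a0 - 2 * (C β * C δ) * C a1 + C β * C β * C a2) * L * hi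
      · apply mul_left_cancel₀ hCD
        apply mul_left_cancel₀ hCD
        simp only [map_add, map_mul, map_sub, map_neg]
        have : C D * (C D * c1) = (-(C γ * C δ * C a0) + (C α * C δ + C β * C γ) * C a1 - C α * C β * C a2) * L := by
          rw [hDe]
          linear_combination -C γ * C δ * e0 + (C α * C δ + C β * C γ) * e1 - C α * C β * e2
        rw [this]
        linear_combination -(-(C γ * C δ * C a0) + (C α * C δ + C β * C γ) * C a1 - C α * C β * C a2) * L * hi
      · apply mul_left_cancel₀ hCD
        apply mul_left_cancel₀ hCD
        simp only [map_add, map_mul, map_sub, map_ofNat]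
        have : C D * (C D * c2) = (C γ * C γ * C a0 - 2 * (C α * C γ) * C a1 + C α * C α * C a2) * L := by
          rw [hDe]
          linear_combination C γ * C γ * e0 - 2 * C α * C γ * e1 + C α * C α * e2
        rw [this]
        linear_combination -(C γ * C γ * C a0 - 2 * (C α * C γ) * C a1 + C α * C α * C a2) * L * hi }

end

section
variable {K B : Type} [Field K] [CommRing B] [Algebra K B] {n : ℕ} {j : MP K n →ₐ[K] B} {x y x' y' : B}
  {G : ℕ → Submodule K B} {c0 c1 c2 : MP K n}

theorem Gr.hxx (h : Gr j x y G) : x * x ∈ G 2 := h.mul 1 1 _ _ h.hx h.hx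
theorem Gr.hxy (h : Gr j x y G) : x * y ∈ G 2 := h.mul 1 1 _ _ h.hx h.hy
theorem Gr.hyy (h : Gr j x y G) : y * y ∈ G 2 := h.mul 1 1 _ _ h.hy h.hy

theorem Gr.nc' (h : Gr j x y G) {f : MP K n} (h0 : InV j x y (j f * (x * x))) (h1 : InV j x y (j f * (x * y)))
    (h2 : InV j x y (j f * (y * y))) : f = 0 := by
  by_contra hf
  exact h.nc ⟨(h.sat 1 _ f h.hxx hf h0).inV, (h.sat 1 _ f h.hxy hf h1).inV, (h.sat 1 _ f h.hyy hf h2).inV⟩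

theorem Chi.unique (h : Gr j x y G) {a : B} {F F' : MP K n} (h1 : Chi j x y c0 c1 c2 a F) (h2 : Chi j x y c0 c1 c2 a F') : F = F' := by
  obtain ⟨a0, a1, a2⟩ := h1
  obtain ⟨b0, b1, b2⟩ := h2
  refine sub_eq_zero.mp (h.nc' (f := F - F') ((b0.sub a0).of_eq ?_) ((b1.sub a1).of_eq ?_) ((b2.sub a2).of_eq ?_)) <;>
  · rw [map_sub]; ring

theorem Gr1.c_ne (h : Gr1 j x y G c0 c1 c2) : ¬ (c0 = 0 ∧ c1 = 0 ∧ c2 = 0) := by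
  rintro ⟨rfl, rfl, rfl⟩
  exact h.line ⟨0, 0, 0, 0, isHomogeneous_zero _ _ _, by simp, by simp, by simp⟩

theorem Gr1.zero (h : Gr1 j x y G c0 c1 c2) {k : ℕ} {a : B} (ha : a ∈ G (k+1)) (hc : Chi j x y c0 c1 c2 a 0) : InVn j x y k a := by
  obtain ⟨h0, h1, h2⟩ := hc
  rw [map_zero, zero_mul, sub_zero] at h0 h1 h2
  by_cases e0 : c0 = 0
  · by_cases e1 : c1 = 0
    · by_cases e2 : c2 = 0
      · exact absurd ⟨e0, e1, e2⟩ h.c_ne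
      · exact h.sat k a _ ha e2 h2
    · exact h.sat k a _ ha e1 h1
  · exact h.sat k a _ ha e0 h0

end

section
variable {K B : Type} [Field K] [CommRing B] [Algebra K B] {n N : ℕ}

structure Dat (I : Ideal (MP K N)) (π : MP K N →ₐ[K] B)
    (ι : MP K n →ₐ[K] MP K N) (x y : MP K N) : Prop where
  ker : ∀ F, F ∈ I ↔ π F = 0
  hN : n + 2 = N
  hι : ∀ i, (ι (X i)).IsHomogeneous 1
  hx : x.IsHomogeneous 1
  hy : y.IsHomogeneous 1
  li : ∀ (a b : K) (f : MP K n), f.IsHomogeneous 1 → ι (C a) * x + ι (C b) * y + ι f = 0 → a = 0 ∧ b = 0 ∧ f = 0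
  adj : Algebra.adjoin K (insert x (insert y (Set.range ι))) = ⊤

variable {I : Ideal (MP K N)} {π : MP K N →ₐ[K] B}
    {ι : MP K n →ₐ[K] MP K N} {x y : MP K N}

theorem ι_C (a : K) : ι (C a) = C a := ι.commutes a

theorem Dat.ιhom (h : Dat I π ι x y) {k : ℕ} {f : MP K n} (hf : f.IsHomogeneous k) : (ι f).IsHomogeneous k := by
  have : ι = aeval (fun i => ι (X i)) := by apply algHom_ext; intro i; simp
  rw [this]
  have h2 := hf.aeval (fun i => ι (X i)) (n := 1) h.hι
  rwa [one_mul] at h2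

theorem Dat.gen (h : Dat I π ι x y) (M : MP K N → Prop) (h1 : M 1) (hadd : ∀ a b, M a → M b → M (a + b))
    (hm : ∀ f a, M a → M (ι f * a)) (hx : ∀ a, M a → M (x * a)) (hy : ∀ a, M a → M (y * a)) (F : MP K N) : M F := by
  have hF : F ∈ Algebra.adjoin K (insert x (insert y (Set.range ι))) := by rw [h.adj]; trivial
  have : ∀ a, M a → M (F * a) := by
    induction hF using Algebra.adjoin_induction with
    | mem z hz =>
      rcases hz with rfl | rfl | ⟨f, rfl⟩
      · exact hx
      · exact hy
      · exact hm f
    | algebraMap r => intro a ha; have := hm (C r) a ha; rwa [ι_C] at this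
    | add p q _ _ hp hq => intro a ha; rw [add_mul]; exact hadd _ _ (hp a ha) (hq a ha)
    | mul p q _ _ hp hq => intro a ha; rw [mul_assoc]; exact hp _ (hq a ha)
  simpa using this 1 h1

theorem Dat.change (h : Dat I π ι x y) {α β γ δ : K} {l l' : MP K n} (hl : l.IsHomogeneous 1) (hl' : l'.IsHomogeneous 1)
    (hD : α * δ - β * γ ≠ 0) {x' y' : MP K N} (hx' : x' = ι (C α) * x + ι (C β) * y + ι l) (hy' : y' = ι (C γ) * x + ι (C δ) * y + ι l') :
    Dat I π ι x' y' ∧ Lin (π.comp ι) (π x) (π y) (π x') (π y') α β γ δ l l' := by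
  have hlin : Lin ι x y x' y' α β γ δ l l' := ⟨hl, hl', hD, hx', hy'⟩
  refine ⟨⟨h.ker, h.hN, h.hι, ?_, ?_, ?_, ?_⟩, hl, hl', hD, ?_, ?_⟩
  · rw [hx', ι_C, ι_C]; exact ((h.hx.C_mul _).add (h.hy.C_mul _)).add (h.ιhom hl)
  · rw [hy', ι_C, ι_C]; exact ((h.hx.C_mul _).add (h.hy.C_mul _)).add (h.ιhom hl')
  · intro a b f hf he
    obtain ⟨e1, e2, e3⟩ := h.li (a * α + b * γ) (a * β + b * δ) (f + C a * l + C b * l') ((hf.add (hl.C_mul _)).add (hl'.C_mul _)) (by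
      rw [← he, hx', hy']; simp only [map_add, map_mul]; ring)
    have g1 : a = 0 := by
      apply (mul_eq_zero.mp (_ : (α * δ - β * γ) * a = 0)).resolve_left hD
      linear_combination δ * e1 - γ * e2
    have g2 : b = 0 := by
      apply (mul_eq_zero.mp (_ : (α * δ - β * γ) * b = 0)).resolve_left hD
      linear_combination α * e2 - β * e1
    subst g1; subst g2
    simpa using e3
  · have hs := hlin.symm
    obtain ⟨-, -, -, hx2, hy2⟩ := hs
    rw [eq_top_iff, ← h.adj]
    apply Algebra.adjoin_le
    have m1 : x' ∈ Algebra.adjoin K (insert x' (insert y' (Set.range ι))) := Algebra.subset_adjoin (Or.inl rfl)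
    have m2 : y' ∈ Algebra.adjoin K (insert x' (insert y' (Set.range ι))) := Algebra.subset_adjoin (Or.inr (Or.inl rfl))
    have m3 : ∀ f, ι f ∈ Algebra.adjoin K (insert x' (insert y' (Set.range ι))) := fun f => Algebra.subset_adjoin (Or.inr (Or.inr ⟨f, rfl⟩))
    rintro z (rfl | rfl | ⟨f, rfl⟩)
    · rw [hx2]; exact add_mem (add_mem (mul_mem (m3 _) m1) (mul_mem (m3 _) m2)) (m3 _)
    · rw [hy2]; exact add_mem (add_mem (mul_mem (m3 _) m1) (mul_mem (m3 _) m2)) (m3 _)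
    · exact m3 f
  · rw [hx']; simp
  · rw [hy']; simp

/-- normal form modulo `J` -/
def NF (ι : MP K n →ₐ[K] MP K N) (x y m1 m2 : MP K N) (J : Ideal (MP K N))
    (F : MP K N) : Prop := ∃ f0 f1 f2 f3 f4, F - (ι f0 + ι f1 * x + ι f2 * y + ι f3 * m1 + ι f4 * m2) ∈ J

variable {m1 m2 : MP K N} {J : Ideal (MP K N)}

theorem NF.add {F F' : MP K N} (h : NF ι x y m1 m2 J F) (h' : NF ι x y m1 m2 J F') : NF ι x y m1 m2 J (F + F') := by
  obtain ⟨f0, f1, f2, f3, f4, h⟩ := h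
  obtain ⟨g0, g1, g2, g3, g4, h'⟩ := h'
  refine ⟨f0 + g0, f1 + g1, f2 + g2, f3 + g3, f4 + g4, ?_⟩
  convert add_mem h h' using 1
  simp only [map_add]; ring

theorem NF.mul {F : MP K N} (f) (h : NF ι x y m1 m2 J F) : NF ι x y m1 m2 J (ι f * F) := by
  obtain ⟨f0, f1, f2, f3, f4, h⟩ := h
  refine ⟨f * f0, f * f1, f * f2, f * f3, f * f4, ?_⟩
  convert J.mul_mem_left (ι f) h using 1
  simp only [map_mul]; ring

theorem NF.j {F : MP K N} (h : F ∈ J) : NF ι x y m1 m2 J F := ⟨0, 0, 0, 0, 0, by simpa using h⟩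

theorem NF.of {F : MP K N} (f0 f1 f2 f3 f4 : MP K n) (h : F - (ι f0 + ι f1 * x + ι f2 * y + ι f3 * m1 + ι f4 * m2) ∈ J) :
    NF ι x y m1 m2 J F := ⟨f0, f1, f2, f3, f4, h⟩

theorem Dat.nf (h : Dat I π ι x y) (hxx : NF ι x y m1 m2 J (x * x)) (hxy : NF ι x y m1 m2 J (x * y)) (hyy : NF ι x y m1 m2 J (y * y))
    (hx1 : NF ι x y m1 m2 J (x * m1)) (hy1 : NF ι x y m1 m2 J (y * m1)) (hx2 : NF ι x y m1 m2 J (x * m2)) (hy2 : NF ι x y m1 m2 J (y * m2))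
    (F : MP K N) : NF ι x y m1 m2 J F := by
  have nx : NF ι x y m1 m2 J x := ⟨0, 1, 0, 0, 0, by simp⟩
  have ny : NF ι x y m1 m2 J y := ⟨0, 0, 1, 0, 0, by simp⟩
  refine h.gen (NF ι x y m1 m2 J) ⟨1, 0, 0, 0, 0, by simp⟩ (fun a b => NF.add) (fun f a => NF.mul f) ?_ ?_ F
  · rintro a ⟨f0, f1, f2, f3, f4, h⟩
    have := ((((nx.mul f0).add (hxx.mul f1)).add (hxy.mul f2)).add ((hx1.mul f3).add (hx2.mul f4))).add (NF.j (ι := ι) (x := x) (y := y) (m1 := m1) (m2 := m2) (J.mul_mem_left x h))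
    convert this using 1; ring
  · rintro a ⟨f0, f1, f2, f3, f4, h⟩
    have := ((((ny.mul f0).add (hxy.mul f1)).add (hyy.mul f2)).add ((hy1.mul f3).add (hy2.mul f4))).add (NF.j (ι := ι) (x := x) (y := y) (m1 := m1) (m2 := m2) (J.mul_mem_left y h))
    convert this using 1; ring

end

section
variable {K B : Type} [Field K] [CommRing B] [IsDomain B] [Algebra K B] {n N : ℕ} {G : ℕ → Submodule K B}

theorem InVn.smul {j : MP K n →ₐ[K] B} {x y a : B} {k : ℕ} (h : InVn j x y k a) (c : K) : InVn j x y k (c • a) := by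
  obtain ⟨f0, f1, f2, h0, h1, h2, rfl⟩ := h
  refine ⟨C c * f0, C c * f1, C c * f2, h0.C_mul _, h1.C_mul _, h2.C_mul _, ?_⟩
  have : ∀ f, j (C c * f) = c • j f := by intro f; rw [← smul_eq_C_mul, map_smul]
  rw [this, this, this, smul_add, smul_add, smul_mul_assoc, smul_mul_assoc]

theorem no_common {j : MP K n →ₐ[K] B} {x y : B} (hG : Gr j x y G) (h1 : InVn j x y 1 (x * x)) (h2 : InVn j x y 1 (x * y)) : False := by
  obtain ⟨c, a, b, hc, ha, hb, e⟩ := id h1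
  obtain ⟨c', a', b', hc', ha', hb', e'⟩ := id h2
  have hb0 : b = 0 := by
    by_contra hne
    have : InV j x y (j b * (y * y)) := by
      refine ((((h1.inV.mul a').add (h2.inV.mul b')).add (inV_x.mul c')).sub ((h2.inV.mul a).add (inV_y.mul c))).of_eq ?_
      linear_combination x * e' - y * e
    exact hG.nc ⟨h1.inV, h2.inV, (hG.sat 1 _ _ hG.hyy hne this).inV⟩
  subst hb0
  rw [map_zero, zero_mul, add_zero] at e
  have n1 : x - j b' ≠ 0 := by
    intro h
    have := (hG.indep (-b') 1 0 (by rw [← h]; simp; ring)).2.1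
    exact one_ne_zero this
  have n2 : x - j a + j b' ≠ 0 := by
    intro h
    have := (hG.indep (-a + b') 1 0 (by rw [← h]; simp; ring)).2.1
    exact one_ne_zero this
  have hN : j (c + a * b' - b' * b') = (x - j b') * (x - j a + j b') := by
    simp only [map_add, map_sub, map_mul]
    linear_combination -e
  have h3 := (hG.indep (a' * c + c' * (b' - a)) (a' * a + a' * (b' - a) + c') (-(c + a * b' - b' * b')) (by
    rw [map_neg, hN]
    simp only [map_add, map_sub, map_mul]
    linear_combination -(x - j a + j b') * e' - j a' * e)).2.2
  rw [neg_eq_zero] at h3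
  rw [h3, map_zero] at hN
  exact mul_ne_zero n1 n2 hN.symm

variable {I : Ideal (MP K N)} {π : MP K N →ₐ[K] B}
    {ι : MP K n →ₐ[K] MP K N} {x y : MP K N}

theorem ci_gen (h : Dat I π ι x y) (hG : Gr (π.comp ι) (π x) (π y) G) {m1 q1 q2 : MP K N}
    (hm : ∀ f, InV (π.comp ι) (π x) (π y) (π (ι f) * π m1) → f = 0) (h1 : π q1 = 0) (h2 : π q2 = 0)
    (nf : ∀ F, NF ι x y m1 0 (Ideal.span {q1, q2}) F) : I = Ideal.span {q1, q2} := by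
  have hle : Ideal.span {q1, q2} ≤ I := by
    rw [Ideal.span_le]
    rintro z (rfl | rfl)
    · exact (h.ker _).mpr h1
    · exact (h.ker _).mpr h2
  refine le_antisymm (fun F hF => ?_) hle
  obtain ⟨f0, f1, f2, f3, f4, hf⟩ := nf F
  have h0 := (h.ker _).mp (hle hf)
  have hF0 := (h.ker _).mp hF
  simp only [mul_zero, add_zero, map_sub, map_add, map_mul, hF0] at h0
  have e3 : f3 = 0 := hm f3 ⟨-f0, -f1, -f2, by simp only [map_neg, AlgHom.comp_apply]; linear_combination -h0⟩
  subst e3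
  obtain ⟨e0, e1, e2⟩ := hG.indep f0 f1 f2 (by simp only [AlgHom.comp_apply]; simp at h0; linear_combination -h0)
  subst e0; subst e1; subst e2
  simpa using hf

theorem ci_hom (h : Dat I π ι x y) {a : MP K N} (ha : a.IsHomogeneous 2) {p0 p1 p2 : MP K n} (h0 : p0.IsHomogeneous 2)
    (h1 : p1.IsHomogeneous 1) (h2 : p2.IsHomogeneous 1) : (a - (ι p0 + ι p1 * x + ι p2 * y)).IsHomogeneous 2 :=
  ha.sub (((h.ιhom h0).add ((h.ιhom h1).mul h.hx)).add ((h.ιhom h2).mul h.hy))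

theorem case_ciA (h : Dat I π ι x y) (hG : Gr (π.comp ι) (π x) (π y) G) {α β : K}
    (h1 : InVn (π.comp ι) (π x) (π y) 1 (π x * π x - α • (π y * π y))) (h2 : InVn (π.comp ι) (π x) (π y) 1 (π x * π y - β • (π y * π y))) :
    ∃ q1 q2 : MP K N, q1.IsHomogeneous 2 ∧ q2.IsHomogeneous 2 ∧ I = Ideal.span {q1, q2} := by
  have hsm : ∀ (c : K) (b : B), c • b = π (ι (C c)) * b := by
    intro c b; rw [ι_C, Algebra.smul_def]; congr 1; exact (π.commutes c).symm
  by_cases hαβ : α = β * β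
  · exfalso
    obtain ⟨h', hl⟩ := h.change (α := 1) (β := -β) (γ := 0) (δ := 1) (l := 0) (l' := 0) (isHomogeneous_zero _ _ _) (isHomogeneous_zero _ _ _)
      (by simp) (x' := x - ι (C β) * y) (y' := y) (by simp; ring) (by simp)
    have hG' := hG.change hl
    have h2' : InVn (π.comp ι) (π (x - ι (C β) * y)) (π y) 1 (π (x - ι (C β) * y) * π y) := by
      refine InVn.lin hl.symm ?_
      convert h2 using 1
      rw [hsm]; simp only [map_sub, map_mul]; ring
    have h1' : InVn (π.comp ι) (π (x - ι (C β) * y)) (π y) 1 (π (x - ι (C β) * y) * π (x - ι (C β) * y)) := by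
      refine InVn.lin hl.symm ?_
      obtain ⟨f0, f1, f2, k0, k1, k2, e⟩ := h1
      obtain ⟨g0, g1, g2, l0, l1, l2, e'⟩ := h2
      refine ⟨f0 - C (2 * β) * g0, f1 - C (2 * β) * g1, f2 - C (2 * β) * g2, k0.sub (l0.C_mul _), k1.sub (l1.C_mul _), k2.sub (l2.C_mul _), ?_⟩
      subst hαβ
      rw [hsm] at e e'
      simp only [map_sub, map_mul, AlgHom.comp_apply, map_ofNat] at e e' ⊢
      linear_combination e - 2 * π (ι (C β)) * e'
    exact no_common hG' h1' h2'
  · have hm : ∀ f, InV (π.comp ι) (π x) (π y) (π (ι f) * π (y * y)) → f = 0 := by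
      intro f hf
      rw [map_mul] at hf
      refine hG.nc' (f := f) ?_ ?_ hf
      · refine ((h1.inV.mul f).add (hf.mul (C α))).of_eq ?_
        rw [hsm]; simp only [AlgHom.comp_apply]; ring
      · refine ((h2.inV.mul f).add (hf.mul (C β))).of_eq ?_
        rw [hsm]; simp only [AlgHom.comp_apply]; ring
    obtain ⟨p0, p1, p2, k0, k1, k2, e⟩ := h1
    obtain ⟨s0, s1, s2, l0, l1, l2, e'⟩ := h2
    rw [hsm] at e e'
    simp only [AlgHom.comp_apply] at e e'
    have hC : ∀ c : K, (ι (C c)).IsHomogeneous 0 := fun c => by rw [ι_C]; exact isHomogeneous_C _ _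
    have hCy : ∀ c : K, (ι (C c) * (y * y)).IsHomogeneous 2 := fun c => by
      have := (hC c).mul (h.hy.mul h.hy); rwa [zero_add] at this
    refine ⟨x * x - ι (C α) * (y * y) - (ι p0 + ι p1 * x + ι p2 * y), x * y - ι (C β) * (y * y) - (ι s0 + ι s1 * x + ι s2 * y),
      ci_hom h ((h.hx.mul h.hx).sub (hCy _)) k0 k1 k2, ci_hom h ((h.hx.mul h.hy).sub (hCy _)) l0 l1 l2, ?_⟩
    set q1 := x * x - ι (C α) * (y * y) - (ι p0 + ι p1 * x + ι p2 * y) with hq1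
    set q2 := x * y - ι (C β) * (y * y) - (ι s0 + ι s1 * x + ι s2 * y) with hq2
    have m1 : q1 ∈ Ideal.span {q1, q2} := Ideal.subset_span (Or.inl rfl)
    have m2 : q2 ∈ Ideal.span {q1, q2} := Ideal.subset_span (Or.inr rfl)
    refine ci_gen h hG hm (by rw [hq1]; simp only [map_sub, map_add, map_mul]; linear_combination e)
      (by rw [hq2]; simp only [map_sub, map_add, map_mul]; linear_combination e') ?_
    set J := Ideal.span {q1, q2}
    have nxx : NF ι x y (y * y) 0 J (x * x) := NF.of p0 p1 p2 (C α) 0 (by convert m1 using 1; rw [hq1]; ring)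
    have nxy : NF ι x y (y * y) 0 J (x * y) := NF.of s0 s1 s2 (C β) 0 (by convert m2 using 1; rw [hq2]; ring)
    have nyy : NF ι x y (y * y) 0 J (y * y) := NF.of 0 0 0 1 0 (by simp)
    have nx : NF ι x y (y * y) 0 J x := NF.of 0 1 0 0 0 (by simp)
    have ny : NF ι x y (y * y) 0 J y := NF.of 0 0 1 0 0 (by simp)
    have nyyy : NF ι x y (y * y) 0 J (y * (y * y)) := by
      have hc : ι (C (α - β * β)⁻¹) * (ι (C α) - ι (C β) * ι (C β)) = 1 := by
        rw [← map_mul, ← map_sub, ← map_mul, ← map_mul, ← map_sub, ← map_mul, inv_mul_cancel₀ (sub_ne_zero.mpr hαβ), map_one, map_one]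
      have := ((((((ny.mul s0).add (nxy.mul s1)).add (nyy.mul s2)).mul (C β)).add (((nx.mul s0).add (nxx.mul s1)).add (nxy.mul s2))).add
        (((ny.mul (-p0)).add (nxy.mul (-p1))).add (nyy.mul (-p2)))).mul (C (α - β * β)⁻¹)
      have h2 := this.add (NF.j (ι := ι) (x := x) (y := y) (m1 := y * y) (m2 := 0) (J.mul_mem_left (ι (C (α - β * β)⁻¹)) (add_mem (add_mem (J.mul_mem_left (-y) m1) (J.mul_mem_left x m2)) (J.mul_mem_left (ι (C β) * y) m2))))
      convert h2 using 1
      rw [hq1, hq2]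
      simp only [map_neg]
      linear_combination -y * (y * y) * hc
    have nxyy : NF ι x y (y * y) 0 J (x * (y * y)) := by
      have h2 := ((nyyy.mul (C β)).add (((ny.mul s0).add (nxy.mul s1)).add (nyy.mul s2))).add (NF.j (ι := ι) (x := x) (y := y) (m1 := y * y) (m2 := 0) (J.mul_mem_left y m2))
      convert h2 using 1
      rw [hq2]; ring
    exact h.nf nxx nxy nyy nxyy nyyy (by rw [mul_zero]; exact NF.j J.zero_mem) (by rw [mul_zero]; exact NF.j J.zero_mem)

theorem case_ciB (h : Dat I π ι x y) (hG : Gr (π.comp ι) (π x) (π y) G)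
    (h1 : InVn (π.comp ι) (π x) (π y) 1 (π x * π x)) (h2 : InVn (π.comp ι) (π x) (π y) 1 (π y * π y)) :
    ∃ q1 q2 : MP K N, q1.IsHomogeneous 2 ∧ q2.IsHomogeneous 2 ∧ I = Ideal.span {q1, q2} := by
  have hm : ∀ f, InV (π.comp ι) (π x) (π y) (π (ι f) * π (x * y)) → f = 0 := by
    intro f hf
    rw [map_mul] at hf
    exact hG.nc' (f := f) (h1.inV.mul f) hf (h2.inV.mul f)
  obtain ⟨p0, p1, p2, k0, k1, k2, e⟩ := h1
  obtain ⟨s0, s1, s2, l0, l1, l2, e'⟩ := h2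
  simp only [AlgHom.comp_apply] at e e'
  refine ⟨x * x - (ι p0 + ι p1 * x + ι p2 * y), y * y - (ι s0 + ι s1 * x + ι s2 * y),
    ci_hom h (h.hx.mul h.hx) k0 k1 k2, ci_hom h (h.hy.mul h.hy) l0 l1 l2, ?_⟩
  set q1 := x * x - (ι p0 + ι p1 * x + ι p2 * y) with hq1
  set q2 := y * y - (ι s0 + ι s1 * x + ι s2 * y) with hq2
  have m1 : q1 ∈ Ideal.span {q1, q2} := Ideal.subset_span (Or.inl rfl)
  have m2 : q2 ∈ Ideal.span {q1, q2} := Ideal.subset_span (Or.inr rfl)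
  refine ci_gen h hG hm (by rw [hq1]; simp only [map_sub, map_add, map_mul]; linear_combination e)
    (by rw [hq2]; simp only [map_sub, map_add, map_mul]; linear_combination e') ?_
  set J := Ideal.span {q1, q2}
  have nxx : NF ι x y (x * y) 0 J (x * x) := NF.of p0 p1 p2 0 0 (by convert m1 using 1; rw [hq1, map_zero]; ring)
  have nyy : NF ι x y (x * y) 0 J (y * y) := NF.of s0 s1 s2 0 0 (by convert m2 using 1; rw [hq2, map_zero]; ring)
  have nxy : NF ι x y (x * y) 0 J (x * y) := NF.of 0 0 0 1 0 (by simp)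
  have nx : NF ι x y (x * y) 0 J x := NF.of 0 1 0 0 0 (by simp)
  have ny : NF ι x y (x * y) 0 J y := NF.of 0 0 1 0 0 (by simp)
  have n1 : NF ι x y (x * y) 0 J (x * (x * y)) := by
    have h2 := (((ny.mul p0).add (nxy.mul p1)).add (nyy.mul p2)).add (NF.j (ι := ι) (x := x) (y := y) (m1 := x * y) (m2 := 0) (J.mul_mem_left y m1))
    convert h2 using 1
    rw [hq1]; ring
  have n2 : NF ι x y (x * y) 0 J (y * (x * y)) := by
    have h2 := (((nx.mul s0).add (nxx.mul s1)).add (nxy.mul s2)).add (NF.j (ι := ι) (x := x) (y := y) (m1 := x * y) (m2 := 0) (J.mul_mem_left x m2))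
    convert h2 using 1
    rw [hq2]; ring
  exact h.nf nxx nxy nyy n1 n2 (by rw [mul_zero]; exact NF.j J.zero_mem) (by rw [mul_zero]; exact NF.j J.zero_mem)

theorem case_ci (h : Dat I π ι x y) (hG : Gr (π.comp ι) (π x) (π y) G) {a0 a1 a2 : K} (hne : ¬ (a0 = 0 ∧ a1 = 0 ∧ a2 = 0))
    (h1 : InVn (π.comp ι) (π x) (π y) 1 (a0 • (π x * π y) - a1 • (π x * π x)))
    (h2 : InVn (π.comp ι) (π x) (π y) 1 (a0 • (π y * π y) - a2 • (π x * π x)))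
    (h3 : InVn (π.comp ι) (π x) (π y) 1 (a1 • (π y * π y) - a2 • (π x * π y))) :
    ∃ q1 q2 : MP K N, q1.IsHomogeneous 2 ∧ q2.IsHomogeneous 2 ∧ I = Ideal.span {q1, q2} := by
  by_cases e2 : a2 = 0
  · by_cases e0 : a0 = 0
    · have e1 : a1 ≠ 0 := fun h => hne ⟨e0, h, e2⟩
      refine case_ciB h hG ?_ ?_
      · have := h1.smul (-a1⁻¹)
        rw [e0, zero_smul, zero_sub, smul_neg, neg_smul, neg_neg, smul_smul, inv_mul_cancel₀ e1, one_smul] at this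
        exact this
      · have := h3.smul (a1⁻¹)
        rw [e2, zero_smul, sub_zero, smul_smul, inv_mul_cancel₀ e1, one_smul] at this
        exact this
    · obtain ⟨h', hl⟩ := h.change (α := 0) (β := 1) (γ := 1) (δ := 0) (l := 0) (l' := 0) (isHomogeneous_zero _ _ _) (isHomogeneous_zero _ _ _)
        (by simp) (x' := y) (y' := x) (by simp) (by simp)
      refine case_ciA h' (hG.change hl) (α := 0) (β := a0⁻¹ * a1) (InVn.lin hl.symm ?_) (InVn.lin hl.symm ?_)
      · have := h2.smul (a0⁻¹)
        rw [e2, zero_smul, sub_zero, smul_smul, inv_mul_cancel₀ e0, one_smul] at this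
        rw [zero_smul, sub_zero]; exact this
      · have := h1.smul (a0⁻¹)
        rw [smul_sub, smul_smul, smul_smul, inv_mul_cancel₀ e0, one_smul] at this
        rw [mul_comm (π y) (π x)]; exact this
  · refine case_ciA h hG (α := a2⁻¹ * a0) (β := a2⁻¹ * a1) ?_ ?_
    · have := h2.smul (-a2⁻¹)
      rw [smul_sub, smul_smul, smul_smul, neg_mul, neg_mul, inv_mul_cancel₀ e2, neg_smul, neg_smul, one_smul] at this
      convert this using 1; abel
    · have := h3.smul (-a2⁻¹)
      rw [smul_sub, smul_smul, smul_smul, neg_mul, neg_mul, inv_mul_cancel₀ e2, neg_smul, neg_smul, one_smul] at this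
      convert this using 1; abel

end

section
variable {K B : Type} [Field K] [CommRing B] [IsDomain B] [Algebra K B] {n N : ℕ} {G : ℕ → Submodule K B}
  {j : MP K n →ₐ[K] B} {x y : B} {c0 c1 c2 : MP K n}

theorem pair_li {c d : MP K n} (hc : c.IsHomogeneous 1) (hd : d.IsHomogeneous 1)
    (h : ¬ ∃ (l : MP K n) (a b : K), l.IsHomogeneous 1 ∧ c = C a * l ∧ d = C b * l) : LinearIndependent K ![c, d] := by
  rw [LinearIndependent.pair_iff]
  intro s t hst
  rw [smul_eq_C_mul, smul_eq_C_mul] at hst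
  by_contra hne
  apply h
  by_cases hs : s = 0
  · have ht : t ≠ 0 := fun ht => hne ⟨hs, ht⟩
    subst hs
    refine ⟨c, 1, 0, hc, by simp, ?_⟩
    simp only [map_zero, zero_mul, zero_add] at hst ⊢
    exact (mul_eq_zero.mp hst).resolve_left (C_ne_zero.mpr ht)
  · refine ⟨d, -(s⁻¹ * t), 1, hd, ?_, by simp⟩
    have : C s⁻¹ * C s = (1 : MP K n) := by rw [← C_mul, inv_mul_cancel₀ hs, C_1]
    simp only [map_neg, C_mul]
    linear_combination C s⁻¹ * hst - c * this

theorem LI2.swap {c d : MP K n} (h : LinearIndependent K ![c, d]) : LinearIndependent K ![d, c] := by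
  rw [LinearIndependent.pair_iff] at h ⊢
  intro s t hst
  exact (h t s (by rw [← hst]; ring)).symm

theorem LI2.ne {c d : MP K n} (h : LinearIndependent K ![c, d]) : c ≠ 0 ∧ d ≠ 0 :=
  ⟨h.ne_zero 0, h.ne_zero 1⟩

theorem Gr.ne (h : Gr j x y G) : x ≠ 0 ∧ y ≠ 0 :=
  ⟨fun e => one_ne_zero (h.indep 0 1 0 (by simp [e])).2.1, fun e => one_ne_zero (h.indep 0 0 1 (by simp [e])).2.2⟩

theorem Gr.indep2 (h : Gr j x y G) {f0 f1 f2 g0 g1 g2 : MP K n} (e : j f0 + j f1 * x + j f2 * y = j g0 + j g1 * x + j g2 * y) :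
    f0 = g0 ∧ f1 = g1 ∧ f2 = g2 := by
  obtain ⟨e0, e1, e2⟩ := h.indep (f0 - g0) (f1 - g1) (f2 - g2) (by simp only [map_sub]; linear_combination e)
  exact ⟨sub_eq_zero.mp e0, sub_eq_zero.mp e1, sub_eq_zero.mp e2⟩

theorem Gr.div (h : Gr j x y G) {k : ℕ} {a : B} (ha : a ∈ G (k+1)) {c : MP K n} (hc : c ≠ 0) {f0 f1 f2 : MP K n}
    (e : j c * a = j f0 + j f1 * x + j f2 * y) : ∃ g0 g1 g2 : MP K n, g0.IsHomogeneous (k+1) ∧ g1.IsHomogeneous k ∧ g2.IsHomogeneous k ∧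
      f0 = c * g0 ∧ f1 = c * g1 ∧ f2 = c * g2 ∧ a = j g0 + j g1 * x + j g2 * y := by
  obtain ⟨g0, g1, g2, k0, k1, k2, rfl⟩ := h.sat k a c ha hc ⟨_, _, _, e⟩
  obtain ⟨e0, e1, e2⟩ := h.indep2 (f0 := c * g0) (f1 := c * g1) (f2 := c * g2) (g0 := f0) (g1 := f1) (g2 := f2) (by rw [← e]; simp only [map_mul]; ring)
  exact ⟨g0, g1, g2, k0, k1, k2, e0.symm, e1.symm, e2.symm, rfl⟩

theorem Gr1.xy1 (h : Gr1 j x y G c0 0 c2) : ∃ f0 f1 f2 : MP K n, f0.IsHomogeneous 2 ∧ f1.IsHomogeneous 1 ∧ f2.IsHomogeneous 1 ∧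
    x * y = j f0 + j f1 * x + j f2 * y := h.zero (k := 1) h.hxy h.chi1

theorem Gr1.xyLI (h : Gr1 j x y G c0 0 c2) : LinearIndependent K ![c0, c2] := by
  refine pair_li h.h0 h.h2 ?_
  rintro ⟨l, a, b, hl, e1, e2⟩
  exact h.line ⟨l, a, 0, b, hl, e1, by simp, e2⟩

theorem Gr1.xy2 (h : Gr1 j x y G c0 0 c2) {nn : MP K n} (hn : nn.IsHomogeneous 2) (e : x * y = j nn) :
    ∃ (p q e : MP K n) (ν : K), p.IsHomogeneous 1 ∧ q.IsHomogeneous 1 ∧ e.IsHomogeneous 1 ∧ ν ≠ 0 ∧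
      x * y = j (C ν * c0 * c2) ∧ j c2 * (x * x) - j c0 * (y * y) = j (c2 * p) * x - j (c0 * q) * y + j (c0 * c2 * e) ∧
      x * (x * x) - j p * (x * x) = j (C ν * c0 * c0) * y - j (C ν * c0 * c0 * q) + j (c0 * e) * x ∧
      y * (y * y) - j q * (y * y) = j (C ν * c2 * c2) * x - j (C ν * c2 * c2 * p) - j (c2 * e) * y := by
  have hli := h.xyLI
  have hG := h.toGr
  obtain ⟨n0, n2⟩ := LI2.ne hli
  have jinj : ∀ f g, j f = j g → f = g := fun f g hfg => (hG.indep2 (f0 := f) (g0 := g) (f1 := 0) (f2 := 0) (g1 := 0) (g2 := 0) (by rw [hfg])).1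
  have jne : ∀ f, f ≠ 0 → j f ≠ 0 := fun f hf hj => hf (jinj f 0 (by rw [hj, map_zero]))
  obtain ⟨R, P, Q, hR, hP, hQ, er⟩ : InVn j x y 2 (j c2 * (x * x) - j c0 * (y * y)) := by
    refine h.zero (k := 2) ?_ ?_
    · exact Submodule.sub_mem _ (hG.mul 1 2 _ _ (hG.hj _ _ h.h2) hG.hxx) (hG.mul 1 2 _ _ (hG.hj _ _ h.h0) hG.hyy)
    · refine ((h.chi0.mul c2).add (h.chi2.mul (-c0))).of_eq ?_ ?_
      · rw [map_neg]; ring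
      · ring
  obtain ⟨F, hF, cF⟩ := h.ex 2 (x * (x * x)) (hG.mul 1 2 _ _ hG.hx hG.hxx)
  obtain ⟨F', hF', cF'⟩ := h.ex 2 (y * (y * y)) (hG.mul 1 2 _ _ hG.hy hG.hyy)
  have ex : j c2 * (x * (x * x)) = j P * (x * x) + (j (Q * nn) + j R * x + j (c0 * nn) * y) := by
    simp only [map_mul]; linear_combination x * er + (j c0 * y + j Q) * e
  have ey : j c0 * (y * (y * y)) = j (-Q) * (y * y) + (j (-(P * nn)) + j (c2 * nn) * x + j (-R) * y) := by
    simp only [map_mul, map_neg]; linear_combination -y * er + (j c2 * x - j P) * e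
  have kx : c2 * F = P * c0 + 0 := (cF.mul c2).unique hG (((h.chi0.mul P).add (InV.chi ⟨_, _, _, rfl⟩)).of_eq ex rfl)
  have ky : c0 * F' = -Q * c2 + 0 := (cF'.mul c0).unique hG (((h.chi2.mul (-Q)).add (InV.chi ⟨_, _, _, rfl⟩)).of_eq ey rfl)
  obtain ⟨p, hp, eP⟩ := hom_dvd (k := 1) h.h2 hP (lin_dvd2 h.h2 h.h0 (LI2.swap hli) ⟨F, by linear_combination -kx⟩)
  obtain ⟨q, hq, eQ⟩ := hom_dvd (k := 1) h.h0 hQ (lin_dvd2 h.h0 h.h2 hli ⟨-F', by linear_combination ky⟩)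
  subst eP; subst eQ
  obtain ⟨a0, a1, a2, -, ha1, ha2, -, f1, f2, ea⟩ := hG.div (k := 2) (Submodule.sub_mem _ (hG.mul 1 2 _ _ hG.hx hG.hxx) (hG.mul 1 2 _ _ (hG.hj _ _ hp) hG.hxx)) n2
    (a := x * (x * x) - j p * (x * x)) (c := c2) (f0 := c0 * q * nn) (f1 := R) (f2 := c0 * nn) (by rw [mul_sub, ex, map_mul j c2 p]; ring)
  obtain ⟨b0, b1, b2, -, hb1, hb2, -, g1, g2, eb⟩ := hG.div (k := 2) (Submodule.add_mem _ (hG.mul 1 2 _ _ hG.hy hG.hyy) (hG.mul 1 2 _ _ (hG.hj _ _ hq) hG.hyy)) n0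
    (a := y * (y * y) + j q * (y * y)) (c := c0) (f0 := -(c2 * p * nn)) (f1 := c2 * nn) (f2 := -R) (by rw [mul_add, ey, map_neg, map_mul j c0 q]; ring)
  obtain ⟨n1, hn1, en1⟩ := hom_dvd (k := 1) h.h2 hn (lin_dvd2 h.h2 h.h0 (LI2.swap hli) ⟨_, f2⟩)
  obtain ⟨n3, hn3, en3⟩ := hom_dvd (k := 0) h.h0 hn1 (lin_dvd2 h.h0 h.h2 hli (lin_dvd2 h.h0 h.h2 hli ⟨b1, by rw [← en1, g1]⟩))
  obtain ⟨ν, rfl⟩ := hom_zero hn3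
  obtain ⟨e', he', ee'⟩ := hom_dvd (k := 1) h.h0 ha1 (lin_dvd2 h.h0 h.h2 hli ⟨-b2, by rw [← f1]; linear_combination -g2⟩)
  subst ee'; subst f1; subst en3; subst en1
  have xy : x * y = j (C ν * c0 * c2) := by rw [e]; congr 1; ring
  refine ⟨p, -q, e', ν, hp, hq.neg, he', ?_, xy, ?_, ?_, ?_⟩
  · rintro rfl
    simp only [map_zero, zero_mul] at xy
    exact mul_ne_zero hG.ne.1 hG.ne.2 xy
  · rw [er]; simp only [map_mul, map_neg]; ring
  · apply mul_left_cancel₀ (jne _ n2)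
    rw [mul_sub, ex]; simp only [map_mul, map_neg]; ring
  · apply mul_left_cancel₀ (jne _ n0)
    rw [mul_sub, ey]; simp only [map_mul, map_neg]; ring

/-- closing the non normal case -/
theorem Dat.close {I J : Ideal (MP K N)} {π : MP K N →ₐ[K] B}
    {ι : MP K n →ₐ[K] MP K N} {x y m1 m2 : MP K N} (h : Dat I π ι x y)
    (hG : Gr1 (π.comp ι) (π x) (π y) G c0 c1 c2) {d1 d2 : MP K n} (hd1 : d1.IsHomogeneous 1) (hd2 : d2.IsHomogeneous 1)
    (hli : LinearIndependent K ![d1, d2])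
    (k1 : Chi (π.comp ι) (π x) (π y) c0 c1 c2 (π m1) d1) (k2 : Chi (π.comp ι) (π x) (π y) c0 c1 c2 (π m2) d2) (hJ : J ≤ I)
    {v0 v1 v2 : MP K n} (hr : ι d2 * m1 - ι d1 * m2 - (ι v0 + ι v1 * x + ι v2 * y) ∈ J)
    (nf : ∀ F, NF ι x y m1 m2 J F) : I = J := by
  refine le_antisymm (fun F hF => ?_) hJ
  obtain ⟨f0, f1, f2, f3, f4, hf⟩ := nf F
  have h0 := (h.ker _).mp (hJ hf)
  have hF0 := (h.ker _).mp hF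
  simp only [map_sub, map_add, map_mul, hF0] at h0
  have e := Chi.unique hG.toGr (((k1.mul f3).add (k2.mul f4))) (InV.chi ⟨-f0, -f1, -f2, by simp only [map_neg, AlgHom.comp_apply]; linear_combination -h0⟩)
  obtain ⟨g, rfl⟩ := lin_dvd2 hd2 hd1 (LI2.swap hli) (F := f3) ⟨-f4, by linear_combination e⟩
  have e4 : f4 = -(g * d1) := by
    apply mul_left_cancel₀ (LI2.ne hli).2
    linear_combination e
  subst e4
  have hr0 := (h.ker _).mp (hJ hr)
  simp only [map_sub, map_add, map_mul] at hr0
  simp only [map_mul, map_neg] at h0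
  obtain ⟨e0, e1, e2⟩ := hG.indep (f0 + g * v0) (f1 + g * v1) (f2 + g * v2) (by
    simp only [AlgHom.comp_apply, map_add, map_mul]; linear_combination -h0 - π (ι g) * hr0)
  have := add_mem hf (J.mul_mem_left (ι g) hr)
  convert this using 1
  have e0' := congrArg ι e0; have e1' := congrArg ι e1; have e2' := congrArg ι e2
  simp only [map_add, map_mul, map_zero, map_neg] at e0' e1' e2' ⊢
  linear_combination e0' + x * e1' + y * e2'

/-- form b -/
def FormB (I : Ideal (MP K N)) : Prop :=
  ∃ X W U Z A0 A1 A2 : MP K N, X.IsHomogeneous 1 ∧ W.IsHomogeneous 1 ∧ U.IsHomogeneous 1 ∧ Z.IsHomogeneous 1 ∧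
    A0.IsHomogeneous 1 ∧ A1.IsHomogeneous 1 ∧ A2.IsHomogeneous 1 ∧ LinearIndependent K ![X, W, U, Z] ∧
    (¬ X * W - U * Z ∣ Z * Z * A0 + Z * W * A1 + W * W * A2) ∧
    I = Ideal.span {X * W - U * Z, X * X * A0 + X * U * A1 + U * U * A2, X * Z * A0 + X * W * A1 + U * W * A2,
      Z * Z * A0 + Z * W * A1 + W * W * A2}

theorem li4 {X W U Z : MP K N} (h : ∀ a b c d : K, C a * X + C b * W + C c * U + C d * Z = 0 → a = 0 ∧ b = 0 ∧ c = 0 ∧ d = 0) :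
    LinearIndependent K ![X, W, U, Z] := by
  rw [Fintype.linearIndependent_iff]
  intro g hg
  rw [Fin.sum_univ_four] at hg
  simp only [smul_eq_C_mul] at hg
  obtain ⟨h0, h1, h2, h3⟩ := h _ _ _ _ hg
  intro i
  fin_cases i <;> assumption

theorem LI2.c {c d : MP K n} (h : LinearIndependent K ![c, d]) {a b : K} (e : C a * c + C b * d = 0) : a = 0 ∧ b = 0 := by
  rw [LinearIndependent.pair_iff] at h
  exact h a b (by rwa [smul_eq_C_mul, smul_eq_C_mul])

variable {I : Ideal (MP K N)} {π : MP K N →ₐ[K] B}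
    {ι : MP K n →ₐ[K] MP K N} {X Y : MP K N}

/-- The point where all coordinates but the second of the two extra ones vanish. -/
theorem Dat.point (h : Dat I π ι X Y) : ∃ κ : MP K N →ₐ[K] K, κ X = 0 ∧ κ Y = 1 ∧
    ∀ f : MP K n, f.IsHomogeneous 1 → κ (ι f) = 0 := by
  obtain rfl := h.hN
  let l : Fin (n + 2) → MP K (n + 2) := Fin.cons X (Fin.cons Y fun i => ι (MvPolynomial.X i))
  have hl1 : ∀ i, (l i).IsHomogeneous 1 := by
    intro i
    refine Fin.cases h.hx (fun i => Fin.cases h.hy (fun i => h.hι i) i) i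
  have hl : LinearIndependent K l := by
    rw [Fintype.linearIndependent_iff]
    intro g hg
    rw [Fin.sum_univ_succ, Fin.sum_univ_succ] at hg
    obtain ⟨h0, h1, h2⟩ := h.li (g 0) (g 1) (∑ i : Fin n, C (g i.succ.succ) * MvPolynomial.X i)
      (IsHomogeneous.sum _ _ _ fun i _ => (isHomogeneous_X K i).C_mul _) (by
        rw [← hg, map_sum]
        simp [l, smul_eq_C_mul, add_assoc])
    have h3 := Fintype.linearIndependent_iff.mp (X_li (K := K) (N := n)) (fun i => g i.succ.succ) (by simpa [smul_eq_C_mul] using h2)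
    intro i
    exact Fin.cases h0 (fun i => Fin.cases h1 (fun i => h3 i) i) i
  obtain ⟨e, he, -⟩ := lin_equiv hl1 hl
  have hs : ∀ i, e.symm (l i) = MvPolynomial.X i := fun i => by rw [← he i, AlgEquiv.symm_apply_apply]
  let κ : MP K (n + 2) →ₐ[K] K := (aeval (fun i : Fin (n + 2) => if i = 1 then (1 : K) else 0)).comp e.symm.toAlgHom
  have hκ : ∀ i, κ (l i) = if i = 1 then 1 else 0 := fun i => by
    show aeval _ (e.symm (l i)) = _
    rw [hs, aeval_X]
  refine ⟨κ, by simpa using (show κ X = _ from hκ 0), by simpa using (show κ Y = _ from hκ 1), fun f hf => ?_⟩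
  have h4 : (κ.comp ι) = aeval (fun _ => (0 : K)) := by
    apply algHom_ext
    intro i
    have : κ (ι (MvPolynomial.X i)) = _ := hκ i.succ.succ
    rw [if_neg (by rw [Fin.ext_iff]; simp)] at this
    simpa using this
  show κ.comp ι f = 0
  rw [h4]
  rw [show (fun _ : Fin n => (0 : K)) = 0 from rfl, aeval_zero, constantCoeff_eq, hf.coeff_eq_zero (by simp)]
  simp

theorem case_xy1 (h : Dat I π ι X Y) (hG : Gr1 (π.comp ι) (π X) (π Y) G c0 0 c2) {nn : MP K n} (hn : nn.IsHomogeneous 2)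
    (e : π X * π Y = (π.comp ι) nn) : FormB I := by
  obtain ⟨p, q, e, ν, hp, hq, he, hν, e1, e2, e3, e4⟩ := hG.xy2 hn e
  have hli := hG.xyLI
  simp only [AlgHom.comp_apply] at e1 e2 e3 e4
  refine ⟨X, Y, ι c0, ι (C ν * c2), X - ι p, - ι e, - ι (C ν) * (Y - ι q), h.hx, h.hy, h.ιhom hG.h0, h.ιhom (hG.h2.C_mul _), h.hx.sub (h.ιhom hp), (h.ιhom he).neg, ?_, ?_, ?_, ?_⟩
  · rw [ι_C, ← C_neg]; exact (h.hy.sub (h.ιhom hq)).C_mul _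
  · refine li4 fun a b c d he => ?_
    obtain ⟨ha, hb, hc⟩ := h.li a b (C c * c0 + C (d * ν) * c2) ((hG.h0.C_mul _).add (hG.h2.C_mul _)) (by
      rw [← he]; simp only [map_add, map_mul, ι_C]; ring)
    obtain ⟨hc, hd⟩ := LI2.c hli hc
    exact ⟨ha, hb, hc, (mul_eq_zero.mp hd).resolve_right hν⟩
  · rintro ⟨u, hu⟩
    obtain ⟨κ, k1, k2, k3⟩ := h.point
    have hu := congrArg κ hu
    simp only [map_add, map_mul, map_sub, map_neg, k1, k2, k3 _ hG.h0, k3 _ hq, ι_C] at hu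
    rw [show κ (ι c2) = 0 from k3 _ hG.h2] at hu
    have h5 : κ (C ν) = ν := κ.commutes ν
    rw [h5] at hu
    apply hν
    linear_combination -hu
  · set q1 := X * Y - ι c0 * ι (C ν * c2) with hq1
    set q2 := X * X * (X - ι p) + X * ι c0 * (-ι e) + ι c0 * ι c0 * (- ι (C ν) * (Y - ι q)) with hq2
    set q3 := X * ι (C ν * c2) * (X - ι p) + X * Y * (-ι e) + ι c0 * Y * (- ι (C ν) * (Y - ι q)) with hq3
    set q4 := ι (C ν * c2) * ι (C ν * c2) * (X - ι p) + ι (C ν * c2) * Y * (-ι e) + Y * Y * (- ι (C ν) * (Y - ι q)) with hq4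
    set J := Ideal.span {q1, q2, q3, q4} with hJ
    have m1 : q1 ∈ J := Ideal.subset_span (by simp)
    have m2 : q2 ∈ J := Ideal.subset_span (by simp)
    have m3 : q3 ∈ J := Ideal.subset_span (by simp)
    have m4 : q4 ∈ J := Ideal.subset_span (by simp)
    have hc : ι (C ν⁻¹) * ι (C ν) = 1 := by rw [← map_mul, ← C_mul, inv_mul_cancel₀ hν, C_1, map_one]
    have hnxy : NF ι X Y (X * X) (Y * Y) J (X * Y) := NF.of (C ν * c0 * c2) 0 0 0 0 (by
      convert m1 using 1; rw [hq1]; simp only [map_mul, map_zero]; ring)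
    refine h.close hG (d1 := c0) (d2 := c2) (m1 := X * X) (m2 := Y * Y) hG.h0 hG.h2 hli (by rw [map_mul]; exact hG.chi0) (by rw [map_mul]; exact hG.chi2) ?_
      (v0 := c0 * c2 * e) (v1 := c2 * p) (v2 := -(c0 * q)) ?_ ?_
    · rw [hJ, Ideal.span_le]
      simp only [map_mul] at e1 e2 e3 e4
      rintro z (rfl | rfl | rfl | rfl)
      · refine (h.ker _).mpr ?_; rw [hq1]; simp only [map_sub, map_mul]; linear_combination e1
      · refine (h.ker _).mpr ?_; rw [hq2]; simp only [map_sub, map_mul, map_add, map_neg]; linear_combination e3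
      · refine (h.ker _).mpr ?_; rw [hq3]; simp only [map_sub, map_mul, map_add, map_neg]; linear_combination π (ι (C ν)) * e2 - π (ι e) * e1
      · refine (h.ker _).mpr ?_; rw [hq4]; simp only [map_sub, map_mul, map_add, map_neg]; linear_combination -π (ι (C ν)) * e4
    · convert J.mul_mem_left (ι (C ν⁻¹)) (add_mem m3 (J.mul_mem_left (ι e) m1)) using 1
      rw [hq3, hq1]; simp only [map_mul, map_neg]
      linear_combination (-(ι c2) * (X * X) + ι c0 * (Y * Y) + ι c0 * ι c2 * ι e + ι c2 * ι p * X - ι c0 * ι q * Y) * hc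
    · refine h.nf (NF.of 0 0 0 1 0 (by simp)) hnxy (NF.of 0 0 0 0 1 (by simp)) ?_ ?_ ?_ ?_
      · refine NF.of (-(C ν * c0 * c0 * q)) (c0 * e) (C ν * c0 * c0) p 0 ?_
        convert m2 using 1; rw [hq2]; simp only [map_mul, map_neg, map_zero]; ring
      · refine NF.of 0 (C ν * c0 * c2) 0 0 0 ?_
        convert J.mul_mem_left X m1 using 1; rw [hq1]; simp only [map_mul, map_neg, map_zero]; ring
      · refine NF.of 0 0 (C ν * c0 * c2) 0 0 ?_
        convert J.mul_mem_left Y m1 using 1; rw [hq1]; simp only [map_mul, map_neg, map_zero]; ring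
      · refine NF.of (-(C ν * c2 * c2 * p)) (C ν * c2 * c2) (-(c2 * e)) 0 q ?_
        convert J.mul_mem_left (-ι (C ν⁻¹)) m4 using 1; rw [hq4]; simp only [map_mul, map_neg, map_zero]
        linear_combination (-Y^3 + ι c2 ^2 * X * ι (C ν) - ι c2 ^2 * ι (C ν) * ι p - ι c2 * ι e * Y + ι q * Y^2) * hc

theorem case_xy (h : Dat I π ι X Y) (hG : Gr1 (π.comp ι) (π X) (π Y) G c0 0 c2) : FormB I := by
  obtain ⟨f0, f1, f2, h0, h1, h2, e⟩ := hG.xy1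
  obtain ⟨h', hl⟩ := h.change (α := 1) (β := 0) (γ := 0) (δ := 1) (l := -f2) (l' := -f1) h2.neg h1.neg (by simp)
    (x' := X - ι f2) (y' := Y - ι f1) (by simp; ring) (by simp; ring)
  have hG' := hG.change hl
  simp only [map_one, map_zero, mul_zero, zero_mul, add_zero, zero_add, mul_one, one_mul] at hG'
  refine case_xy1 h' hG' (nn := f0 + f1 * f2) (h0.add (h1.mul h2)) ?_
  simp only [AlgHom.comp_apply, map_sub, map_add, map_mul] at e ⊢
  linear_combination e

end

section
variable {K B : Type} [Field K] [CommRing B] [IsDomain B] [Algebra K B] {n N : ℕ} {G : ℕ → Submodule K B}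
  {j : MP K n →ₐ[K] B} {x y : B} {a b : MP K n}

theorem Gr.jne (hG : Gr j x y G) {f : MP K n} (hf : f ≠ 0) : j f ≠ 0 := fun h => hf (hG.indep f 0 0 (by simp [h])).1

theorem Gr1.x2LI (h : Gr1 j x y G 0 a b) : LinearIndependent K ![a, b] := by
  refine pair_li h.h1 h.h2 ?_
  rintro ⟨l, s, t, hl, e1, e2⟩
  exact h.line ⟨l, 0, s, t, hl, by simp, e1, e2⟩

theorem Gr1.x2a (h : Gr1 j x y G 0 a b) : ∃ (κ l n' Q' P R' : MP K n) (μ : K), κ.IsHomogeneous 1 ∧ l.IsHomogeneous 1 ∧ n'.IsHomogeneous 1 ∧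
    Q'.IsHomogeneous 1 ∧ P.IsHomogeneous 2 ∧ R'.IsHomogeneous 2 ∧
    (x - j κ) * (x - j κ) = j l * (x - j κ) + j (C μ * a) * y + j (a * n') ∧
    j b * ((x - j κ) * y) - j a * (y * y) = j P * (x - j κ) + j (a * Q') * y + j (a * R') := by
  have hli := h.x2LI
  have hG := h.toGr
  obtain ⟨na, nb⟩ := LI2.ne hli
  have dv : ∀ F, a ∣ b * F → a ∣ F := fun F => lin_dvd2 h.h1 h.h2 hli
  obtain ⟨nn, l, m, hn, hl, hm, ex⟩ := h.zero (k := 1) h.hxx h.chi0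
  obtain ⟨R, P, Q, hR, hP, hQ, er⟩ : InVn j x y 2 (j b * (x * y) - j a * (y * y)) := by
    refine h.zero (k := 2) ?_ ?_
    · exact Submodule.sub_mem _ (hG.mul 1 2 _ _ (hG.hj _ _ h.h2) hG.hxy) (hG.mul 1 2 _ _ (hG.hj _ _ h.h1) hG.hyy)
    · refine ((h.chi1.mul b).add (h.chi2.mul (-a))).of_eq ?_ ?_
      · rw [map_neg]; ring
      · ring
  have hxyy : x * (y * y) ∈ G (2+1) := hG.mul 1 2 _ _ hG.hx hG.hyy
  obtain ⟨F, hF, cF⟩ := h.ex 2 (x * (y * y)) hxyy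
  have e1 : j a * (x * (y * y)) = j (b * l - Q) * (x * y) + j (b * m) * (y * y) + (j (-(P * nn)) + j (-(P * l) - R) * x + j (b * nn - P * m) * y) := by
    simp only [map_mul, map_sub, map_neg]; linear_combination -x * er + (j b * y - j P) * ex
  have k1 := (cF.mul a).unique hG ((((h.chi1.mul (b * l - Q)).add (h.chi2.mul (b * m))).add (InV.chi ⟨_, _, _, rfl⟩)).of_eq e1 rfl)
  obtain ⟨m', hm', em⟩ := hom_dvd (k := 0) h.h1 hm (dv _ (dv _ ⟨F - (b * l - Q), by linear_combination -k1⟩))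
  obtain ⟨μ, rfl⟩ := hom_zero hm'
  subst em
  have e2 : j a * (j b * (x * (y * y) - j (l + C μ * b) * (y * y)) + j Q * (y * y)) = j (b * (l * R - P * nn) - Q * R) + j (-(b * R) - Q * P) * x
      + j (b * (l * Q + b * nn - P * (a * C μ)) - Q * Q) * y := by
    simp only [map_mul, map_sub, map_neg, map_add] at e1 ⊢
    linear_combination j b * e1 + (j b * j l - j Q) * er
  obtain ⟨g0, g1, g2, -, -, -, f0, f1, f2, -⟩ := hG.div (k := 3) (by
    refine Submodule.add_mem _ (hG.mul 1 3 _ _ (hG.hj _ _ h.h2) (Submodule.sub_mem _ hxyy ?_)) (hG.mul 2 2 _ _ (hG.hj _ _ hQ) hG.hyy)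
    exact hG.mul 1 2 _ _ (hG.hj _ _ (hl.add (h.h2.C_mul _))) hG.hyy) na e2
  obtain ⟨u, hu⟩ := lin_sq h.h1 h.h2 hli (F := Q) (G := l * Q + b * nn) ⟨- g2 - b * P * C μ, by linear_combination -f2⟩
  obtain ⟨Q', κ, hQ', hκ, eQ⟩ := hom_two (k := 1) h.h1 h.h2 hQ hu
  obtain ⟨n', hn', en⟩ := hom_dvd (k := 1) h.h1 (F := nn + l * κ - κ * κ) ((hn.add (hl.mul hκ)).sub (hκ.mul hκ)) (by
    refine dv _ (dv _ ⟨g2 + b * P * C μ - b * l * Q' + Q' * (Q + b * κ), ?_⟩)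
    linear_combination f2 + (-b * l + Q + b * κ) * eQ)
  obtain ⟨R', hR', eR⟩ := hom_dvd (k := 2) h.h1 (F := R + P * κ) (hR.add (hP.mul hκ)) (by
    refine dv _ ⟨-g1 - Q' * P, ?_⟩
    linear_combination -f1 - P * eQ)
  refine ⟨κ, l - 2 * κ, n', Q', P, R', μ, hκ, ?_, hn', hQ', hP, hR', ?_, ?_⟩
  · have : (2 : MP K n) = C 2 := (map_ofNat C 2).symm
    rw [this]; exact hl.sub (hκ.C_mul _)
  · rw [← en]; simp only [map_mul, map_sub, map_add, map_ofNat] at ex ⊢; linear_combination ex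
  · rw [← eR]
    have eQ' := congrArg j eQ
    simp only [map_mul, map_sub, map_add] at er eQ' ⊢; linear_combination er + y * eQ'

theorem Gr1.x2b (h : Gr1 j x y G 0 a b) {l n' Q' P R' : MP K n} {μ : K} (hl : l.IsHomogeneous 1) (hn' : n'.IsHomogeneous 1)
    (hQ' : Q'.IsHomogeneous 1) (hP : P.IsHomogeneous 2) (hR' : R'.IsHomogeneous 2)
    (ex : x * x = j l * x + j (C μ * a) * y + j (a * n'))
    (er : j b * (x * y) - j a * (y * y) = j P * x + j (a * Q') * y + j (a * R')) :
    ∃ (κ Q P R : MP K n) (ν lam : K), κ.IsHomogeneous 1 ∧ Q.IsHomogeneous 1 ∧ P.IsHomogeneous 1 ∧ R.IsHomogeneous 1 ∧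
    x * x = j (C lam * a - C μ * b) * x + j (C μ * a) * (y - j κ) + j (a * (C μ * Q + C ν * a)) ∧
    j b * (x * (y - j κ)) - j a * ((y - j κ) * (y - j κ)) = j (a * P) * x + j (a * Q) * (y - j κ) + j (a * (a * R)) := by
  have hli := h.x2LI
  have hG := h.toGr
  obtain ⟨na, nb⟩ := LI2.ne hli
  have dv : ∀ F, a ∣ b * F → a ∣ F := fun F => lin_dvd2 h.h1 h.h2 hli
  have hyyy : y * (y * y) ∈ G (2+1) := hG.mul 1 2 _ _ hG.hy hG.hyy
  obtain ⟨F, hF, cF⟩ := h.ex 2 (y * (y * y)) hyyy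
  have e1 : x * (y * y) = j (-Q') * (x * y) + j (l + C μ * b) * (y * y) + (j (l * R' - P * n') + j (-R') * x + j (l * Q' + b * n' - P * C μ) * y) := by
    apply mul_left_cancel₀ (hG.jne na)
    simp only [map_mul, map_sub, map_neg, map_add] at ex er ⊢; linear_combination (j l - x) * er + (j b * y - j P) * ex
  have e2 : j a * (y * (y * y)) = j (-(b * Q') - P) * (x * y) + j (b * (l + C μ * b) - a * Q') * (y * y) +
      (j (b * (l * R' - P * n')) + j (-(b * R')) * x + j (b * (l * Q' + b * n' - P * C μ) - a * R') * y) := by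
    simp only [map_mul, map_sub, map_neg, map_add] at e1 er ⊢; linear_combination -y * er + j b * e1
  have k1 := (cF.mul a).unique hG ((((h.chi1.mul _).add (h.chi2.mul _)).add (InV.chi ⟨_, _, _, rfl⟩)).of_eq e2 rfl)
  obtain ⟨l', hl', el⟩ := hom_dvd (k := 0) h.h1 (F := l + C μ * b) (hl.add (h.h2.C_mul _)) (dv _ (dv _ ⟨F + b * Q' + P + b * Q', by linear_combination -k1⟩))
  obtain ⟨lam, rfl⟩ := hom_zero hl'
  have e3 : j a * (j b * (y * (y * y) - j (C lam * b - 2 * Q') * (y * y)) + j P * (y * y)) = j (b * (b * (l * R' - P * n')) - b * (a * (Q' * R')) - P * (a * R')) +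
      j (-(b * (b * R')) - b * Q' * P - P * P) * x + j (b * (b * (l * Q' + b * n' - P * C μ)) - a * (b * R') - a * (b * (Q' * Q')) - P * (a * Q')) * y := by
    have el' := congrArg j el
    simp only [map_mul, map_sub, map_neg, map_add, map_ofNat] at e2 er el' ⊢; linear_combination j b * e2 - (j b * j Q' + j P) * er + j b * j b * (y * y) * el'
  obtain ⟨g0, g1, g2, -, -, -, f0, f1, f2, -⟩ := hG.div (k := 3) (by
    refine Submodule.add_mem _ (hG.mul 1 3 _ _ (hG.hj _ _ h.h2) (Submodule.sub_mem _ hyyy ?_)) (hG.mul 2 2 _ _ (hG.hj _ _ hP) hG.hyy)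
    refine hG.mul 1 2 _ _ (hG.hj _ _ ((h.h2.C_mul _).sub ?_)) hG.hyy
    have : (2 : MP K n) = C 2 := (map_ofNat C 2).symm
    rw [this]; exact hQ'.C_mul _) na e3
  obtain ⟨u, hu⟩ := lin_sq h.h1 h.h2 hli (F := P) (G := -(Q' * P + b * R')) ⟨- g1, by linear_combination -f1⟩
  obtain ⟨P1, P', hP1, hP', eP⟩ := hom_two (k := 1) h.h1 h.h2 hP hu
  obtain ⟨R, hR, eR⟩ := hom_dvd (k := 1) h.h1 (F := R' + Q' * P' + P' * P') ((hR'.add (hQ'.mul hP')).add (hP'.mul hP')) (by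
    refine dv _ (dv _ ⟨-g1 - b * Q' * P1 - P1 * (P + b * P'), ?_⟩)
    linear_combination -f1 + (-b * Q' - P - b * P') * eP)
  obtain ⟨ν', hν', en⟩ := hom_dvd (k := 0) h.h1 (F := n' - C μ * Q' - C μ * P') ((hn'.sub (hQ'.C_mul _)).sub (hP'.C_mul _)) (by
    refine dv _ (dv _ (dv _ ⟨g2 - b * b * C lam * Q' + b * b * C μ * P1 + b * R' + b * (Q' * Q') + P * Q', ?_⟩))
    linear_combination f2 + b * b * C μ * eP - b * b * Q' * el)
  obtain ⟨ν, rfl⟩ := hom_zero hν'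
  have h2 : (2 : MP K n) = C 2 := (map_ofNat C 2).symm
  refine ⟨P', Q' + 2 * P', P1, R, ν, lam, hP', by rw [h2]; exact hQ'.add (hP'.C_mul _), hP1, hR, ?_, ?_⟩
  · have el' := congrArg j el
    have en' := congrArg j en
    simp only [map_mul, map_sub, map_add, map_ofNat] at ex el' en' ⊢; linear_combination ex + x * el' + j a * en'
  · have eP' := congrArg j eP
    have eR' := congrArg j eR
    simp only [map_mul, map_sub, map_add, map_ofNat] at er eR' eP' ⊢; linear_combination er + x * eP' + j a * eR'

variable {I : Ideal (MP K N)} {π : MP K N →ₐ[K] B}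
    {ι : MP K n →ₐ[K] MP K N} {x y : MP K N}

theorem case_x2c [IsAlgClosed K] (h : Dat I π ι x y) (hG : Gr1 (π.comp ι) (π x) (π y) G 0 a b) {Q P R : MP K n} {μ ν lam : K}
    (hQ : Q.IsHomogeneous 1) (hP : P.IsHomogeneous 1) (hR : R.IsHomogeneous 1)
    (ex : π x * π x = π (ι (C lam * a - C μ * b)) * π x + π (ι (C μ * a)) * π y + π (ι (a * (C μ * Q + C ν * a))))
    (er : π (ι b) * (π x * π y) - π (ι a) * (π y * π y) = π (ι (a * P)) * π x + π (ι (a * Q)) * π y + π (ι (a * (a * R)))) : FormB I := by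
  have hli := hG.x2LI
  have hμ : μ ≠ 0 := by
    rintro rfl
    obtain ⟨ρ, hρ⟩ := IsAlgClosed.exists_root (Polynomial.X^2 - Polynomial.C lam * Polynomial.X - Polynomial.C ν : Polynomial K) (by
      have : (Polynomial.X^2 - Polynomial.C lam * Polynomial.X - Polynomial.C ν : Polynomial K).degree = 2 := by compute_degree!
      rw [this]; norm_num)
    simp only [Polynomial.IsRoot.def, Polynomial.eval_sub, Polynomial.eval_pow, Polynomial.eval_X, Polynomial.eval_mul, Polynomial.eval_C] at hρ
    have hρ' := congrArg (fun c => π (ι (C c))) hρ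
    have : (π x - π (ι (C ρ * a))) * (π x - π (ι (C (lam - ρ) * a))) = 0 := by
      simp only [map_mul, map_sub, map_add, map_zero, map_pow] at hρ' ex ⊢
      linear_combination ex - π (ι a) ^ 2 * hρ'
    rcases mul_eq_zero.mp this with e | e
    · exact one_ne_zero (hG.indep (-(C ρ * a)) 1 0 (by rw [← e]; simp; ring)).2.1
    · exact one_ne_zero (hG.indep (-(C (lam - ρ) * a)) 1 0 (by rw [← e]; simp only [AlgHom.comp_apply, map_neg, map_one, map_zero]; ring)).2.1
  have nx := hG.toGr.ne.1
  refine ⟨x, x + ι (C μ * b - C lam * a), ι a, ι (C μ) * y + ι (C μ * Q + C ν * a), y, ι (C μ * P) - ι (C lam) * y, ι (C μ * R) - ι (C ν) * y,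
    h.hx, h.hx.add (h.ιhom ((hG.h2.C_mul _).sub (hG.h1.C_mul _))), h.ιhom hG.h1, ?_, h.hy, ?_, ?_, ?_, ?_, ?_⟩
  · rw [ι_C]; exact (h.hy.C_mul _).add (h.ιhom ((hQ.C_mul _).add (hG.h1.C_mul _)))
  · rw [ι_C]; exact (h.ιhom (hP.C_mul _)).sub (h.hy.C_mul _)
  · rw [ι_C]; exact (h.ιhom (hR.C_mul _)).sub (h.hy.C_mul _)
  · refine li4 fun c1 c2 c3 c4 he => ?_
    obtain ⟨h1, h2, h3⟩ := h.li (c1 + c2) (c4 * μ) (C c2 * (C μ * b - C lam * a) + C c3 * a + C c4 * (C μ * Q + C ν * a))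
      (((((hG.h2.C_mul _).sub (hG.h1.C_mul _)).C_mul _).add (hG.h1.C_mul _)).add (((hQ.C_mul _).add (hG.h1.C_mul _)).C_mul _)) (by
      rw [← he]; simp only [map_add, map_mul, map_sub, ι_C]; ring)
    have h4 := (mul_eq_zero.mp h2).resolve_right hμ
    subst h4
    obtain ⟨h5, h6⟩ := LI2.c hli (a := c3 - c2 * lam) (b := c2 * μ) (by simp only [map_sub, map_mul, map_zero] at h3 ⊢; linear_combination h3)
    have h7 := (mul_eq_zero.mp h6).resolve_right hμ
    subst h7
    exact ⟨by simpa using h1, rfl, by simpa using h5, rfl⟩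
  · rintro ⟨u, hu⟩
    obtain ⟨κ, k1, k2, k3⟩ := h.point
    have hu := congrArg κ hu
    have ha : κ (ι a) = 0 := k3 _ hG.h1
    have hb : κ (ι b) = 0 := k3 _ hG.h2
    have hq : κ (ι Q) = 0 := k3 _ hQ
    have h5 : κ (C μ) = μ := κ.commutes μ
    simp only [map_add, map_mul, map_sub, k1, k2, ha, hb, hq, ι_C, h5] at hu
    apply hμ
    apply pow_eq_zero_iff (two_ne_zero) |>.mp
    linear_combination hu
  · set X := x with hX
    set W := x + ι (C μ * b - C lam * a) with hW
    set U := ι a with hU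
    set Z := ι (C μ) * y + ι (C μ * Q + C ν * a) with hZ
    set A0 := y with hA0
    set A1 := ι (C μ * P) - ι (C lam) * y with hA1
    set A2 := ι (C μ * R) - ι (C ν) * y with hA2
    set q1 := X * W - U * Z with hq1
    set q2 := X * X * A0 + X * U * A1 + U * U * A2 with hq2
    set q3 := X * Z * A0 + X * W * A1 + U * W * A2 with hq3
    set q4 := Z * Z * A0 + Z * W * A1 + W * W * A2 with hq4
    set J := Ideal.span {q1, q2, q3, q4} with hJ
    have m1 : q1 ∈ J := Ideal.subset_span (by simp)
    have m2 : q2 ∈ J := Ideal.subset_span (by simp)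
    have m3 : q3 ∈ J := Ideal.subset_span (by simp)
    have m4 : q4 ∈ J := Ideal.subset_span (by simp)
    have p1 : π q1 = 0 := by
      rw [hq1, hX, hW, hU, hZ]; simp only [map_mul, map_sub, map_add] at ex ⊢; linear_combination ex
    have p2 : π q2 = 0 := by
      rw [hq2, hX, hA0, hU, hA1, hA2]; simp only [map_mul, map_sub, map_add] at ex er ⊢; linear_combination π y * ex - π (ι (C μ)) * er
    have p3 : π q3 = 0 := by
      apply (mul_eq_zero.mp (_ : π X * π q3 = 0)).resolve_left nx
      have := congrArg π (show X * q3 = Z * q2 + (X * A1 + U * A2) * q1 by rw [hq3, hq2, hq1]; ring)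
      rw [← map_mul, this]; simp only [map_add, map_mul, p1, p2]; ring
    have p4 : π q4 = 0 := by
      apply (mul_eq_zero.mp (_ : π X * π q4 = 0)).resolve_left nx
      have := congrArg π (show X * q4 = Z * q3 + (W * A2) * q1 by rw [hq3, hq4, hq1]; ring)
      rw [← map_mul, this]; simp only [map_add, map_mul, p1, p3]; ring
    have hc : ι (C μ⁻¹) * ι (C μ) = 1 := by rw [← map_mul, ← C_mul, inv_mul_cancel₀ hμ, C_1, map_one]
    refine h.close hG (d1 := a) (d2 := b) (m1 := x * y) (m2 := y * y) hG.h1 hG.h2 hli (by rw [map_mul]; exact hG.chi1) (by rw [map_mul]; exact hG.chi2) ?_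
      (v0 := a * (a * R)) (v1 := a * P) (v2 := a * Q) ?_ ?_
    · rw [hJ, Ideal.span_le]
      rintro z (rfl | rfl | rfl | rfl)
      · exact (h.ker _).mpr p1
      · exact (h.ker _).mpr p2
      · exact (h.ker _).mpr p3
      · exact (h.ker _).mpr p4
    · convert J.mul_mem_left (ι (C μ⁻¹)) (add_mem (J.mul_mem_left y m1) (J.mul_mem_left (-1) m2)) using 1
      rw [hq1, hq2, hX, hW, hU, hZ, hA0, hA1, hA2]; simp only [map_mul, map_neg, map_sub, map_add]
      linear_combination (-(ι b) * (x * y) + ι a * (y * y) + ι a * (ι a * ι R) + ι a * ι P * x + ι a * ι Q * y) * hc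
    · have nx : NF ι x y (x * y) (y * y) J x := NF.of 0 1 0 0 0 (by simp)
      have ny : NF ι x y (x * y) (y * y) J y := NF.of 0 0 1 0 0 (by simp)
      have n1 : NF ι x y (x * y) (y * y) J 1 := NF.of 1 0 0 0 0 (by simp)
      have nxy : NF ι x y (x * y) (y * y) J (x * y) := NF.of 0 0 0 1 0 (by simp)
      have nyy : NF ι x y (x * y) (y * y) J (y * y) := NF.of 0 0 0 0 1 (by simp)
      have nxx : NF ι x y (x * y) (y * y) J (x * x) := NF.of (a * (C μ * Q + C ν * a)) (C lam * a - C μ * b) (C μ * a) 0 0 (by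
        convert m1 using 1
        rw [hq1, hX, hW, hU, hZ]; simp only [map_mul, map_zero, map_sub, map_add]; ring)
      have nxxy : NF ι x y (x * y) (y * y) J (x * (x * y)) := NF.of 0 0 (a * (C μ * Q + C ν * a)) (C lam * a - C μ * b) (C μ * a) (by
        convert J.mul_mem_left y m1 using 1
        rw [hq1, hX, hW, hU, hZ]; simp only [map_mul, map_zero, map_sub, map_add]; ring)
      obtain ⟨z, hz⟩ : ∃ z, z = C μ * Q + C ν * a := ⟨_, rfl⟩
      obtain ⟨w, hw⟩ : ∃ w, w = C μ * b - C lam * a := ⟨_, rfl⟩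
      rw [← hz] at hZ
      rw [← hw] at hW
      have nxyy : NF ι x y (x * y) (y * y) J (x * (y * y)) := by
        have := ((((((nxy.mul (-z + C lam * w + a * C ν)).add (nxx.mul (-(C μ * P)))).add (nx.mul (-(C μ * P * w) - a * C μ * R))).add (nxxy.mul (C lam))).add
          (n1.mul (-(a * C μ * R * w)))).add (ny.mul (a * C ν * w))).add (NF.j (ι := ι) (x := x) (y := y) (m1 := x * y) (m2 := y * y) m3)
        have := this.mul (C μ⁻¹)
        convert this using 1
        rw [hq3, hX, hW, hU, hZ, hA0, hA1, hA2]
        simp only [map_mul, map_neg, map_sub, map_add]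
        linear_combination -x * (y * y) * hc
      have nyyy : NF ι x y (x * y) (y * y) J (y * (y * y)) := by
        have := (((((((nyy.mul (-(2 * C μ * z) + C lam * C μ * w)).add (ny.mul (-(z * z) - C μ * C μ * P * w + C lam * z * w + C ν * w * w))).add
          (nxy.mul (-(C μ * C μ * P) + C lam * z + 2 * w * C ν))).add (nx.mul (-(C μ * P * z) - 2 * C μ * R * w))).add (n1.mul (-(C μ * P * z * w) - C μ * R * w * w))).add
          (nxyy.mul (C lam * C μ))).add ((nxx.mul (-(C μ * R))).add (nxxy.mul (C ν)))).add (NF.j (ι := ι) (x := x) (y := y) (m1 := x * y) (m2 := y * y) m4)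
        have := this.mul (C μ⁻¹ * C μ⁻¹)
        convert this using 1
        rw [hq4, hW, hZ, hA0, hA1, hA2]
        simp only [map_mul, map_neg, map_sub, map_add, map_ofNat]
        linear_combination -y * (y * y) * (ι (C μ⁻¹) * ι (C μ) + 1) * hc
      have nyxy : NF ι x y (x * y) (y * y) J (y * (x * y)) := by
        have e : y * (x * y) = x * (y * y) := by ring
        rw [e]; exact nxyy
      exact h.nf nxx nxy nyy nxxy nyxy nxyy nyyy

theorem case_x2 [IsAlgClosed K] (h : Dat I π ι x y) (hG : Gr1 (π.comp ι) (π x) (π y) G 0 a b) : FormB I := by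
  obtain ⟨κ, l, n', Q', P, R', μ, hκ, hl, hn, hQ, hP, hR, e1, e2⟩ := hG.x2a
  obtain ⟨h', hl'⟩ := h.change (α := 1) (β := 0) (γ := 0) (δ := 1) (l := -κ) (l' := 0) hκ.neg (isHomogeneous_zero _ _ _) (by simp)
    (x' := x - ι κ) (y' := y) (by simp; ring) (by simp)
  have hG' := hG.change hl'
  simp only [map_one, map_zero, mul_zero, zero_mul, add_zero, zero_add, mul_one, one_mul] at hG'
  obtain ⟨κ2, Q, P, R, ν, lam, hκ2, hQ, hP, hR, e3, e4⟩ := hG'.x2b hl hn hQ hP hR (by simpa only [AlgHom.comp_apply, map_sub] using e1) (by simpa only [AlgHom.comp_apply, map_sub] using e2)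
  obtain ⟨h2, hl2⟩ := h'.change (α := 1) (β := 0) (γ := 0) (δ := 1) (l := 0) (l' := -κ2) (isHomogeneous_zero _ _ _) hκ2.neg (by simp)
    (x' := x - ι κ) (y' := y - ι κ2) (by simp) (by simp; ring)
  have hG2 := hG'.change hl2
  simp only [map_one, map_zero, mul_zero, zero_mul, add_zero, zero_add, mul_one, one_mul] at hG2
  refine case_x2c h2 hG2 hQ hP hR (μ := μ) (ν := ν) (lam := lam) ?_ ?_
  · rw [map_sub π y]; exact e3
  · rw [map_sub π y]; exact e4

end

section
variable {K B : Type} [Field K] [IsAlgClosed K] [CommRing B] [IsDomain B] [Algebra K B] {n N : ℕ} {G : ℕ → Submodule K B}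
  {c0 c1 c2 : MP K n}
variable {I : Ideal (MP K N)} {π : MP K N →ₐ[K] B}
    {ι : MP K n →ₐ[K] MP K N} {x y : MP K N}

theorem case_dep1 (h : Dat I π ι x y) (hG : Gr1 (π.comp ι) (π x) (π y) G c0 c1 c2) {α β γ δ : K} (hD : α * δ - β * γ ≠ 0)
    (e : C α * C γ * c0 + (C α * C δ + C β * C γ) * c1 + C β * C δ * c2 = 0) : FormB I := by
  obtain ⟨h', hl⟩ := h.change (α := α) (β := β) (γ := γ) (δ := δ) (l := 0) (l' := 0) (isHomogeneous_zero _ _ _) (isHomogeneous_zero _ _ _) hD rfl rfl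
  have hG' := hG.change hl
  rw [e] at hG'
  exact case_xy h' hG'

theorem case_dep2 (h : Dat I π ι x y) (hG : Gr1 (π.comp ι) (π x) (π y) G c0 c1 c2) {α β γ δ : K} (hD : α * δ - β * γ ≠ 0)
    (e : C α * C α * c0 + 2 * (C α * C β) * c1 + C β * C β * c2 = 0) : FormB I := by
  obtain ⟨h', hl⟩ := h.change (α := α) (β := β) (γ := γ) (δ := δ) (l := 0) (l' := 0) (isHomogeneous_zero _ _ _) (isHomogeneous_zero _ _ _) hD rfl rfl
  have hG' := hG.change hl
  rw [e] at hG'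
  exact case_x2 h' hG'

theorem case_dep (h : Dat I π ι x y) (hG : Gr1 (π.comp ι) (π x) (π y) G c0 c1 c2) {a b c : K} (hne : ¬ (a = 0 ∧ b = 0 ∧ c = 0))
    (e : C a * c0 + C b * c1 + C c * c2 = 0) : FormB I := by
  by_cases ha : a = 0
  · subst ha
    by_cases hb : b = 0
    · subst hb
      have hc : c ≠ 0 := fun hc => hne ⟨rfl, rfl, hc⟩
      have : c2 = 0 := by simpa [hc] using e
      exact case_dep2 h hG (α := 0) (β := 1) (γ := 1) (δ := 0) (by simp) (by simp [this])
    · refine case_dep1 h hG (α := 0) (β := 1) (γ := b) (δ := c) (by simpa using hb) ?_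
      simp only [map_zero, map_one] at e ⊢
      linear_combination e
  · obtain ⟨r, hr⟩ := IsAlgClosed.exists_root (Polynomial.C a * Polynomial.X^2 + Polynomial.C b * Polynomial.X + Polynomial.C c : Polynomial K) (by
      rw [Polynomial.degree_quadratic ha]; norm_num)
    simp only [Polynomial.IsRoot.def, Polynomial.eval_add, Polynomial.eval_pow, Polynomial.eval_X, Polynomial.eval_mul, Polynomial.eval_C] at hr
    -- a X² + b X + c = a (X - r) (X - s)
    obtain ⟨s, hs⟩ : ∃ s, s = -(a⁻¹ * b) - r := ⟨_, rfl⟩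
    have hai : a⁻¹ * a = 1 := inv_mul_cancel₀ ha
    have hb : a⁻¹ * b = -(r + s) := by rw [hs]; ring
    have hc : a⁻¹ * c = r * s := by linear_combination a⁻¹ * hr - r * r * hai - r * hb
    have e' : c0 + C (-(r + s)) * c1 + C (r * s) * c2 = 0 := by
      rw [← hb, ← hc]
      have h1 : C a⁻¹ * C a = (1 : MP K n) := by rw [← C_mul, hai, C_1]
      simp only [C_mul]
      linear_combination C a⁻¹ * e - c0 * h1
    simp only [map_neg, map_add, map_mul] at e'
    -- χ of (x + r' y)(x + s' y)
    by_cases hrs : r = s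
    · subst hrs
      refine case_dep2 h hG (α := 1) (β := -r) (γ := 0) (δ := 1) (by simp) ?_
      simp only [map_one, map_neg]; linear_combination e'
    · refine case_dep1 h hG (α := 1) (β := -r) (γ := 1) (δ := -s) (fun h => hrs (by linear_combination h)) ?_
      simp only [map_one, map_neg]; linear_combination e'

end

section
variable {K : Type} [Field K] {N : ℕ} {X W U Z A0 A1 A2 : MP K N}

theorem q_prime (hX : X.IsHomogeneous 1) (hW : W.IsHomogeneous 1) (hU : U.IsHomogeneous 1) (hZ : Z.IsHomogeneous 1)
    (hl : LinearIndependent K ![X, W, U, Z]) : Prime (X * W - U * Z) := by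
  obtain ⟨e, s, hs, he⟩ := lin_equiv' (l := ![X, W, U, Z]) (by simp [Fin.forall_fin_succ, *]) hl
  have e0 : e (MvPolynomial.X (s 0)) = X := he 0
  have e1 : e (MvPolynomial.X (s 1)) = W := he 1
  have e2 : e (MvPolynomial.X (s 2)) = U := he 2
  have e3 : e (MvPolynomial.X (s 3)) = Z := he 3
  have hi : Irreducible (MvPolynomial.X (s 0) * MvPolynomial.X (s 1) + (- (MvPolynomial.X (s 2) * MvPolynomial.X (s 3))) : MP K N) := by
    refine irreducible_mul_X_add _ _ _ (X_ne_zero _) ?_ ?_ ?_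
    · rw [vars_X, Finset.mem_singleton]; exact hs.ne (by decide)
    · rw [vars_neg]; intro h
      have := vars_mul _ _ h
      rw [vars_X, vars_X, Finset.mem_union, Finset.mem_singleton, Finset.mem_singleton] at this
      rcases this with h | h
      · exact absurd (hs h) (by decide)
      · exact absurd (hs h) (by decide)
    · refine (X_prime (R := K) (i := s 0)).irreducible.isRelPrime_iff_not_dvd.mpr ?_
      rw [dvd_neg, (X_prime (R := K) (i := s 0)).dvd_mul]
      rintro (h | h)
      · exact X_ndvd (hs.ne (by decide)) h
      · exact X_ndvd (hs.ne (by decide)) h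
  have hp := hi.prime
  have h2 := (MulEquiv.prime_iff (e : MP K N ≃* MP K N)).mpr hp
  have h3 : (e : MP K N ≃* MP K N) (MvPolynomial.X (s 0) * MvPolynomial.X (s 1) + (- (MvPolynomial.X (s 2) * MvPolynomial.X (s 3)))) = X * W - U * Z := by
    show e _ = _
    rw [map_add, map_neg, map_mul, map_mul, e0, e1, e2, e3]; ring
  rwa [h3] at h2

theorem LI.sub {k m : ℕ} {l : Fin k → MP K N} (hl : LinearIndependent K l) (s : Fin m → Fin k) (hs : Function.Injective s)
    {l' : Fin m → MP K N} (h : ∀ i, l' i = l (s i)) : LinearIndependent K l' := by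
  rw [show l' = l ∘ s from funext h]; exact hl.comp s hs

theorem syz1 (hX : X.IsHomogeneous 1) (hW : W.IsHomogeneous 1) (hU : U.IsHomogeneous 1) (hZ : Z.IsHomogeneous 1)
    (hl : LinearIndependent K ![X, W, U, Z]) (hq : ¬ X * W - U * Z ∣ Z * Z * A0 + Z * W * A1 + W * W * A2) {b0 b1 b2 b3 : MP K N}
    (h : b0 * (X * W - U * Z) + b1 * (X * X * A0 + X * U * A1 + U * U * A2) + b2 * (X * Z * A0 + X * W * A1 + U * W * A2)
      + b3 * (Z * Z * A0 + Z * W * A1 + W * W * A2) = 0) : ∃ g1 g2 g3 g4,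
      b0 = g1 * (X * A1 + U * A2) - g2 * (X * A0) + g3 * (W * A2) - g4 * (Z * A0 + W * A1) ∧
      b1 = g1 * Z + g2 * W ∧ b2 = - g1 * X - g2 * U + g3 * Z + g4 * W ∧ b3 = - g3 * X - g4 * U := by
  have hp := q_prime hX hW hU hZ hl
  have nX : X ≠ 0 := hl.ne_zero 0
  have nZ : Z ≠ 0 := hl.ne_zero 3
  have lXZ : LinearIndependent K ![X, Z] := LI.sub hl ![0, 3] (by decide) (by simp [Fin.forall_fin_two])
  have lXZU : LinearIndependent K ![X, Z, U] := LI.sub hl ![0, 3, 2] (by decide) (by simp [Fin.forall_fin_succ])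
  have h1 : X * W - U * Z ∣ (Z * Z * A0 + Z * W * A1 + W * W * A2) * (b1 * X * X + b2 * X * Z + b3 * Z * Z) := by
    have e : Z * Z * ((Z * Z * A0 + Z * W * A1 + W * W * A2) * (b1 * X * X + b2 * X * Z + b3 * Z * Z))
      = (X * W - U * Z) * (Z * Z * (b1 * ((X * A1 + U * A2) * Z + X * W * A2) + b2 * Z * W * A2 - b0 * Z * Z)
        ) := by
      linear_combination Z ^ 4 * h
    have hz : ¬ X * W - U * Z ∣ Z := by
      intro h
      obtain ⟨u, hu⟩ := h
      have := (hp.irreducible.dvd_symm (lin_prime hZ nZ).irreducible ⟨u, hu⟩)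
      have h2 : Z ∣ W * X := by
        have := dvd_add this (Dvd.intro_left U rfl : Z ∣ U * Z); rwa [sub_add_cancel, mul_comm] at this
      rcases (lin_prime hZ nZ).dvd_or_dvd h2 with h3 | h3
      · have h4 := lin_dvd2 hZ hW (F := 1) (LI.sub hl ![3, 1] (by decide) (by simp [Fin.forall_fin_two])) (by rwa [mul_one])
        exact (lin_prime hZ nZ).not_unit (isUnit_of_dvd_one h4)
      · have h4 := lin_dvd2 hZ hX (F := 1) (LI.sub hl ![3, 0] (by decide) (by simp [Fin.forall_fin_two])) (by rwa [mul_one])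
        exact (lin_prime hZ nZ).not_unit (isUnit_of_dvd_one h4)
    have h5 : X * W - U * Z ∣ Z * Z * ((Z * Z * A0 + Z * W * A1 + W * W * A2) * (b1 * X * X + b2 * X * Z + b3 * Z * Z)) := ⟨_, e⟩
    rcases hp.dvd_or_dvd h5 with h6 | h6
    · rcases hp.dvd_or_dvd h6 with h6 | h6 <;> exact absurd h6 hz
    · exact h6
  obtain ⟨k, hk⟩ := (hp.dvd_or_dvd h1).resolve_left hq
  have h2 : X ∣ Z * b3 - U * (-k) := by
    refine lin_dvd2 hX hZ lXZ ⟨W * k - b1 * X - b2 * Z, ?_⟩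
    linear_combination hk
  obtain ⟨u, ⟨v, hv⟩, ⟨v', hv'⟩⟩ := lin_dvd3 hX hZ hU lXZU h2
  -- b3 = U u + X v
  have hk2 : b1 * X + (b2 + v * Z + u * W) * Z = (X * W - U * Z) * (-v') := by
    refine mul_left_cancel₀ nX ?_
    linear_combination hk - Z * Z * hv - (X * W - U * Z) * hv'
  have h3 : X ∣ Z * (b2 + v * Z + u * W - U * v') := ⟨- W * v' - b1, by linear_combination hk2⟩
  obtain ⟨w, hw⟩ := lin_dvd2 hX hZ lXZ h3
  have h4 : b1 = - W * v' - w * Z := by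
    refine mul_left_cancel₀ nX ?_
    linear_combination hk2 - Z * hw
  refine ⟨-w, -v', -v, -u, ?_, ?_, ?_, ?_⟩
  · refine mul_left_cancel₀ hp.ne_zero ?_
    have hv2 : b3 = U * u + X * v := by linear_combination hv
    have hw2 : b2 = - v * Z - u * W + U * v' + X * w := by linear_combination hw
    subst h4 hv2 hw2
    linear_combination h
  · linear_combination h4
  · linear_combination hw
  · linear_combination hv

theorem syz2 (hX : X.IsHomogeneous 1) (hW : W.IsHomogeneous 1) (hU : U.IsHomogeneous 1) (hZ : Z.IsHomogeneous 1)
    (hl : LinearIndependent K ![X, W, U, Z]) {g1 g2 g3 g4 : MP K N}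
    (h1 : g1 * Z + g2 * W = 0) (h2 : - g1 * X - g2 * U + g3 * Z + g4 * W = 0) (h3 : - g3 * X - g4 * U = 0) :
    ∃ k, g1 = - W * k ∧ g2 = Z * k ∧ g3 = U * k ∧ g4 = - X * k := by
  have nX : X ≠ 0 := hl.ne_zero 0
  have hp := q_prime hX hW hU hZ hl
  have nW : W ≠ 0 := hl.ne_zero 1
  obtain ⟨k, hk⟩ := lin_dvd2 hW hZ (F := g1) (LI.sub hl ![1, 3] (by decide) (by simp [Fin.forall_fin_two])) ⟨-g2, by linear_combination h1⟩
  obtain ⟨m, hm⟩ := lin_dvd2 hX hU (F := g4) (LI.sub hl ![0, 2] (by decide) (by simp [Fin.forall_fin_two])) ⟨-g3, by linear_combination -h3⟩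
  have e2 : g2 = - Z * k := mul_left_cancel₀ nW (by subst hk; linear_combination h1)
  have e3 : g3 = - U * m := mul_left_cancel₀ nX (by subst hm; linear_combination -h3)
  have e4 : k = m := by
    refine mul_left_cancel₀ hp.ne_zero ?_
    subst hk hm e2 e3
    linear_combination -h2
  subst e4
  exact ⟨-k, by rw [hk]; ring, by rw [e2]; ring, by rw [e3]; ring, by rw [hm]; ring⟩

end

section
variable {K : Type} [Field K] {r : ℕ}

def bet (i j : ℕ) : ℕ := match i, j with
  | 1, 1 => 1
  | 1, 2 => 3
  | 2, 2 => 4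
  | 3, 2 => 1
  | 0, _ => 0
  | _, _ => 0

/-- Coordinates on a graded free module. -/
def cd {β : ℕ → ℕ} {k : ℕ} (e : Fin k ≃ (j : ℕ) × Fin (β j)) : AMD.FreeGr K r β ≃ₗ[PS K r] (Fin k → PS K r) :=
  (Finsupp.domLCongr e.symm).trans (Finsupp.linearEquivFunOnFinite _ _ _)

theorem cd_single {β : ℕ → ℕ} {k : ℕ} (e : Fin k ≃ (j : ℕ) × Fin (β j)) (p) :
    cd (K := K) (r := r) e (Finsupp.single p 1) = Pi.single (e.symm p) 1 := by
  simp [cd, Finsupp.domLCongr_single]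

theorem cd_symm {β : ℕ → ℕ} {k : ℕ} (e : Fin k ≃ (j : ℕ) × Fin (β j)) (v : Fin k → PS K r) (p) :
    (cd e).symm v p = v (e.symm p) := by
  obtain ⟨w, rfl⟩ := (cd (K := K) (r := r) e).surjective v
  rw [LinearEquiv.symm_apply_apply]
  show w p = Finsupp.equivMapDomain e.symm w (e.symm p)
  rw [Finsupp.equivMapDomain_apply]; simp

def mk {β β' : ℕ → ℕ} {k k' : ℕ} (e : Fin k ≃ (j : ℕ) × Fin (β j)) (e' : Fin k' ≃ (j : ℕ) × Fin (β' j))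
    (A : Matrix (Fin k') (Fin k) (PS K r)) : AMD.FreeGr K r β →ₗ[PS K r] AMD.FreeGr K r β' :=
  (cd e').symm.toLinearMap ∘ₗ A.mulVecLin ∘ₗ (cd e).toLinearMap

variable {β β' : ℕ → ℕ} {k k' : ℕ} (e : Fin k ≃ (j : ℕ) × Fin (β j)) (e' : Fin k' ≃ (j : ℕ) × Fin (β' j))
    (A : Matrix (Fin k') (Fin k) (PS K r))

theorem mk_min {m m' : ℕ} (h : ∀ i i', A i' i = 0 ∨ ∃ dd : ℕ, 1 ≤ dd ∧ dd + (m' + (e' i').1) = m + (e i).1 ∧ (A i' i).IsHomogeneous dd) :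
    AMD.IsMinGrMap K r β β' m m' (mk e e' A) := by
  intro j t j' t'
  have : (mk e e' A (Finsupp.single ⟨j, t⟩ 1)) ⟨j', t'⟩ = A (e'.symm ⟨j', t'⟩) (e.symm ⟨j, t⟩) := by
    show (cd e').symm (A.mulVec (cd e (Finsupp.single ⟨j, t⟩ 1))) ⟨j', t'⟩ = _
    rw [cd_single, cd_symm, Matrix.mulVec_single_one]; rfl
  rw [this]
  simpa using h (e.symm ⟨j, t⟩) (e'.symm ⟨j', t'⟩)

theorem mk_ker (v) : mk e e' A v = 0 ↔ A.mulVec (cd e v) = 0 := by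
  show (cd e').symm (A.mulVec (cd e v)) = 0 ↔ _
  rw [LinearEquiv.map_eq_zero_iff]

theorem mk_range (v) : v ∈ LinearMap.range (mk e e' A) ↔ ∃ w, cd e' v = A.mulVec w := by
  constructor
  · rintro ⟨w, rfl⟩
    exact ⟨cd e w, by show cd e' ((cd e').symm _) = _; rw [LinearEquiv.apply_symm_apply]; rfl⟩
  · rintro ⟨w, hw⟩
    refine ⟨(cd e).symm w, ?_⟩
    show (cd e').symm (A.mulVec (cd e ((cd e).symm w))) = v
    rw [LinearEquiv.apply_symm_apply, ← hw, LinearEquiv.symm_apply_apply]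

def f1 : Fin 4 → (j : ℕ) × Fin (bet 1 j) := ![⟨1, (0 : Fin 1)⟩, ⟨2, (0 : Fin 3)⟩, ⟨2, (1 : Fin 3)⟩, ⟨2, (2 : Fin 3)⟩]
def f2 : Fin 4 → (j : ℕ) × Fin (bet 2 j) := fun i => ⟨2, i⟩
def f3 : Fin 1 → (j : ℕ) × Fin (bet 3 j) := fun i => ⟨2, i⟩

theorem f1_bij : Function.Bijective f1 := by
  refine ⟨by decide, ?_⟩
  rintro ⟨j, t⟩
  rcases j with _ | _ | _ | j
  · exact Fin.elim0 t
  · change Fin 1 at t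
    exact ⟨0, by fin_cases t; rfl⟩
  · change Fin 3 at t
    fin_cases t
    · exact ⟨1, rfl⟩
    · exact ⟨2, rfl⟩
    · exact ⟨3, rfl⟩
  · exact Fin.elim0 t

theorem f2_bij : Function.Bijective f2 := by
  refine ⟨by decide, ?_⟩
  rintro ⟨j, t⟩
  rcases j with _ | _ | _ | j
  · exact Fin.elim0 t
  · exact Fin.elim0 t
  · exact ⟨t, rfl⟩
  · exact Fin.elim0 t

theorem f3_bij : Function.Bijective f3 := by
  refine ⟨by decide, ?_⟩
  rintro ⟨j, t⟩
  rcases j with _ | _ | _ | j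
  · exact Fin.elim0 t
  · exact Fin.elim0 t
  · exact ⟨t, rfl⟩
  · exact Fin.elim0 t

theorem bet_sub (n : ℕ) (v : AMD.FreeGr K r (bet (n + 4))) : v = 0 := by
  ext ⟨j, t⟩
  exact Fin.elim0 t

theorem FormB.betti {I : Ideal (PS K r)} (h : FormB I) : AMD.HasBettiDiagram K r I bet := by
  obtain ⟨X, W, U, Z, A0, A1, A2, hX, hW, hU, hZ, h0, h1, h2, hl, hq, rfl⟩ := h
  let e1 : Fin 4 ≃ (j : ℕ) × Fin (bet 1 j) := Equiv.ofBijective f1 f1_bij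
  let e2 : Fin 4 ≃ (j : ℕ) × Fin (bet 2 j) := Equiv.ofBijective f2 f2_bij
  let e3 : Fin 1 ≃ (j : ℕ) × Fin (bet 3 j) := Equiv.ofBijective f3 f3_bij
  let M1 : Matrix (Fin 4) (Fin 4) (PS K r) := !![X * A1 + U * A2, - (X * A0), W * A2, - (Z * A0 + W * A1); Z, W, 0, 0; -X, -U, Z, W; 0, 0, -X, -U]
  let M2 : Matrix (Fin 4) (Fin 1) (PS K r) := !![-W; Z; U; -X]
  let g : Fin 4 → PS K r := ![X * W - U * Z, X * X * A0 + X * U * A1 + U * U * A2, X * Z * A0 + X * W * A1 + U * W * A2,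
      Z * Z * A0 + Z * W * A1 + W * W * A2]
  let φ : (i : ℕ) → (AMD.FreeGr K r (bet (i + 2)) →ₗ[PS K r] AMD.FreeGr K r (bet (i + 1))) := fun i => match i with
    | 0 => mk e2 e1 M1
    | 1 => mk e3 e2 M2
    | (n + 2) => 0
  let ε : AMD.FreeGr K r (bet 1) →ₗ[PS K r] PS K r := (Fintype.linearCombination (PS K r) g) ∘ₗ (cd e1).toLinearMap
  have hε : ∀ v, ε v = cd e1 v 0 * g 0 + cd e1 v 1 * g 1 + cd e1 v 2 * g 2 + cd e1 v 3 * g 3 := by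
    intro v
    show Fintype.linearCombination (PS K r) g (cd e1 v) = _
    rw [Fintype.linearCombination_apply, Fin.sum_univ_four]; rfl
  refine ⟨φ, ε, ?_, ?_, ?_, ?_, ?_⟩
  · intro j t
    have : ε (Finsupp.single ⟨j, t⟩ 1) = g (e1.symm ⟨j, t⟩) := by
      show Fintype.linearCombination (PS K r) g (cd e1 _) = _
      rw [cd_single, Fintype.linearCombination_apply_single, one_smul]
    rw [this]
    obtain ⟨i, hi⟩ := e1.surjective ⟨j, t⟩
    rw [← hi, Equiv.symm_apply_apply]
    have hj : j = (e1 i).1 := by rw [hi]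
    rw [hj]
    fin_cases i
    · exact (hX.mul hW).sub (hU.mul hZ)
    · exact (((hX.mul hX).mul h0).add ((hX.mul hU).mul h1)).add ((hU.mul hU).mul h2)
    · exact (((hX.mul hZ).mul h0).add ((hX.mul hW).mul h1)).add ((hU.mul hW).mul h2)
    · exact (((hZ.mul hZ).mul h0).add ((hZ.mul hW).mul h1)).add ((hW.mul hW).mul h2)
  · intro i
    match i with
    | 0 =>
      refine mk_min e2 e1 M1 ?_
      intro i i'
      rcases Fin.eq_zero_or_eq_succ i' with rfl | ⟨i', rfl⟩
      · refine Or.inr ⟨2, by norm_num, rfl, ?_⟩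
        fin_cases i
        · exact (hX.mul h1).add (hU.mul h2)
        · exact (hX.mul h0).neg
        · exact hW.mul h2
        · exact ((hZ.mul h0).add (hW.mul h1)).neg
      · refine Or.inr ⟨1, by norm_num, by fin_cases i' <;> rfl, ?_⟩
        have := isHomogeneous_zero (Fin (r + 1)) K 1
        fin_cases i' <;> fin_cases i <;> first | exact this | exact hX | exact hX.neg | exact hU.neg | exact hZ | exact hW
    | 1 =>
      refine mk_min e3 e2 M2 ?_
      intro i i'
      refine Or.inr ⟨1, by norm_num, rfl, ?_⟩
      fin_cases i <;> fin_cases i' <;> first | exact hW.neg | exact hZ | exact hU | exact hX.neg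
    | (n + 2) => exact fun j t _ _ => Fin.elim0 t
  · ext f
    rw [LinearMap.mem_range]
    constructor
    · rintro ⟨v, rfl⟩
      rw [hε]
      refine add_mem (add_mem (add_mem ?_ ?_) ?_) ?_ <;> refine Ideal.mul_mem_left _ _ (Ideal.subset_span ?_)
      · exact Or.inl rfl
      · exact Or.inr (Or.inl rfl)
      · exact Or.inr (Or.inr (Or.inl rfl))
      · exact Or.inr (Or.inr (Or.inr rfl))
    · intro hf
      rw [Ideal.mem_span_insert] at hf
      obtain ⟨a, z, hz, rfl⟩ := hf
      rw [Ideal.mem_span_insert] at hz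
      obtain ⟨b, z, hz, rfl⟩ := hz
      rw [Ideal.mem_span_pair] at hz
      obtain ⟨c, d, rfl⟩ := hz
      refine ⟨(cd e1).symm ![a, b, c, d], ?_⟩
      rw [hε, LinearEquiv.apply_symm_apply]
      simp [g]; ring
  · ext v
    rw [LinearMap.mem_ker, hε]
    show _ ↔ v ∈ LinearMap.range (mk e2 e1 M1)
    rw [mk_range]
    constructor
    · intro h
      obtain ⟨g1, g2, g3, g4, k0, k1, k2, k3⟩ := syz1 hX hW hU hZ hl hq h
      refine ⟨![g1, g2, g3, g4], ?_⟩
      ext1 i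
      fin_cases i
      · rw [Fin.zero_eta, k0]; simp [M1, Matrix.mulVec, dotProduct, Fin.sum_univ_four]; ring
      · simp only [Fin.mk_one]; rw [k1]; simp [M1, Matrix.mulVec, dotProduct, Fin.sum_univ_four]; ring
      · simp only [Fin.reduceFinMk]; rw [k2]; simp [M1, Matrix.mulVec, dotProduct, Fin.sum_univ_four]; ring
      · simp only [Fin.reduceFinMk]; rw [k3]; simp [M1, Matrix.mulVec, dotProduct, Fin.sum_univ_four]; ring
    · rintro ⟨w, hw⟩
      rw [hw]
      simp [M1, g, Matrix.mulVec, dotProduct, Fin.sum_univ_four]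
      ring
  · intro i
    match i with
    | 0 =>
      ext v
      show mk e2 e1 M1 v = 0 ↔ v ∈ LinearMap.range (mk e3 e2 M2)
      rw [mk_range, mk_ker]
      constructor
      · intro h
        have k1 := congrFun h 1
        have k2 := congrFun h 2
        have k3 := congrFun h 3
        simp [M1, Matrix.mulVec, dotProduct, Fin.sum_univ_four] at k1 k2 k3
        obtain ⟨k, a1, a2, a3, a4⟩ := syz2 hX hW hU hZ hl (g1 := cd e2 v 0) (g2 := cd e2 v 1) (g3 := cd e2 v 2) (g4 := cd e2 v 3)
          (by linear_combination k1) (by linear_combination k2) (by linear_combination k3)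
        refine ⟨fun _ => k, ?_⟩
        ext1 i
        fin_cases i
        · rw [Fin.zero_eta, a1]; simp [M2, Matrix.mulVec, dotProduct]
        · simp only [Fin.mk_one]; rw [a2]; simp [M2, Matrix.mulVec, dotProduct]
        · simp only [Fin.reduceFinMk]; rw [a3]; simp [M2, Matrix.mulVec, dotProduct]
        · simp only [Fin.reduceFinMk]; rw [a4]; simp [M2, Matrix.mulVec, dotProduct]
      · rintro ⟨w, hw⟩
        rw [hw]
        ext1 i
        fin_cases i <;> simp [M1, M2, Matrix.mulVec, dotProduct, Fin.sum_univ_four] <;> ring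
    | 1 =>
      ext v
      show mk e3 e2 M2 v = 0 ↔ v ∈ LinearMap.range 0
      rw [mk_ker, LinearMap.range_zero, Submodule.mem_bot]
      constructor
      · intro h
        have k1 := congrFun h 1
        simp [M2, Matrix.mulVec, dotProduct] at k1
        rcases k1 with k1 | k1
        · exact absurd k1 (hl.ne_zero 3)
        · refine (cd e3).injective ?_
          rw [map_zero]
          ext1 i
          rw [Subsingleton.elim i 0]; exact k1
      · rintro rfl; simp
    | (n + 2) =>
      ext v
      rw [bet_sub n v]; simp

end

section
variable {K : Type} [Field K] {r : ℕ}

theorem cone_crit {I : Ideal (PS K r)} (P : Submodule K (PS K r)) [FiniteDimensional K P] (hP : ∀ p ∈ P, p.IsHomogeneous 1)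
    (hr : Module.finrank K P ≤ r) (s : Set (PS K r)) (hs : s ⊆ Algebra.adjoin K (P : Set (PS K r))) (hI : I = Ideal.span s) :
    AMD.IsConeIdeal K r I := by
  let b := Module.finBasis K P
  have hl : LinearIndependent K (fun i => (b i : PS K r)) := b.linearIndependent.map' P.subtype (Submodule.ker_subtype P)
  obtain ⟨l', h1, h2, h3⟩ := lin_extend (N := r + 1) (by omega) (fun i => hP _ (b i).2) hl
  obtain ⟨e, he, he'⟩ := lin_equiv h1 h2
  have hb : ∀ i, e.symm (b i : PS K r) = rename Fin.castSucc (X (Fin.castLE hr i)) := by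
    intro i
    rw [← h3 i, ← he, AlgEquiv.symm_apply_apply, rename_X]; rfl
  have hPs : ∀ p ∈ Algebra.adjoin K (P : Set (PS K r)), ∃ f : MP K r, e.symm p = rename Fin.castSucc f := by
    intro p hp
    induction hp using Algebra.adjoin_induction with
    | mem p hp =>
      have := congrArg (Subtype.val) (b.sum_repr ⟨p, hp⟩)
      rw [AddSubmonoidClass.coe_finsetSum] at this
      refine ⟨∑ i, C (b.repr ⟨p, hp⟩ i) * X (Fin.castLE hr i), ?_⟩
      refine (congrArg e.symm this).symm.trans ?_
      rw [map_sum, map_sum]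
      refine Finset.sum_congr rfl fun i _ => ?_
      rw [Submodule.coe_smul, map_smul, hb, map_mul, smul_eq_C_mul, rename_C]
    | algebraMap c => exact ⟨C c, by rw [AlgEquiv.commutes, rename_C]; rfl⟩
    | add p q _ _ hp hq =>
      obtain ⟨f, hf⟩ := hp
      obtain ⟨g, hg⟩ := hq
      exact ⟨f + g, by rw [map_add, map_add, hf, hg]⟩
    | mul p q _ _ hp hq =>
      obtain ⟨f, hf⟩ := hp
      obtain ⟨g, hg⟩ := hq
      exact ⟨f * g, by rw [map_mul, map_mul, hf, hg]⟩
  refine ⟨e.symm, he', Ideal.span {f | ∃ p ∈ s, e.symm p = rename Fin.castSucc f}, ?_⟩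
  rw [hI]
  refine le_antisymm ?_ ?_
  · rw [Ideal.map_le_iff_le_comap, Ideal.span_le]
    intro p hp
    obtain ⟨f, hf⟩ := hPs p (hs hp)
    rw [SetLike.mem_coe, Ideal.mem_comap, hf]
    exact Ideal.mem_map_of_mem _ (Ideal.subset_span ⟨p, hp, hf⟩)
  · rw [Ideal.map_le_iff_le_comap, Ideal.span_le]
    rintro f ⟨p, hp, hf⟩
    rw [SetLike.mem_coe, Ideal.mem_comap, ← hf]
    exact Ideal.mem_map_of_mem _ (Ideal.subset_span hp)

theorem FormB.cone {I : Ideal (PS K r)} (h : FormB I) (hr : 7 ≤ r) : AMD.IsConeIdeal K r I := by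
  obtain ⟨X, W, U, Z, A0, A1, A2, hX, hW, hU, hZ, h0, h1, h2, hl, hq, e⟩ := h
  let a : Fin 7 → PS K r := ![X, W, U, Z, A0, A1, A2]
  have hfin : FiniteDimensional K (Submodule.span K (Set.range a)) := FiniteDimensional.span_of_finite K (Set.finite_range a)
  have ha : ∀ i, a i ∈ Algebra.adjoin K (Submodule.span K (Set.range a) : Set (PS K r)) := fun i =>
    Algebra.subset_adjoin (Submodule.subset_span ⟨i, rfl⟩)
  refine cone_crit (Submodule.span K (Set.range a)) ?_ ((finrank_range_le_card a).trans (by simpa using hr)) _ ?_ e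
  · intro p hp
    have : Submodule.span K (Set.range a) ≤ homogeneousSubmodule (Fin (r + 1)) K 1 := by
      rw [Submodule.span_le]
      rintro _ ⟨i, rfl⟩
      fin_cases i <;> assumption
    exact this hp
  · have a0 := ha 0
    have a1 := ha 1
    have a2 := ha 2
    have a3 := ha 3
    have a4 := ha 4
    have a5 := ha 5
    have a6 := ha 6
    rintro p (rfl | rfl | rfl | rfl)
    · exact sub_mem (mul_mem a0 a1) (mul_mem a2 a3)
    · exact add_mem (add_mem (mul_mem (mul_mem a0 a0) a4) (mul_mem (mul_mem a0 a2) a5)) (mul_mem (mul_mem a2 a2) a6)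
    · exact add_mem (add_mem (mul_mem (mul_mem a0 a3) a4) (mul_mem (mul_mem a0 a1) a5)) (mul_mem (mul_mem a2 a1) a6)
    · exact add_mem (add_mem (mul_mem (mul_mem a3 a3) a4) (mul_mem (mul_mem a3 a1) a5)) (mul_mem (mul_mem a1 a1) a6)

end

section
variable {K B : Type} [Field K] [CommRing B] [IsDomain B] [Algebra K B] {n : ℕ} {j : MP K n →ₐ[K] B} {x y : B}
  {G : ℕ → Submodule K B} {c0 c1 c2 : MP K n}

theorem li01 (hl : LinearIndependent K ![c0, c1, c2]) : LinearIndependent K ![c0, c1] :=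
  LI.sub hl ![0, 1] (by decide) (by simp [Fin.forall_fin_two])

theorem li02 (hl : LinearIndependent K ![c0, c1, c2]) : LinearIndependent K ![c0, c2] :=
  LI.sub hl ![0, 2] (by decide) (by simp [Fin.forall_fin_two])

/-- Koszul exactness -/
theorem kos {k : ℕ} (h0 : c0.IsHomogeneous 1) (h1 : c1.IsHomogeneous 1) (h2 : c2.IsHomogeneous 1) (hl : LinearIndependent K ![c0, c1, c2])
    {l0 l1 l2 : MP K n} (g1 : l1.IsHomogeneous (1 + k)) (g2 : l2.IsHomogeneous (1 + k))
    (e : c0 * l0 + c1 * l1 + c2 * l2 = 0) : ∃ α β γ : MP K n, α.IsHomogeneous k ∧ β.IsHomogeneous k ∧ γ.IsHomogeneous k ∧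
      l0 = α * c1 + β * c2 ∧ l1 = -(α * c0) + γ * c2 ∧ l2 = -(β * c0) - γ * c1 := by
  obtain ⟨u, hu, -⟩ := lin_dvd3 h0 h1 h2 hl (F := l1) (G := -l2) ⟨-l0, by linear_combination e⟩
  obtain ⟨v, w, hv, hw, rfl⟩ := hom_two h0 h2 g1 hu
  have k2 : (l2 + c1 * w).IsHomogeneous (1 + k) := g2.add (h1.mul hw)
  obtain ⟨z, hz, ez⟩ := hom_dvd h0 k2 (lin_dvd2 h0 h2 (li02 hl) ⟨-l0 - c1 * v, by linear_combination e⟩)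
  obtain rfl : l2 = c0 * z - c1 * w := by linear_combination ez
  refine ⟨-v, -z, w, hv.neg, hz.neg, hw, ?_, by ring, by ring⟩
  apply mul_left_cancel₀ (show c0 ≠ 0 from hl.ne_zero 0)
  linear_combination e

theorem kos0 (h0 : c0.IsHomogeneous 1) (h1 : c1.IsHomogeneous 1) (h2 : c2.IsHomogeneous 1) (hl : LinearIndependent K ![c0, c1, c2])
    {l0 l1 l2 : MP K n} (g1 : l1.IsHomogeneous 1) (g2 : l2.IsHomogeneous 1)
    (e : c0 * l0 + c1 * l1 + c2 * l2 = 0) : ∃ α β γ : K,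
      l0 = C α * c1 + C β * c2 ∧ l1 = -(C α * c0) + C γ * c2 ∧ l2 = -(C β * c0) - C γ * c1 := by
  obtain ⟨α, β, γ, hα, hβ, hγ, h⟩ := kos (k := 0) h0 h1 h2 hl g1 g2 e
  obtain ⟨α, rfl⟩ := hom_zero hα
  obtain ⟨β, rfl⟩ := hom_zero hβ
  obtain ⟨γ, rfl⟩ := hom_zero hγ
  exact ⟨α, β, γ, h⟩

theorem Gr1.mem3 (h : Gr1 j x y G c0 c1 c2) {a b : B} {c d : MP K n} (hc : c.IsHomogeneous 1) (hd : d.IsHomogeneous 1)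
    (ha : a ∈ G 2) (hb : b ∈ G 2) (hv : InV j x y (j c * a - j d * b)) : InVn j x y 2 (j c * a - j d * b) :=
  h.sat 2 _ 1 (Submodule.sub_mem _ (h.mul 1 2 _ _ (h.hj _ _ hc) ha) (h.mul 1 2 _ _ (h.hj _ _ hd) hb)) one_ne_zero (by rwa [map_one, one_mul])

/-- the conductor relations -/
theorem tri (h : Gr1 j x y G c0 c1 c2) (hl : LinearIndependent K ![c0, c1, c2]) :
    ∃ r0 r1 r2 p0 p1 p2 q0 q1 q2 : MP K n, (r0.IsHomogeneous 2 ∧ r1.IsHomogeneous 2 ∧ r2.IsHomogeneous 2) ∧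
      (p0.IsHomogeneous 1 ∧ p1.IsHomogeneous 1 ∧ p2.IsHomogeneous 1) ∧ (q0.IsHomogeneous 1 ∧ q1.IsHomogeneous 1 ∧ q2.IsHomogeneous 1) ∧
      j c1 * (x * x - (j r0 + j p0 * x + j q0 * y)) = j c0 * (x * y - (j r1 + j p1 * x + j q1 * y)) ∧
      j c2 * (x * x - (j r0 + j p0 * x + j q0 * y)) = j c0 * (y * y - (j r2 + j p2 * x + j q2 * y)) := by
  obtain ⟨A0, A1, A2, hA0, hA1, hA2, eA⟩ := h.mem3 h.h0 h.h1 h.hxy h.hxx h.chi1.1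
  obtain ⟨B0, B1, B2, hB0, hB1, hB2, eB⟩ := h.mem3 h.h0 h.h2 h.hyy h.hxx h.chi2.1
  obtain ⟨C0, C1, C2, hC0, hC1, hC2, eC⟩ := h.mem3 h.h1 h.h2 h.hyy h.hxy h.chi2.2.1
  obtain ⟨k0, k1, k2⟩ := h.indep (c0 * C0 + c1 * (-B0) + c2 * A0) (c0 * C1 + c1 * (-B1) + c2 * A1) (c0 * C2 + c1 * (-B2) + c2 * A2) (by
    simp only [map_add, map_mul, map_neg]
    linear_combination -j c0 * eC + j c1 * eB - j c2 * eA)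
  obtain ⟨r2, r1, r0, hr2, hr1, hr0, -, e2, e1⟩ := kos (k := 2) h.h0 h.h1 h.h2 hl hB0.neg hA0 k0
  obtain ⟨p2, p1, p0, hp2, hp1, hp0, -, f2, f1⟩ := kos (k := 1) h.h0 h.h1 h.h2 hl hB1.neg hA1 k1
  obtain ⟨q2, q1, q0, hq2, hq1, hq0, -, g2, g1⟩ := kos (k := 1) h.h0 h.h1 h.h2 hl hB2.neg hA2 k2
  obtain rfl := neg_eq_iff_eq_neg.mp e2
  obtain rfl := neg_eq_iff_eq_neg.mp f2
  obtain rfl := neg_eq_iff_eq_neg.mp g2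
  subst e1; subst f1; subst g1
  refine ⟨r0, -r1, r2, p0, -p1, p2, q0, -q1, q2, ⟨hr0, hr1.neg, hr2⟩, ⟨hp0, hp1.neg, hp2⟩, ⟨hq0, hq1.neg, hq2⟩, ?_, ?_⟩
  · simp only [map_add, map_mul, map_neg, map_sub] at eA ⊢
    linear_combination -eA
  · simp only [map_add, map_mul, map_neg, map_sub] at eB ⊢
    linear_combination -eB

/-- multiplication on the extra generator -/
theorem tri_mul (h : Gr1 j x y G c0 c1 c2) (hl : LinearIndependent K ![c0, c1, c2]) {u v s : B} (hu : u ∈ G 2) (hv : v ∈ G 2) (hs : s ∈ G 1)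
    (ku : Chi j x y c0 c1 c2 u c0) (kv : Chi j x y c0 c1 c2 v c1)
    (e : j c1 * u = j c0 * v) : ∃ a0 a1 a2 a3 : MP K n, a0.IsHomogeneous 2 ∧ a1.IsHomogeneous 1 ∧ a2.IsHomogeneous 1 ∧ a3.IsHomogeneous 1 ∧
      s * u = j a3 * u + j c0 * (j a0 + j a1 * x + j a2 * y) := by
  obtain ⟨F0, hF0, k0⟩ := h.ex 2 (s * u) (h.mul 1 2 _ _ hs hu)
  obtain ⟨F1, hF1, k1⟩ := h.ex 2 (s * v) (h.mul 1 2 _ _ hs hv)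
  have e1 : c1 * F0 = c0 * F1 := Chi.unique h.toGr (k0.mul c1) ((k1.mul c0).of_eq (by linear_combination s * e) rfl)
  obtain ⟨a3, h3, rfl⟩ := hom_dvd (k := 1) h.h0 hF0 (lin_dvd2 h.h0 h.h1 (li01 hl) ⟨F1, e1⟩)
  obtain rfl : F1 = c1 * a3 := by
    apply mul_left_cancel₀ (show c0 ≠ 0 from hl.ne_zero 0)
    linear_combination -e1
  have m3 := h.hj _ _ h3
  obtain ⟨f0, f1, f2, m0, m1, m2, ef⟩ := h.zero (k := 2) (a := s * u + j (-a3) * u) (Submodule.add_mem _ (h.mul 1 2 _ _ hs hu)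
    (h.mul 1 2 _ _ (h.hj _ _ h3.neg) hu)) ((k0.add (ku.mul (-a3))).of_eq rfl (by ring))
  obtain ⟨g0, g1, g2, -, -, -, eg⟩ := h.zero (k := 2) (a := s * v + j (-a3) * v) (Submodule.add_mem _ (h.mul 1 2 _ _ hs hv)
    (h.mul 1 2 _ _ (h.hj _ _ h3.neg) hv)) ((k1.add (kv.mul (-a3))).of_eq rfl (by ring))
  obtain ⟨i0, i1, i2⟩ := h.toGr.indep2 (f0 := c1 * f0) (f1 := c1 * f1) (f2 := c1 * f2) (g0 := c0 * g0) (g1 := c0 * g1) (g2 := c0 * g2) (by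
    simp only [map_mul]
    linear_combination -j c1 * ef + j c0 * eg + (s + j (-a3)) * e)
  obtain ⟨a0, ha0, rfl⟩ := hom_dvd (k := 2) h.h0 m0 (lin_dvd2 h.h0 h.h1 (li01 hl) ⟨_, i0⟩)
  obtain ⟨a1, ha1, rfl⟩ := hom_dvd (k := 1) h.h0 m1 (lin_dvd2 h.h0 h.h1 (li01 hl) ⟨_, i1⟩)
  obtain ⟨a2, ha2, rfl⟩ := hom_dvd (k := 1) h.h0 m2 (lin_dvd2 h.h0 h.h1 (li01 hl) ⟨_, i2⟩)
  refine ⟨a0, a1, a2, a3, ha0, ha1, ha2, h3, ?_⟩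
  simp only [map_mul, map_neg] at ef
  linear_combination ef

end

section
variable {K Ω : Type} [Field K] [Field Ω] [Algebra K Ω] {n : ℕ} {J : MP K n →ₐ[K] Ω} {x y : Ω}
  {c0 c1 c2 : MP K n}

/-- parametrization data -/
structure Ver (J : MP K n →ₐ[K] Ω) (x y : Ω) (c0 c1 c2 : MP K n) (ω ξ η : Ω) (F m k b c b' c' g e : K) : Prop where
  R1 : x = J c0 * ξ + J c1 * η + J (C m * c1)
  R2 : y = J c1 * ξ + J c2 * η + J (C k * c1)
  C1 : η * x = J (C c * c1) * ξ - J (C b * c1) * η + J (C F * c0 + C g * c1)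
  C2 : ξ * y = J (C c' * c1) * η - J (C b' * c1) * ξ + J (C F * c2 + C e * c1)
  hω : ω ≠ 0
  Q0 : J c0 = ω * (η ^ 2 + J (C (m + b)) * η - J (C c) * ξ - J (C g))
  Q1 : J c1 = ω * (J (C F) - ξ * η)
  Q2 : J c2 = ω * (ξ ^ 2 + J (C (k + b')) * ξ - J (C c') * η - J (C e))

theorem J_C (a : K) : J (C a) = algebraMap K Ω a := J.commutes a

theorem alg_mem [IsAlgClosed K] {z : Ω} (p q r : K) (h : z ^ 3 + J (C p) * z ^ 2 + J (C q) * z + J (C r) = 0) : ∃ a, z = J (C a) := by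
  simp only [J_C] at *
  have hi : IsIntegral K z := by
    refine ⟨Polynomial.X ^ 3 + (Polynomial.C p * Polynomial.X ^ 2 + Polynomial.C q * Polynomial.X + Polynomial.C r), ?_, ?_⟩
    · apply Polynomial.monic_X_pow_add
      exact lt_of_le_of_lt Polynomial.degree_quadratic_le (by norm_num)
    · simp only [Polynomial.eval₂_add, Polynomial.eval₂_mul, Polynomial.eval₂_pow, Polynomial.eval₂_X, Polynomial.eval₂_C]
      linear_combination h
  have hr := minpoly.mem_range_of_degree_eq_one K z (IsAlgClosed.degree_eq_one_of_irreducible K (minpoly.irreducible hi))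
  obtain ⟨a, rfl⟩ := hr
  exact ⟨a, rfl⟩

theorem ver_of [IsAlgClosed K] (hJ : ∀ f, J f = 0 → f = 0) (h0 : c0.IsHomogeneous 1) (h1 : c1.IsHomogeneous 1) (h2 : c2.IsHomogeneous 1) (hl : LinearIndependent K ![c0, c1, c2])
    {z : Ω} (ind : ∀ f0 f1 f2 f3, J f0 + J f1 * x + J f2 * y + J f3 * z = 0 → f0 = 0 ∧ f1 = 0 ∧ f2 = 0 ∧ f3 = 0)
    {r0 r1 r2 p0 p2 q0 q2 a0 a1 a2 a3 b0 b1 b2 b3 : MP K n}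
    (hp0 : p0.IsHomogeneous 1) (hq0 : q0.IsHomogeneous 1) (hq2 : q2.IsHomogeneous 1)
    (ha1 : a1.IsHomogeneous 1) (ha2 : a2.IsHomogeneous 1) (ha3 : a3.IsHomogeneous 1) (hb2 : b2.IsHomogeneous 1) (hb3 : b3.IsHomogeneous 1)
    (exx : x * x = J c0 * z + (J r0 + J p0 * x + J q0 * y)) (exy : x * y = J c1 * z + J r1) (eyy : y * y = J c2 * z + (J r2 + J p2 * x + J q2 * y))
    (ezx : x * z = J a3 * z + (J a0 + J a1 * x + J a2 * y)) (ezy : y * z = J b3 * z + (J b0 + J b1 * x + J b2 * y)) :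
    ∃ ω ξ η : Ω, ∃ F m k b c b' c' g e : K, Ver J x y c0 c1 c2 ω ξ η F m k b c b' c' g e := by
  obtain ⟨-, x1, y1, z1⟩ := ind (c1 * a0 - (c0 * b0 + p0 * r1 + q0 * r2)) (c1 * a1 + r1 - (c0 * b1 + q0 * p2)) (c1 * a2 - (c0 * b2 + q0 * q2 + r0))
    (c1 * a3 - (c0 * b3 + p0 * c1 + q0 * c2)) (by
    simp only [map_sub, map_add, map_mul]
    linear_combination y * exx - x * exy - J c1 * ezx + J c0 * ezy + J p0 * exy + J q0 * eyy)
  obtain ⟨-, x2, y2, z2⟩ := ind (c2 * a0 + p2 * r0 + q2 * r1 - c1 * b0) (c2 * a1 + p2 * p0 + r2 - c1 * b1) (c2 * a2 + p2 * q0 - (c1 * b2 + r1))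
    (c2 * a3 + p2 * c0 + q2 * c1 - c1 * b3) (by
    simp only [map_sub, map_add, map_mul]
    linear_combination y * exy - x * eyy - J c2 * ezx - J p2 * exx - J q2 * exy + J c1 * ezy)
  obtain ⟨α, β, γ, s1, s2, s3⟩ := kos0 h0 h1 h2 hl (ha3.sub hp0) hq0.neg (l0 := -b3) (by linear_combination z1)
  obtain ⟨α', β', γ', t1, t2, t3⟩ := kos0 h0 h1 h2 hl (hq2.sub hb3) ha3 (l0 := p2) (by linear_combination z2)
  obtain ⟨e, f, g, u1, u2, u3⟩ := kos0 h0 h1 h2 hl (hb2.sub ha1) ha2.neg (l0 := b1) (by linear_combination -x1 + -y2)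
  have D : c0 * c2 - c1 * c1 ≠ 0 := by
    intro hD
    have d1 : c0 ∣ c1 * (c1 * 1) := ⟨c2, by linear_combination -hD⟩
    have d2 := lin_dvd2 h0 h1 (li01 hl) (lin_dvd2 h0 h1 (li01 hl) d1)
    exact (lin_prime h0 (hl.ne_zero 0)).not_isUnit (isUnit_of_dvd_one d2)
  have D' : J c0 * J c2 - J c1 * J c1 ≠ 0 := fun h => D (hJ _ (by simpa only [map_sub, map_mul] using h))
  obtain ⟨m, rfl⟩ : ∃ m, γ' = β - m := ⟨β - γ', by ring⟩
  obtain ⟨k, rfl⟩ : ∃ k, α = β' - k := ⟨β' - α, by ring⟩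
  obtain ⟨F, rfl⟩ : ∃ F, f = F - β * β' := ⟨f + β * β', by ring⟩
  obtain ⟨g', rfl⟩ : ∃ g', g = g' - γ * β' + β * m := ⟨g + γ * β' - β * m, by ring⟩
  obtain ⟨e', rfl⟩ : ∃ e', e = e' - α' * β + β' * k := ⟨e + α' * β - β' * k, by ring⟩
  obtain rfl : b3 = -(C (β' - k) * c1 + C β * c2) := by linear_combination -s1
  subst t3
  subst t1
  obtain ⟨hp, hq, hq2', hb1, hb2', ha2'⟩ : J p0 = _ ∧ J q0 = _ ∧ J q2 = _ ∧ J b1 = _ ∧ J b2 = _ ∧ J a2 = _ := ⟨congrArg J (by linear_combination -s2 : p0 = -(C β' * c0) - C (β - m) * c1 + C (β' - k) * c0 - C γ * c2),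
    congrArg J (by linear_combination -s3 : q0 = C β * c0 + C γ * c1), congrArg J (eq_add_of_sub_eq t2), congrArg J u1, congrArg J (eq_add_of_sub_eq u2),
    congrArg J (by linear_combination -u3 : a2 = C (F - β * β') * c0 + C (g' - γ * β' + β * m) * c1)⟩
  have x1' := congrArg J x1
  have y1' := congrArg J y1
  have x2' := congrArg J x2
  simp only [map_add, map_sub, map_mul, map_neg, map_zero] at hp hq hq2' hb1 hb2' ha2' x1' y1' x2'
  rw [hb1, hq] at x1'
  rw [ha2', hb2', hq, hq2'] at y1'
  rw [hb1, hp] at x2'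
  obtain ⟨ξ, hξ⟩ : ∃ ξ, (J c0 * J c2 - J c1 * J c1) * ξ = J c2 * (x - J (C m * c1)) - J c1 * (y - J (C k * c1)) := ⟨_, mul_div_cancel₀ _ D'⟩
  obtain ⟨η, hη⟩ : ∃ η, (J c0 * J c2 - J c1 * J c1) * η = J c0 * (y - J (C k * c1)) - J c1 * (x - J (C m * c1)) := ⟨_, mul_div_cancel₀ _ D'⟩
  have R1 : x = J c0 * ξ + J c1 * η + J (C m * c1) := by
    apply mul_left_cancel₀ D'
    linear_combination - J c0 * hξ - J c1 * hη
  have R2 : y = J c1 * ξ + J c2 * η + J (C k * c1) := by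
    apply mul_left_cancel₀ D'
    linear_combination - J c1 * hξ - J c2 * hη
  have C1 : η * x = J (C γ * c1) * ξ - J (C β * c1) * η + J (C F * c0 + C g' * c1) := by
    rw [hp, hq] at exx
    apply mul_left_cancel₀ D'
    simp only [map_add, map_sub, map_mul, map_neg] at hξ hη ⊢
    linear_combination (x + J (C β) * J c1) * hη - J (C γ) * J c1 * hξ + J c0 * exy - J c1 * exx + J c0 * x1' + J c1 * y1'
  have C2 : ξ * y = J (C α' * c1) * η - J (C β' * c1) * ξ + J (C F * c2 + C e' * c1) := by
    rw [hq2'] at eyy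
    apply mul_left_cancel₀ D'
    simp only [map_add, map_sub, map_mul, map_neg] at hξ hη eyy ⊢
    linear_combination (y + J (C β') * J c1) * hξ - J (C α') * J c1 * hη + J c2 * exy - J c1 * eyy + J c2 * x1' - J c1 * x2'
  have Q0 : J c0 * (J (C F) - ξ * η) = J c1 * (η ^ 2 + J (C (m + β)) * η - J (C γ) * ξ - J (C g')) := by
    simp only [map_add, map_mul] at R1 C1 ⊢
    linear_combination -C1 + η * R1
  have Q2 : J c2 * (J (C F) - ξ * η) = J c1 * (ξ ^ 2 + J (C (k + β')) * ξ - J (C α') * η - J (C e')) := by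
    simp only [map_add, map_mul] at R2 C2 ⊢
    linear_combination -C2 + ξ * R2
  have n1 : J c1 ≠ 0 := fun h => (show c1 ≠ 0 from hl.ne_zero 1) (hJ _ h)
  have hne : J (C F) - ξ * η ≠ 0 := by
    intro h
    rw [h, mul_zero, eq_comm, mul_eq_zero] at Q0 Q2
    have Q0 := Q0.resolve_left n1
    have Q2 := Q2.resolve_left n1
    obtain ⟨u, rfl⟩ := alg_mem (J := J) (z := η) (m + β) (-g') (-(γ * F)) (by
      simp only [map_neg, map_mul]
      linear_combination η * Q0 - J (C γ) * h)
    obtain ⟨v, rfl⟩ := alg_mem (J := J) (z := ξ) (k + β') (-e') (-(α' * F)) (by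
      simp only [map_neg, map_mul]
      linear_combination ξ * Q2 - J (C α') * h)
    have := (ind (c0 * C v + c1 * C u + C m * c1) (-1) 0 0 (by
      simp only [map_add, map_mul, map_neg, map_one, map_zero] at R1 ⊢
      linear_combination -R1)).2.1
    exact one_ne_zero (neg_eq_zero.mp this)
  refine ⟨J c1 / (J (C F) - ξ * η), ξ, η, F, m, k, β, γ, β', α', g', e', R1, R2, C1, C2, div_ne_zero n1 hne, ?_, ?_, ?_⟩
  · rw [div_mul_eq_mul_div, eq_div_iff hne]; exact Q0
  · rw [div_mul_cancel₀ _ hne]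
  · rw [div_mul_eq_mul_div, eq_div_iff hne]; exact Q2

end

section
variable {K B : Type} [Field K] [CommRing B] [IsDomain B] [Algebra K B] {n : ℕ}
  {G : ℕ → Submodule K B} {c0 c1 c2 : MP K n}

/-- the embedding into the fraction field -/
def fr (K B : Type) [Field K] [CommRing B] [IsDomain B] [Algebra K B] : B →ₐ[K] FractionRing B := IsScalarTower.toAlgHom K B (FractionRing B)

theorem fr_inj : Function.Injective (fr K B) := IsFractionRing.injective B (FractionRing B)

theorem Gr1.ver [IsAlgClosed K] {j : MP K n →ₐ[K] B} {x y : B} (h : Gr1 j x y G c0 c1 c2) (hl : LinearIndependent K ![c0, c1, c2])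
    {r0 r1 r2 p0 p2 q0 q2 : MP K n} (hr0 : r0.IsHomogeneous 2) (hr1 : r1.IsHomogeneous 2)
    (hp0 : p0.IsHomogeneous 1) (hq0 : q0.IsHomogeneous 1) (hq2 : q2.IsHomogeneous 1)
    (e1 : j c1 * (x * x - (j r0 + j p0 * x + j q0 * y)) = j c0 * (x * y - j r1))
    (e2 : j c2 * (x * x - (j r0 + j p0 * x + j q0 * y)) = j c0 * (y * y - (j r2 + j p2 * x + j q2 * y))) :
    ∃ ω ξ η, ∃ F m k b c b' c' g e : K, Ver ((fr K B).comp j) (fr K B x) (fr K B y) c0 c1 c2 ω ξ η F m k b c b' c' g e := by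
  have n0 : c0 ≠ 0 := hl.ne_zero 0
  have j0 := h.toGr.jne n0
  have mu : x * x - (j r0 + j p0 * x + j q0 * y) ∈ G 2 := Submodule.sub_mem _ h.hxx (Submodule.add_mem _ (Submodule.add_mem _ (h.hj _ _ hr0)
    (h.mul 1 1 _ _ (h.hj _ _ hp0) h.hx)) (h.mul 1 1 _ _ (h.hj _ _ hq0) h.hy))
  have mv : x * y - j r1 ∈ G 2 := Submodule.sub_mem _ h.hxy (h.hj _ _ hr1)
  have ku : Chi j x y c0 c1 c2 (x * x - (j r0 + j p0 * x + j q0 * y)) c0 := by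
    refine (h.chi0.add (InV.chi ⟨-r0, -p0, -q0, rfl⟩)).of_eq ?_ (by ring)
    simp only [map_neg]; ring
  have kv : Chi j x y c0 c1 c2 (x * y - j r1) c1 := by
    refine (h.chi1.add (inV_j (-r1)).chi).of_eq ?_ (by ring)
    simp only [map_neg]; ring
  obtain ⟨a0, a1, a2, a3, -, ha1, ha2, ha3, ea⟩ := tri_mul h hl mu mv h.hx ku kv e1
  obtain ⟨b0, b1, b2, b3, -, -, hb2, hb3, eb⟩ := tri_mul h hl mu mv h.hy ku kv e1
  have f0 : fr K B (j c0) ≠ 0 := fun h => j0 (fr_inj (K := K) (by rw [h, map_zero]))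
  obtain ⟨z, hz⟩ : ∃ z, fr K B (j c0) * z = fr K B (x * x - (j r0 + j p0 * x + j q0 * y)) := ⟨_, mul_div_cancel₀ _ f0⟩
  have hz1 : fr K B (j c1) * z = fr K B (x * y - j r1) := by
    apply mul_left_cancel₀ f0
    rw [← map_mul, ← e1, map_mul, ← hz]; ring
  have hz2 : fr K B (j c2) * z = fr K B (y * y - (j r2 + j p2 * x + j q2 * y)) := by
    apply mul_left_cancel₀ f0
    rw [← map_mul, ← e2, map_mul, ← hz]; ring
  refine ver_of (J := (fr K B).comp j) (z := z) ?_ h.h0 h.h1 h.h2 hl ?_ (a0 := a0) (b0 := b0) (b1 := b1) (r0 := r0) (r1 := r1) (r2 := r2) (p2 := p2) hp0 hq0 hq2 ha1 ha2 ha3 hb2 hb3 ?_ ?_ ?_ ?_ ?_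
  · intro f hf
    by_contra hne
    exact h.toGr.jne hne (fr_inj (K := K) (by rw [map_zero]; exact hf))
  · intro f0 f1 f2 f3 hf
    have key : ∀ c : MP K n, ∀ w v, InV j x y v → fr K B (j c) * z = fr K B (w - v) → InV j x y (j f3 * w) ∧
        (f3 = 0 → j (c * f0) + j (c * f1) * x + j (c * f2) * y = 0) := by
      intro c w v hv hc
      have : j (c * f0) + j (c * f1) * x + j (c * f2) * y + j f3 * (w - v) = 0 := by
        apply fr_inj (K := K)
        simp only [map_add, map_mul, map_zero] at hf ⊢
        simp only [AlgHom.comp_apply] at hf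
        rw [← hc]
        linear_combination fr K B (j c) * hf
      refine ⟨((hv.mul f3).sub ⟨c * f0, c * f1, c * f2, rfl⟩).of_eq (by linear_combination this), ?_⟩
      rintro rfl
      simpa using this
    have k0 := key c0 _ _ ⟨_, _, _, rfl⟩ hz
    have e3 := h.toGr.nc' k0.1 (key c1 _ _ (inV_j r1) hz1).1 (key c2 _ _ ⟨_, _, _, rfl⟩ hz2).1
    obtain ⟨i0, i1, i2⟩ := h.indep _ _ _ (k0.2 e3)
    exact ⟨(mul_eq_zero.mp i0).resolve_left n0, (mul_eq_zero.mp i1).resolve_left n0, (mul_eq_zero.mp i2).resolve_left n0, e3⟩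
  · simp only [map_sub, map_add, map_mul] at hz
    simp only [AlgHom.comp_apply]
    linear_combination -hz
  · simp only [map_sub, map_add, map_mul] at hz1
    simp only [AlgHom.comp_apply]
    linear_combination -hz1
  · simp only [map_sub, map_add, map_mul] at hz2
    simp only [AlgHom.comp_apply]
    linear_combination -hz2
  · apply mul_left_cancel₀ f0
    have := congrArg (fr K B) ea
    rw [map_mul, map_add, map_mul, ← hz] at this
    simp only [map_add, map_mul] at this
    simp only [AlgHom.comp_apply]
    linear_combination this
  · apply mul_left_cancel₀ f0
    have := congrArg (fr K B) eb
    rw [map_mul, map_add, map_mul, ← hz] at this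
    simp only [map_add, map_mul] at this
    simp only [AlgHom.comp_apply]
    linear_combination this

variable {N : ℕ} {I : Ideal (MP K N)} {π : MP K N →ₐ[K] B}
  {ι : MP K n →ₐ[K] MP K N} {x y : MP K N}

theorem norm3 [IsAlgClosed K] (h : Dat I π ι x y) (hG : Gr1 (π.comp ι) (π x) (π y) G c0 c1 c2) (hl : LinearIndependent K ![c0, c1, c2]) :
    ∃ x' y', Dat I π ι x' y' ∧ Gr1 (π.comp ι) (π x') (π y') G c0 c1 c2 ∧ ∃ ω ξ η, ∃ F m k b c b' c' g e : K,
      Ver ((fr K B).comp (π.comp ι)) (fr K B (π x')) (fr K B (π y')) c0 c1 c2 ω ξ η F m k b c b' c' g e := by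
  obtain ⟨r0, r1, r2, p0, p1, p2, q0, q1, q2, ⟨hr0, hr1, hr2⟩, ⟨hp0, hp1, hp2⟩, ⟨hq0, hq1, hq2⟩, e1, e2⟩ := tri hG hl
  obtain ⟨hd, hlin⟩ := h.change (α := 1) (β := 0) (γ := 0) (δ := 1) hq1.neg hp1.neg (by simp) (x' := x - ι q1) (y' := y - ι p1) (by simp; ring) (by simp; ring)
  have hG' := hG.change hlin
  simp only [map_one, map_zero, one_mul, zero_mul, mul_zero, add_zero, mul_one, zero_add] at hG'
  refine ⟨_, _, hd, hG', hG'.ver hl (r0 := r0 + p0 * q1 + q0 * p1 - q1 * q1) (r1 := r1 + p1 * q1) (r2 := r2 + p2 * q1 + q2 * p1 - p1 * p1)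
    (p0 := p0 - 2 * q1) (q0 := q0) (p2 := p2) (q2 := q2 - 2 * p1) (((hr0.add (hp0.mul hq1)).add (hq0.mul hp1)).sub (hq1.mul hq1)) (hr1.add (hp1.mul hq1))
    (hp0.sub ?_) hq0 (hq2.sub ?_) ?_ ?_⟩
  · rw [two_mul]; exact hq1.add hq1
  · rw [two_mul]; exact hp1.add hp1
  · simp only [map_sub, map_add, map_mul, map_ofNat, AlgHom.comp_apply] at e1 ⊢
    linear_combination e1
  · simp only [map_sub, map_add, map_mul, map_ofNat, AlgHom.comp_apply] at e2 ⊢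
    linear_combination e2

end

section
variable {K Ω : Type} [Field K] [Field Ω] [Algebra K Ω] {n r : ℕ}

theorem algind {g v : Fin n → Ω} (hv : AlgebraicIndependent K v) (h : ∀ i, v i ∈ Algebra.adjoin K (Set.range g)) : AlgebraicIndependent K g := by
  set A := Algebra.adjoin K (Set.range g) with hA
  let g' : Fin n → A := fun i => ⟨g i, Algebra.subset_adjoin ⟨i, rfl⟩⟩
  have h1 : AlgebraicIndependent K (fun i => (⟨v i, h i⟩ : A)) := AlgebraicIndependent.of_comp A.val hv
  have h2 : Algebra.adjoin K (Set.range g') = ⊤ := by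
    rw [eq_top_iff]
    rintro ⟨z, hz⟩ -
    have := Algebra.adjoin_le (S := (Algebra.adjoin K (Set.range g')).map A.val) (s := Set.range g) (by
      rintro _ ⟨i, rfl⟩
      exact ⟨g' i, Algebra.subset_adjoin ⟨i, rfl⟩, rfl⟩) hz
    obtain ⟨w, hw, rfl⟩ := this
    exact hw
  have : Algebra.IsAlgebraic (Algebra.adjoin K (Set.range g')) A := by
    refine ⟨fun z => ?_⟩
    exact isAlgebraic_algebraMap (⟨z, h2 ▸ Algebra.mem_top⟩ : Algebra.adjoin K (Set.range g'))
  have h3 := (Algebra.IsAlgebraic.isTranscendenceBasis_of_le_trdeg_of_finite K g' h1.cardinalMk_le_trdeg).1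
  exact h3.map' (f := A.val) Subtype.val_injective

theorem cone_split {I : Ideal (PS K r)} (Φ : PS K r →ₐ[K] Ω) (hI : ∀ F, F ∈ I ↔ Φ F = 0) (a : Fin r → PS K r) (ha : ∀ i, (a i).IsHomogeneous 1) (ℓ : PS K r)
    (hg : Algebra.adjoin K (insert ℓ (Set.range a)) = ⊤) (A' : Subalgebra K Ω) (hA : ∀ i, Φ (a i) ∈ A') (ht : Transcendental A' (Φ ℓ)) : AMD.IsConeIdeal K r I := by
  set P := Submodule.span K (Set.range a)
  set A := Algebra.adjoin K (P : Set (PS K r))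
  have hAA : ∀ F ∈ A, Φ F ∈ A' := by
    intro F hF
    have h1 : A ≤ A'.comap Φ := Algebra.adjoin_le (by
      intro p hp
      refine (Submodule.span_le (p := Subalgebra.toSubmodule (A'.comap Φ))).mpr ?_ hp
      rintro _ ⟨i, rfl⟩
      exact hA i)
    exact h1 hF
  let ψ : A →+* A' := ((Φ.comp A.val).codRestrict A' (fun F => hAA _ F.2)).toRingHom
  have : FiniteDimensional K P := FiniteDimensional.span_of_finite _ (Set.finite_range _)
  refine cone_crit P ?_ ((finrank_range_le_card a).trans (by simp)) ((I : Set (PS K r)) ∩ A) Set.inter_subset_right ?_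
  · intro p hp
    refine (Submodule.span_le (p := homogeneousSubmodule (Fin (r + 1)) K 1)).mpr ?_ hp
    rintro _ ⟨i, rfl⟩
    exact ha i
  · refine le_antisymm ?_ (Ideal.span_le.mpr Set.inter_subset_left)
    intro F hF
    have hp : ∀ F, ∃ p : Polynomial A, Polynomial.aeval ℓ p = F := by
      intro F
      have h1 : F ∈ Algebra.adjoin K (insert ℓ (Set.range a)) := by rw [hg]; trivial
      induction h1 using Algebra.adjoin_induction with
      | mem z hz =>
        rcases hz with rfl | ⟨i, rfl⟩
        · exact ⟨Polynomial.X, by simp⟩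
        · exact ⟨Polynomial.C ⟨a i, Algebra.subset_adjoin (Submodule.subset_span ⟨i, rfl⟩)⟩, by simp⟩
      | algebraMap z => exact ⟨Polynomial.C (algebraMap K A z), by simp⟩
      | add z w _ _ hz hw =>
        obtain ⟨p, rfl⟩ := hz
        obtain ⟨q, rfl⟩ := hw
        exact ⟨p + q, map_add _ _ _⟩
      | mul z w _ _ hz hw =>
        obtain ⟨p, rfl⟩ := hz
        obtain ⟨q, rfl⟩ := hw
        exact ⟨p * q, map_mul _ _ _⟩
    obtain ⟨p, rfl⟩ := hp F
    have h2 := (hI _).mp hF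
    have h3 : Polynomial.aeval (Φ ℓ) (p.map ψ) = 0 := by
      rw [← h2, Polynomial.aeval_def, Polynomial.eval₂_map, Polynomial.eval₂_eq_sum_range, Polynomial.aeval_eq_sum_range, map_sum]
      refine Finset.sum_congr rfl fun i _ => ?_
      rw [Algebra.smul_def, map_mul, map_pow]; rfl
    have h4 := (transcendental_iff.mp ht) _ h3
    rw [Polynomial.aeval_eq_sum_range]
    refine Ideal.sum_mem _ fun i _ => ?_
    rw [Algebra.smul_def]
    refine Ideal.mul_mem_right _ _ (Ideal.subset_span ⟨(hI _).mpr ?_, (p.coeff i).2⟩)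
    have h5 := congrArg (fun q => (q.coeff i : Ω)) h4
    rw [Polynomial.coeff_map] at h5
    exact h5

variable {J : MP K (n + 3) →ₐ[K] Ω} {x y ω ξ η : Ω} {c0 c1 c2 : MP K (n + 3)} {F m k b c b' c' g e : K}

/-- the parameters -/
def par (J : MP K (n + 3) →ₐ[K] Ω) (ω ξ η : Ω) (τ : Fin (n + 3) → MP K (n + 3)) : Fin (n + 3) → Ω :=
  Fin.cons ω (Fin.cons ξ (Fin.cons η (fun i => J (τ i.succ.succ.succ))))

theorem Ver.mem (h : Ver J x y c0 c1 c2 ω ξ η F m k b c b' c' g e) {A : Subalgebra K Ω} (h0 : ω ∈ A) (h1 : ξ ∈ A) (h2 : η ∈ A) :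
    J c0 ∈ A ∧ J c1 ∈ A ∧ J c2 ∈ A ∧ x ∈ A ∧ y ∈ A := by
  have hC : ∀ a, J (C a) ∈ A := fun a => by rw [J_C]; exact A.algebraMap_mem a
  have k0 : J c0 ∈ A := by rw [h.Q0]; exact A.mul_mem h0 (A.sub_mem (A.sub_mem (A.add_mem (A.pow_mem h2 2) (A.mul_mem (hC _) h2)) (A.mul_mem (hC _) h1)) (hC _))
  have k1 : J c1 ∈ A := by rw [h.Q1]; exact A.mul_mem h0 (A.sub_mem (hC _) (A.mul_mem h1 h2))
  have k2 : J c2 ∈ A := by rw [h.Q2]; exact A.mul_mem h0 (A.sub_mem (A.sub_mem (A.add_mem (A.pow_mem h1 2) (A.mul_mem (hC _) h1)) (A.mul_mem (hC _) h2)) (hC _))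
  refine ⟨k0, k1, k2, ?_, ?_⟩
  · rw [h.R1, map_mul]; exact A.add_mem (A.add_mem (A.mul_mem k0 h1) (A.mul_mem k1 h2)) (A.mul_mem (hC _) k1)
  · rw [h.R2, map_mul]; exact A.add_mem (A.add_mem (A.mul_mem k1 h1) (A.mul_mem k2 h2)) (A.mul_mem (hC _) k1)

theorem Ver.ind (h : Ver J x y c0 c1 c2 ω ξ η F m k b c b' c' g e) (hJ : Function.Injective J) {τ : Fin (n + 3) → MP K (n + 3)}
    (h1 : ∀ i, (τ i).IsHomogeneous 1) (hl : LinearIndependent K τ) (t0 : τ 0 = c0) (t1 : τ 1 = c1) (t2 : τ 2 = c2) : AlgebraicIndependent K (par J ω ξ η τ) := by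
  obtain ⟨e, he, -⟩ := lin_equiv h1 hl
  have hv : AlgebraicIndependent K (fun i => J (τ i)) := by
    have := (MvPolynomial.algebraicIndependent_X (Fin (n+3)) K).map' (f := J.comp e.toAlgHom) (hJ.comp e.injective)
    convert this using 1
    funext i; simp [he]
  have hm : ∀ i, par J ω ξ η τ i ∈ Algebra.adjoin K (Set.range (par J ω ξ η τ)) := fun i => Algebra.subset_adjoin ⟨i, rfl⟩
  obtain ⟨k0, k1, k2, -, -⟩ := h.mem (hm 0) (hm 1) (hm 2)
  refine algind hv fun i => ?_
  refine Fin.cases (t0 ▸ k0) (Fin.cases (t1 ▸ k1) (Fin.cases (t2 ▸ k2) fun i => ?_)) i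
  exact hm i.succ.succ.succ

end

section
variable {K B : Type} [Field K] [CommRing B] [IsDomain B] [Algebra K B] {n r : ℕ}
  {G : ℕ → Submodule K B} {c0 c1 c2 : MP K (n + 3)} {I : Ideal (PS K r)} {π : PS K r →ₐ[K] B}
  {ι : MP K (n + 3) →ₐ[K] PS K r} {x y : PS K r} {ω ξ η : FractionRing B} {F m k b c b' c' g e : K}

theorem extend3 (hG : Gr1 (π.comp ι) (π x) (π y) G c0 c1 c2) (hl : LinearIndependent K ![c0, c1, c2])
    (hv : Ver ((fr K B).comp (π.comp ι)) (fr K B (π x)) (fr K B (π y)) c0 c1 c2 ω ξ η F m k b c b' c' g e) :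
    ∃ τ : Fin (n + 3) → MP K (n + 3), (∀ i, (τ i).IsHomogeneous 1) ∧ LinearIndependent K τ ∧ τ 0 = c0 ∧ τ 1 = c1 ∧ τ 2 = c2 ∧
      AlgebraicIndependent K (par ((fr K B).comp (π.comp ι)) ω ξ η τ) := by
  obtain ⟨τ, h1, h2, h3⟩ := lin_extend (k := 3) (N := n + 3) (by omega) (l := ![c0, c1, c2]) (by simp [Fin.forall_fin_succ, hG.h0, hG.h1, hG.h2]) hl
  have t0 : τ 0 = c0 := h3 0
  have t1 : τ 1 = c1 := h3 1
  have t2 : τ 2 = c2 := h3 2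
  refine ⟨τ, h1, h2, t0, t1, t2, hv.ind ?_ h1 h2 t0 t1 t2⟩
  rw [injective_iff_map_eq_zero]
  intro f hf
  by_contra hne
  exact hG.toGr.jne hne (fr_inj (K := K) (by rw [map_zero]; exact hf))

theorem cone3 {c0 c1 c2 : MP K (n + 1 + 3)} {ι : MP K (n + 1 + 3) →ₐ[K] PS K r}
    (h : Dat I π ι x y) (hG : Gr1 (π.comp ι) (π x) (π y) G c0 c1 c2) (hl : LinearIndependent K ![c0, c1, c2])
    (hv : Ver ((fr K B).comp (π.comp ι)) (fr K B (π x)) (fr K B (π y)) c0 c1 c2 ω ξ η F m k b c b' c' g e) : AMD.IsConeIdeal K r I := by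
  obtain ⟨τ, h1, h2, t0, t1, t2, h3⟩ := extend3 hG hl hv
  obtain rfl : r = n + 3 + 1 + 1 := by have := h.hN; omega
  obtain ⟨e, he, -⟩ := lin_equiv h1 h2
  set A' := Algebra.adjoin K (par ((fr K B).comp (π.comp ι)) ω ξ η τ '' {Fin.last _}ᶜ)
  have hm : ∀ i, i ≠ Fin.last _ → par ((fr K B).comp (π.comp ι)) ω ξ η τ i ∈ A' := fun i hi => Algebra.subset_adjoin ⟨i, hi, rfl⟩
  obtain ⟨k0, k1, k2, kx, ky⟩ := hv.mem (hm 0 (by simp [Fin.ext_iff])) (hm (Fin.succ 0) (by simp [Fin.ext_iff])) (hm (Fin.succ (Fin.succ 0)) (by intro h; have := congrArg Fin.val h; simp at this; rw [Nat.mod_eq_of_lt (by omega)] at this; omega))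
  have key : ∀ i, i ≠ Fin.last _ → fr K B (π (ι (τ i))) ∈ A' := by
    refine Fin.cases (fun _ => t0 ▸ k0) (Fin.cases (fun _ => t1 ▸ k1) (Fin.cases (fun _ => t2 ▸ k2) fun i hi => ?_))
    exact hm i.succ.succ.succ hi
  refine cone_split ((fr K B).comp π) (fun F => ?_) (Fin.cons x (Fin.cons y (fun i => ι (τ (Fin.succAbove (Fin.last _) i))))) ?_ (ι (τ (Fin.last _))) ?_ A' ?_
    (h3.transcendental_adjoin (i := Fin.last _) (by simp))
  · rw [h.ker]; exact ⟨fun h => by rw [AlgHom.comp_apply, h, map_zero], fun h => fr_inj (K := K) (by rw [map_zero]; exact h)⟩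
  · refine Fin.cases h.hx (Fin.cases h.hy fun i => h.ιhom (h1 _))
  · rw [eq_top_iff, ← h.adj]
    refine Algebra.adjoin_le ?_
    rintro z (rfl | rfl | ⟨f, rfl⟩)
    · exact Algebra.subset_adjoin (Or.inr ⟨0, rfl⟩)
    · exact Algebra.subset_adjoin (Or.inr ⟨1, rfl⟩)
    · obtain ⟨f, rfl⟩ := e.surjective f
      induction f using MvPolynomial.induction_on with
      | C a =>
        rw [← MvPolynomial.algebraMap_eq, AlgEquiv.commutes, AlgHom.commutes]; exact Subalgebra.algebraMap_mem _ _
      | add p q hp hq => rw [map_add, map_add]; exact add_mem hp hq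
      | mul_X p i hp =>
        rw [map_mul, map_mul, he]
        refine mul_mem hp (Algebra.subset_adjoin ?_)
        rcases eq_or_ne i (Fin.last _) with rfl | hi
        · exact Or.inl rfl
        · obtain ⟨i, rfl⟩ := Fin.exists_succAbove_eq hi
          exact Or.inr ⟨i.succ.succ, rfl⟩
  · refine Fin.cases kx (Fin.cases ky fun i => key _ (Fin.succAbove_ne _ _))

end

section
variable {K : Type} [Field K]

/-- the affine Veronese parametrization -/
def nu (K : Type) [Field K] : MP K 6 →ₐ[K] MP K 3 :=
  aeval ![X 0, X 0 * X 1, X 0 * X 2, X 0 * X 1 ^ 2, X 0 * X 1 * X 2, X 0 * X 2 ^ 2]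

def jj (K : Type) [Field K] : MP K 3 →ₐ[K] MP K 6 := aeval ![X 0, X 3, X 5]

def nrm (K : Type) [Field K] (a b c : ℕ) : MP K 6 :=
  X 0 ^ (a + (b % 2) * (c % 2) - (b + 1) / 2 - (c + 1) / 2) * X 3 ^ (b / 2) * X 5 ^ (c / 2) *
    (if b % 2 = 0 then (if c % 2 = 0 then 1 else X 2) else (if c % 2 = 0 then X 1 else X 4))

def rho (K : Type) [Field K] : MP K 3 →ₗ[K] MP K 6 :=
  (basisMonomials (Fin 3) K).constr K (fun u => nrm K (u 0) (u 1) (u 2))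

theorem rho_mon (a b c : ℕ) : rho K (X 0 ^ a * X 1 ^ b * X 2 ^ c) = nrm K a b c := by
  have : (X 0 ^ a * X 1 ^ b * X 2 ^ c : MP K 3) = basisMonomials (Fin 3) K (Finsupp.single 0 a + Finsupp.single 1 b + Finsupp.single 2 c) := by
    simp [X_pow_eq_monomial, monomial_mul]
  rw [this, rho, Module.Basis.constr_basis]
  simp

theorem rho_nu (q : MP K 6) (b c : ℕ) (hb : b < 2) (hc : c < 2)
    (hq : q = if b = 0 then (if c = 0 then 1 else X 2) else (if c = 0 then X 1 else X 4)) (p : MP K 3) : rho K (nu K (jj K p * q)) = jj K p * q := by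
  induction p using MvPolynomial.induction_on' with
  | add f g hf hg => rw [map_add, add_mul, map_add, map_add, hf, hg]
  | monomial u a =>
    have h1 : (monomial u a : MP K 3) = a • (X 0 ^ u 0 * X 1 ^ u 1 * X 2 ^ u 2) := by
      rw [monomial_eq, Finsupp.prod_fintype _ _ (by simp), Fin.prod_univ_three, MvPolynomial.smul_eq_C_mul]
    rw [h1, map_smul, smul_mul_assoc, map_smul, map_smul]
    congr 1
    have h2 : nu K (jj K (X 0 ^ u 0 * X 1 ^ u 1 * X 2 ^ u 2) * q) = X 0 ^ (u 0 + u 1 + u 2 + (b + c + 1) / 2) * X 1 ^ (2 * u 1 + b) * X 2 ^ (2 * u 2 + c) := by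
      rw [hq]
      interval_cases b <;> interval_cases c <;> simp [jj, nu] <;> ring
    rw [h2, rho_mon, hq, nrm]
    have e1 : (2 * u 1 + b) % 2 = b := by omega
    have e2 : (2 * u 2 + c) % 2 = c := by omega
    have e3 : (2 * u 1 + b) / 2 = u 1 := by omega
    have e4 : (2 * u 2 + c) / 2 = u 2 := by omega
    have e5 : u 0 + u 1 + u 2 + (b + c + 1) / 2 + b * c - (2 * u 1 + b + 1) / 2 - (2 * u 2 + c + 1) / 2 = u 0 := by
      interval_cases b <;> interval_cases c <;> omega
    rw [e1, e2, e3, e4, e5]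
    simp [jj]

theorem nrm_ex (F : MP K 6) : ∃ p q s t : MP K 3,
    F - (jj K p * 1 + jj K q * X 1 + jj K s * X 2 + jj K t * X 4) ∈ AMD.veroneseIdeal K := by
  have hV : ∀ {f}, f ∈ _ → f ∈ AMD.veroneseIdeal K := fun h => Ideal.subset_span h
  have v1 := hV (f := X 0 * X 3 - X 1 * X 1) (by simp)
  have v2 := hV (f := X 0 * X 4 - X 1 * X 2) (by simp)
  have v3 := hV (f := X 0 * X 5 - X 2 * X 2) (by simp)
  have v4 := hV (f := X 1 * X 4 - X 2 * X 3) (by simp)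
  have v5 := hV (f := X 1 * X 5 - X 2 * X 4) (by simp)
  have v6 := hV (f := X 3 * X 5 - X 4 * X 4) (by simp)
  clear hV
  generalize AMD.veroneseIdeal K = V at *
  have j0 : jj K (X 0) = X 0 := by simp [jj]
  have j1 : jj K (X 1) = X 3 := by simp [jj]
  have j2 : jj K (X 2) = X 5 := by simp [jj]
  induction F using MvPolynomial.induction_on with
  | C a => exact ⟨C a, 0, 0, 0, by simp [jj]⟩
  | add f g hf hg =>
    obtain ⟨p, q, s, t, h⟩ := hf
    obtain ⟨p', q', s', t', h'⟩ := hg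
    refine ⟨p + p', q + q', s + s', t + t', ?_⟩
    convert V.add_mem h h' using 1
    simp only [map_add]; ring
  | mul_X f i hf =>
    obtain ⟨p, q, s, t, h⟩ := hf
    have h := V.mul_mem_right (X i) h
    fin_cases i
    · refine ⟨p * X 0, q * X 0, s * X 0, t * X 0, ?_⟩
      convert h using 1
      simp only [map_mul, j0, Fin.zero_eta]; ring
    · refine ⟨q * (X 0 * X 1), p, t * X 1, s * X 0, ?_⟩
      convert V.sub_mem (V.sub_mem (V.sub_mem h (V.mul_mem_left (jj K q) v1)) (V.mul_mem_left (jj K s) v2)) (V.mul_mem_left (-jj K t) v4) using 1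
      simp only [map_mul, j0, j1, Fin.mk_one]; ring
    · refine ⟨s * (X 0 * X 2), t * X 2, p, q * X 0, ?_⟩
      convert V.sub_mem (V.sub_mem (V.sub_mem h (V.mul_mem_left (jj K s) v3)) (V.mul_mem_left (jj K q) v2)) (V.mul_mem_left (jj K t) v5) using 1
      simp only [map_mul, j0, j2, Fin.reduceFinMk]; ring
    · refine ⟨p * X 1, q * X 1, s * X 1, t * X 1, ?_⟩
      convert h using 1
      simp only [map_mul, j1, Fin.reduceFinMk]; ring
    · refine ⟨t * (X 1 * X 2), s * X 2, q * X 1, p, ?_⟩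
      convert V.add_mem (V.sub_mem (V.sub_mem h (V.mul_mem_left (jj K t) v6)) (V.mul_mem_left (jj K s) v5)) (V.mul_mem_left (jj K q) v4) using 1
      simp only [map_mul, j1, j2, Fin.reduceFinMk]; ring
    · refine ⟨p * X 2, q * X 2, s * X 2, t * X 2, ?_⟩
      convert h using 1
      simp only [map_mul, j2, Fin.reduceFinMk]; ring

theorem ver_ker (F : MP K 6) : F ∈ AMD.veroneseIdeal K ↔ nu K F = 0 := by
  have hle : ∀ F ∈ AMD.veroneseIdeal K, nu K F = 0 := by
    intro F hF
    have : AMD.veroneseIdeal K ≤ RingHom.ker (nu K) := by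
      refine Ideal.span_le.mpr ?_
      intro z hz
      simp only [Set.mem_insert_iff, Set.mem_singleton_iff] at hz
      rcases hz with rfl | rfl | rfl | rfl | rfl | rfl <;> simp [nu] <;> ring
    exact this hF
  refine ⟨hle F, fun h => ?_⟩
  obtain ⟨p, q, s, t, hF⟩ := nrm_ex F
  have h1 := hle _ hF
  rw [map_sub, h, zero_sub, neg_eq_zero] at h1
  have h2 := congrArg (rho K) h1
  rw [map_add, map_add, map_add, map_add, map_add, map_add, rho_nu _ 0 0 (by simp) (by simp) (by simp), rho_nu _ 1 0 (by simp) (by simp) (by simp),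
    rho_nu _ 0 1 (by simp) (by simp) (by simp), rho_nu _ 1 1 (by simp) (by simp) (by simp), map_zero] at h2
  rwa [h2, sub_zero] at hF

end

section
variable {K B : Type} [Field K] [CommRing B] [Algebra K B] {n N : ℕ}
  {I : Ideal (MP K N)} {π : MP K N →ₐ[K] B}
  {ι : MP K n →ₐ[K] MP K N} {x y : MP K N}

theorem sum_hom (a : Fin n → K) : (∑ i, C (a i) * X i : MP K n).IsHomogeneous 1 :=
  IsHomogeneous.sum _ _ _ fun i _ => (isHomogeneous_X _ i).C_mul _

theorem lin_sum {F : MP K n} (hF : F.IsHomogeneous 1) : ∃ a : Fin n → K, F = ∑ i, C (a i) * X i := by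
  obtain ⟨a, ha⟩ := (Submodule.mem_span_range_iff_exists_fun K).mp (lin_mem_span (isHomogeneous_X K) X_li hF)
  exact ⟨a, by simp only [← ha, smul_eq_C_mul]⟩

theorem sum_zero {a : Fin n → K} (h : ∑ i, C (a i) * (X i : MP K n) = 0) (i : Fin n) : a i = 0 :=
  Fintype.linearIndependent_iff.mp (X_li (K := K)) a (by simpa only [smul_eq_C_mul] using h) i

theorem Dat.lin (h : Dat I π ι x y) {F : MP K N} (hF : F.IsHomogeneous 1) :
    ∃ a b f, f.IsHomogeneous 1 ∧ F = ι (C a) * x + ι (C b) * y + ι f := by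
  obtain rfl := h.hN
  have h1 : LinearIndependent K (Fin.cons x (Fin.cons y (fun i => ι (X i))) : Fin (n + 1 + 1) → MP K (n + 2)) := by
    rw [Fintype.linearIndependent_iff]
    intro g hg
    rw [Fin.sum_univ_succ, Fin.sum_univ_succ] at hg
    simp only [Fin.cons_zero, Fin.cons_succ, smul_eq_C_mul] at hg
    obtain ⟨a, b, c⟩ := h.li (g 0) (g (Fin.succ 0)) (∑ i, C (g (Fin.succ (Fin.succ i))) * X i) (sum_hom _) (by
      rw [← hg, map_sum, ι_C, ι_C]; simp only [map_mul, ι_C]; ring)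
    exact Fin.cases a (Fin.cases b (sum_zero c))
  obtain ⟨g, hg⟩ := (Submodule.mem_span_range_iff_exists_fun K).mp (lin_mem_span (N := n + 1 + 1) (Fin.cases h.hx (Fin.cases h.hy h.hι)) h1 hF)
  rw [Fin.sum_univ_succ, Fin.sum_univ_succ] at hg
  refine ⟨g 0, g (Fin.succ 0), ∑ i, C (g (Fin.succ (Fin.succ i))) * X i, sum_hom _, ?_⟩
  rw [← hg, map_sum]
  simp only [Fin.cons_zero, Fin.cons_succ, smul_eq_C_mul, map_mul, ι_C]
  ring

theorem proj_lin {p : MP K (n + 1)} (hp : p.IsHomogeneous 1) (h0 : eval (Pi.single (Fin.last n) 1) p = 0) :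
    ∃ L : MP K n, L.IsHomogeneous 1 ∧ rename Fin.castSucc L = p := by
  obtain ⟨a, rfl⟩ := lin_sum hp
  refine ⟨∑ i, C (a (Fin.castSucc i)) * X i, sum_hom _, ?_⟩
  rw [Fin.sum_univ_castSucc] at h0 ⊢
  simp [Fin.castSucc_ne_last] at h0
  simp [h0]

end

section
variable {K B : Type} [Field K] [CommRing B] [IsDomain B] [Algebra K B] {n : ℕ} {G : ℕ → Submodule K B}
  {c0 c1 c2 : MP K n} {j : MP K n →ₐ[K] B} {x y : B} {ω ξ η : FractionRing B} {F m k b c b' c' g e : K}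

theorem noA (hG : Gr1 j x y G c0 c1 c2) (hl : LinearIndependent K ![c0, c1, c2])
    (hv : Ver ((fr K B).comp j) (fr K B x) (fr K B y) c0 c1 c2 ω ξ η F m k b c b' c' g e) {A0 A1 A2 : B}
    (h0 : ∃ a b f, A0 = j (C a) * x + j (C b) * y + j f) (h1 : ∃ a b f, A1 = j (C a) * x + j (C b) * y + j f)
    (h2 : ∃ a b f, A2 = j (C a) * x + j (C b) * y + j f) (e1 : fr K B A1 = ξ * fr K B A0) (e2 : fr K B A2 = η * fr K B A0) : A0 = 0 := by
  have V0 : InV j x y A0 := by obtain ⟨a, b, f, rfl⟩ := h0; exact ⟨f, C a, C b, by ring⟩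
  have V1 : InV j x y A1 := by obtain ⟨a, b, f, rfl⟩ := h1; exact ⟨f, C a, C b, by ring⟩
  have V2 : InV j x y A2 := by obtain ⟨a, b, f, rfl⟩ := h2; exact ⟨f, C a, C b, by ring⟩
  have Mx : x * A0 = j c0 * A1 + j c1 * A2 + j (C m * c1) * A0 := by
    refine fr_inj (K := K) ?_
    have := hv.R1
    simp only [AlgHom.comp_apply] at this
    simp only [map_add, map_mul] at this ⊢
    rw [this, e1, e2]; ring
  have My : y * A1 = j (C c' * c1) * A2 - j (C b' * c1) * A1 + j (C F * c2 + C e * c1) * A0 := by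
    refine fr_inj (K := K) ?_
    have := hv.C2
    simp only [AlgHom.comp_apply] at this
    simp only [map_add, map_mul, map_sub] at this ⊢
    rw [e1, e2]; linear_combination fr K B A0 * this
  have Mz : x * A2 = j (C c * c1) * A1 - j (C b * c1) * A2 + j (C F * c0 + C g * c1) * A0 := by
    refine fr_inj (K := K) ?_
    have := hv.C1
    simp only [AlgHom.comp_apply] at this
    simp only [map_add, map_mul, map_sub] at this ⊢
    rw [e1, e2]; linear_combination fr K B A0 * this
  have kx : ∀ {A}, (∃ a b f, A = j (C a) * x + j (C b) * y + j f) → InV j x y (x * A) → ∃ f, A = j f := by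
    rintro _ ⟨a, b, f, rfl⟩ h
    have := Chi.unique hG.toGr (((hG.chi0.mul (C a)).add (hG.chi1.mul (C b))).add ((inV_x (j := j) (x := x) (y := y)).mul f).chi)
      ((h.of_eq (by ring)).chi (c0 := c0) (c1 := c1) (c2 := c2))
    obtain ⟨rfl, rfl⟩ := LI2.c (li01 hl) (by simpa using this)
    exact ⟨f, by simp⟩
  have ky : ∀ {A}, (∃ a b f, A = j (C a) * x + j (C b) * y + j f) → InV j x y (y * A) → ∃ f, A = j f := by
    rintro _ ⟨a, b, f, rfl⟩ h
    have := Chi.unique hG.toGr (((hG.chi1.mul (C a)).add (hG.chi2.mul (C b))).add ((inV_y (j := j) (x := x) (y := y)).mul f).chi)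
      ((h.of_eq (by ring)).chi (c0 := c0) (c1 := c1) (c2 := c2))
    obtain ⟨rfl, rfl⟩ := LI2.c (c := c1) (d := c2) (LI.sub hl ![1, 2] (by decide) (by simp [Fin.forall_fin_two])) (by simpa using this)
    exact ⟨f, by simp⟩
  obtain ⟨f0, rfl⟩ := kx h0 (Mx ▸ ((V1.mul c0).add (V2.mul c1)).add (V0.mul _))
  obtain ⟨f1, rfl⟩ := ky h1 (My ▸ ((V2.mul _).sub (V1.mul _)).add (V0.mul _))
  obtain ⟨f2, rfl⟩ := kx h2 (Mz ▸ ((V1.mul _).sub (V2.mul _)).add (V0.mul _))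
  obtain ⟨-, h, -⟩ := hG.toGr.indep (-(c0 * f1 + c1 * f2 + C m * c1 * f0)) f0 0 (by
    simp only [map_add, map_mul, map_neg, map_zero] at Mx ⊢; linear_combination Mx)
  rw [h, map_zero]

end

section
variable {K B : Type} [Field K] [CommRing B] [IsDomain B] [Algebra K B] {G : ℕ → Submodule K B}
  {c0 c1 c2 : MP K (0 + 3)} {I : Ideal (PS K 4)} {π : PS K 4 →ₐ[K] B}
  {ι : MP K (0 + 3) →ₐ[K] PS K 4} {x y : PS K 4} {ω ξ η : FractionRing B} {F m k b c b' c' g e : K}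

theorem ver5 (h : Dat I π ι x y) (hG : Gr1 (π.comp ι) (π x) (π y) G c0 c1 c2) (hl : LinearIndependent K ![c0, c1, c2])
    (hv : Ver ((fr K B).comp (π.comp ι)) (fr K B (π x)) (fr K B (π y)) c0 c1 c2 ω ξ η F m k b c b' c' g e)
    (hnd : AMD.Nondeg K 4 I) : AMD.IsGenProjVeronese4 K I := by
  obtain ⟨τ, t1, tl, t0, t1', t2, hind⟩ := extend3 hG hl hv
  set p := par ((fr K B).comp (π.comp ι)) ω ξ η τ with hp
  have p0 : p 0 = ω := rfl
  have p1 : p 1 = ξ := rfl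
  have p2 : p 2 = η := rfl
  let Nu : PS K 5 →ₐ[K] FractionRing B := (aeval p).comp (nu K)
  have hker : ∀ F, F ∈ AMD.veroneseIdeal K ↔ Nu F = 0 := fun F => by
    rw [ver_ker]
    exact ⟨fun h => by rw [AlgHom.comp_apply, h, map_zero], fun h => hind (by rw [map_zero]; exact h)⟩
  have hI : ∀ F, F ∈ I ↔ fr K B (π F) = 0 := fun F => by
    rw [h.ker]; exact ⟨fun h => by rw [h, map_zero], fun h => fr_inj (K := K) (by rw [map_zero]; exact h)⟩
  have N0 : Nu (X 0) = ω := by simp [Nu, nu, p0]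
  have N1 : Nu (X 1) = ω * ξ := by simp [Nu, nu, p0, p1]
  have N2 : Nu (X 2) = ω * η := by simp [Nu, nu, p0, p2]
  have N3 : Nu (X 3) = ω * ξ ^ 2 := by simp [Nu, nu, p0, p1]
  have N4 : Nu (X 4) = ω * ξ * η := by simp [Nu, nu, p0, p1, p2]
  have N5 : Nu (X 5) = ω * η ^ 2 := by simp [Nu, nu, p0, p2]
  have NC : ∀ a, Nu (C a) = algebraMap K _ a := fun a => Nu.commutes a
  clear_value Nu
  let W := (homogeneousSubmodule (Fin 6) K 1).map Nu.toLinearMap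
  have hX : ∀ i, (X i : PS K 5).IsHomogeneous 1 := isHomogeneous_X K
  have WX : ∀ i, Nu (X i) ∈ W := fun i => ⟨X i, hX i, rfl⟩
  have Q0 := hv.Q0; have Q1 := hv.Q1; have Q2 := hv.Q2; have R1 := hv.R1; have R2 := hv.R2
  simp only [J_C, map_mul] at Q0 Q1 Q2 R1 R2
  have Wc : ∀ {z} (a : Fin 6 → K), z = ∑ i, algebraMap K _ (a i) * Nu (X i) → z ∈ W := fun a hz => by
    rw [hz]
    exact Submodule.sum_mem _ fun i _ => by rw [← Algebra.smul_def]; exact Submodule.smul_mem _ _ (WX i)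
  have W0 := Wc (z := fr K B (π (ι c0))) ![-g, -c, m + b, 0, 0, 1] (Q0.trans (by simp [Fin.sum_univ_six, N0, N1, N2, N3, N4, N5]; ring))
  have W1 := Wc (z := fr K B (π (ι c1))) ![F, 0, 0, 0, -1, 0] (Q1.trans (by simp [Fin.sum_univ_six, N0, N1, N2, N3, N4, N5]; ring))
  have W2 := Wc (z := fr K B (π (ι c2))) ![-e, k + b', -c', 1, 0, 0] (Q2.trans (by simp [Fin.sum_univ_six, N0, N1, N2, N3, N4, N5]; ring))
  have Wx := Wc (z := fr K B (π x)) ![F * m, -g, F, -c, b, 0] (R1.trans (by rw [Q0, Q1]; simp [Fin.sum_univ_six, N0, N1, N2, N3, N4, N5]; ring))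
  have Wy := Wc (z := fr K B (π y)) ![F * k, F, -e, 0, b', -c'] (R2.trans (by rw [Q1, Q2]; simp [Fin.sum_univ_six, N0, N1, N2, N3, N4, N5]; ring))
  have Wf : ∀ f : MP K (0 + 3), f.IsHomogeneous 1 → fr K B (π (ι f)) ∈ W := by
    intro f hf
    have : Submodule.span K (Set.range τ) ≤ W.comap ((fr K B).comp (π.comp ι)).toLinearMap := by
      rw [Submodule.span_le]
      rintro _ ⟨i, rfl⟩
      refine Fin.cases (t0 ▸ W0) (Fin.cases (t1' ▸ W1) (Fin.cases (t2 ▸ W2) fun i => i.elim0)) i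
    exact this (lin_mem_span t1 tl hf)
  have WF : ∀ i, ∃ l : PS K 5, l.IsHomogeneous 1 ∧ Nu l = fr K B (π (X i)) := by
    intro i
    obtain ⟨a, b, f, hf, e⟩ := h.lin (isHomogeneous_X K i)
    have : fr K B (π (X i)) ∈ W := by
      rw [e, ι_C, ι_C, ← smul_eq_C_mul, ← smul_eq_C_mul]
      simp only [map_add, map_smul]
      exact W.add_mem (W.add_mem (W.smul_mem _ Wx) (W.smul_mem _ Wy)) (Wf f hf)
    obtain ⟨l, h1, h2⟩ := this
    exact ⟨l, h1, h2⟩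
  choose l l1 l2 using WF
  have hlam : ∀ F, Nu (aeval l F) = fr K B (π F) := fun F => by
    have : Nu.comp (aeval l) = (fr K B).comp π := by apply algHom_ext; intro i; simp [l2]
    exact DFunLike.congr_fun this F
  have lli : LinearIndependent K l := by
    rw [Fintype.linearIndependent_iff]
    intro a ha
    refine sum_zero (hnd _ ((hI _).mpr ?_) (sum_hom a))
    rw [← hlam, map_sum]
    simp only [map_mul, aeval_X, aeval_C, ← Algebra.smul_def]
    rw [ha, map_zero]
  obtain ⟨l', a1, a2, a3⟩ := lin_extend (N := 6) (by omega) l1 lli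
  obtain ⟨e, he, he'⟩ := lin_equiv a1 a2
  have hlam' : ∀ F, e (rename Fin.castSucc F) = aeval l F := fun F => by
    have : (e : PS K 5 →ₐ[K] PS K 5).comp (rename Fin.castSucc) = aeval l := by
      apply algHom_ext; intro i; simp only [AlgHom.comp_apply, rename_X, aeval_X, AlgEquiv.coe_toAlgHom, he]; exact a3 i
    exact DFunLike.congr_fun this F
  have hmap : ∀ F, F ∈ Ideal.map e.symm (AMD.veroneseIdeal K) ↔ e F ∈ AMD.veroneseIdeal K := by
    intro F
    constructor
    · intro hF
      have : Ideal.map e.symm (AMD.veroneseIdeal K) ≤ Ideal.comap e (AMD.veroneseIdeal K) := by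
        rw [Ideal.map_le_iff_le_comap]
        intro z hz
        simpa using hz
      exact this hF
    · intro hF
      simpa using Ideal.mem_map_of_mem e.symm hF
  refine ⟨e.symm, he', ?_, ?_⟩
  · intro hle
    have hev : ∀ z ∈ AMD.pointIdl K 4, eval (Pi.single (Fin.last 5) 1) z = 0 := by
      intro z hz
      have : AMD.pointIdl K 4 ≤ RingHom.ker (eval (Pi.single (Fin.last 5) 1 : Fin 6 → K)) := by
        refine Ideal.span_le.mpr ?_
        rintro _ ⟨i, hi, rfl⟩
        simpa [Pi.single_apply] using hi
      exact this hz
    have hd := hev _ (hle (Ideal.mem_map_of_mem e.symm (Ideal.subset_span rfl)))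
    set D : Fin 6 → K := fun i => eval (Pi.single (Fin.last 5) 1) (e.symm (X i)) with hD
    let M : Matrix (Fin 3) (Fin 3) K := !![D 0, D 1, D 2; D 1, D 3, D 4; D 2, D 4, D 5]
    have hM : M.det = 0 := by
      rw [← hd, Matrix.det_fin_three]
      simp [M, hD, AMD.veroneseDet, two_mul]; ring
    obtain ⟨κ, hκ, hκ0⟩ := Matrix.exists_mulVec_eq_zero_iff.mpr hM
    have key : ∀ i0 i1 i2, D i0 * κ 0 + D i1 * κ 1 + D i2 * κ 2 = 0 → ∃ L : PS K 4, L.IsHomogeneous 1 ∧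
        aeval l L = C (κ 0) * X i0 + C (κ 1) * X i1 + C (κ 2) * X i2 := by
      intro i0 i1 i2 h0
      have sC : ∀ a, e.symm (C a) = C a := fun a => e.symm.commutes a
      obtain ⟨L, L1, L2⟩ := proj_lin (n := 5) (p := e.symm (C (κ 0) * X i0 + C (κ 1) * X i1 + C (κ 2) * X i2)) (by
        simp only [map_add, map_mul, sC]
        exact (((he' _).C_mul _).add ((he' _).C_mul _)).add ((he' _).C_mul _)) (by
        rw [← h0]; simp only [map_add, map_mul, sC, eval_C, hD]; ring)
      exact ⟨L, L1, by rw [← hlam', L2, AlgEquiv.apply_symm_apply]⟩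
    have hk : ∀ i, (M.mulVec κ) i = 0 := fun i => by rw [hκ0]; rfl
    obtain ⟨L0, u0, v0⟩ := key 0 1 2 (by simpa [M, Matrix.mulVec, dotProduct, Fin.sum_univ_three] using hk 0)
    obtain ⟨L1, u1, v1⟩ := key 1 3 4 (by simpa [M, Matrix.mulVec, dotProduct, Fin.sum_univ_three] using hk 1)
    obtain ⟨L2, u2, v2⟩ := key 2 4 5 (by simpa [M, Matrix.mulVec, dotProduct, Fin.sum_univ_three] using hk 2)
    have form : ∀ {L : PS K 4}, L.IsHomogeneous 1 → ∃ a b f, π L = (π.comp ι) (C a) * π x + (π.comp ι) (C b) * π y + (π.comp ι) f := by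
      intro L hL
      obtain ⟨a, b, f, -, e⟩ := h.lin hL
      exact ⟨a, b, f, by rw [e]; simp only [map_add, map_mul, AlgHom.comp_apply]⟩
    have hz := noA hG hl hv (form u0) (form u1) (form u2)
      (by rw [← hlam, ← hlam, v0, v1]; simp only [map_add, map_mul, N0, N1, N2, N3, N4]; ring)
      (by rw [← hlam, ← hlam, v0, v2]; simp only [map_add, map_mul, N0, N1, N2, N4, N5]; ring)
    rw [hnd L0 ((h.ker _).mpr hz) u0, map_zero] at v0
    apply hκ
    funext i
    have q0 := congrArg (eval (Pi.single 0 1)) v0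
    have q1 := congrArg (eval (Pi.single 1 1)) v0
    have q2 := congrArg (eval (Pi.single 2 1)) v0
    simp at q0 q1 q2
    fin_cases i
    · exact q0.symm
    · exact q1.symm
    · exact q2.symm
  · ext F
    rw [Ideal.mem_comap, hmap, hlam', hker, hlam, hI]

end

section
variable {K : Type} [Field K]

theorem dat_of {E : Type} [Field E] [Algebra K E] {m : ℕ} {I : Ideal (PS K (m + 1 + 2))} {v : Fin (m + 1 + 2 + 1) → E}
    {L : Fin (m + 2) → PS K (m + 1 + 2)} {x y : PS K (m + 1 + 2)} (hI : ∀ F, F ∈ I ↔ hz v F = 0) (hL : ∀ i, (L i).IsHomogeneous 1)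
    (hx : x.IsHomogeneous 1) (hy : y.IsHomogeneous 1)
    (hli : LinearIndependent K (Fin.cons x (Fin.cons y L) : Fin (m + 2 + 1 + 1) → PS K (m + 1 + 2))) : Dat I (hz v) (aeval L) x y := by
  refine ⟨hI, rfl, fun i => by rw [aeval_X]; exact hL i, hx, hy, ?_, ?_⟩
  · intro a b f hf h0
    obtain ⟨u, rfl⟩ := lin_sum hf
    have := Fintype.linearIndependent_iff.mp hli (Fin.cons a (Fin.cons b u)) (by
      rw [Fin.sum_univ_succ, Fin.sum_univ_succ]
      simp only [Fin.cons_zero, Fin.cons_succ, Algebra.smul_def]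
      rw [← h0, map_sum]
      simp only [map_mul, aeval_C, aeval_X]
      ring)
    refine ⟨this 0, this 1, Finset.sum_eq_zero fun i _ => ?_⟩
    have h2 : u i = 0 := this i.succ.succ
    rw [h2, C_0, zero_mul]
  · obtain ⟨e, he, -⟩ := lin_equiv (N := m + 2 + 1 + 1) (l := Fin.cons x (Fin.cons y L)) (Fin.cases hx (Fin.cases hy hL)) hli
    rw [eq_top_iff]
    rintro f -
    obtain ⟨f, rfl⟩ := e.surjective f
    induction f using MvPolynomial.induction_on with
    | C a => exact (e.commutes a).symm ▸ Subalgebra.algebraMap_mem _ a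
    | add p q hp hq => rw [map_add]; exact add_mem hp hq
    | mul_X p i hp =>
      rw [map_mul, he]
      refine mul_mem hp (Algebra.subset_adjoin ?_)
      refine Fin.cases (Or.inl rfl) (Fin.cases (Or.inr (Or.inl rfl)) fun i => Or.inr (Or.inr ⟨X i, ?_⟩)) i
      exact aeval_X L i

theorem final [IsAlgClosed K] {r : ℕ} (I : Ideal (PS K r)) (hprime : I.IsPrime)
    (hhom : AMD.IsHomIdeal K r I) (hnd : AMD.Nondeg K r I) (d : ℕ) (hd : d + 2 = r) (hdeg : AMD.DegreeEq K r I d 4)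
    (hcone : ¬ AMD.IsConeIdeal K r I) (hver : ¬ AMD.IsGenProjVeronese K r I) :
    (∃ q₁ q₂ : PS K r, q₁.IsHomogeneous 2 ∧ q₂.IsHomogeneous 2 ∧ I = Ideal.span {q₁, q₂}) ∨ (d ≤ 4 ∧ AMD.HasBettiDiagram K r I bet) := by
  obtain ⟨E, _, _, v, m, t, L, x, y, rfl, hI, hS, hL, hx, hy, hLt, hli⟩ := setup_exists I hprime hhom hnd d hd hdeg
  subst hd
  have hD := dat_of hI hL hx hy hli
  have hπ : ((hz v).comp (aeval L) : MP K (m + 2) →ₐ[K] _) = hz (Fin.cons 1 t : Fin (m + 2) → E) := by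
    apply algHom_ext
    intro i
    rw [AlgHom.comp_apply, aeval_X, hz_hom v (hL i), hLt, hz, aeval_X, pow_one]
  have ex : hz v x = Polynomial.C (aeval v x) * Polynomial.X := by rw [hz_hom v hx, pow_one]
  have ey : hz v y = Polynomial.C (aeval v y) * Polynomial.X := by rw [hz_hom v hy, pow_one]
  have hG := gr_of_setup hS
  have hdich := dich hS
  rw [← hπ, ← ex, ← ey] at hG hdich
  rcases hdich with ⟨a0, a1, a2, hne, h1, h2, h3⟩ | ⟨c0, c1, c2, hG1⟩
  · exact Or.inl (case_ci hD hG hne h1 h2 h3)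
  by_cases hl : LinearIndependent K ![c0, c1, c2]
  · exfalso
    obtain ⟨x', y', hD', hG', ω, ξ, η, F, mm, k, b, c, b', c', g, e, hv⟩ := norm3 hD hG1 hl
    clear hG hG1 hπ hli hLt hD
    have h3 : 3 ≤ m + 2 := lin_card (l := ![c0, c1, c2]) (by simp [Fin.forall_fin_succ, hG'.h0, hG'.h1, hG'.h2]) hl
    generalize (aeval L : MP K (m + 2) →ₐ[K] PS K (m + 1 + 2)) = ι at *
    generalize hz (K := K) v = π at *
    generalize Gn K t = G at *
    obtain ⟨n, rfl⟩ : ∃ n, m = n + 1 := ⟨m - 1, by omega⟩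
    cases n with
    | zero =>
      refine hver ⟨rfl, ?_⟩
      have : (rename (Fin.cast rfl) : PS K 4 →ₐ[K] PS K 4) = AlgHom.id K _ := by
        apply algHom_ext; intro i; simp
      have h5 := ver5 hD' hG' hl hv hnd
      convert h5 using 1
      exact (congrArg (fun f : PS K 4 →ₐ[K] PS K 4 => Ideal.map f I) this).trans (Ideal.map_id I)
    | succ n => exact hcone (cone3 (n := n) hD' hG' hl hv)
  · rw [Fintype.linearIndependent_iff] at hl
    push Not at hl
    obtain ⟨g, hg, i, hi⟩ := hl
    have hB := case_dep hD hG1 (a := g 0) (b := g 1) (c := g 2) (by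
      rintro ⟨h0, h1, h2⟩
      apply hi
      fin_cases i <;> assumption) (by
      rw [Fin.sum_univ_three] at hg
      simpa [smul_eq_C_mul] using hg)
    refine Or.inr ⟨?_, hB.betti⟩
    by_contra h4
    exact hcone (hB.cone (by omega))

end

end

end AMDP
end

noncomputable section
open MvPolynomial

/-- **Theorem 2.1.**  A non-degenerate variety `X ⊆ ℙ^r_K` of degree `4` and
codimension `2` which is not a cone and not a generic projection of the Veronese
surface is either a complete intersection of two quadrics, or has `dim X ≤ 4` and
Betti diagram `β₁₁ = 1, β₁₂ = 3, β₂₂ = 4, β₃₂ = 1` (all other entries zero). -/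
theorem variety_of_almost_minimal_degree_codim_two
    (K : Type) [Field K] [IsAlgClosed K] (r : ℕ)
    (I : Ideal (PS K r)) (hprime : I.IsPrime)
    (hhom : AMD.IsHomIdeal K r I) (hnd : AMD.Nondeg K r I)
    (d : ℕ) (hdim : AMD.DimEq K r I d) (hcodim : d + 2 = r)
    (hdeg : AMD.DegreeEq K r I d 4)
    (hcone : ¬ AMD.IsConeIdeal K r I)
    (hver : ¬ AMD.IsGenProjVeronese K r I) :
    (∃ q₁ q₂ : PS K r, q₁.IsHomogeneous 2 ∧ q₂.IsHomogeneous 2 ∧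
        I = Ideal.span {q₁, q₂}) ∨
    (d ≤ 4 ∧ AMD.HasBettiDiagram K r I (fun i j => match i, j with
      | 1, 1 => 1 | 1, 2 => 3 | 2, 2 => 4 | 3, 2 => 1 | _, _ => 0)) := by
  rcases AMDP.final I hprime hhom hnd d hcodim hdeg hcone hver with h | ⟨h1, h2⟩
  · exact .inl h
  refine .inr ⟨h1, (congrArg (AMD.HasBettiDiagram K r I) (funext fun i => funext fun j => ?_)).mp h2⟩
  rcases i with _ | _ | _ | _ | i <;> rcases j with _ | _ | _ | j <;> rfl
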